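/- Let m ≥ 2, let F be a finite field with |F| = q, and assume (m,q) ≠ (2,2). There is no nontrivial 2-(v,k,λ) design with prime replication number r admitting a flag-transitive automorphism group G that is almost simple with socle X isomorphic to the projective symplectic group PSp_{2m}(F) = Sp_{2m}(F)/Z(Sp_{2m}(F)). -/

import Mathlib

open Pointwise

variable {P : Type*}

/-- `blocks` is the block set of a 2-(v,k,lam) design on the point set `P`:
`P` has `v ≥ 2` points, every block is a `k`-subset of `P`, and every pair of
distinct points lies in exactly `lam ≥ 1` common blocks. -/
def IsTwoDesign [Fintype P] [DecidableEq P] (blocks : Finset (Finset P))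
    (v k lam : ℕ) : Prop :=
  Fintype.card P = v ∧ 2 ≤ v ∧ 1 ≤ lam ∧
    (∀ B ∈ blocks, B.card = k) ∧
    ∀ x y : P, x ≠ y → (blocks.filter fun B => x ∈ B ∧ y ∈ B).card = lam

/-- The number of blocks containing a given point `x`. -/
def pointDegree [DecidableEq P] (blocks : Finset (Finset P)) (x : P) : ℕ :=
  (blocks.filter fun B => x ∈ B).card

/-- `G` is a group of automorphisms of the design with block set `blocks`:
every element of `G` is a permutation of the points mapping blocks to blocks. -/
def IsAutGroup [DecidableEq P] (blocks : Finset (Finset P))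
    (G : Subgroup (Equiv.Perm P)) : Prop :=
  ∀ g ∈ G, ∀ B ∈ blocks, B.image g ∈ blocks

/-- `G` acts transitively on the flags (incident point-block pairs) of the design. -/
def IsFlagTransitive [DecidableEq P] (blocks : Finset (Finset P))
    (G : Subgroup (Equiv.Perm P)) : Prop :=
  ∀ B₁ ∈ blocks, ∀ B₂ ∈ blocks, ∀ x₁ ∈ B₁, ∀ x₂ ∈ B₂,
    ∃ g ∈ G, g x₁ = x₂ ∧ B₁.image g = B₂

set_option linter.all false

namespace NFT

/-! ### Generalities on group actions -/

lemma exists_rho {H Y : Type*} [Group H] [Finite H] [MulAction H Y] [Finite Y] {r : ℕ}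
    (hr : r.Prime) (hY : Nat.card Y = r) (ht : ∀ y y' : Y, ∃ h : H, h • y = y')
    (N : Subgroup H) [N.Normal] (hN : ∃ n ∈ N, ∃ y : Y, n • y ≠ y) :
    ∃ ρ ∈ N, (∃ a, orderOf ρ = r ^ a) ∧ ∀ y y' : Y, ∃ i : ℕ, ρ ^ i • y = y' := by
  classical
  haveI : MulAction.IsPretransitive H Y := ⟨ht⟩
  haveI : MulAction.IsPreprimitive H Y := MulAction.IsPreprimitive.of_prime_card (by rw [hY]; exact hr)
  haveI : Fact r.Prime := ⟨hr⟩
  have hfix : MulAction.fixedPoints N Y ≠ Set.univ := by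
    obtain ⟨n, hn, y, hy⟩ := hN
    intro h
    have : y ∈ MulAction.fixedPoints N Y := by rw [h]; trivial
    exact hy (this ⟨n, hn⟩)
  haveI : MulAction.IsPretransitive N Y :=
    MulAction.IsQuasiPreprimitive.isPretransitive_of_normal hfix
  have hne : Nonempty Y := by
    obtain ⟨n, hn, y, hy⟩ := hN
    exact ⟨y⟩
  obtain ⟨y0⟩ := hne
  let f : N →* Equiv.Perm Y := MulAction.toPermHom N Y
  have hdvd : r ∣ Nat.card f.range := by
    haveI : MulAction.IsPretransitive f.range Y := by
      constructor
      intro x y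
      obtain ⟨n, hn⟩ := MulAction.exists_smul_eq N x y
      exact ⟨⟨f n, n, rfl⟩, hn⟩
    have h1 := MulAction.index_stabilizer_of_transitive f.range y0
    rw [hY] at h1
    rw [← h1]
    exact Subgroup.index_dvd_card _
  obtain ⟨σ, hσ⟩ := exists_prime_orderOf_dvd_card' (G := f.range) r hdvd
  obtain ⟨n, hn⟩ := σ.2
  have hσ' : orderOf (f n) = r := by
    rw [hn, Subgroup.orderOf_coe, hσ]
  have hpos : 0 < orderOf n := orderOf_pos n
  obtain ⟨a, s, hs, has⟩ := Nat.exists_eq_pow_mul_and_not_dvd (n := orderOf n) (by omega) r hr.ne_one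
  have hcop : Nat.Coprime r s := (Nat.Prime.coprime_iff_not_dvd hr).2 hs
  have hspos : 0 < s := Nat.pos_of_ne_zero (by rintro rfl; simp at hs)
  have ho1 : orderOf (n ^ s) = r ^ a := by
    rw [orderOf_pow_of_dvd hspos.ne' ⟨r ^ a, by rw [has]; ring⟩, has]
    exact Nat.mul_div_cancel _ hspos
  have ho2 : orderOf (f (n ^ s)) = r := by
    rw [map_pow, Nat.Coprime.orderOf_pow (by rw [hσ']; exact hcop), hσ']
  haveI : Fintype Y := Fintype.ofFinite Y
  have hcyc : (f (n ^ s)).IsCycle := by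
    apply Equiv.Perm.isCycle_of_prime_order'
    · rw [ho2]; exact hr
    · rw [ho2, ← Nat.card_eq_fintype_card, hY]; have := hr.pos; omega
  have hsupp : ∀ y, (f (n ^ s)) y ≠ y := by
    have h1 := hcyc.orderOf
    rw [ho2] at h1
    have h2 : (f (n ^ s)).support = Finset.univ := by
      apply Finset.eq_univ_of_card
      rw [← h1, ← hY, Nat.card_eq_fintype_card]
    intro y
    have : y ∈ (f (n ^ s)).support := by rw [h2]; simp
    exact Equiv.Perm.mem_support.1 this
  refine ⟨((n ^ s : N) : H), (n ^ s).2, ⟨a, by rw [Subgroup.orderOf_coe, ho1]⟩, ?_⟩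
  intro y y'
  obtain ⟨i, hi⟩ := hcyc.exists_pow_eq (hsupp y) (hsupp y')
  refine ⟨i, ?_⟩
  rw [← hi, ← map_pow]
  rfl

lemma pgroup_card_mod {G X : Type*} [Group G] [MulAction G X] {p : ℕ} (hp : p.Prime)
    (hG : IsPGroup p G) (S : Finset X) (hS : ∀ g : G, ∀ x ∈ S, g • x ∈ S)
    [DecidablePred fun x : X => ∀ g : G, g • x = x] :
    S.card ≡ (S.filter fun x => ∀ g : G, g • x = x).card [MOD p] := by
  classical
  haveI : Fact p.Prime := ⟨hp⟩
  letI act : MulAction G S :=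
    { smul := fun g x => ⟨g • x.1, hS g x.1 x.2⟩
      one_smul := fun x => Subtype.ext (one_smul G x.1)
      mul_smul := fun g h x => Subtype.ext (mul_smul g h x.1) }
  have h := hG.card_modEq_card_fixedPoints (S : Type _)
  rw [Nat.card_eq_fintype_card, Fintype.card_coe] at h
  refine h.trans ?_
  have h2 : Nat.card (MulAction.fixedPoints G S) = (S.filter fun x => ∀ g : G, g • x = x).card := by
    rw [← Nat.card_eq_finsetCard]
    exact Nat.card_congr ⟨fun x => ⟨x.1.1, Finset.mem_filter.2 ⟨x.1.2, fun g => congrArg Subtype.val (x.2 g)⟩⟩,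
      fun y => ⟨⟨y.1, (Finset.mem_filter.1 y.2).1⟩, fun g => Subtype.ext ((Finset.mem_filter.1 y.2).2 g)⟩,
      fun x => rfl, fun y => rfl⟩
  rw [h2]

/-- an element of prime power order without fixed points on an invariant finite set -/
lemma card_dvd_of_no_fix {G X : Type*} [Group G] [Finite G] [MulAction G X] {p a : ℕ} (hp : p.Prime)
    (ρ : G) (hρ : orderOf ρ = p ^ a) (S : Finset X) (hS : ∀ x ∈ S, ρ • x ∈ S)
    (hf : ∀ x ∈ S, ρ • x ≠ x) : p ∣ S.card := by
  classical
  have hG : IsPGroup p (Subgroup.zpowers ρ) := IsPGroup.of_card (n := a) (by rw [Nat.card_zpowers, hρ])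
  have hS' : ∀ g : Subgroup.zpowers ρ, ∀ x ∈ S, g • x ∈ S := by
    rintro ⟨g, hg⟩ x hx
    obtain ⟨i, rfl⟩ := mem_powers_iff_mem_zpowers.2 hg
    change ρ ^ i • x ∈ S
    clear hg
    induction i with
    | zero => simpa using hx
    | succ n ih => rw [pow_succ', mul_smul]; exact hS _ ih
  have h := pgroup_card_mod hp hG S hS'
  rw [Finset.filter_false_of_mem] at h
  · exact (Nat.modEq_zero_iff_dvd).1 (by simpa using h)
  · intro x hx h
    exact hf x hx (h ⟨ρ, Subgroup.mem_zpowers ρ⟩)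

/-! ### Flag-transitive designs -/

structure FTD (Γ : Type*) {P : Type*} [Group Γ] [MulAction Γ P] [Fintype P] [DecidableEq P]
    (bl : Finset (Finset P)) (k lam r : ℕ) : Prop where
  blk : ∀ B ∈ bl, B.card = k
  pair : ∀ x y : P, x ≠ y → (bl.filter fun B => x ∈ B ∧ y ∈ B).card = lam
  deg : ∀ x : P, (bl.filter fun B => x ∈ B).card = r
  prime : r.Prime
  k3 : 3 ≤ k
  kv : k + 2 ≤ Fintype.card P
  lam1 : 1 ≤ lam
  inv : ∀ g : Γ, ∀ B ∈ bl, g • B ∈ bl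
  trans : ∀ B₁ ∈ bl, ∀ B₂ ∈ bl, ∀ x₁ ∈ B₁, ∀ x₂ ∈ B₂, ∃ g : Γ, g • x₁ = x₂ ∧ g • B₁ = B₂

section FTD
variable {Γ P : Type*} [Group Γ] [MulAction Γ P] [Fintype P] [DecidableEq P]
  {bl : Finset (Finset P)} {k lam r : ℕ}

lemma FTD.ex_not (h : FTD Γ bl k lam r) (x : P) : ∃ y, y ≠ x := by
  have : 1 < Fintype.card P := by have := h.kv; have := h.k3; omega
  exact Fintype.exists_ne_of_one_lt_card this x

lemma FTD.count (h : FTD Γ bl k lam r) (x : P) :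
    r * (k - 1) = lam * (Fintype.card P - 1) := by
  classical
  have h1 : ∑ B ∈ bl.filter (fun B => x ∈ B), (B.erase x).card = r * (k - 1) := by
    rw [Finset.sum_congr rfl (g := fun _ => k - 1), Finset.sum_const, h.deg x, smul_eq_mul]
    intro B hB
    rw [Finset.mem_filter] at hB
    rw [Finset.card_erase_of_mem hB.2, h.blk B hB.1]
  have h2 : ∑ y ∈ Finset.univ.erase x, (bl.filter fun B => x ∈ B ∧ y ∈ B).card
      = lam * (Fintype.card P - 1) := by
    rw [Finset.sum_congr rfl (g := fun _ => lam), Finset.sum_const,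
      Finset.card_erase_of_mem (Finset.mem_univ _), smul_eq_mul, mul_comm, Finset.card_univ]
    intro y hy
    exact h.pair x y (Finset.ne_of_mem_erase hy).symm
  rw [← h1, ← h2]
  have := Finset.sum_card_bipartiteAbove_eq_sum_card_bipartiteBelow
    (s := bl.filter (fun B => x ∈ B)) (t := Finset.univ.erase x) (fun B y => y ∈ B)
  convert this using 2 with B hB y hy
  · congr 1
    ext y
    simp [Finset.bipartiteAbove, and_comm]
  · congr 1
    ext B
    simp [Finset.bipartiteBelow]
    tauto

lemma FTD.point (h : FTD Γ bl k lam r) : Nonempty P := by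
  have : 0 < Fintype.card P := by have := h.kv; omega
  exact Fintype.card_pos_iff.1 this

lemma FTD.lam_lt (h : FTD Γ bl k lam r) : lam < r := by
  obtain ⟨x⟩ := h.point
  have h1 := h.count x
  have h2 := h.k3
  have h3 := h.kv
  have h4 := h.lam1
  by_contra hc
  push Not at hc
  have : r * (k - 1) < lam * (Fintype.card P - 1) := by
    calc r * (k - 1) ≤ lam * (k - 1) := Nat.mul_le_mul_right _ hc
      _ < _ := Nat.mul_lt_mul_of_pos_left (by omega) (by omega)
  omega

lemma FTD.ex_t (h : FTD Γ bl k lam r) :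
    ∃ t, 1 ≤ t ∧ Fintype.card P = 1 + r * t ∧ k = 1 + lam * t := by
  obtain ⟨x⟩ := h.point
  have h1 := h.count x
  have h2 := h.k3
  have h3 := h.kv
  have hr := h.prime
  have hd : r ∣ Fintype.card P - 1 := by
    have : r ∣ lam * (Fintype.card P - 1) := ⟨k - 1, h1.symm⟩
    refine (Nat.Coprime.dvd_mul_left ?_).1 this
    rw [Nat.Prime.coprime_iff_not_dvd hr]
    intro hd
    have := Nat.le_of_dvd h.lam1 hd
    have := h.lam_lt
    omega
  obtain ⟨t, ht⟩ := hd
  refine ⟨t, ?_, by omega, ?_⟩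
  · rcases Nat.eq_zero_or_pos t with rfl | h'
    · simp at ht; omega
    · exact h'
  · rw [ht] at h1
    have : r * (k - 1) = r * (lam * t) := by rw [h1]; ring
    have := Nat.eq_of_mul_eq_mul_left hr.pos this
    omega

lemma FTD.bk (h : FTD Γ bl k lam r) : bl.card * k = Fintype.card P * r := by
  have := Finset.sum_card_bipartiteAbove_eq_sum_card_bipartiteBelow
    (s := bl) (t := Finset.univ) (fun (B : Finset P) y => y ∈ B)
  rw [Finset.sum_congr rfl (g := fun _ => k), Finset.sum_const] at this
  · rw [smul_eq_mul] at this
    rw [this, Finset.sum_congr rfl (g := fun _ => r), Finset.sum_const, smul_eq_mul, Finset.card_univ]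
    intro y _
    rw [← h.deg y]; rfl
  · intro B hB
    rw [← h.blk B hB]
    congr 1
    ext; simp [Finset.bipartiteAbove]

/-- incidence map -/
def incid (bl : Finset (Finset P)) : (P → ℚ) →ₗ[ℚ] (bl → ℚ) where
  toFun f := fun B => ∑ x ∈ B.1, f x
  map_add' f g := by ext B; simp [Finset.sum_add_distrib]
  map_smul' c f := by ext B; simp [Finset.mul_sum]

lemma FTD.incid_inj (h : FTD Γ bl k lam r) : Function.Injective (incid bl) := by
  rw [← LinearMap.ker_eq_bot, LinearMap.ker_eq_bot']
  intro f hf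
  have hf' : ∀ B ∈ bl, ∑ x ∈ B, f x = 0 := fun B hB => congrFun hf ⟨B, hB⟩
  have key : ∀ x, ((r : ℚ) - lam) * f x + lam * ∑ y, f y = 0 := by
    intro x
    have h0 : ∑ B ∈ bl.filter (fun B => x ∈ B), ∑ y ∈ B, f y = 0 :=
      Finset.sum_eq_zero fun B hB => hf' B (Finset.mem_filter.1 hB).1
    have h1 : ∑ B ∈ bl.filter (fun B => x ∈ B), ∑ y ∈ B, f y
        = ∑ y, ((bl.filter fun B => x ∈ B ∧ y ∈ B).card : ℚ) * f y := by
      have : ∀ B ∈ bl.filter (fun B => x ∈ B), ∑ y ∈ B, f y = ∑ y, if y ∈ B then f y else 0 := by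
        intro B _
        simp
      rw [Finset.sum_congr rfl this, Finset.sum_comm]
      apply Finset.sum_congr rfl
      intro y _
      rw [← Finset.sum_filter, Finset.sum_const, Finset.filter_filter, nsmul_eq_mul]
    rw [h1, ← Finset.add_sum_erase _ _ (Finset.mem_univ x)] at h0
    rw [← Finset.add_sum_erase _ f (Finset.mem_univ x)]
    have h2 : ∑ y ∈ Finset.univ.erase x, ((bl.filter fun B => x ∈ B ∧ y ∈ B).card : ℚ) * f y
        = lam * ∑ y ∈ Finset.univ.erase x, f y := by
      rw [Finset.mul_sum]
      apply Finset.sum_congr rfl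
      intro y hy
      rw [h.pair x y (Finset.ne_of_mem_erase hy).symm]
    rw [h2] at h0
    simp only [and_self, h.deg x] at h0
    linarith
  have hlt : (lam : ℚ) < r := by exact_mod_cast h.lam_lt
  have hs : ∑ y, f y = 0 := by
    have h3 : ∑ x, (((r : ℚ) - lam) * f x + lam * ∑ y, f y) = 0 := Finset.sum_eq_zero fun x _ => key x
    rw [Finset.sum_add_distrib, ← Finset.mul_sum, Finset.sum_const, nsmul_eq_mul, Finset.card_univ] at h3
    have h4 : ((r : ℚ) - lam + Fintype.card P * lam) * ∑ y, f y = 0 := by linarith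
    rcases mul_eq_zero.1 h4 with h5 | h5
    · have : (0 : ℚ) ≤ Fintype.card P * lam := by positivity
      linarith
    · exact h5
  ext x
  have := key x
  rw [hs, mul_zero, add_zero] at this
  rcases mul_eq_zero.1 this with h5 | h5
  · linarith
  · simpa using h5

lemma FTD.fisher (h : FTD Γ bl k lam r) : k ≤ r := by
  have h1 := LinearMap.finrank_le_finrank_of_injective h.incid_inj
  simp only [Module.finrank_fintype_fun_eq_card, Fintype.card_coe] at h1
  have h2 := h.bk
  by_contra hc
  push Not at hc
  have h3 : 0 < Fintype.card P := by have := h.kv; omega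
  have : Fintype.card P * r < bl.card * k := by
    calc Fintype.card P * r < Fintype.card P * k := Nat.mul_lt_mul_of_pos_left hc h3
      _ ≤ bl.card * k := Nat.mul_le_mul_right _ h1
  omega

lemma FTD.r3 (h : FTD Γ bl k lam r) : 3 ≤ r := h.k3.trans h.fisher

/-- the parameters: either symmetric or `k < r` -/
lemma FTD.params (h : FTD Γ bl k lam r) : ∃ t, 1 ≤ t ∧ t + 1 ≤ r ∧ Fintype.card P = 1 + r * t ∧
    k = 1 + lam * t ∧ (lam * t = r - 1 ∨ ∃ c, 1 ≤ c ∧ r = lam + c + lam * c * t ∧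
      Fintype.card P = k * (1 + c * t) ∧ bl.card = r * (1 + c * t)) := by
  obtain ⟨t, ht, hv, hk⟩ := h.ex_t
  have hf := h.fisher
  have hl := h.lam1
  have hll := h.lam_lt
  have hr := h.prime
  refine ⟨t, ht, ?_, hv, hk, ?_⟩
  · have : t ≤ lam * t := Nat.le_mul_of_pos_left _ hl
    omega
  rcases Nat.lt_or_ge k r with hkr | hkr
  · right
    have hbk := h.bk
    have hcop : Nat.Coprime k r := by
      rw [Nat.coprime_comm, Nat.Prime.coprime_iff_not_dvd hr]
      intro hd
      have := Nat.le_of_dvd (by omega) hd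
      omega
    have hkv : k ∣ Fintype.card P := hcop.dvd_of_dvd_mul_right ⟨bl.card, by rw [← hbk]; ring⟩
    obtain ⟨n, hn⟩ := hkv
    have hn1 : 1 ≤ n := by
      rcases Nat.eq_zero_or_pos n with rfl | h'
      · omega
      · exact h'
    have hd : t ∣ n - 1 := by
      have h1 : (t : ℤ) ∣ (n : ℤ) - 1 := by
        refine ⟨(r : ℤ) - lam * n, ?_⟩
        have h2 : ((1 + r * t : ℕ) : ℤ) = ((1 + lam * t) * n : ℕ) := by
          rw [← hv, hn, hk]
        push_cast at h2
        linarith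
      have h3 : ((n - 1 : ℕ) : ℤ) = (n : ℤ) - 1 := by push_cast [hn1]; ring
      rw [← h3] at h1
      exact_mod_cast h1
    obtain ⟨c, hc⟩ := hd
    have hn' : n = 1 + c * t := by rw [mul_comm c t]; omega
    have hb : bl.card = r * n := by
      have : bl.card * k = (r * n) * k := by rw [hbk, hn]; ring
      exact Nat.eq_of_mul_eq_mul_right (by omega) this
    have hrr : r = lam + c + lam * c * t := by
      have h4 : r * t = (lam + c + lam * c * t) * t := by
        have : 1 + r * t = (1 + lam * t) * (1 + c * t) := by rw [← hv, hn, hk, hn']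
        nlinarith
      exact Nat.eq_of_mul_eq_mul_right (by omega) h4
    refine ⟨c, ?_, hrr, by rw [hn, hn'], by rw [hb, hn']⟩
    rcases Nat.eq_zero_or_pos c with rfl | h'
    · simp at hrr; omega
    · exact h'
  · left; omega

lemma FTD.v_lt (h : FTD Γ bl k lam r) : Fintype.card P < r ^ 2 := by
  obtain ⟨t, h1, h2, h3, -⟩ := h.params
  have := h.r3
  nlinarith

lemma mem_smul_fin {g : Γ} {x : P} {B : Finset P} : g • x ∈ g • B ↔ x ∈ B :=
  Finset.smul_mem_smul_finset_iff g

/-- blocks through two points -/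
def Bl (bl : Finset (Finset P)) (x y : P) : Finset (Finset P) := bl.filter fun B => x ∈ B ∧ y ∈ B

lemma mem_Bl {x y : P} {B : Finset P} : B ∈ Bl bl x y ↔ B ∈ bl ∧ x ∈ B ∧ y ∈ B := by
  simp [Bl]

lemma FTD.Bl_eq (h : FTD Γ bl k lam r) {x y z w : P} (hxy : x ≠ y) (hzw : z ≠ w)
    (hs : ∀ B ∈ bl, x ∈ B → y ∈ B → z ∈ B ∧ w ∈ B) : Bl bl x y = Bl bl z w := by
  apply Finset.eq_of_subset_of_card_le
  · intro B hB
    rw [mem_Bl] at hB ⊢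
    exact ⟨hB.1, hs B hB.1 hB.2.1 hB.2.2⟩
  · rw [Bl, Bl, h.pair _ _ hxy, h.pair _ _ hzw]

lemma FTD.smul_mem_Bl (h : FTD Γ bl k lam r) (g : Γ) {x y : P} {B : Finset P} (hB : B ∈ Bl bl x y) :
    g • B ∈ Bl bl (g • x) (g • y) := by
  rw [mem_Bl] at hB ⊢
  exact ⟨h.inv g B hB.1, mem_smul_fin.2 hB.2.1, mem_smul_fin.2 hB.2.2⟩

lemma FTD.smul_mem_Bl_iff (h : FTD Γ bl k lam r) (g : Γ) {x y : P} {B : Finset P} :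
    g • B ∈ Bl bl (g • x) (g • y) ↔ B ∈ Bl bl x y := by
  refine ⟨fun hB => ?_, h.smul_mem_Bl g⟩
  have := h.smul_mem_Bl g⁻¹ hB
  simpa using this

lemma FTD.Bl_nonempty (h : FTD Γ bl k lam r) {x y : P} (hxy : x ≠ y) : (Bl bl x y).Nonempty := by
  rw [← Finset.card_pos, Bl, h.pair _ _ hxy]
  exact h.lam1

lemma FTD.ex_block_sep (h : FTD Γ bl k lam r) {x y : P} (hxy : x ≠ y) : ∃ B ∈ bl, x ∈ B ∧ y ∉ B := by
  by_contra hc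
  push Not at hc
  have : (bl.filter fun B => x ∈ B) = bl.filter fun B => x ∈ B ∧ y ∈ B := by
    ext B
    simp only [Finset.mem_filter]
    constructor
    · rintro ⟨h1, h2⟩; exact ⟨h1, h2, hc B h1 h2⟩
    · rintro ⟨h1, h2, h3⟩; exact ⟨h1, h2⟩
  have h1 := h.deg x
  rw [this, h.pair _ _ hxy] at h1
  have := h.lam_lt
  omega

lemma FTD.ex_block (h : FTD Γ bl k lam r) (x : P) : ∃ B ∈ bl, x ∈ B := by
  obtain ⟨y, hy⟩ := h.ex_not x
  obtain ⟨B, hB, hx, -⟩ := h.ex_block_sep hy.symm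
  exact ⟨B, hB, hx⟩

lemma FTD.ptrans (h : FTD Γ bl k lam r) (x y : P) : ∃ g : Γ, g • x = y := by
  obtain ⟨B, hB, hx⟩ := h.ex_block x
  obtain ⟨C, hC, hy⟩ := h.ex_block y
  obtain ⟨g, hg, -⟩ := h.trans B hB C hC x hx y hy
  exact ⟨g, hg⟩

/-- kernel on the blocks through a point -/
def KK (Γ : Type*) [Group Γ] [MulAction Γ P] (bl : Finset (Finset P)) (α : P) : Subgroup Γ where
  carrier := {g | ∀ B ∈ bl, α ∈ B → g • B = B}
  mul_mem' := by
    intro a b ha hb B hB h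
    rw [mul_smul, hb B hB h, ha B hB h]
  one_mem' := by intro B _ _; simp
  inv_mem' := by
    intro a ha B hB h
    rw [inv_smul_eq_iff, ha B hB h]

lemma mem_KK {α : P} {g : Γ} : g ∈ KK Γ bl α ↔ ∀ B ∈ bl, α ∈ B → g • B = B := Iff.rfl

lemma FTD.KK_fix (h : FTD Γ bl k lam r) {α : P} {g : Γ} (hg : g ∈ KK Γ bl α) : g • α = α := by
  by_contra hc
  obtain ⟨B, hB, h1, h2⟩ := h.ex_block_sep (Ne.symm hc)
  apply h2
  rw [← hg B hB h1]
  exact mem_smul_fin.2 h1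

lemma FTD.KK_conj (h : FTD Γ bl k lam r) {α : P} {g : Γ} (hg : g ∈ KK Γ bl α) (u : Γ) :
    u * g * u⁻¹ ∈ KK Γ bl (u • α) := by
  intro B hB h1
  rw [mul_smul, mul_smul, hg, smul_inv_smul]
  · exact h.inv _ _ hB
  · rw [← mem_smul_fin (g := u), smul_inv_smul]; exact h1

lemma FTD.TI (h : FTD Γ bl k lam r) {α β : P} (hab : α ≠ β) {g : Γ} (ha : g ∈ KK Γ bl α)
    (hb : g ∈ KK Γ bl β) (x : P) : g • x = x := by
  have hga := h.KK_fix ha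
  have hgb := h.KK_fix hb
  -- moved points
  have moved : ∀ γ : P, g • γ ≠ γ → γ ≠ α ∧ γ ≠ β ∧ Bl bl γ (g • γ) = Bl bl α β ∧
      (∀ B ∈ Bl bl α β, γ ∈ B) := by
    intro γ hγ
    have h1 : γ ≠ α := by rintro rfl; exact hγ hga
    have h2 : γ ≠ β := by rintro rfl; exact hγ hgb
    have h3 : Bl bl α γ = Bl bl γ (g • γ) := by
      apply h.Bl_eq (Ne.symm h1) (Ne.symm hγ)
      intro B hB hx hy
      refine ⟨hy, ?_⟩
      rw [← ha B hB hx]; exact mem_smul_fin.2 hy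
    have h4 : Bl bl β γ = Bl bl γ (g • γ) := by
      apply h.Bl_eq (Ne.symm h2) (Ne.symm hγ)
      intro B hB hx hy
      refine ⟨hy, ?_⟩
      rw [← hb B hB hx]; exact mem_smul_fin.2 hy
    have h5 : Bl bl α γ = Bl bl α β := by
      apply h.Bl_eq (Ne.symm h1) hab
      intro B hB hx hy
      refine ⟨hx, ?_⟩
      have : B ∈ Bl bl α γ := mem_Bl.2 ⟨hB, hx, hy⟩
      rw [h3, ← h4] at this
      exact (mem_Bl.1 this).2.1
    refine ⟨h1, h2, by rw [← h3, h5], ?_⟩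
    intro B hB
    rw [← h5] at hB
    exact (mem_Bl.1 hB).2.2
  by_contra hγ
  obtain ⟨h1, h2, h3, h4⟩ := moved x hγ
  obtain ⟨B1, hB1⟩ := h.Bl_nonempty hab
  have : ∃ B2 ∈ bl, x ∈ B2 ∧ B2 ∉ Bl bl α β := by
    obtain ⟨B, hB, hx, hn⟩ := h.ex_block_sep (Ne.symm hγ)
    refine ⟨B, hB, hx, fun hc => hn ?_⟩
    rw [← h3] at hc
    exact (mem_Bl.1 hc).2.2
  obtain ⟨B2, hB2, hx2, hn2⟩ := this
  obtain ⟨u, hu1, hu2⟩ := h.trans B1 (mem_Bl.1 hB1).1 B2 hB2 x (h4 B1 hB1) x hx2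
  -- membership in the line through any two of α, β, x
  have hax : Bl bl α β = Bl bl x α := h.Bl_eq hab h1 fun B hB p1 p2 => ⟨h4 B (mem_Bl.2 ⟨hB, p1, p2⟩), p1⟩
  have hbx : Bl bl α β = Bl bl x β := h.Bl_eq hab h2 fun B hB p1 p2 => ⟨h4 B (mem_Bl.2 ⟨hB, p1, p2⟩), p2⟩
  have fixd : ∀ η : P, x ≠ η → Bl bl α β = Bl bl x η → g • (u • η) = u • η := by
    intro η hne hη
    by_contra hc
    obtain ⟨-, -, -, m4⟩ := moved _ hc
    have e1 : Bl bl α β = Bl bl x (u • η) := by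
      apply h.Bl_eq hab
      · intro he; apply hne; rw [← hu1] at he; exact smul_left_cancel u (by rw [hu1] at he ⊢; exact he)
      · intro B hB p1 p2
        exact ⟨h4 B (mem_Bl.2 ⟨hB, p1, p2⟩), m4 B (mem_Bl.2 ⟨hB, p1, p2⟩)⟩
    apply hn2
    rw [e1, ← hu2]
    have := h.smul_mem_Bl u (hη ▸ hB1)
    rwa [hu1] at this
  have f1 := fixd α h1 hax
  have f2 := fixd β h2 hbx
  -- blocks through u α, u β are those through x, u α
  have e2 : ∀ B, B ∈ Bl bl (u • α) (u • β) ↔ B ∈ Bl bl x (u • α) := by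
    intro B
    have := h.smul_mem_Bl_iff u (x := α) (y := β) (B := u⁻¹ • B)
    rw [smul_inv_smul, hax] at this
    rw [this, ← h.smul_mem_Bl_iff u, smul_inv_smul, hu1]
  have hne : x ≠ u • α := by
    intro he; apply h1; exact smul_left_cancel u (by rw [hu1]; exact he)
  have e3 : Bl bl x (u • α) = Bl bl x (g • x) := by
    apply h.Bl_eq hne (Ne.symm hγ)
    intro B hB p1 p2
    refine ⟨p1, ?_⟩
    have q1 := (e2 B).2 (mem_Bl.2 ⟨hB, p1, p2⟩)
    have q2 := h.smul_mem_Bl g⁻¹ q1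
    rw [inv_smul_eq_iff.2 f1.symm, inv_smul_eq_iff.2 f2.symm, e2] at q2
    have q3 := h.smul_mem_Bl g q2
    rw [smul_inv_smul] at q3
    exact (mem_Bl.1 q3).2.1
  apply hn2
  rw [← h3, ← e3, ← hu2]
  have := h.smul_mem_Bl u (hax ▸ hB1)
  rwa [hu1] at this

/-- the centralizer of a non-trivially acting element of `K_α` fixes `α` -/
lemma FTD.comm_fix (h : FTD Γ bl k lam r) {α : P} {g u : Γ} (hg : g ∈ KK Γ bl α)
    (hne : ∃ x : P, g • x ≠ x) (hc : u * g = g * u) : u • α = α := by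
  by_contra hu
  have h1 := h.KK_conj hg u
  rw [hc, mul_assoc, mul_inv_cancel, mul_one] at h1
  obtain ⟨x, hx⟩ := hne
  exact hx (h.TI (Ne.symm hu) hg h1 x)

/-- a rotation: element of `r`-power order, transitive on the blocks through `α` -/
structure IsRho (bl : Finset (Finset P)) (r : ℕ) (α : P) (ρ : Γ) : Prop where
  fix : ρ • α = α
  ord : ∃ a, orderOf ρ = r ^ a
  tr : ∀ B ∈ bl, ∀ C ∈ bl, α ∈ B → α ∈ C → ∃ i : ℕ, ρ ^ i • B = C

lemma FTD.exists_rho [Finite Γ] (h : FTD Γ bl k lam r) (α : P) (H N : Subgroup Γ)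
    (hα : ∀ g ∈ H, g • α = α)
    (ht : ∀ B ∈ bl, ∀ C ∈ bl, α ∈ B → α ∈ C → ∃ g ∈ H, g • B = C)
    (hNH : N ≤ H) (hn : ∀ g ∈ H, ∀ n ∈ N, g * n * g⁻¹ ∈ N)
    (hK : ¬ N ≤ KK Γ bl α) : ∃ ρ ∈ N, IsRho bl r α ρ := by
  classical
  letI act : MulAction H {B : Finset P // B ∈ bl ∧ α ∈ B} :=
    { smul := fun g B => ⟨g.1 • B.1, h.inv g.1 _ B.2.1, by
        have := mem_smul_fin (g := g.1).2 B.2.2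
        rwa [hα g.1 g.2] at this⟩
      one_smul := fun B => Subtype.ext (one_smul Γ B.1)
      mul_smul := fun a b B => Subtype.ext (mul_smul a.1 b.1 B.1) }
  have hN : (N.subgroupOf H).Normal := by
    constructor
    intro n hn' g
    rw [Subgroup.mem_subgroupOf] at hn' ⊢
    exact hn g.1 g.2 _ hn'
  have hcard : Nat.card {B : Finset P // B ∈ bl ∧ α ∈ B} = r := by
    rw [← h.deg α, ← Nat.card_eq_finsetCard]
    exact Nat.card_congr (Equiv.subtypeEquivRight fun B => by simp)
  obtain ⟨ρ, hρ, ⟨a, ha⟩, htr⟩ := NFT.exists_rho (H := H) h.prime hcard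
    (by
      rintro ⟨B, hB, hB'⟩ ⟨C, hC, hC'⟩
      obtain ⟨g, hg, e⟩ := ht B hB C hC hB' hC'
      exact ⟨⟨g, hg⟩, Subtype.ext e⟩)
    (N.subgroupOf H)
    (by
      by_contra hc
      push Not at hc
      apply hK
      intro n hn' B hB hB'
      exact congrArg Subtype.val (hc ⟨n, hNH hn'⟩ (Subgroup.mem_subgroupOf.2 hn') ⟨B, hB, hB'⟩))
  refine ⟨ρ.1, Subgroup.mem_subgroupOf.1 hρ, hα _ ρ.2, ⟨a, by rw [Subgroup.orderOf_coe, ha]⟩, ?_⟩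
  intro B hB C hC hB' hC'
  obtain ⟨i, hi⟩ := htr ⟨B, hB, hB'⟩ ⟨C, hC, hC'⟩
  exact ⟨i, congrArg Subtype.val hi⟩

lemma FTD.stab_trans (h : FTD Γ bl k lam r) (α : P) : ∀ B ∈ bl, ∀ C ∈ bl, α ∈ B → α ∈ C →
    ∃ g ∈ MulAction.stabilizer Γ α, g • B = C := by
  intro B hB C hC h1 h2
  obtain ⟨g, hg, hg'⟩ := h.trans B hB C hC α h1 α h2
  exact ⟨g, hg, hg'⟩

lemma FTD.stab_not_KK (h : FTD Γ bl k lam r) (α : P) {H : Subgroup Γ}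
    (ht : ∀ B ∈ bl, ∀ C ∈ bl, α ∈ B → α ∈ C → ∃ g ∈ H, g • B = C) : ¬ H ≤ KK Γ bl α := by
  intro hc
  obtain ⟨y, hy⟩ := h.ex_not α
  obtain ⟨B, hB, h1, h2⟩ := h.ex_block_sep hy.symm
  obtain ⟨C, hC⟩ := h.Bl_nonempty hy.symm
  rw [mem_Bl] at hC
  obtain ⟨g, hg, e⟩ := ht B hB C hC.1 h1 hC.2.1
  have := hc hg B hB h1
  rw [e] at this
  subst this
  exact h2 hC.2.2

lemma FTD.exists_rho' [Finite Γ] (h : FTD Γ bl k lam r) (α : P) : ∃ ρ : Γ, IsRho bl r α ρ := by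
  obtain ⟨ρ, -, hρ⟩ := h.exists_rho α (MulAction.stabilizer Γ α) (MulAction.stabilizer Γ α)
    (fun g hg => hg) (h.stab_trans α) le_rfl
    (fun g hg n hn => mul_mem (mul_mem hg hn) (inv_mem hg)) (h.stab_not_KK α (h.stab_trans α))
  exact ⟨ρ, hρ⟩

lemma FTD.rho_fix_only (h : FTD Γ bl k lam r) {α : P} {ρ : Γ} (hρ : IsRho bl r α ρ) {β : P}
    (hβ : ρ • β = β) : β = α := by
  by_contra hc
  obtain ⟨B, hB, h1, h2⟩ := h.ex_block_sep (Ne.symm hc)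
  obtain ⟨C, hC⟩ := h.Bl_nonempty (Ne.symm hc)
  rw [mem_Bl] at hC
  obtain ⟨i, hi⟩ := hρ.tr C hC.1 B hB hC.2.1 h1
  apply h2
  rw [← hi]
  have h3 : ρ ^ i • β = β := by
    have : ρ ^ i ∈ MulAction.stabilizer Γ β := pow_mem (show ρ ∈ MulAction.stabilizer Γ β from hβ) i
    exact this
  have := mem_smul_fin (g := ρ ^ i).2 hC.2.2
  rwa [h3] at this

lemma FTD.rho_comm_fix (h : FTD Γ bl k lam r) {α : P} {ρ : Γ} (hρ : IsRho bl r α ρ) {g : Γ}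
    (hg : g * ρ = ρ * g) : g • α = α := by
  apply h.rho_fix_only hρ
  rw [← mul_smul, ← hg, mul_smul, hρ.fix]

lemma FTD.rho_comm (h : FTD Γ bl k lam r) {α : P} {ρ : Γ} (hρ : IsRho bl r α ρ) {g : Γ}
    (hg : g * ρ = ρ * g) : ∃ i : ℕ, (ρ ^ i)⁻¹ * g ∈ KK Γ bl α := by
  have hα := h.rho_comm_fix hρ hg
  obtain ⟨B, hB, h1⟩ := h.ex_block α
  have h2 : α ∈ g • B := by
    have := mem_smul_fin (g := g).2 h1
    rwa [hα] at this
  obtain ⟨i, hi⟩ := hρ.tr B hB (g • B) (h.inv g B hB) h1 h2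
  refine ⟨i, fun C hC hC' => ?_⟩
  obtain ⟨j, rfl⟩ := hρ.tr B hB C hC h1 hC'
  rw [mul_smul, inv_smul_eq_iff, ← mul_smul, (Commute.pow_right hg j : g * ρ ^ j = ρ ^ j * g), mul_smul, ← hi,
    ← mul_smul, ← mul_smul, ← pow_add, ← pow_add, add_comm]

lemma FTD.rho_comm_K (h : FTD Γ bl k lam r) {α : P} {ρ : Γ} (hρ : IsRho bl r α ρ) {g : Γ}
    (hg : g * ρ = ρ * g) {n : ℕ} (hgn : g ^ n = 1) (hn : ¬ r ∣ n) : g ∈ KK Γ bl α := by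
  obtain ⟨i, hi⟩ := h.rho_comm hρ hg
  obtain ⟨a, ha⟩ := hρ.ord
  have hcomm : Commute ((ρ ^ i)⁻¹) g := (Commute.pow_right (show Commute g ρ from hg) i).inv_right.symm
  have h1 : ((ρ ^ i)⁻¹ * g) ^ n ∈ KK Γ bl α := pow_mem hi n
  rw [hcomm.mul_pow, hgn, mul_one, inv_pow, ← pow_mul] at h1
  have h2 : ρ ^ (i * n) ∈ KK Γ bl α := by simpa using inv_mem h1
  -- ρ ^ i is a power of ρ ^ (i n)
  have hcop : Nat.Coprime n (orderOf (ρ ^ i)) := by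
    have hd : orderOf (ρ ^ i) ∣ r ^ a := ha ▸ orderOf_pow_dvd i
    apply Nat.Coprime.coprime_dvd_right hd
    apply Nat.Coprime.pow_right
    rw [Nat.coprime_comm, Nat.Prime.coprime_iff_not_dvd h.prime]
    exact hn
  obtain ⟨m, hm⟩ := exists_pow_eq_self_of_coprime hcop
  have h3 : ρ ^ i ∈ KK Γ bl α := by
    rw [← hm, ← pow_mul ρ i n]
    exact pow_mem h2 m
  have := mul_mem h3 hi
  rwa [mul_inv_cancel_left] at this

/-- `K_α` contains no element of order `r` acting non-trivially -/
lemma FTD.KK_no_r (h : FTD Γ bl k lam r) {α : P} {g : Γ} (hg : g ∈ KK Γ bl α) (hr : g ^ r = 1)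
    (x : P) : g • x = x := by
  by_contra hx
  have hxa : α ≠ x := by rintro rfl; exact hx (h.KK_fix hg)
  obtain ⟨B, hB⟩ := h.Bl_nonempty hxa
  rw [mem_Bl] at hB
  have horb : ∀ i : ℕ, g ^ i • x ∈ B.erase α := by
    intro i
    have h1 := pow_mem hg i
    rw [Finset.mem_erase]
    constructor
    · intro he
      have := h.KK_fix h1
      rw [← he] at this
      exact hxa (by rw [← he]; exact smul_left_cancel _ this)
    · rw [← h1 B hB.1 hB.2.1]
      exact mem_smul_fin.2 hB.2.2
  have hp : Function.minimalPeriod (fun y : P => g • y) x = r := by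
    have hd : Function.minimalPeriod (fun y : P => g • y) x ∣ r := by
      apply Function.IsPeriodicPt.minimalPeriod_dvd
      change (fun y : P => g • y)^[r] x = x
      rw [smul_iterate, hr]; exact one_smul Γ x
    rcases (Nat.dvd_prime h.prime).1 hd with h1 | h1
    · rw [Function.minimalPeriod_eq_one_iff_isFixedPt] at h1
      exact absurd h1 hx
    · exact h1
  have hinj : ((Finset.range r).image fun i => g ^ i • x).card = r := by
    rw [Finset.card_image_of_injOn, Finset.card_range]
    intro i hi j hj hij
    simp only [Finset.coe_range, Set.mem_Iio] at hi hj
    have := Function.iterate_injOn_Iio_minimalPeriod (f := fun y : P => g • y) (x := x)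
    apply this (by simpa [hp] using hi) (by simpa [hp] using hj)
    simpa [smul_iterate] using hij
  have hle : ((Finset.range r).image fun i => g ^ i • x).card ≤ (B.erase α).card := by
    apply Finset.card_le_card
    intro y hy
    obtain ⟨i, -, rfl⟩ := Finset.mem_image.1 hy
    exact horb i
  rw [hinj, Finset.card_erase_of_mem hB.2.1, h.blk B hB.1] at hle
  have := h.fisher
  have := h.k3
  omega

end FTD
end NFT

namespace NFT

/-! ### The symplectic space and its isometries -/

abbrev VV (m : ℕ) (F : Type*) := (Fin m → F) × (Fin m → F)

section Sympl
variable {m : ℕ} {F : Type*} [Field F]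

/-- the symplectic form -/
def om : VV m F →ₗ[F] VV m F →ₗ[F] F :=
  LinearMap.mk₂ F (fun x y => x.1 ⬝ᵥ y.2 - x.2 ⬝ᵥ y.1)
    (fun x x' y => by simp [add_dotProduct]; ring)
    (fun c x y => by simp [smul_dotProduct]; ring)
    (fun x y y' => by simp [dotProduct_add]; ring)
    (fun c x y => by simp [dotProduct_smul]; ring)

lemma om_apply (x y : VV m F) : om x y = x.1 ⬝ᵥ y.2 - x.2 ⬝ᵥ y.1 := rfl

@[simp] lemma om_self (x : VV m F) : om x x = 0 := by
  rw [om_apply, dotProduct_comm, sub_self]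

lemma om_swap (x y : VV m F) : om x y = - om y x := by
  rw [om_apply, om_apply, dotProduct_comm x.1, dotProduct_comm x.2]; ring

lemma om_zero_swap {x y : VV m F} (h : om x y = 0) : om y x = 0 := by
  rw [om_swap, h, neg_zero]

lemma om_nd {x : VV m F} (h : ∀ y, om x y = 0) : x = 0 := by
  ext i
  · have := h (0, Pi.single i 1)
    simpa [om_apply] using this
  · have := h (Pi.single i 1, 0)
    simpa [om_apply] using this

lemma om_nd' {x : VV m F} (h : x ≠ 0) : ∃ y, om x y = 1 := by
  by_contra hc
  push Not at hc
  apply h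
  apply om_nd
  intro y
  by_contra hy
  apply hc ((om x y)⁻¹ • y)
  rw [map_smul, smul_eq_mul, inv_mul_cancel₀ hy]

lemma om_ext {x y : VV m F} (h : ∀ w, om x w = om y w) : x = y := by
  rw [← sub_eq_zero]
  apply om_nd
  intro w
  rw [map_sub, LinearMap.sub_apply, h, sub_self]

/-- the symplectic group -/
def Sp (m : ℕ) (F : Type*) [Field F] : Subgroup (VV m F ≃ₗ[F] VV m F) where
  carrier := {g | ∀ x y, om (g x) (g y) = om x y}
  mul_mem' := by
    intro a b ha hb x y
    change om (a (b x)) (a (b y)) = _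
    rw [ha, hb]
  one_mem' := by intro x y; rfl
  inv_mem' := by
    intro a ha x y
    have := ha (a⁻¹ x) (a⁻¹ y)
    rw [← this]
    congr 1
    · congr 1; exact congrArg (fun f : VV m F ≃ₗ[F] VV m F => f x) (mul_inv_cancel a)
    · exact congrArg (fun f : VV m F ≃ₗ[F] VV m F => f y) (mul_inv_cancel a)

lemma Sp.om (g : Sp m F) (x y : VV m F) : om (g.1 x) (g.1 y) = om x y := g.2 x y

@[simp] lemma Sp.mul_apply (g h : Sp m F) (x : VV m F) : (g * h).1 x = g.1 (h.1 x) := rfl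
@[simp] lemma Sp.one_apply (x : VV m F) : (1 : Sp m F).1 x = x := rfl
@[simp] lemma Sp.inv_apply_self (g : Sp m F) (x : VV m F) : (g⁻¹).1 (g.1 x) = x := by
  rw [← Sp.mul_apply, inv_mul_cancel]; rfl
@[simp] lemma Sp.apply_inv_self (g : Sp m F) (x : VV m F) : g.1 ((g⁻¹).1 x) = x := by
  rw [← Sp.mul_apply, mul_inv_cancel]; rfl

lemma Sp.ext' {g h : Sp m F} (e : ∀ x, g.1 x = h.1 x) : g = h :=
  Subtype.ext (LinearEquiv.ext e)

lemma Sp.apply_eq_zero {g : Sp m F} {x : VV m F} : g.1 x = 0 ↔ x = 0 := by simp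

lemma Sp.om_inv (g : Sp m F) (x y : VV m F) : NFT.om (g.1 x) y = NFT.om x ((g⁻¹).1 y) := by
  rw [← Sp.om g x, Sp.apply_inv_self]

instance [Finite F] : Finite (Sp m F) := by
  apply Finite.of_injective (fun g : Sp m F => (fun x => g.1 x : VV m F → VV m F))
  intro g h e
  exact Sp.ext' fun x => congrFun e x

/-- construct an isometry -/
noncomputable def mkSp (f : VV m F →ₗ[F] VV m F) (hf : ∀ x y, om (f x) (f y) = om x y) : Sp m F :=
  ⟨LinearEquiv.ofInjectiveEndo f (by
    rw [← LinearMap.ker_eq_bot, LinearMap.ker_eq_bot']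
    intro x hx
    apply om_nd
    intro y
    rw [← hf, hx]
    simp), fun x y => hf x y⟩

@[simp] lemma mkSp_apply (f : VV m F →ₗ[F] VV m F) (hf) (x : VV m F) : (mkSp f hf).1 x = f x := rfl

/-- transvection -/
noncomputable def tv (x : VV m F) (c : F) : Sp m F :=
  mkSp (LinearMap.id + c • ((om.flip x).smulRight x)) (by
    intro w z
    simp only [LinearMap.add_apply, LinearMap.id_apply, LinearMap.smul_apply, LinearMap.smulRight_apply,
      LinearMap.flip_apply, map_add, map_smul, smul_eq_mul, om_self]
    rw [om_swap z x]; ring)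

lemma tv_apply (x : VV m F) (c : F) (w : VV m F) : (tv x c).1 w = w + (c * om w x) • x := by
  simp [tv, mul_smul]

/-- Siegel transformation -/
noncomputable def sg (x u : VV m F) : Sp m F := by
  classical
  exact if h : om x u = 0 then
    mkSp (LinearMap.id + (om.flip u).smulRight x + (om.flip x).smulRight u) (by
      intro w z
      simp only [LinearMap.add_apply, LinearMap.id_apply, LinearMap.smulRight_apply,
        LinearMap.flip_apply, map_add, map_smul, LinearMap.smul_apply, smul_eq_mul, om_self, h, om_zero_swap h]
      rw [om_swap z x, om_swap z u]; ring)
  else 1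

lemma sg_apply {x u : VV m F} (h : om x u = 0) (w : VV m F) :
    (sg x u).1 w = w + om w u • x + om w x • u := by
  simp [sg, h]

/-- torus element -/
noncomputable def dg (x y : VV m F) (a : F) : Sp m F := by
  classical
  exact if h : om x y = 1 ∧ a ≠ 0 then
    mkSp (LinearMap.id + (a - 1) • (om.flip y).smulRight x + (a⁻¹ - 1) • (om x).smulRight y) (by
      obtain ⟨h1, h2⟩ := h
      have h3 : om y x = -1 := by rw [om_swap, h1]
      intro w z
      simp only [LinearMap.add_apply, LinearMap.id_apply, LinearMap.smulRight_apply,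
        LinearMap.flip_apply, map_add, map_smul, LinearMap.smul_apply, smul_eq_mul, om_self, h1, h3]
      rw [om_swap w y, om_swap w x, om_swap z y]; field_simp; ring)
  else 1

lemma dg_apply {x y : VV m F} {a : F} (h : om x y = 1) (ha : a ≠ 0) (w : VV m F) :
    (dg x y a).1 w = w + ((a - 1) * om w y) • x + ((a⁻¹ - 1) * om x w) • y := by
  simp [dg, h, ha, mul_smul]

lemma dg_x {x y : VV m F} {a : F} (h : om x y = 1) (ha : a ≠ 0) : (dg x y a).1 x = a • x := by
  rw [dg_apply h ha, h, om_self]; module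

lemma dg_y {x y : VV m F} {a : F} (h : om x y = 1) (ha : a ≠ 0) : (dg x y a).1 y = a⁻¹ • y := by
  rw [dg_apply h ha, h, om_self]; module

lemma dg_perp {x y : VV m F} {a : F} (h : om x y = 1) (ha : a ≠ 0) {w : VV m F} (h1 : om x w = 0)
    (h2 : om w y = 0) : (dg x y a).1 w = w := by
  rw [dg_apply h ha, h1, h2]; module

lemma tv_conj (g : Sp m F) (x : VV m F) (c : F) : g * tv x c * g⁻¹ = tv (g.1 x) c := by
  apply Sp.ext'
  intro w
  rw [Sp.mul_apply, Sp.mul_apply, tv_apply, tv_apply, map_add, map_smul, Sp.apply_inv_self]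
  rw [← Sp.om g, Sp.apply_inv_self]

lemma sg_conj (g : Sp m F) {x u : VV m F} (h : om x u = 0) : g * sg x u * g⁻¹ = sg (g.1 x) (g.1 u) := by
  apply Sp.ext'
  intro w
  rw [Sp.mul_apply, Sp.mul_apply, sg_apply h, sg_apply (by rw [Sp.om, h]), map_add, map_add, map_smul, map_smul,
    Sp.apply_inv_self]
  rw [← Sp.om g, ← Sp.om g (g⁻¹.1 w) x, Sp.apply_inv_self]

lemma tv_mul (x : VV m F) (c d : F) : tv x c * tv x d = tv x (c + d) := by
  apply Sp.ext'
  intro w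
  simp only [Sp.mul_apply, tv_apply, map_add, map_smul, LinearMap.add_apply, LinearMap.smul_apply, om_self]
  module

@[simp] lemma tv_zero (x : VV m F) : tv x 0 = 1 := by
  apply Sp.ext'; intro w; simp [tv_apply]

@[simp] lemma tv_zero' (c : F) : tv (0 : VV m F) c = 1 := by
  apply Sp.ext'; intro w; simp [tv_apply]

lemma tv_inv (x : VV m F) (c : F) : (tv x c)⁻¹ = tv x (-c) := by
  rw [inv_eq_iff_mul_eq_one, tv_mul, add_neg_cancel, tv_zero]

lemma tv_smul (x : VV m F) (a c : F) : tv (a • x) c = tv x (a * a * c) := by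
  apply Sp.ext'; intro w
  simp only [tv_apply, map_smul, smul_eq_mul, smul_smul]
  congr 2; ring

lemma tv_pow (x : VV m F) (c : F) (n : ℕ) : tv x c ^ n = tv x (n * c) := by
  induction n with
  | zero => simp
  | succ n ih => rw [pow_succ, ih, tv_mul]; congr 1; push_cast; ring

lemma tv_comm {x y : VV m F} (h : om x y = 0) (c d : F) : tv x c * tv y d = tv y d * tv x c := by
  apply Sp.ext'
  intro w
  simp only [Sp.mul_apply, tv_apply, map_add, map_smul, LinearMap.add_apply, LinearMap.smul_apply, h, om_zero_swap h]
  module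

lemma tv_eq_one {x : VV m F} (hx : x ≠ 0) {c : F} (h : tv x c = 1) : c = 0 := by
  obtain ⟨y, hy⟩ := om_nd' hx
  have h1 : (tv x c).1 y = y := by rw [h]; rfl
  rw [tv_apply, om_swap, hy] at h1
  have h2 : (c * -1) • x = 0 := by simpa using h1
  rcases smul_eq_zero.1 h2 with h3 | h3
  · simpa using h3
  · exact absurd h3 hx

lemma tv_self (x : VV m F) (c : F) : (tv x c).1 x = x := by simp [tv_apply]

lemma tv_perp {x w : VV m F} (h : om w x = 0) (c : F) : (tv x c).1 w = w := by simp [tv_apply, h]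

lemma sg_mul {x u u' : VV m F} (h : om x u = 0) (h' : om x u' = 0) :
    sg x u * sg x u' = sg x (u + u') * tv x (om u' u) := by
  apply Sp.ext'
  intro w
  have h'' : om x (u + u') = 0 := by rw [map_add, h, h', add_zero]
  simp only [Sp.mul_apply, tv_apply, sg_apply h, sg_apply h', sg_apply h'', map_add, map_smul,
    LinearMap.add_apply, LinearMap.smul_apply, h, h', om_zero_swap h, om_zero_swap h', om_self, smul_eq_mul, mul_zero,
    add_zero]
  module

lemma sg_tv_comm {x u : VV m F} (h : om x u = 0) (c : F) : sg x u * tv x c = tv x c * sg x u := by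
  apply Sp.ext'
  intro w
  simp only [Sp.mul_apply, tv_apply, sg_apply h, map_add, map_smul,
    LinearMap.add_apply, LinearMap.smul_apply, h, om_zero_swap h, om_self, smul_eq_mul, mul_zero,
    add_zero]
  module

lemma sg_self (x : VV m F) (c : F) : sg x (c • x) = tv x (2 * c) := by
  apply Sp.ext'; intro w
  rw [sg_apply (by simp), tv_apply]
  simp only [map_smul, smul_eq_mul]
  module

@[simp] lemma sg_zero (x : VV m F) : sg x 0 = 1 := by
  apply Sp.ext'; intro w
  rw [sg_apply (by simp)]
  simp

lemma sg_x {x u : VV m F} (h : om x u = 0) : (sg x u).1 x = x := by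
  rw [sg_apply h, h]; simp

/-! transitivity -/

lemma exists_avoid {V : Type*} [AddCommGroup V] [Module F V] (S : Submodule F V) (f g : V →ₗ[F] F)
    (hf : ∃ x ∈ S, f x ≠ 0) (hg : ∃ x ∈ S, g x ≠ 0) : ∃ x ∈ S, f x ≠ 0 ∧ g x ≠ 0 := by
  obtain ⟨x, hx, hfx⟩ := hf
  obtain ⟨y, hy, hgy⟩ := hg
  by_cases h1 : g x = 0
  · by_cases h2 : f y = 0
    · exact ⟨x + y, S.add_mem hx hy, by simpa [h2] using hfx, by simpa [h1] using hgy⟩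
    · exact ⟨y, hy, h2, hgy⟩
  · exact ⟨x, hx, hfx, h1⟩

/-- perp of a vector -/
def pp (x : VV m F) : Submodule F (VV m F) := LinearMap.ker (om x)

@[simp] lemma mem_pp {x y : VV m F} : y ∈ pp x ↔ om x y = 0 := Iff.rfl

lemma perp_perp {x u : VV m F} (hx : x ≠ 0) (h : ∀ w, om x w = 0 → om u w = 0) : ∃ a : F, u = a • x := by
  obtain ⟨y, hy⟩ := om_nd' hx
  refine ⟨om u y, om_ext fun w => ?_⟩
  have := h (w - om x w • y) (by rw [map_sub, map_smul, hy]; simp)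
  rw [map_sub, map_smul, smul_eq_mul, sub_eq_zero] at this
  rw [this, map_smul, LinearMap.smul_apply, smul_eq_mul, mul_comm]

lemma ex_perp_not {x u : VV m F} (hx : x ≠ 0) (hu : ∀ a : F, u ≠ a • x) : ∃ w, om x w = 0 ∧ om u w ≠ 0 := by
  by_contra hc
  push Not at hc
  obtain ⟨a, ha⟩ := perp_perp hx hc
  exact hu a ha

lemma tv_move {x y : VV m F} (h : om x y ≠ 0) : (tv (y - x) (om x y)⁻¹).1 x = y := by
  rw [tv_apply, map_sub, om_self, sub_zero, inv_mul_cancel₀ h]; simp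

lemma sp_trans {x y : VV m F} (hx : x ≠ 0) (hy : y ≠ 0) : ∃ g : Sp m F, g.1 x = y := by
  obtain ⟨x', hx'⟩ := om_nd' hx
  obtain ⟨y', hy'⟩ := om_nd' hy
  obtain ⟨z, -, h1, h2⟩ := exists_avoid ⊤ (om x) (om y) ⟨x', trivial, by simp [hx']⟩ ⟨y', trivial, by simp [hy']⟩
  have h3 : om z y ≠ 0 := by rw [om_swap]; simpa using h2
  exact ⟨tv (y - z) (om z y)⁻¹ * tv (z - x) (om x z)⁻¹, by rw [Sp.mul_apply, tv_move h1, tv_move h3]⟩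

lemma stab_trans {x u v : VV m F} (hx : x ≠ 0) (hu : ∀ a : F, u ≠ a • x) (hv : ∀ a : F, v ≠ a • x)
    (hxu : om x u = 0) (hxv : om x v = 0) : ∃ g : Sp m F, g.1 x = x ∧ g.1 u = v := by
  obtain ⟨w, hw, hw'⟩ := ex_perp_not hx hu
  obtain ⟨z, hz, hz'⟩ := ex_perp_not hx hv
  obtain ⟨y, h0, h1, h2⟩ := exists_avoid (pp x) (om u) (om v) ⟨w, hw, hw'⟩ ⟨z, hz, hz'⟩
  rw [mem_pp] at h0
  have h3 : om y v ≠ 0 := by rw [om_swap]; simpa using h2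
  refine ⟨tv (v - y) (om y v)⁻¹ * tv (y - u) (om u y)⁻¹, ?_, by rw [Sp.mul_apply, tv_move h1, tv_move h3]⟩
  rw [Sp.mul_apply, tv_perp (x := y - u) (w := x) (by simp [h0, hxu]), tv_perp (by simp [h0, hxv])]

lemma comm_tv_scalar {g : Sp m F} (h : ∀ x, g * tv x 1 = tv x 1 * g) :
    (∀ x, g.1 x = x) ∨ (∀ x, g.1 x = - x) := by
  have h1 : ∀ x, g.1 x = x ∨ g.1 x = -x := by
    intro x
    by_cases hx : x = 0
    · simp [hx]
    have h2 : tv (g.1 x) 1 = tv x 1 := by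
      rw [← tv_conj, h, mul_assoc, mul_inv_cancel, mul_one]
    obtain ⟨y, hy⟩ := om_nd' (show g.1 x ≠ 0 by simpa using hx)
    have h3 : ∀ w, om w (g.1 x) • g.1 x = om w x • x := by
      intro w
      have : (tv (g.1 x) 1).1 w = (tv x 1).1 w := by rw [h2]
      simpa [tv_apply] using this
    have h4 := h3 y
    rw [om_swap, hy] at h4
    obtain ⟨b, hb⟩ : ∃ b : F, g.1 x = b • x := ⟨- om y x, by
      have : g.1 x = -((-1 : F) • g.1 x) := by module
      rw [this, h4]; module⟩
    obtain ⟨z, hz⟩ := om_nd' hx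
    have h5 := h3 z
    rw [hb, map_smul, smul_smul, smul_eq_mul, om_swap z, hz] at h5
    have h6 : (b * b - 1) • x = 0 := by
      have : (b * b - 1) • x = -((b * -1 * b) • x - (-1 : F) • x) := by module
      rw [this, h5]; simp
    have h7 : b * b = 1 := by
      rcases smul_eq_zero.1 h6 with h8 | h8
      · linear_combination h8
      · exact absurd h8 hx
    rcases mul_self_eq_one_iff.1 h7 with h8 | h8
    · left; rw [hb, h8, one_smul]
    · right; rw [hb, h8]; module
  by_contra hc
  push Not at hc
  obtain ⟨⟨x, hx⟩, ⟨y, hy⟩⟩ := hc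
  have hx' := (h1 x).resolve_left hx
  have hy' := (h1 y).resolve_right hy
  rcases h1 (x + y) with h2 | h2
  · rw [map_add, hx', hy'] at h2
    apply hx; rw [hx']; exact add_right_cancel h2
  · rw [map_add, hx', hy', neg_add] at h2
    apply hy; rw [hy']; exact add_left_cancel h2

/-- a central isometry which fixes a non-zero vector is trivial -/
lemma scalar_fix {g : Sp m F} (h : (∀ x, g.1 x = x) ∨ (∀ x, g.1 x = - x)) {x : VV m F} (hx : x ≠ 0)
    (hgx : g.1 x = x) : g = 1 := by
  rcases h with h | h
  · exact Sp.ext' h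
  · have h1 := h x
    rw [hgx] at h1
    have h2 : (2 : F) • x = 0 := by
      have : (2 : F) • x = x + x := by module
      rw [this]; nth_rewrite 1 [h1]; simp
    have h3 : (2 : F) = 0 := (smul_eq_zero.1 h2).resolve_right hx
    apply Sp.ext'
    intro y
    rw [h y, Sp.one_apply]
    have : -y = y - (2 : F) • y := by module
    rw [this, h3]; simp

end Sympl
end NFT

namespace NFT

/-! ### Character counting -/

lemma card_char_trivial {A : Type*} [AddCommGroup A] [Finite A] (K : AddSubgroup A) :
    Nat.card {χ : AddChar A ℂ // ∀ a ∈ K, χ a = 1} ≤ K.index := by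
  classical
  have : Fintype (A ⧸ K) := Fintype.ofFinite _
  have h1 : K.index = Nat.card (AddChar (A ⧸ K) ℂ) := by
    rw [Nat.card_eq_fintype_card, AddChar.card_eq, ← Nat.card_eq_fintype_card]; rfl
  rw [h1]
  let f : {χ : AddChar A ℂ // ∀ a ∈ K, χ a = 1} → AddChar (A ⧸ K) ℂ := fun χ =>
    AddChar.toAddMonoidHomEquiv.symm (QuotientAddGroup.lift K (AddChar.toAddMonoidHom χ.1) (by
      intro a ha
      rw [AddMonoidHom.mem_ker]
      exact χ.2 a ha))
  apply Nat.card_le_card_of_injective f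
  intro χ χ' h
  apply Subtype.ext
  ext a
  exact congrArg (fun ψ : AddChar (A ⧸ K) ℂ => ψ (QuotientAddGroup.mk a)) h

lemma char_ne {A : Type*} [AddCommGroup A] (χ : AddChar A ℂ) (a : A) : χ a ≠ 0 := by
  intro h
  have : χ (a + -a) = 1 := by rw [add_neg_cancel, AddChar.map_zero_eq_one]
  rw [AddChar.map_add_eq_mul, h, zero_mul] at this
  exact zero_ne_one this

lemma char_count {A Φ : Type*} [AddCommGroup A] [Finite A] [AddCommGroup Φ] [Finite Φ]
    (act : Φ → A →+ A) (hact : ∀ φ ψ a, act (φ + ψ) a = act φ (act ψ a)) (h0 : ∀ a, act 0 a = a)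
    (T : Set Φ) (W Z : AddSubgroup A) (hTW : ∀ φ ∈ T, ∀ a ∈ W, act φ a ∈ W)
    (hZ : ∀ φ, ∀ a ∈ Z, act φ a = a) (ε : ℕ)
    (hst : ∀ χ : AddChar A ℂ, (∃ a ∈ Z, χ a ≠ 1) → Nat.card {δ : Φ // ∀ a, χ (act δ a) = χ a} ≤ ε)
    (hZW : ¬ Z ≤ W) : Nat.card T ≤ ε * (W ⊔ Z).index := by
  classical
  obtain ⟨z, hz, hzW⟩ := SetLike.not_le_iff_exists.1 hZW
  obtain ⟨ψ, hψ⟩ := (AddChar.exists_apply_ne_zero (a := (QuotientAddGroup.mk z : A ⧸ W))).2 (by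
    rwa [Ne, QuotientAddGroup.eq_zero_iff])
  let χ : AddChar A ℂ := ψ.compAddMonoidHom (QuotientAddGroup.mk' W)
  have hχW : ∀ a ∈ W, χ a = 1 := by
    intro a ha
    change ψ (QuotientAddGroup.mk a) = 1
    rw [(QuotientAddGroup.eq_zero_iff a).2 ha, AddChar.map_zero_eq_one]
  have hχz : χ z ≠ 1 := hψ
  have hχne : ∀ a, χ a ≠ 0 := fun a => char_ne χ a
  have hs := hst χ ⟨z, hz, hχz⟩
  let f : T → {χ : AddChar A ℂ // ∀ a ∈ W ⊔ Z, χ a = 1} := fun φ =>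
    ⟨χ.compAddMonoidHom (act φ.1) * χ⁻¹, by
      intro a ha
      obtain ⟨w, hw, y, hy, rfl⟩ := AddSubgroup.mem_sup.1 ha
      rw [AddChar.mul_apply, AddChar.compAddMonoidHom_apply, map_add, AddChar.map_add_eq_mul,
        hχW _ (hTW _ φ.2 _ hw), hZ _ _ hy, one_mul, AddChar.inv_apply', AddChar.map_add_eq_mul, hχW _ hw, one_mul,
        mul_inv_cancel₀ (hχne y)]⟩
  haveI : Fintype T := Fintype.ofFinite _
  haveI : Fintype {χ : AddChar A ℂ // ∀ a ∈ W ⊔ Z, χ a = 1} := Fintype.ofFinite _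
  have h1 := Finset.card_le_mul_card_image (f := f) (Finset.univ : Finset T) ε (by
    intro b hb
    obtain ⟨φ0, -, rfl⟩ := Finset.mem_image.1 hb
    refine le_trans ?_ hs
    rw [← Nat.card_eq_finsetCard]
    refine Nat.card_le_card_of_injective (fun φ => ⟨φ.1.1 - φ0.1, ?_⟩) ?_
    · intro a
      have h2 := (Finset.mem_filter.1 φ.2).2
      have h3 : ∀ a, χ (act φ.1.1 a) = χ (act φ0.1 a) := by
        intro a
        have := congrArg (fun ψ : {χ : AddChar A ℂ // ∀ a ∈ W ⊔ Z, χ a = 1} => ψ.1 a) h2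
        simp only [f, AddChar.mul_apply, AddChar.compAddMonoidHom_apply, AddChar.inv_apply'] at this
        exact mul_right_cancel₀ (inv_ne_zero (hχne a)) this
      have h4 := h3 (act (-φ0.1) a)
      rw [← hact, ← hact, add_neg_cancel, h0, ← sub_eq_add_neg] at h4
      exact h4
    · intro φ φ' h
      have := congrArg Subtype.val h
      exact Subtype.ext (Subtype.ext (sub_left_injective this)))
  rw [Finset.card_univ, ← Nat.card_eq_fintype_card] at h1
  refine h1.trans (Nat.mul_le_mul_left _ ?_)
  refine le_trans ?_ (card_char_trivial (W ⊔ Z))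
  rw [Nat.card_eq_fintype_card]
  exact Finset.card_le_univ _

/-! ### The groups `A` and `U` -/
section AU
variable {m : ℕ} {F : Type*} [Field F]
open Matrix

/-- symmetric matrices -/
def Sy (m : ℕ) (F : Type*) [Field F] : Submodule F (Matrix (Fin m) (Fin m) F) where
  carrier := {S | Sᵀ = S}
  add_mem' := by intro a b ha hb; simp only [Set.mem_setOf_eq] at *; rw [transpose_add, ha, hb]
  zero_mem' := by simp
  smul_mem' := by intro c a ha; simp only [Set.mem_setOf_eq] at *; rw [transpose_smul, ha]

lemma Sy.dot (S : Sy m F) (a b : Fin m → F) : (S.1 *ᵥ a) ⬝ᵥ b = a ⬝ᵥ S.1 *ᵥ b := by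
  rw [dotProduct_mulVec, ← mulVec_transpose]
  rw [show S.1ᵀ = S.1 from S.2]

noncomputable def nS (S : Sy m F) : Sp m F :=
  mkSp { toFun := fun w => (w.1 + S.1 *ᵥ w.2, w.2)
         map_add' := by intro x y; ext <;> simp [mulVec_add]; ring
         map_smul' := by intro c x; ext <;> simp [mulVec_smul, mul_add] } (by
    intro x y
    simp only [om_apply, LinearMap.coe_mk, AddHom.coe_mk, add_dotProduct, dotProduct_add, Sy.dot]
    ring)

@[simp] lemma nS_apply (S : Sy m F) (w : VV m F) : (nS S).1 w = (w.1 + S.1 *ᵥ w.2, w.2) := rfl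

lemma nS_add (S S' : Sy m F) : nS (S + S') = nS S * nS S' := by
  apply Sp.ext'
  intro w
  simp [add_mulVec]
  ring

lemma nS_zero : nS (0 : Sy m F) = 1 := by
  apply Sp.ext'
  intro w
  simp

lemma nS_neg (S : Sy m F) : nS (-S) = (nS S)⁻¹ := by
  rw [eq_inv_iff_mul_eq_one, ← nS_add, neg_add_cancel, nS_zero]

lemma nS_inj {S S' : Sy m F} (h : nS S = nS S') : S = S' := by
  apply Subtype.ext
  ext i j
  have h1 : (nS S).1 (0, Pi.single j 1) = (nS S').1 (0, Pi.single j 1) := by rw [h]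
  have := congrFun (congrArg Prod.fst h1) i
  simpa using this

/-- `c v vᵀ` -/
def sq (v : Fin m → F) (c : F) : Sy m F := ⟨c • vecMulVec v v, by
  change (c • vecMulVec v v)ᵀ = _
  rw [transpose_smul, transpose_vecMulVec]⟩

/-- `c (v wᵀ + w vᵀ)` -/
def cr (v w : Fin m → F) (c : F) : Sy m F := ⟨c • (vecMulVec v w + vecMulVec w v), by
  change (c • (vecMulVec v w + vecMulVec w v))ᵀ = _
  rw [transpose_smul, transpose_add, transpose_vecMulVec, transpose_vecMulVec, add_comm]⟩

lemma tv_eq_nS (v : Fin m → F) (c : F) : tv (v, 0) c = nS (sq v (-c)) := by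
  apply Sp.ext'
  intro w
  rw [tv_apply, nS_apply]
  ext i
  · simp [sq, om_apply, vecMulVec_mulVec, smul_mulVec, neg_mulVec, dotProduct_comm w.2 v]
    try ring
  · simp

/-- the index set for `U` -/
def Ph (i : Fin m) (F : Type*) [Field F] : AddSubgroup (Fin m → F) where
  carrier := {φ | φ i = 0}
  add_mem' := by intro a b ha hb; simp only [Set.mem_setOf_eq] at *; simp [ha, hb]
  zero_mem' := by simp
  neg_mem' := by intro a ha; simp only [Set.mem_setOf_eq] at *; simp [ha]

variable (i : Fin m)

def ee (i : Fin m) : Fin m → F := Pi.single i 1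

noncomputable def uU (φ : Ph i F) : Sp m F := sg (ee i, 0) (0, φ.1)

lemma Ph.perp (φ : Ph i F) : om ((ee i, 0) : VV m F) (0, φ.1) = 0 := by
  have : φ.1 i = 0 := φ.2
  simp [om_apply, ee, this]

lemma uU_apply (φ : Ph i F) (w : VV m F) :
    (uU i φ).1 w = (w.1 + (w.1 ⬝ᵥ φ.1) • ee i, w.2 - w.2 i • φ.1) := by
  rw [uU, sg_apply (Ph.perp i φ)]
  ext j
  · simp [om_apply]
  · simp [om_apply, ee]; ring

lemma uU_add (φ ψ : Ph i F) : uU i (φ + ψ) = uU i φ * uU i ψ := by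
  rw [uU, uU, uU, sg_mul (Ph.perp i φ) (Ph.perp i ψ)]
  have : om ((0, ψ.1) : VV m F) (0, φ.1) = 0 := by simp [om_apply]
  rw [this, tv_zero, mul_one]
  simp

lemma uU_zero : uU i (0 : Ph i F) = 1 := by
  apply Sp.ext'
  intro w
  rw [uU_apply]
  simp

lemma uU_neg (φ : Ph i F) : uU i (-φ) = (uU i φ)⁻¹ := by
  rw [eq_inv_iff_mul_eq_one, ← uU_add, neg_add_cancel, uU_zero]

/-- action on symmetric matrices -/
def actS (φ : Ph i F) : Sy m F →+ Sy m F where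
  toFun S := ⟨(1 + vecMulVec (ee i) φ.1) * S.1 * (1 + vecMulVec (ee i) φ.1)ᵀ, by
    change (_)ᵀ = _
    rw [transpose_mul, transpose_mul, transpose_transpose, show S.1ᵀ = S.1 from S.2, mul_assoc]⟩
  map_zero' := by apply Subtype.ext; simp
  map_add' := by intro S S'; apply Subtype.ext; simp [mul_add, add_mul]; abel

lemma uU_conj (φ : Ph i F) (S : Sy m F) : uU i φ * nS S * (uU i φ)⁻¹ = nS (actS i φ S) := by
  rw [mul_inv_eq_iff_eq_mul]
  apply Sp.ext'
  intro w
  have h0 : φ.1 i = 0 := φ.2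
  simp only [Sp.mul_apply, nS_apply, uU_apply]
  have key : (1 + vecMulVec (ee i) φ.1 : Matrix (Fin m) (Fin m) F)ᵀ *ᵥ (w.2 - w.2 i • φ.1) = w.2 := by
    rw [transpose_add, transpose_one, transpose_vecMulVec, add_mulVec, one_mulVec, vecMulVec_mulVec]
    ext j
    simp [ee, h0]
  have k2 : ∀ a : Fin m → F, (1 + vecMulVec (ee i) φ.1 : Matrix (Fin m) (Fin m) F) *ᵥ a = a + (a ⬝ᵥ φ.1) • ee i := by
    intro a
    rw [add_mulVec, one_mulVec, vecMulVec_mulVec]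
    ext j
    simp [dotProduct_comm]
  congr 1
  change _ = _ + ((1 + vecMulVec (ee i) φ.1) * S.1 * (1 + vecMulVec (ee i) φ.1)ᵀ) *ᵥ _
  rw [← mulVec_mulVec, key, ← mulVec_mulVec, k2]
  rw [add_dotProduct]
  module

lemma actS_add (φ ψ : Ph i F) (S : Sy m F) : actS i (φ + ψ) S = actS i φ (actS i ψ S) := by
  apply nS_inj
  rw [← uU_conj, ← uU_conj, ← uU_conj, uU_add]
  group

lemma actS_zero (S : Sy m F) : actS i 0 S = S := by
  apply nS_inj
  rw [← uU_conj, uU_zero]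
  group

lemma actS_sq (φ : Ph i F) (v : Fin m → F) (c : F) :
    actS i φ (sq v c) = sq v c + cr v (ee i) (c * (φ.1 ⬝ᵥ v)) + sq (ee i) (c * (φ.1 ⬝ᵥ v) ^ 2) := by
  apply Subtype.ext
  simp only [actS, sq, cr, AddMonoidHom.coe_mk, ZeroHom.coe_mk, Submodule.coe_add, transpose_add, transpose_one,
    transpose_vecMulVec, mul_add, add_mul, one_mul, mul_one, Matrix.smul_mul, Matrix.mul_smul, vecMulVec_mul_vecMulVec]
  ext a b
  simp [vecMulVec_apply, dotProduct_comm v]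
  ring

lemma actS_cr (φ : Ph i F) (v w : Fin m → F) (c : F) :
    actS i φ (cr v w c) = cr v w c + cr v (ee i) (c * (φ.1 ⬝ᵥ w)) + cr w (ee i) (c * (φ.1 ⬝ᵥ v))
      + sq (ee i) (2 * c * (φ.1 ⬝ᵥ v) * (φ.1 ⬝ᵥ w)) := by
  apply Subtype.ext
  simp only [actS, sq, cr, AddMonoidHom.coe_mk, ZeroHom.coe_mk, Submodule.coe_add, transpose_add, transpose_one,
    transpose_vecMulVec, mul_add, add_mul, one_mul, mul_one, Matrix.smul_mul, Matrix.mul_smul, vecMulVec_mul_vecMulVec]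
  ext a b
  simp [vecMulVec_apply, dotProduct_comm v, dotProduct_comm w]
  ring

lemma sq_add (v : Fin m → F) (c d : F) : sq v (c + d) = sq v c + sq v d := by
  apply Subtype.ext; simp [sq, add_smul]

lemma cr_add (v w : Fin m → F) (c d : F) : cr v w (c + d) = cr v w c + cr v w d := by
  apply Subtype.ext; simp [cr, add_smul]; abel

lemma sq_zero (v : Fin m → F) : sq v (0 : F) = 0 := by
  apply Subtype.ext; simp [sq]

lemma cr_zero (v w : Fin m → F) : cr v w (0 : F) = 0 := by
  apply Subtype.ext; simp [cr]

lemma cr_self (v : Fin m → F) (c : F) : cr v v c = sq v (2 * c) := by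
  apply Subtype.ext; simp only [sq, cr]; module

/-- the group `Z` inside symmetric matrices -/
def ZS (i : Fin m) (F : Type*) [Field F] : AddSubgroup (Sy m F) where
  carrier := Set.range (sq (ee i))
  add_mem' := by rintro _ _ ⟨c, rfl⟩ ⟨d, rfl⟩; exact ⟨c + d, sq_add _ _ _⟩
  zero_mem' := ⟨0, sq_zero _⟩
  neg_mem' := by
    rintro _ ⟨c, rfl⟩
    exact ⟨-c, by rw [eq_neg_iff_add_eq_zero, ← sq_add, neg_add_cancel, sq_zero]⟩

lemma dot_ee (φ : Ph i F) : φ.1 ⬝ᵥ ee i = 0 := by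
  have : φ.1 i = 0 := φ.2
  simp [ee, this]

lemma dot_ee' (φ : Ph i F) (j : Fin m) : φ.1 ⬝ᵥ ee j = φ.1 j := by simp [ee]

lemma actS_Z (φ : Ph i F) (a : Sy m F) (ha : a ∈ ZS i F) : actS i φ a = a := by
  obtain ⟨c, rfl⟩ := ha
  rw [actS_sq, dot_ee]
  simp [sq_zero, cr_zero]

lemma char_stab_odd (h2 : (2 : F) ≠ 0) (χ : AddChar (Sy m F) ℂ) (hχ : ∃ a ∈ ZS i F, χ a ≠ 1) :
    Nat.card {δ : Ph i F // ∀ a, χ (actS i δ a) = χ a} ≤ 1 := by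
  have : Subsingleton {δ : Ph i F // ∀ a, χ (actS i δ a) = χ a} := by
    have key : ∀ δ : Ph i F, (∀ a, χ (actS i δ a) = χ a) → δ = 0 := by
      intro δ hδ
      by_contra hne
      have : ∃ j, δ.1 j ≠ 0 := by
        by_contra hc
        push Not at hc
        exact hne (Subtype.ext (funext hc))
      obtain ⟨j, hj⟩ := this
      obtain ⟨_, ⟨c, rfl⟩, hc⟩ := hχ
      apply hc
      have h1 := hδ (cr (ee i) (ee j) (c / (2 * δ.1 j)))
      rw [actS_cr, dot_ee, dot_ee', cr_self, mul_zero, cr_zero, mul_zero, zero_mul, sq_zero, add_zero, add_zero,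
        AddChar.map_add_eq_mul, show 2 * (c / (2 * δ.1 j) * δ.1 j) = c by field_simp] at h1
      exact mul_left_cancel₀ (char_ne χ (cr (ee i) (ee j) (c / (2 * δ.1 j)))) (by rw [h1, mul_one])
    constructor
    intro a b
    exact Subtype.ext (by rw [key a.1 a.2, key b.1 b.2])
  exact Finite.card_le_one_iff_subsingleton.2 this

lemma char_stab_even [Finite F] (h2 : (2 : F) = 0) (χ : AddChar (Sy m F) ℂ) (hχ : ∃ a ∈ ZS i F, χ a ≠ 1) :
    Nat.card {δ : Ph i F // ∀ a, χ (actS i δ a) = χ a} ≤ 2 := by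
  classical
  haveI : Fintype {δ : Ph i F // ∀ a, χ (actS i δ a) = χ a} := Fintype.ofFinite _
  obtain ⟨_, ⟨c0, rfl⟩, hc0⟩ := hχ
  have e1 : ∀ δ : Ph i F, (∀ a, χ (actS i δ a) = χ a) → ∀ j, δ.1 j ≠ 0 → ∀ c,
      χ (cr (ee j) (ee i) c) * χ (sq (ee i) (c * δ.1 j)) = 1 := by
    intro δ hδ j hj c
    have h1 := hδ (sq (ee j) (c / δ.1 j))
    rw [actS_sq, dot_ee', add_assoc, AddChar.map_add_eq_mul, AddChar.map_add_eq_mul] at h1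
    have h3 := mul_left_cancel₀ (char_ne χ (sq (ee j) (c / δ.1 j))) (h1.trans (mul_one _).symm)
    rw [show c / δ.1 j * δ.1 j = c by field_simp, show c / δ.1 j * δ.1 j ^ 2 = c * δ.1 j by field_simp] at h3
    exact h3
  have e2 : ∀ δ : Ph i F, (∀ a, χ (actS i δ a) = χ a) → ∀ j l, δ.1 j ≠ 0 → δ.1 l = 0 → ∀ c,
      χ (cr (ee l) (ee i) c) = 1 := by
    intro δ hδ j l hj hl c
    have h1 := hδ (cr (ee j) (ee l) (c / δ.1 j))
    rw [actS_cr, dot_ee', dot_ee', hl, mul_zero, mul_zero, cr_zero, sq_zero, add_zero, add_zero,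
      AddChar.map_add_eq_mul] at h1
    have h3 := mul_left_cancel₀ (char_ne χ (cr (ee j) (ee l) (c / δ.1 j))) (h1.trans (mul_one _).symm)
    rwa [show c / δ.1 j * δ.1 j = c by field_simp] at h3
  have exn : ∀ δ : Ph i F, δ ≠ 0 → ∃ j, δ.1 j ≠ 0 := by
    intro δ hne
    by_contra hc
    push Not at hc
    exact hne (Subtype.ext (funext hc))
  have key : ∀ δ δ' : Ph i F, (∀ a, χ (actS i δ a) = χ a) → (∀ a, χ (actS i δ' a) = χ a) → δ ≠ 0 → δ' ≠ 0 →
      δ = δ' := by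
    have half : ∀ δ δ' : Ph i F, (∀ a, χ (actS i δ a) = χ a) → (∀ a, χ (actS i δ' a) = χ a) → δ' ≠ 0 →
        ∀ j, δ.1 j ≠ 0 → δ'.1 j ≠ 0 := by
      intro δ δ' hδ hδ' hn j hj hj'
      obtain ⟨l, hl⟩ := exn δ' hn
      have h3 := e1 δ hδ j hj (c0 / δ.1 j)
      rw [e2 δ' hδ' l j hl hj', one_mul, div_mul_cancel₀ _ hj] at h3
      exact hc0 h3
    intro δ δ' hδ hδ' hn hn'
    apply Subtype.ext
    funext j
    by_cases hj : δ.1 j = 0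
    · by_cases hj' : δ'.1 j = 0
      · rw [hj, hj']
      · exact absurd hj (half δ' δ hδ' hδ hn j hj')
    · have hj' := half δ δ' hδ hδ' hn' j hj
      by_contra hne
      have hd : δ.1 j - δ'.1 j ≠ 0 := sub_ne_zero.2 hne
      have h3 := e1 δ hδ j hj (c0 / (δ.1 j - δ'.1 j))
      have h4 := e1 δ' hδ' j hj' (c0 / (δ.1 j - δ'.1 j))
      have h5 := mul_left_cancel₀ (char_ne χ _) (h3.trans h4.symm)
      apply hc0
      have h6 : c0 = c0 / (δ.1 j - δ'.1 j) * δ.1 j - c0 / (δ.1 j - δ'.1 j) * δ'.1 j := by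
        rw [← mul_sub, div_mul_cancel₀ _ hd]
      have h7 : c0 / (δ.1 j - δ'.1 j) * δ.1 j = c0 + c0 / (δ.1 j - δ'.1 j) * δ'.1 j := by linear_combination -h6
      rw [h7, sq_add, AddChar.map_add_eq_mul] at h5
      exact mul_right_cancel₀ (char_ne χ (sq (ee i) (c0 / (δ.1 j - δ'.1 j) * δ'.1 j))) (by rw [h5, one_mul])
  rw [Nat.card_eq_fintype_card]
  by_contra hc
  push Not at hc
  rw [Fintype.two_lt_card_iff] at hc
  obtain ⟨a, b, c, hab, hac, hbc⟩ := hc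
  by_cases ha : a.1 = 0
  · have hb : b.1 ≠ 0 := fun h => hab (Subtype.ext (by rw [ha, h]))
    have hc : c.1 ≠ 0 := fun h => hac (Subtype.ext (by rw [ha, h]))
    exact hbc (Subtype.ext (key _ _ b.2 c.2 hb hc))
  · by_cases hb : b.1 = 0
    · have hc : c.1 ≠ 0 := fun h => hbc (Subtype.ext (by rw [hb, h]))
      exact hac (Subtype.ext (key _ _ a.2 c.2 ha hc))
    · exact hab (Subtype.ext (key _ _ a.2 b.2 ha hb))

end AU
end NFT

namespace NFT
section AU2
variable {m : ℕ} {F : Type*} [Field F] (i : Fin m)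
open Matrix

lemma Ph_card [Finite F] : Nat.card (Ph i F) = Nat.card F ^ (m - 1) := by
  have h1 := AddSubgroup.card_mul_index (Ph i F)
  have h2 : Ph i F = (Pi.evalAddMonoidHom (fun _ : Fin m => F) i).ker := by
    ext φ; rfl
  have h3 : (Ph i F).index = Nat.card F := by
    rw [h2, AddSubgroup.index_ker]
    have : (Pi.evalAddMonoidHom (fun _ : Fin m => F) i).range = ⊤ := by
      rw [AddMonoidHom.range_eq_top]
      intro c
      exact ⟨Pi.single i c, by simp⟩
    rw [this, AddSubgroup.card_top]
  rw [h3, Nat.card_fun, Nat.card_eq_fintype_card (α := Fin m), Fintype.card_fin] at h1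
  have hm : 0 < m := i.pos
  have hq : 0 < Nat.card F := Nat.card_pos
  have : Nat.card F ^ m = Nat.card F ^ (m - 1) * Nat.card F := by
    rw [← pow_succ, Nat.sub_add_cancel hm]
  exact Nat.eq_of_mul_eq_mul_right hq (h1.trans this)

lemma uU_nS_inj {φ φ' : Ph i F} {S S' : Sy m F} (h : uU i φ * nS S = uU i φ' * nS S') : φ = φ' ∧ S = S' := by
  have h1 : φ = φ' := by
    apply Subtype.ext
    funext j
    by_cases hj : j = i
    · subst hj
      rw [show φ.1 j = 0 from φ.2, show φ'.1 j = 0 from φ'.2]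
    have h2 : (uU i φ * nS S).1 (ee j, 0) = (uU i φ' * nS S').1 (ee j, 0) := by rw [h]
    simp only [Sp.mul_apply, nS_apply, uU_apply] at h2
    have := congrFun (congrArg Prod.fst h2) i
    simpa [ee] using this
  refine ⟨h1, ?_⟩
  subst h1
  exact nS_inj (mul_left_cancel h)

def RR (i : Fin m) (F : Type*) [Field F] : Subgroup (Sp m F) where
  carrier := {g | ∃ φ S, g = uU i φ * nS S}
  one_mem' := ⟨0, 0, by rw [uU_zero, nS_zero, one_mul]⟩
  mul_mem' := by
    rintro _ _ ⟨φ, S, rfl⟩ ⟨ψ, S', rfl⟩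
    refine ⟨φ + ψ, actS i (-ψ) S + S', ?_⟩
    rw [uU_add, nS_add, ← uU_conj, uU_neg]
    group
  inv_mem' := by
    rintro _ ⟨φ, S, rfl⟩
    refine ⟨-φ, actS i φ (-S), ?_⟩
    rw [← uU_conj, uU_neg, nS_neg]
    group

lemma mem_RR {g : Sp m F} : g ∈ RR i F ↔ ∃ φ S, g = uU i φ * nS S := Iff.rfl

lemma uU_mem_RR (φ : Ph i F) : uU i φ ∈ RR i F := ⟨φ, 0, by rw [nS_zero, mul_one]⟩
lemma nS_mem_RR (S : Sy m F) : nS S ∈ RR i F := ⟨0, S, by rw [uU_zero, one_mul]⟩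

lemma RR_card [Finite F] : Nat.card (RR i F) = Nat.card (Ph i F) * Nat.card (Sy m F) := by
  rw [← Nat.card_prod]
  symm
  refine Nat.card_congr (Equiv.ofBijective (fun x => ⟨uU i x.1 * nS x.2, x.1, x.2, rfl⟩) ⟨?_, ?_⟩)
  · rintro ⟨a, b⟩ ⟨c, d⟩ h
    obtain ⟨h1, h2⟩ := uU_nS_inj i (congrArg Subtype.val h)
    simp only [] at h1 h2
    rw [h1, h2]
  · rintro ⟨_, φ, S, rfl⟩
    exact ⟨(φ, S), rfl⟩

lemma RR_pgroup [Finite F] {p f : ℕ} (hq : Nat.card F = p ^ f) : IsPGroup p (RR i F) := by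
  have h : Nat.card (Sy m F) = Nat.card F ^ Module.finrank F (Sy m F) := Module.natCard_eq_pow_finrank
  apply IsPGroup.of_card (n := f * (m - 1) + f * Module.finrank F (Sy m F))
  rw [RR_card, Ph_card, h, hq]
  ring

/-- preimage in `Sy` -/
def WS (H : Subgroup (Sp m F)) : AddSubgroup (Sy m F) where
  carrier := {S | nS S ∈ H}
  zero_mem' := by change nS 0 ∈ H; rw [nS_zero]; exact H.one_mem
  add_mem' := by intro a b ha hb; change nS (a + b) ∈ H; rw [nS_add]; exact H.mul_mem ha hb
  neg_mem' := by intro a ha; change nS (-a) ∈ H; rw [nS_neg]; exact H.inv_mem ha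

lemma mem_WS (H : Subgroup (Sp m F)) (S : Sy m F) : S ∈ WS H ↔ nS S ∈ H := Iff.rfl

lemma AU_card [Finite F] (H : Subgroup (Sp m F)) :
    Nat.card (H ⊓ RR i F : Subgroup (Sp m F)) ≤ Nat.card {φ : Ph i F | ∃ S, uU i φ * nS S ∈ H} * Nat.card (WS H) := by
  rw [← Nat.card_prod]
  have h1 : ∀ g : (H ⊓ RR i F : Subgroup (Sp m F)), ∃ φ S, g.1 = uU i φ * nS S := fun g => g.2.2
  choose fφ fS hf using h1
  have h2 : ∀ φ : {φ : Ph i F | ∃ S, uU i φ * nS S ∈ H}, ∃ S, uU i φ.1 * nS S ∈ H := fun φ => φ.2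
  choose s hs using h2
  have hT : ∀ g : (H ⊓ RR i F : Subgroup (Sp m F)), fφ g ∈ {φ : Ph i F | ∃ S, uU i φ * nS S ∈ H} :=
    fun g => ⟨fS g, by rw [← hf]; exact g.2.1⟩
  refine Nat.card_le_card_of_injective (fun g => (⟨fφ g, hT g⟩, ⟨fS g - s ⟨fφ g, hT g⟩, ?_⟩)) ?_
  · rw [mem_WS]
    have h3 := H.mul_mem (H.inv_mem (hs ⟨fφ g, hT g⟩)) g.2.1
    rw [hf g] at h3
    rw [sub_eq_neg_add, nS_add, nS_neg]
    convert h3 using 1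
    group
  · intro g g' h
    simp only [Prod.mk.injEq, Subtype.mk.injEq] at h
    obtain ⟨h3, h4⟩ := h
    apply Subtype.ext
    rw [hf g, hf g']
    simp only [h3] at h4
    rw [h3, sub_left_injective h4]

noncomputable def eps (F : Type*) [Field F] : ℕ := by classical exact if (2 : F) = 0 then 2 else 1

lemma char_stab [Finite F] (χ : AddChar (Sy m F) ℂ) (hχ : ∃ a ∈ ZS i F, χ a ≠ 1) :
    Nat.card {δ : Ph i F // ∀ a, χ (actS i δ a) = χ a} ≤ eps F := by
  unfold eps
  split_ifs with h
  · exact char_stab_even i h χ hχ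
  · exact char_stab_odd i h χ hχ

lemma AU_num {w I t e x y z h : ℕ} (hw : 0 < w) (hi : 0 < I) (h1 : t ≤ e * I) (h2 : h ≤ t * w)
    (h3 : h * z = x * (w * (y * I))) : x * y ≤ e * z := by
  refine Nat.le_of_mul_le_mul_left ?_ (Nat.mul_pos hw hi)
  calc w * I * (x * y)
      = x * (w * (y * I)) := by ring
    _ = h * z := h3.symm
    _ ≤ (t * w) * z := Nat.mul_le_mul_right _ h2
    _ ≤ ((e * I) * w) * z := Nat.mul_le_mul_right _ (Nat.mul_le_mul_right _ h1)
    _ = _ := by ring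

lemma AU_T [Finite F] (H : Subgroup (Sp m F)) (hZ : ¬ ZS i F ≤ WS H) :
    Nat.card {φ : Ph i F | ∃ S, uU i φ * nS S ∈ H} ≤ eps F * (WS H ⊔ ZS i F).index := by
  refine char_count (A := Sy m F) (Φ := Ph i F) (actS i) ?_ ?_ {φ : Ph i F | ∃ S, uU i φ * nS S ∈ H} (WS H) (ZS i F) ?_ ?_ (eps F) ?_ hZ
  · intro a b c; exact actS_add i a b c
  · intro a; exact actS_zero i a
  rotate_left
  · intro a b c; exact actS_Z i a b c
  · intro a b; exact char_stab i a b
  rintro φ ⟨S, hS⟩ a ha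
  rw [mem_WS] at ha ⊢
  have h3 := H.mul_mem (H.mul_mem hS ha) (H.inv_mem hS)
  rw [← uU_conj]
  have : nS S * nS a = nS a * nS S := by rw [← nS_add, add_comm, nS_add]
  have h4 : uU i φ * nS S * nS a * (uU i φ * nS S)⁻¹ = uU i φ * nS a * (uU i φ)⁻¹ := by
    rw [mul_assoc (uU i φ), this]; group
  rw [← h4]
  exact h3

lemma AU_H [Finite F] (H : Subgroup (Sp m F)) :
    Nat.card (H ⊓ RR i F : Subgroup (Sp m F)) * H.relIndex (RR i F) = Nat.card (Ph i F) * Nat.card (Sy m F) := by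
  rw [← RR_card, ← Subgroup.inf_relIndex_right]
  rw [← Subgroup.card_mul_index ((H ⊓ RR i F).subgroupOf (RR i F)), Subgroup.relIndex]
  congr 1
  exact (Nat.card_congr (Subgroup.subgroupOfEquivOfLe inf_le_right).toEquiv).symm

lemma AU_main [Finite F] (H : Subgroup (Sp m F)) (hZ : ¬ ZS i F ≤ WS H) :
    Nat.card F ^ (m - 1) * (WS H).relIndex (ZS i F) ≤ eps F * H.relIndex (RR i F) := by
  have h1 := AU_T i H hZ
  have h2 := AU_card i H
  have h3 := AU_H i H
  have h4 : Nat.card (WS H) * ((WS H).relIndex (ZS i F) * (WS H ⊔ ZS i F).index) = Nat.card (Sy m F) := by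
    rw [← AddSubgroup.relIndex_sup_right, sup_comm (ZS i F), AddSubgroup.relIndex_mul_index le_sup_left,
      AddSubgroup.card_mul_index]
  rw [Ph_card, ← h4] at h3
  have hw : 0 < Nat.card (WS H) := Nat.card_pos
  have hi : 0 < (WS H ⊔ ZS i F).index := Nat.pos_of_ne_zero AddSubgroup.index_ne_zero_of_finite
  exact AU_num hw hi h1 h2 h3

lemma ZS_card [Finite F] : Nat.card (ZS i F) = Nat.card F := by
  symm
  refine Nat.card_congr (Equiv.ofBijective (fun c => ⟨sq (ee i) c, c, rfl⟩) ⟨?_, ?_⟩)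
  · intro c d h
    have := congrFun (congrFun (congrArg Subtype.val (congrArg Subtype.val h)) i) i
    simpa [sq, ee, vecMulVec_apply] using this
  · rintro ⟨_, c, rfl⟩
    exact ⟨c, rfl⟩

/-- base vector -/
def eb (i : Fin m) (F : Type*) [Field F] : VV m F := (ee i, 0)

lemma eb_ne : eb i F ≠ 0 := by
  intro h
  have := congrFun (congrArg Prod.fst h) i
  simp [eb, ee] at this

lemma tv_mem_iff (H : Subgroup (Sp m F)) (c : F) : tv (eb i F) c ∈ H ↔ sq (ee i) (-c) ∈ WS H := by
  rw [mem_WS, eb, tv_eq_nS]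

lemma AU_N [Finite F] (H : Subgroup (Sp m F)) (h : ∀ c : F, c ≠ 0 → tv (eb i F) c ∉ H) :
    Nat.card F ^ m ≤ eps F * H.relIndex (RR i F) := by
  have h1 : WS H ⊓ ZS i F = ⊥ := by
    rw [eq_bot_iff]
    rintro _ ⟨hx, c, rfl⟩
    by_contra hne
    refine h (-c) ?_ ?_
    · intro hc
      rw [neg_eq_zero.1 hc, sq_zero] at hne
      exact hne rfl
    · rw [tv_mem_iff, neg_neg]
      exact hx
  have h2 := AU_main i H (by
    intro hle
    have : ZS i F = ⊥ := by rw [← h1]; exact (inf_eq_right.2 hle).symm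
    have h3 := ZS_card (F := F) i
    rw [this, AddSubgroup.card_bot] at h3
    have := Finite.one_lt_card (α := F)
    omega)
  rw [← AddSubgroup.inf_relIndex_right, h1, AddSubgroup.relIndex_bot_left, ZS_card, ← pow_succ,
    Nat.sub_add_cancel i.pos] at h2
  exact h2

lemma AU_P [Finite F] {p f : ℕ} (hp : p.Prime) (hq : Nat.card F = p ^ f) (H : Subgroup (Sp m F))
    (h : ∃ c : F, tv (eb i F) c ∉ H) :
    Nat.card F ^ (m - 1) * p ≤ eps F * H.relIndex (RR i F) := by
  have hZ : ¬ ZS i F ≤ WS H := by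
    intro hle
    obtain ⟨c, hc⟩ := h
    rw [tv_mem_iff] at hc
    exact hc (hle ⟨-c, rfl⟩)
  refine le_trans (Nat.mul_le_mul_left _ ?_) (AU_main i H hZ)
  have h1 : (WS H).relIndex (ZS i F) ∣ p ^ f := by
    rw [← hq, ← ZS_card i]
    exact AddSubgroup.relIndex_dvd_card _ _
  obtain ⟨a, -, ha⟩ := (Nat.dvd_prime_pow hp).1 h1
  rw [ha]
  have : a ≠ 0 := by
    rintro rfl
    rw [pow_zero, AddSubgroup.relIndex_eq_one] at ha
    exact hZ ha
  exact Nat.le_self_pow this p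

lemma AU_2 [Finite F] (H : Subgroup (Sp m F)) (h : ∀ φ : Ph i F, φ ≠ 0 → uU i φ ∉ H) :
    Nat.card F ^ (m - 1) ≤ H.relIndex (RR i F) := by
  rw [← Ph_card i]
  change _ ≤ Nat.card (RR i F ⧸ H.subgroupOf (RR i F))
  refine Nat.card_le_card_of_injective (fun φ => QuotientGroup.mk ⟨uU i φ, uU_mem_RR i φ⟩) ?_
  intro φ ψ hh
  by_contra hne
  have h2 := QuotientGroup.eq.1 hh
  rw [Subgroup.mem_subgroupOf] at h2
  refine h (-φ + ψ) ?_ ?_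
  · intro h0
    exact hne (neg_add_eq_zero.1 h0)
  · rw [uU_add, uU_neg]
    exact h2

lemma dvd_of_orbits {Γ P : Type*} [Group Γ] [Finite Γ] [MulAction Γ P] [Fintype P] (R : Subgroup Γ) {p : ℕ} (hp : p.Prime)
    (hR : IsPGroup p R) (e : ℕ) (h : ∀ β : P, p ^ e ≤ (MulAction.stabilizer Γ β).relIndex R) :
    p ^ e ∣ Fintype.card P := by
  classical
  haveI : Fact p.Prime := ⟨hp⟩
  rw [← Nat.card_eq_fintype_card, Nat.card_congr (MulAction.selfEquivSigmaOrbits R P), Nat.card_sigma]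
  apply Finset.dvd_sum
  intro ω _
  have h1 := h ω.out
  have h2 : (MulAction.stabilizer Γ ω.out).relIndex R = Nat.card (MulAction.orbit R ω.out) := by
    have : MulAction.stabilizer R ω.out = (MulAction.stabilizer Γ ω.out).subgroupOf R := by
      ext g
      rw [Subgroup.mem_subgroupOf, MulAction.mem_stabilizer_iff, MulAction.mem_stabilizer_iff]; rfl
    rw [Subgroup.relIndex, ← this, MulAction.index_stabilizer]
    rfl
  rw [h2] at h1
  obtain ⟨n, hn⟩ := hR.card_orbit ω.out
  rw [hn] at h1 ⊢
  exact pow_dvd_pow _ ((Nat.pow_le_pow_iff_right hp.one_lt).1 h1)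

end AU2
end NFT

namespace NFT

structure SpD (m : ℕ) (F : Type*) [Field F] {P : Type*} [MulAction (Sp m F) P] [Fintype P] [DecidableEq P]
    (bl : Finset (Finset P)) (k lam r p f : ℕ) : Prop where
  ftd : FTD (Sp m F) bl k lam r
  fth : ∀ g : Sp m F, (∀ x : P, g • x = x) → (∀ w, g.1 w = w) ∨ (∀ w, g.1 w = - w)
  smp : ∀ N : Subgroup (Sp m F), N.Normal → (∀ g ∈ N, ∀ x : P, g • x = x) ∨
    (∀ g : Sp m F, ∃ n ∈ N, ∀ x : P, n • x = g • x)
  hm : 2 ≤ m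
  hp : p.Prime
  hq : Nat.card F = p ^ f
  h22 : ¬ (m = 2 ∧ Nat.card F = 2)

section
variable {m : ℕ} {F : Type*} [Field F] [Finite F] {P : Type*} [MulAction (Sp m F) P] [Fintype P] [DecidableEq P]
  {bl : Finset (Finset P)} {k lam r p f : ℕ}

lemma SpD.f1 (h : SpD m F bl k lam r p f) : 1 ≤ f := by
  rcases Nat.eq_zero_or_pos f with h0 | h0
  · have := h.hq
    rw [h0, pow_zero] at this
    have h1 := Finite.one_lt_card (α := F)
    omega
  · exact h0

lemma SpD.pF (h : SpD m F bl k lam r p f) : (p : F) = 0 := by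
  haveI := Fintype.ofFinite F
  have h1 : ((Nat.card F : ℕ) : F) = 0 := by
    rw [Nat.card_eq_fintype_card]; exact Nat.cast_card_eq_zero F
  rw [h.hq, Nat.cast_pow] at h1
  exact pow_eq_zero_iff (by have := h.f1; omega) |>.1 h1

lemma SpD.tv_p (h : SpD m F bl k lam r p f) (x : VV m F) (c : F) : tv x c ^ p = 1 := by
  rw [tv_pow, h.pF, zero_mul, tv_zero]

lemma SpD.act_ne (h : SpD m F bl k lam r p f) {g : Sp m F} {x : VV m F} (hx : x ≠ 0) (hgx : g.1 x = x)
    (hg : g ≠ 1) : ∃ a : P, g • a ≠ a := by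
  by_contra hc
  push Not at hc
  exact hg (scalar_fix (h.fth g hc) hx hgx)

lemma SpD.tv_ne (h : SpD m F bl k lam r p f) {x : VV m F} (hx : x ≠ 0) {c : F} (hc : c ≠ 0) :
    ∃ a : P, tv x c • a ≠ a :=
  h.act_ne hx (tv_self x c) (fun h1 => hc (tv_eq_one hx h1))

lemma SpD.ex_ne (h : SpD m F bl k lam r p f) : ∃ x : VV m F, x ≠ 0 :=
  ⟨_, eb_ne (F := F) ⟨0, by have := h.hm; omega⟩⟩

lemma SpD.not_all (h : SpD m F bl k lam r p f) (α : P) : ¬ ∀ (x : VV m F) (c : F), x ≠ 0 → tv x c • α = α := by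
  intro hall
  have hmem : ∀ (x : VV m F) (c : F), tv x c ∈ (MulAction.stabilizer (Sp m F) α).normalCore := by
    intro x c b
    rw [tv_conj, MulAction.mem_stabilizer_iff]
    by_cases h0 : b.1 x = 0
    · rw [h0, tv_zero', one_smul]
    · exact hall _ _ h0
  obtain ⟨x, hx⟩ := h.ex_ne
  rcases h.smp _ (Subgroup.normalCore_normal _) with h1 | h1
  · obtain ⟨a, ha⟩ := h.tv_ne hx (one_ne_zero)
    exact ha (h1 _ (hmem x 1) a)
  · obtain ⟨β, hβ⟩ := h.ftd.ex_not α
    obtain ⟨g, hg⟩ := h.ftd.ptrans α β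
    obtain ⟨n, hn, hn'⟩ := h1 g
    have := Subgroup.normalCore_le _ hn
    rw [MulAction.mem_stabilizer_iff, hn', hg] at this
    exact hβ this

/-! `D` sets -/

def DS (H : Subgroup (Sp m F)) : Set (VV m F) := {x | x ≠ 0 ∧ ∀ c, tv x c ∈ H}

lemma DS.smul {H : Subgroup (Sp m F)} {x : VV m F} (hx : x ∈ DS H) {a : F} (ha : a ≠ 0) : a • x ∈ DS H :=
  ⟨smul_ne_zero ha hx.1, fun c => by rw [tv_smul]; exact hx.2 _⟩

lemma DS.map {H : Subgroup (Sp m F)} {x : VV m F} (hx : x ∈ DS H) {g : Sp m F} (hg : g ∈ H) : g.1 x ∈ DS H :=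
  ⟨by simpa using hx.1, fun c => by
    rw [← tv_conj]; exact H.mul_mem (H.mul_mem hg (hx.2 c)) (H.inv_mem hg)⟩

lemma DS.add_smul {H : Subgroup (Sp m F)} {x y : VV m F} (hx : x ∈ DS H) (hy : y ∈ DS H) (h : om x y ≠ 0) (a : F) :
    y + a • x ∈ DS H := by
  have h1 := DS.map hy (hx.2 (a / om y x))
  have h2 : om y x ≠ 0 := fun h0 => h (om_zero_swap h0)
  rwa [tv_apply, div_mul_cancel₀ _ h2] at h1

lemma DS.add {H : Subgroup (Sp m F)} {x y : VV m F} (hx : x ∈ DS H) (hy : y ∈ DS H) (h : om x y ≠ 0) :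
    x + y ∈ DS H := by
  have := DS.add_smul hx hy h 1
  rwa [one_smul, add_comm] at this

/-! r ≠ p -/

lemma comm_fix_of_small {G : Type*} [Group G] [Finite G] [MulAction G P] (hp : p.Prime) (hG : IsPGroup p G)
    (hv : Fintype.card P < p ^ 2) (a b : G) (β : P) : (a * b * a⁻¹ * b⁻¹) • β = β := by
  haveI : Fact p.Prime := ⟨hp⟩
  obtain ⟨n, hn⟩ := hG.index (MulAction.stabilizer G β)
  have h1 : (MulAction.stabilizer G β).index < p ^ 2 := by
    refine lt_of_le_of_lt ?_ hv
    rw [MulAction.index_stabilizer, ← Nat.card_eq_fintype_card]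
    exact Nat.card_le_card_of_injective (Subtype.val) Subtype.val_injective
  rw [hn] at h1
  have h2 : n < 2 := (Nat.pow_lt_pow_iff_right hp.one_lt).1 h1
  rw [← MulAction.mem_stabilizer_iff]
  rcases Nat.lt_or_ge n 1 with h3 | h3
  · have : n = 0 := by omega
    subst this
    rw [pow_zero, Subgroup.index_eq_one] at hn
    rw [hn]; trivial
  · have : n = 1 := by omega
    subst this
    rw [pow_one] at hn
    obtain ⟨c, hc⟩ := (IsPGroup.iff_card (p := p)).1 hG
    have hc0 : c ≠ 0 := by
      rintro rfl
      have h4 := (MulAction.stabilizer G β).index_dvd_card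
      rw [hn, hc, pow_zero] at h4
      exact hp.one_lt.ne' (Nat.dvd_one.1 h4)
    haveI : (MulAction.stabilizer G β).Normal := by
      apply Subgroup.normal_of_index_eq_minFac_card
      rw [hn, hc, hp.pow_minFac hc0]
    have hcy : IsCyclic (G ⧸ MulAction.stabilizer G β) := isCyclic_of_prime_card (p := p) hn
    have hcomm : ∀ x y : G ⧸ MulAction.stabilizer G β, x * y = y * x := by
      letI := hcy.commGroup
      intro x y; exact mul_comm x y
    rw [← QuotientGroup.eq_one_iff]
    rw [QuotientGroup.mk_mul, QuotientGroup.mk_mul, QuotientGroup.mk_mul, hcomm (a : G ⧸ MulAction.stabilizer G β) b,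
      QuotientGroup.mk_inv, QuotientGroup.mk_inv]
    group

lemma SpD.r_ne_p (h : SpD m F bl k lam r p f) : r ≠ p := by
  intro hrp
  have h3 := h.ftd.r3
  have hm := h.hm
  have h2 : (2 : F) ≠ 0 := by
    intro h2
    have h4 : ((Nat.gcd p 2 : ℕ) : F) = 0 := by
      have hc : ringChar F ∣ Nat.gcd p 2 :=
        Nat.dvd_gcd (ringChar.dvd h.pF) (ringChar.dvd (by exact_mod_cast h2))
      exact (ringChar.spec F _).2 hc
    have : Nat.gcd p 2 = 1 := (Nat.coprime_primes h.hp Nat.prime_two).2 (by omega)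
    rw [this] at h4
    simp at h4
  let i : Fin m := ⟨0, by omega⟩
  let j : Fin m := ⟨1, by omega⟩
  have hij : j ≠ i := by simp [i, j]
  let φ : Ph i F := ⟨Pi.single j 1, by change (Pi.single j 1 : Fin m → F) i = (0 : F); simp [hij.symm]⟩
  have hv := h.ftd.v_lt
  have key := fun β : P => comm_fix_of_small (G := RR i F) h.hp (RR_pgroup i h.hq) (hrp ▸ hv) ⟨uU i φ, uU_mem_RR i φ⟩
    ⟨nS (cr (ee i) (ee j) 1), nS_mem_RR i _⟩ β
  have e : uU i φ * nS (cr (ee i) (ee j) 1) * (uU i φ)⁻¹ * (nS (cr (ee i) (ee j) 1))⁻¹ = tv (eb i F) (-2) := by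
    rw [uU_conj, actS_cr, dot_ee, dot_ee', cr_self, eb, tv_eq_nS, ← nS_neg, ← nS_add]
    congr 1
    have : φ.1 j = 1 := by simp [φ]
    rw [this]
    simp [sq_zero, cr_zero]
  obtain ⟨a, ha⟩ := h.tv_ne (eb_ne (F := F) i) (neg_ne_zero.2 h2)
  apply ha
  rw [← e]
  exact key a

lemma SpD.r_not_p (h : SpD m F bl k lam r p f) : ¬ r ∣ p := fun hd =>
  h.r_ne_p ((Nat.prime_dvd_prime_iff_eq h.ftd.prime h.hp).1 hd)

lemma SpD.r_not_q (h : SpD m F bl k lam r p f) (n : ℕ) : ¬ r ∣ Nat.card F ^ n := fun hd => by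
  rw [h.hq, ← pow_mul] at hd
  exact h.r_not_p (h.ftd.prime.dvd_of_dvd_pow hd)

/-! Lemma K -/

lemma card_pp {x : VV m F} (hx : x ≠ 0) : Nat.card (pp x) * Nat.card F = Nat.card (VV m F) := by
  have h1 := AddSubgroup.card_mul_index (pp x).toAddSubgroup
  have h2 : (pp x).toAddSubgroup = ((om x : VV m F →ₗ[F] F).toAddMonoidHom).ker := by
    ext w; rfl
  have h3 : (pp x).toAddSubgroup.index = Nat.card F := by
    rw [h2, AddSubgroup.index_ker]
    have : ((om x : VV m F →ₗ[F] F).toAddMonoidHom).range = ⊤ := by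
      rw [AddMonoidHom.range_eq_top]
      intro c
      obtain ⟨y, hy⟩ := om_nd' hx
      refine ⟨c • y, ?_⟩
      change om x (c • y) = c
      rw [map_smul, hy, smul_eq_mul, mul_one]
    rw [this, AddSubgroup.card_top]
  rw [h3] at h1
  exact h1

lemma card_VV : Nat.card (VV m F) = Nat.card F ^ (2 * m) := by
  rw [Nat.card_prod, Nat.card_fun, Nat.card_eq_fintype_card (α := Fin m), Fintype.card_fin]
  ring

lemma SpD.K1 (h : SpD m F bl k lam r p f) {α : P} {x : VV m F} {c : F} (hx : x ≠ 0) (hc : c ≠ 0)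
    (hK : tv x c ∈ KK (Sp m F) bl α) {g : Sp m F} (hg : g.1 x = x) : g • α = α := by
  apply h.ftd.comm_fix hK (h.tv_ne hx hc)
  have := tv_conj g x c
  rw [hg, mul_inv_eq_iff_eq_mul] at this
  exact this

lemma SpD.K2 (h : SpD m F bl k lam r p f) {α : P} {x y : VV m F} {c : F} (hx : x ≠ 0) (hc : c ≠ 0)
    (hK : tv x c ∈ KK (Sp m F) bl α) (hKy : tv y c ∈ KK (Sp m F) bl α) : om x y = 0 := by
  by_contra hxy
  have hy : y ≠ 0 := by rintro rfl; simp at hxy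
  have hyx : om y x ≠ 0 := fun h0 => hxy (om_zero_swap h0)
  set H := MulAction.stabilizer (Sp m F) α
  have dx : ∀ z, z ≠ 0 → om x z = 0 → z ∈ DS H := fun z hz hz' => ⟨hz, fun d =>
    h.K1 hx hc hK (tv_perp hz' d)⟩
  have dy : ∀ z, z ≠ 0 → om y z = 0 → z ∈ DS H := fun z hz hz' => ⟨hz, fun d =>
    h.K1 hy hc hKy (tv_perp hz' d)⟩
  apply h.not_all α
  intro z d hz
  suffices z ∈ DS H from this.2 d
  by_cases h1 : om x z = 0
  · exact dx z hz h1
  have nm : ∀ u : VV m F, om x u ≠ 0 → ∀ a : F, u ≠ a • x := by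
    rintro u hu a rfl
    simp at hu
  obtain ⟨w1, hw1, hw1'⟩ := ex_perp_not hx (nm y hxy)
  obtain ⟨w2, hw2, hw2'⟩ := ex_perp_not hx (nm z h1)
  obtain ⟨w, hw, hwy, hwz⟩ := exists_avoid (pp x) (om y) (om z) ⟨w1, hw1, hw1'⟩ ⟨w2, hw2, hw2'⟩
  have hw0 : w ≠ 0 := by rintro rfl; simp at hwy
  have d1 : w ∈ DS H := dx w hw0 hw
  set s := -(om y z / om y w)
  have e1 : om y (z + s • w) = 0 := by
    rw [map_add, map_smul, smul_eq_mul, neg_mul, div_mul_cancel₀ _ hwy, add_neg_cancel]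
  have e2 : om w (z + s • w) ≠ 0 := by
    rw [map_add, map_smul, om_self, smul_zero, add_zero]
    exact fun h0 => hwz (om_zero_swap h0)
  have d2 : z + s • w ∈ DS H := dy _ (by intro h0; rw [h0] at e2; simp at e2) e1
  have := DS.add_smul d1 d2 e2 (-s)
  rwa [show z + s • w + (-s) • w = z by module] at this

lemma SpD.K3 (h : SpD m F bl k lam r p f) {α : P} {x y : VV m F} {c : F} (hx : x ≠ 0) (hc : c ≠ 0)
    (hK : tv x c ∈ KK (Sp m F) bl α) (hKy : tv y c ∈ KK (Sp m F) bl α) : ∃ a : F, y = a • x := by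
  by_contra hne
  push Not at hne
  have hxy := h.K2 hx hc hK hKy
  have hy : y ≠ 0 := by rintro rfl; exact hne 0 (by simp)
  obtain ⟨w, hw, hyw⟩ := ex_perp_not hx hne
  have hwx : ∀ a : F, w ≠ a • x := by
    rintro a rfl
    apply hyw
    rw [map_smul, om_zero_swap hxy, smul_zero]
  obtain ⟨g, hg1, hg2⟩ := stab_trans hx hne hwx hxy hw
  have h1 := h.ftd.KK_conj hKy g
  rw [tv_conj, hg2, h.K1 hx hc hK hg1] at h1
  exact hyw (h.K2 hy hc hKy h1)

lemma SpD.lemK (h : SpD m F bl k lam r p f) {α : P} {x : VV m F} {c : F} (hx : x ≠ 0) (hc : c ≠ 0) :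
    tv x c ∉ KK (Sp m F) bl α := by
  classical
  intro hK
  haveI : Fintype (VV m F) := Fintype.ofFinite _
  obtain ⟨ρ, hρ⟩ := h.ftd.exists_rho' α
  obtain ⟨a, ha⟩ := hρ.ord
  have hpp := card_pp hx
  have hq1 := Finite.one_lt_card (α := F)
  -- ρ x = b x
  have h1 : tv (ρ.1 x) c ∈ KK (Sp m F) bl α := by
    have := h.ftd.KK_conj hK ρ
    rwa [tv_conj, hρ.fix] at this
  obtain ⟨b, hb⟩ := h.K3 hx hc hK h1
  have hdiv := card_dvd_of_no_fix h.ftd.prime ρ ha (Finset.univ.filter fun y : VV m F => om x y ≠ 0) (by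
      intro y hy
      simp only [Finset.mem_filter, Finset.mem_univ, true_and] at hy ⊢
      change om x (ρ.1 y) ≠ 0
      intro h0
      have h2 : om (ρ.1 x) (ρ.1 y) = 0 := by rw [hb, map_smul, LinearMap.smul_apply, h0, smul_zero]
      rw [Sp.om] at h2
      exact hy h2) (by
      intro y hy hfix
      simp only [Finset.mem_filter, Finset.mem_univ, true_and] at hy
      change ρ.1 y = y at hfix
      apply hy
      refine h.K2 hx hc hK ?_
      refine h.ftd.rho_comm_K hρ ?_ (h.tv_p y c) h.r_not_p
      have := tv_conj ρ y c
      rw [hfix, mul_inv_eq_iff_eq_mul] at this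
      exact this.symm)
  have hcard : (Finset.univ.filter fun y : VV m F => om x y ≠ 0).card = Nat.card (pp x) * (Nat.card F - 1) := by
    have h2 := Finset.card_filter_add_card_filter_not (s := (Finset.univ : Finset (VV m F))) (fun y : VV m F => om x y = 0)
    have h3 : (Finset.univ.filter fun y : VV m F => om x y = 0).card = Nat.card (pp x) := by
      rw [← Nat.card_eq_finsetCard]
      apply Nat.card_congr
      exact Equiv.subtypeEquivRight (by intro y; simp)
    rw [h3, Finset.card_univ, ← Nat.card_eq_fintype_card, ← hpp] at h2
    rw [Nat.mul_sub, mul_one]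
    exact Nat.eq_sub_of_add_eq' h2
  have hppq : Nat.card (pp x) = Nat.card F ^ (2 * m - 1) := by
    rw [card_VV] at hpp
    have h5 : Nat.card F ^ (2 * m) = Nat.card F ^ (2 * m - 1) * Nat.card F := by
      rw [← pow_succ]; congr 1; have := h.hm; omega
    exact Nat.eq_of_mul_eq_mul_right (by omega) (hpp.trans h5)
  rw [hcard, hppq] at hdiv
  have hr : r ≤ Nat.card F - 1 := by
    rcases h.ftd.prime.dvd_mul.1 hdiv with h6 | h6
    · exact absurd h6 (h.r_not_q _)
    · exact Nat.le_of_dvd (by omega) h6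
  -- injection
  obtain ⟨y0, hy0⟩ := om_nd' hx
  have hne : ∀ w : pp x, y0 + w.1 ≠ 0 := by
    intro w h0
    have : om x (y0 + w.1) = 1 := by rw [map_add, hy0, show om x w.1 = 0 from w.2, add_zero]
    rw [h0, map_zero] at this
    exact zero_ne_one this
  have hg : ∀ w : pp x, ∃ g : Sp m F, g.1 x = y0 + w.1 := fun w => sp_trans hx (hne w)
  choose g hg using hg
  have hinj : Function.Injective (fun w : pp x => g w • α) := by
    intro w w' hww
    have h7 := h.ftd.KK_conj hK (g w)
    have h8 := h.ftd.KK_conj hK (g w')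
    rw [tv_conj, hg] at h7 h8
    simp only [] at hww
    rw [← hww] at h8
    obtain ⟨a, ha⟩ := h.K3 (hne w) hc h7 h8
    have h9 : om x (y0 + w'.1) = om x (a • (y0 + w.1)) := by rw [ha]
    rw [map_smul, map_add, map_add, hy0, show om x w.1 = 0 from w.2, show om x w'.1 = 0 from w'.2, add_zero,
      smul_eq_mul, mul_one] at h9
    rw [← h9, one_smul] at ha
    exact Subtype.ext (add_left_cancel ha).symm
  have h10 := Nat.card_le_card_of_injective _ hinj
  rw [hppq, Nat.card_eq_fintype_card (α := P)] at h10
  have h11 := h.ftd.v_lt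
  have h12 : r ^ 2 ≤ Nat.card F ^ 2 := Nat.pow_le_pow_left (by omega) 2
  have h13 : Nat.card F ^ 2 ≤ Nat.card F ^ (2 * m - 1) := Nat.pow_le_pow_right (by omega) (by have := h.hm; omega)
  omega

lemma SpD.lemA (h : SpD m F bl k lam r p f) {α : P} {ρ : Sp m F} (hρ : IsRho bl r α ρ) {y : VV m F}
    (hy : ρ.1 y = y) : y = 0 := by
  by_contra hne
  refine h.lemK (α := α) hne (one_ne_zero) ?_
  refine h.ftd.rho_comm_K hρ ?_ (h.tv_p y 1) h.r_not_p
  have := tv_conj ρ y 1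
  rw [hy, mul_inv_eq_iff_eq_mul] at this
  exact this.symm

/-- `r` divides the number of nonzero vectors of an invariant finset -/
lemma SpD.rho_dvd (h : SpD m F bl k lam r p f) {α : P} {ρ : Sp m F} (hρ : IsRho bl r α ρ)
    (U : Submodule F (VV m F)) (hU : ∀ y ∈ U, ρ.1 y ∈ U) : r ∣ Nat.card U - 1 := by
  classical
  haveI : Fintype (VV m F) := Fintype.ofFinite _
  obtain ⟨a, ha⟩ := hρ.ord
  have := card_dvd_of_no_fix h.ftd.prime ρ ha (Finset.univ.filter fun y : VV m F => y ∈ U ∧ y ≠ 0) (by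
    intro y hy
    simp only [Finset.mem_filter, Finset.mem_univ, true_and] at hy ⊢
    exact ⟨hU y hy.1, by change ρ.1 y ≠ 0; simpa using hy.2⟩) (by
    intro y hy hfix
    simp only [Finset.mem_filter, Finset.mem_univ, true_and] at hy
    exact hy.2 (h.lemA hρ hfix))
  convert this using 1
  have h3 : (Finset.univ.filter fun y : VV m F => y ∈ U).card = Nat.card U := by
    rw [← Nat.card_eq_finsetCard]
    apply Nat.card_congr
    exact Equiv.subtypeEquivRight (by intro y; simp)
  rw [← h3]
  have : (Finset.univ.filter fun y : VV m F => y ∈ U ∧ y ≠ 0) = (Finset.univ.filter fun y : VV m F => y ∈ U).erase 0 := by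
    ext y
    simp [and_comm]
  rw [this, Finset.card_erase_of_mem (by simp)]

lemma SpD.r_dvd (h : SpD m F bl k lam r p f) : r ∣ Nat.card F ^ m - 1 ∨ r ∣ Nat.card F ^ m + 1 := by
  obtain ⟨α⟩ := h.ftd.point
  obtain ⟨ρ, hρ⟩ := h.ftd.exists_rho' α
  have h1 := h.rho_dvd hρ ⊤ (fun _ _ => trivial)
  have h2 : Nat.card (⊤ : Submodule F (VV m F)) = Nat.card F ^ (2 * m) := by
    rw [← card_VV]; exact Nat.card_congr (Equiv.Set.univ _)
  rw [h2, mul_comm, pow_mul] at h1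
  have h3 : (Nat.card F ^ m) ^ 2 - 1 = (Nat.card F ^ m + 1) * (Nat.card F ^ m - 1) := by
    have := Nat.sq_sub_sq (Nat.card F ^ m) 1
    simpa using this
  rw [h3] at h1
  exact (h.ftd.prime.dvd_mul.1 h1).symm

end
end NFT

namespace NFT
section
variable {m : ℕ} {F : Type*} [Field F] [Finite F] {P : Type*} [MulAction (Sp m F) P] [Fintype P] [DecidableEq P]
  {bl : Finset (Finset P)} {k lam r p f : ℕ}

lemma om_repr (φ : VV m F →ₗ[F] F) : ∃ y, ∀ x, om x y = φ x := by
  have hinj : Function.Injective (om : VV m F →ₗ[F] VV m F →ₗ[F] F) := by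
    intro x y hxy
    exact om_ext (fun w => by rw [hxy])
  have hs := (LinearMap.injective_iff_surjective_of_finrank_eq_finrank
    (f := (om : VV m F →ₗ[F] Module.Dual F (VV m F))) (Subspace.dual_finrank_eq).symm).1 hinj
  obtain ⟨y, hy⟩ := hs (-φ)
  refine ⟨y, fun x => ?_⟩
  rw [om_swap, hy]
  simp

lemma ex_sep (M : Submodule F (VV m F)) {x : VV m F} (hx : x ∉ M) : ∃ y, (∀ u ∈ M, om u y = 0) ∧ om x y ≠ 0 := by
  obtain ⟨φ, h1, h2⟩ := Submodule.exists_le_ker_of_notMem hx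
  obtain ⟨y, hy⟩ := om_repr φ
  exact ⟨y, fun u hu => by rw [hy]; exact h2 hu, by rw [hy]; exact h1⟩

lemma McL (D : Set (VV m F)) (hsm : ∀ x ∈ D, ∀ a : F, a ≠ 0 → a • x ∈ D)
    (hadd : ∀ x ∈ D, ∀ y ∈ D, om x y ≠ 0 → x + y ∈ D)
    (N : Submodule F (VV m F)) (hiso : ∀ x ∈ N, ∀ y ∈ N, om x y = 0) (hN : ∀ x ∈ N, x ≠ 0 → x ∈ D)
    (n1 n2 : VV m F) (hn1 : n1 ∈ N) (hn2 : n2 ∈ N) (h1 : n1 ≠ 0) (h2 : n2 ≠ 0) (h12 : n1 ≠ n2)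
    (hspan : ∀ y, (∀ x ∈ D, om x y = 0) → y = 0)
    (hconn : ∀ D1 D2 : Set (VV m F), D1 ∪ D2 = D → (∀ x ∈ D1, ∀ y ∈ D2, om x y = 0) → D1.Nonempty → D2 = ∅) :
    ∀ x, x ≠ 0 → x ∈ D := by
  set D1 : Set (VV m F) := {z | z ∈ D ∧ ∃ n ∈ N, om z n ≠ 0} with hD1
  have hneg : ∀ z ∈ D1, -z ∈ D1 := by
    rintro z ⟨hz, n, hn, hzn⟩
    refine ⟨?_, n, hn, by simpa using hzn⟩
    have := hsm z hz (-1) (neg_ne_zero.2 one_ne_zero)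
    simpa using this
  have hsm1 : ∀ z ∈ D1, ∀ a : F, a ≠ 0 → a • z ∈ D1 := by
    rintro z ⟨hz, n, hn, hzn⟩ a ha
    exact ⟨hsm z hz a ha, n, hn, by simpa [ha] using hzn⟩
  have ha : ∀ z ∈ D1, ∀ n ∈ N, z + n ∈ D1 := by
    rintro z ⟨hz, n', hn', hzn'⟩ n hn
    refine ⟨?_, n', hn', by rw [map_add, LinearMap.add_apply, hiso n hn n' hn', add_zero]; exact hzn'⟩
    by_cases hzn : om z n = 0
    · have hz' : z + n' ∈ D := hadd z hz n' (hN n' hn' (by rintro rfl; simp at hzn')) hzn'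
      have e : om (z + n') (n - n') ≠ 0 := by
        rw [map_add, LinearMap.add_apply, map_sub, hzn, hiso n' hn' _ (N.sub_mem hn hn'), zero_sub, add_zero]
        exact neg_ne_zero.2 hzn'
      have := hadd _ hz' _ (hN _ (N.sub_mem hn hn') (by intro h0; rw [h0] at e; simp at e)) e
      rwa [show z + n' + (n - n') = z + n by abel] at this
    · exact hadd z hz n (hN n hn (by rintro rfl; simp at hzn)) hzn
  have hb : ∀ z1 ∈ D1, ∀ z2 ∈ D1, (∃ n ∈ N, om (z1 + z2) n ≠ 0) → z1 + z2 ∈ D1 := by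
    intro z1 hz1 z2 hz2 hn
    refine ⟨?_, hn⟩
    by_cases h12 : om z1 z2 = 0
    · obtain ⟨hz2D, n', hn', hz2n⟩ := id hz2
      have hz1' := ha z1 hz1 n' hn'
      have e : om (z1 + n') z2 ≠ 0 := by
        rw [map_add, LinearMap.add_apply, h12, zero_add]
        exact fun h0 => hz2n (om_zero_swap h0)
      have h3 := hadd _ hz1'.1 _ hz2D e
      obtain ⟨n, hn, hnn⟩ := hn
      have h4 : z1 + n' + z2 ∈ D1 := ⟨h3, n, hn, by
        rw [show z1 + n' + z2 = z1 + z2 + n' by abel, map_add, LinearMap.add_apply, hiso n' hn' n hn, add_zero]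
        exact hnn⟩
      have h5 := (ha _ h4 (-n') (N.neg_mem hn')).1
      rwa [show z1 + n' + z2 + -n' = z1 + z2 by abel] at h5
    · exact hadd _ hz1.1 _ hz2.1 h12
  have hdN : ∀ x ∈ D, x ∉ D1 → ∀ n ∈ N, om x n = 0 := by
    intro x hx hx1 n hn
    by_contra hc
    exact hx1 ⟨hx, n, hn, hc⟩
  have hsepN : ∀ n ∈ N, (∀ z ∈ D1, om z n = 0) → n = 0 := by
    intro n hn hz
    apply hspan
    intro x hx
    by_cases hx1 : x ∈ D1
    · exact hz x hx1
    · exact hdN x hx hx1 n hn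
  obtain ⟨z0, hz0, hz0n⟩ : ∃ z ∈ D1, om z n1 ≠ 0 := by
    by_contra hc
    push Not at hc
    exact h1 (hsepN n1 hn1 hc)
  -- another functional
  have hother : ∀ z ∈ D1, ∃ z' ∈ D1, ∃ n ∈ N, om (z' - z) n ≠ 0 := by
    intro z hz
    have haux : ∀ n ∈ N, n ≠ 0 → om z n = 0 → ∃ z' ∈ D1, ∃ n ∈ N, om (z' - z) n ≠ 0 := by
      intro n hn hn0 hzn
      by_contra hc
      push Not at hc
      apply hn0
      apply hsepN n hn
      intro z' hz'
      have := hc z' hz' n hn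
      rwa [map_sub, LinearMap.sub_apply, hzn, sub_zero] at this
    by_cases e1 : om z n1 = 0
    · exact haux n1 hn1 h1 e1
    by_cases e2 : om z n2 = 0
    · exact haux n2 hn2 h2 e2
    by_cases e3 : om z n2 • n1 - om z n1 • n2 = 0
    · refine ⟨(om z n1 / om z n2) • z, hsm1 z hz _ (div_ne_zero e1 e2), n1, hn1, ?_⟩
      rw [map_sub, LinearMap.sub_apply, map_smul, LinearMap.smul_apply, smul_eq_mul]
      intro h0
      have h3 : om z n1 / om z n2 = 1 := by
        have : (om z n1 / om z n2 - 1) * om z n1 = 0 := by rw [sub_mul, one_mul]; exact h0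
        rcases mul_eq_zero.1 this with h4 | h4
        · exact sub_eq_zero.1 h4
        · exact absurd h4 e1
      have h4 : om z n1 = om z n2 := (div_eq_one_iff_eq e2).1 h3
      rw [h4, ← smul_sub] at e3
      rcases smul_eq_zero.1 e3 with h5 | h5
      · exact e2 h5
      · exact h12 (sub_eq_zero.1 h5)
    · refine haux _ (N.sub_mem (N.smul_mem _ hn1) (N.smul_mem _ hn2)) e3 ?_
      simp; ring
  have hd1 : ∀ d : VV m F, (∀ n ∈ N, om d n = 0) → ∀ z ∈ D1, z + d ∈ D1 → ∀ z' ∈ D1,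
      (∃ n ∈ N, om (z' - z) n ≠ 0) → z' + d ∈ D1 := by
    intro d hd z hz hzd z' hz' hn
    have h3 : z' + -z ∈ D1 := hb z' hz' (-z) (hneg z hz) (by rwa [← sub_eq_add_neg])
    obtain ⟨n, hn, hnn⟩ := hz'.2
    have h4 := hb _ h3 _ hzd ⟨n, hn, by
      rw [show z' + -z + (z + d) = z' + d by abel, map_add, LinearMap.add_apply, hd n hn, add_zero]; exact hnn⟩
    rwa [show z' + -z + (z + d) = z' + d by abel] at h4
  have hd : ∀ d : VV m F, (∀ n ∈ N, om d n = 0) → ∀ z ∈ D1, z + d ∈ D1 → ∀ z' ∈ D1, z' + d ∈ D1 := by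
    intro d hd z hz hzd z' hz'
    by_cases hn : ∃ n ∈ N, om (z' - z) n ≠ 0
    · exact hd1 d hd z hz hzd z' hz' hn
    · push Not at hn
      obtain ⟨z'', hz'', n, hnN, hnn⟩ := hother z hz
      have h3 := hd1 d hd z hz hzd z'' hz'' ⟨n, hnN, hnn⟩
      refine hd1 d hd z'' hz'' h3 z' hz' ⟨n, hnN, ?_⟩
      have h4 := hn n hnN
      intro h0
      apply hnn
      rw [map_sub, LinearMap.sub_apply] at h4 h0 ⊢
      linear_combination h4 - h0
  set Δ : Set (VV m F) := {d | (∀ n ∈ N, om d n = 0) ∧ ∀ z ∈ D1, z + d ∈ D1} with hΔ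
  have hΔadd : ∀ d ∈ Δ, ∀ e ∈ Δ, d + e ∈ Δ := by
    rintro d ⟨hd1, hd2⟩ e ⟨he1, he2⟩
    refine ⟨fun n hn => by rw [map_add, LinearMap.add_apply, hd1 n hn, he1 n hn, add_zero], fun z hz => ?_⟩
    rw [← add_assoc]
    exact he2 _ (hd2 z hz)
  have hΔ0 : (0 : VV m F) ∈ Δ := ⟨by simp, fun z hz => by rwa [add_zero]⟩
  let Dt : Submodule F (VV m F) :=
    { carrier := D1 ∪ Δ
      zero_mem' := Or.inr hΔ0
      add_mem' := by
        rintro a b (ha | ha) (hb' | hb')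
        · by_cases hn : ∃ n ∈ N, om (a + b) n ≠ 0
          · exact Or.inl (hb a ha b hb' hn)
          · push Not at hn
            refine Or.inr ⟨hn, hd _ hn (-a) (hneg a ha) ?_⟩
            rwa [neg_add_cancel_left]
        · exact Or.inl (hb'.2 a ha)
        · rw [add_comm]; exact Or.inl (ha.2 b hb')
        · exact Or.inr (hΔadd a ha b hb')
      smul_mem' := by
        rintro c x hx
        by_cases hc : c = 0
        · subst hc; rw [zero_smul]; exact Or.inr hΔ0
        rcases hx with hx | hx
        · exact Or.inl (hsm1 x hx c hc)
        · have e : ∀ n ∈ N, om (c • x) n = 0 := fun n hn => by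
            rw [map_smul, LinearMap.smul_apply, hx.1 n hn, smul_zero]
          refine Or.inr ⟨e, hd _ e (c • z0) (hsm1 z0 hz0 c hc) ?_⟩
          rw [← smul_add]
          exact hsm1 _ (hx.2 z0 hz0) c hc }
  have hDt : ∀ x, x ∈ Dt ↔ x ∈ D1 ∨ x ∈ Δ := fun x => Iff.rfl
  have hperp : ∀ y ∈ D, y ∉ Dt → ∀ z ∈ D1, om z y = 0 := by
    intro y hy hyt z hz
    by_contra hc
    have hy1 : y ∉ D1 := fun h0 => hyt (Or.inl h0)
    have hyN := hdN y hy hy1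
    have h3 := hadd z hz.1 y hy hc
    obtain ⟨n, hn, hnn⟩ := hz.2
    have h4 : z + y ∈ D1 := ⟨h3, n, hn, by rw [map_add, LinearMap.add_apply, hyN n hn, add_zero]; exact hnn⟩
    exact hyt (Or.inr ⟨hyN, hd y hyN z hz h4⟩)
  have hD2 := hconn (D ∩ Dt) (D \ Dt) (Set.inter_union_diff _ _) (by
    rintro x ⟨hx, hxt⟩ y ⟨hy, hyt⟩
    rcases hxt with hx1 | hx1
    · exact hperp y hy hyt x hx1
    · have e1 := hperp y hy hyt z0 hz0
      have e2 := hperp y hy hyt _ (hx1.2 z0 hz0)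
      rwa [map_add, LinearMap.add_apply, e1, zero_add] at e2) ⟨z0, hz0.1, Or.inl hz0⟩
  have hDsub : ∀ x ∈ D, x ∈ Dt := by
    intro x hx
    by_contra hc
    have : x ∈ D \ (Dt : Set (VV m F)) := ⟨hx, hc⟩
    rw [hD2] at this
    exact this
  have htop : ∀ x, x ∈ Dt := by
    intro x
    by_contra hc
    obtain ⟨y, hy1, hy2⟩ := ex_sep Dt hc
    rw [hspan y (fun x hx => hy1 x (hDsub x hx))] at hy2
    simp at hy2
  have hout : ∀ x, (∃ n ∈ N, om x n ≠ 0) → x ∈ D1 := by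
    rintro x ⟨n, hn, hnn⟩
    rcases htop x with h3 | h3
    · exact h3
    · exact absurd (h3.1 n hn) hnn
  intro x hx
  by_cases hxn : ∃ n ∈ N, om x n ≠ 0
  · exact (hout x hxn).1
  · push Not at hxn
    obtain ⟨y1, hy1⟩ := om_nd' hx
    obtain ⟨y2, hy2⟩ := om_nd' h1
    obtain ⟨z, -, hz1, hz2⟩ := exists_avoid (⊤ : Submodule F (VV m F)) (om x) (om n1)
      ⟨y1, trivial, by rw [hy1]; exact one_ne_zero⟩ ⟨y2, trivial, by rw [hy2]; exact one_ne_zero⟩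
    have hz2' : om z n1 ≠ 0 := fun h0 => hz2 (om_zero_swap h0)
    have e1 : z ∈ D1 := hout z ⟨n1, hn1, hz2'⟩
    have e2 : x + z ∈ D1 := hout _ ⟨n1, hn1, by rw [map_add, LinearMap.add_apply, hxn n1 hn1, zero_add]; exact hz2'⟩
    have := hadd _ e2.1 _ (hneg z e1).1 (by simpa using hz1)
    rwa [add_neg_cancel_right] at this

end
end NFT

namespace NFT
section
variable {m : ℕ} {F : Type*} [Field F] [Finite F] {P : Type*} [MulAction (Sp m F) P] [Fintype P] [DecidableEq P]
  {bl : Finset (Finset P)} {k lam r p f : ℕ}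

/-- group generated by the root groups of a set -/
def EE (D : Set (VV m F)) : Subgroup (Sp m F) := Subgroup.closure {g | ∃ x ∈ D, ∃ c, g = tv x c}

lemma EE.mem {D : Set (VV m F)} {x : VV m F} (hx : x ∈ D) (c : F) : tv x c ∈ EE D :=
  Subgroup.subset_closure ⟨x, hx, c, rfl⟩

lemma EE.fix {D : Set (VV m F)} {y : VV m F} (hy : ∀ x ∈ D, om x y = 0) {g : Sp m F} (hg : g ∈ EE D) : g.1 y = y := by
  induction hg using Subgroup.closure_induction with
  | mem g hg => obtain ⟨x, hx, c, rfl⟩ := hg; exact tv_perp (om_zero_swap (hy x hx)) c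
  | one => rfl
  | mul a b _ _ ha hb => rw [Sp.mul_apply, hb, ha]
  | inv a _ ha =>
    have := congrArg (a⁻¹).1 ha
    rw [Sp.inv_apply_self] at this
    exact this.symm

lemma EE.comm {D : Set (VV m F)} {y : VV m F} (hy : ∀ x ∈ D, om x y = 0) {g : Sp m F} (hg : g ∈ EE D) (c : F) :
    tv y c * g = g * tv y c := by
  have := tv_conj g y c
  rw [EE.fix hy hg, mul_inv_eq_iff_eq_mul] at this
  exact this.symm

abbrev Da (F : Type*) [Field F] {m : ℕ} {P : Type*} [MulAction (Sp m F) P] (α : P) : Set (VV m F) :=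
  DS (MulAction.stabilizer (Sp m F) α)

lemma SpD.EE_le {D : Set (VV m F)} {α : P} (hD : D ⊆ Da F α) : EE D ≤ MulAction.stabilizer (Sp m F) α := by
  rw [EE, Subgroup.closure_le]
  rintro _ ⟨x, hx, c, rfl⟩
  exact (hD hx).2 c

lemma SpD.EE_not (h : SpD m F bl k lam r p f) {D : Set (VV m F)} {α : P} (hD : D ⊆ Da F α) (hne : D.Nonempty) :
    ¬ EE D ≤ KK (Sp m F) bl α := by
  intro hle
  obtain ⟨x, hx⟩ := hne
  exact h.lemK (hD hx).1 one_ne_zero (hle (EE.mem hx 1))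

lemma SpD.EE_rho (h : SpD m F bl k lam r p f) {α : P} (hne : (Da F α : Set (VV m F)).Nonempty) :
    ∃ ρ ∈ EE (Da F α : Set (VV m F)), IsRho bl r α ρ := by
  refine h.ftd.exists_rho α (MulAction.stabilizer (Sp m F) α) (EE (Da F α)) (fun g hg => hg)
    (h.ftd.stab_trans α) (SpD.EE_le subset_rfl) ?_ (h.EE_not subset_rfl hne)
  intro g hg n hn
  induction hn using Subgroup.closure_induction with
  | mem n hn => obtain ⟨x, hx, c, rfl⟩ := hn; rw [tv_conj]; exact EE.mem (DS.map hx hg) c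
  | one => simp
  | mul a b _ _ ha hb =>
    have := (EE (Da F α)).mul_mem ha hb
    convert this using 1; group
  | inv a _ ha =>
    have := (EE (Da F α)).inv_mem ha
    convert this using 1; group

lemma SpD.D_span (h : SpD m F bl k lam r p f) {α : P} (hne : (Da F α : Set (VV m F)).Nonempty) (y : VV m F)
    (hy : ∀ x ∈ Da F α, om x y = 0) : y = 0 := by
  obtain ⟨ρ, hρ, hr⟩ := h.EE_rho hne
  exact h.lemA hr (EE.fix hy hρ)

lemma SpD.D_conn (h : SpD m F bl k lam r p f) {α : P} (D1 D2 : Set (VV m F)) (h12 : D1 ∪ D2 = Da F α)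
    (hp : ∀ x ∈ D1, ∀ y ∈ D2, om x y = 0) (h1 : D1.Nonempty) : D2 = ∅ := by
  by_contra hc
  obtain ⟨y, hy⟩ := Set.nonempty_iff_ne_empty.2 hc
  have hs1 : D1 ⊆ Da F α := h12 ▸ Set.subset_union_left
  obtain ⟨ρ, hρ, hr⟩ := h.EE_rho (α := α) (h1.mono hs1)
  have hle : EE D1 ≤ EE (Da F α) := by
    apply Subgroup.closure_mono
    rintro _ ⟨x, hx, c, rfl⟩
    exact ⟨x, hs1 hx, c, rfl⟩
  have hnorm : EE (Da F α) ≤ Subgroup.normalizer (EE D1 : Set (Sp m F)) := by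
    rw [EE, Subgroup.closure_le]
    rintro _ ⟨x, hx, c, rfl⟩
    rw [← h12] at hx
    rcases hx with hx | hx
    · exact Subgroup.le_normalizer (EE.mem hx c)
    · have hcm : ∀ g ∈ EE D1, tv x c * g * (tv x c)⁻¹ = g := by
        intro g hg
        rw [EE.comm (fun z hz => hp z hz x hx) hg c, mul_inv_cancel_right]
      have hcm' : ∀ g ∈ EE D1, (tv x c)⁻¹ * g * (tv x c) = g := by
        intro g hg
        rw [mul_assoc, ← EE.comm (fun z hz => hp z hz x hx) hg c, inv_mul_cancel_left]
      rw [SetLike.mem_coe, Subgroup.mem_normalizer_iff]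
      intro g
      constructor
      · intro hg; rw [hcm g hg]; exact hg
      · intro hg
        have := hcm' _ hg
        rw [show (tv x c)⁻¹ * (tv x c * g * (tv x c)⁻¹) * tv x c = g by group] at this
        rw [this]; exact hg
  obtain ⟨ρ1, hρ1, hr1⟩ := h.ftd.exists_rho α (EE (Da F α)) (EE D1) (fun g hg => SpD.EE_le subset_rfl hg) (by
    intro B hB C hC hαB hαC
    obtain ⟨i, hi⟩ := hr.tr B hB C hC hαB hαC
    exact ⟨ρ ^ i, Subgroup.pow_mem _ hρ i, hi⟩) hle (by
    intro g hg n hn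
    exact (Subgroup.mem_normalizer_iff.1 (hnorm hg) n).1 hn) (h.EE_not hs1 h1)
  have hy0 := h.lemA hr1 (EE.fix (fun x hx => hp x hx y hy) hρ1)
  have : y ∈ Da F α := h12 ▸ Or.inr hy
  exact this.1 hy0

lemma SpD.no_plane (h : SpD m F bl k lam r p f) {α : P} (N : Submodule F (VV m F))
    (hiso : ∀ x ∈ N, ∀ y ∈ N, om x y = 0) (hN : ∀ x ∈ N, x ≠ 0 → x ∈ Da F α)
    {n1 n2 : VV m F} (hn1 : n1 ∈ N) (hn2 : n2 ∈ N) (h1 : n1 ≠ 0) (h2 : n2 ≠ 0) (h12 : n1 ≠ n2) : False := by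
  apply h.not_all α
  intro x c hx
  have := McL (Da F α) (fun x hx a ha => DS.smul hx ha) (fun x hx y hy hxy => DS.add hx hy hxy) N hiso hN
    n1 n2 hn1 hn2 h1 h2 h12 (h.D_span ⟨n1, hN n1 hn1 h1⟩) (fun D1 D2 a b c => h.D_conn D1 D2 a b c) x hx
  exact this.2 c

lemma SpD.D_empty (h : SpD m F bl k lam r p f) (hq : 2 < Nat.card F) (α : P) (x : VV m F) (hx : x ∈ Da F α) : False := by
  classical
  haveI := Fintype.ofFinite F
  rw [Nat.card_eq_fintype_card] at hq
  obtain ⟨a, b, c, hab, hac, hbc⟩ := Fintype.two_lt_card_iff.1 hq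
  have : ∃ a : F, a ≠ 0 ∧ a ≠ 1 := by
    by_contra hcon
    push Not at hcon
    have H : ∀ a : F, a = 0 ∨ a = 1 := fun a => or_iff_not_imp_left.2 (hcon a)
    rcases H a with rfl | rfl <;> rcases H b with rfl | rfl <;> rcases H c with rfl | rfl <;> simp_all
  obtain ⟨a, ha0, ha1⟩ := this
  refine h.no_plane (α := α) (Submodule.span F {x}) ?_ ?_ (n1 := x) (n2 := a • x) ?_ ?_ hx.1 (smul_ne_zero ha0 hx.1) ?_
  · intro y hy z hz
    obtain ⟨c, rfl⟩ := Submodule.mem_span_singleton.1 hy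
    obtain ⟨d, rfl⟩ := Submodule.mem_span_singleton.1 hz
    simp
  · intro y hy hy0
    obtain ⟨c, rfl⟩ := Submodule.mem_span_singleton.1 hy
    exact DS.smul hx (by rintro rfl; simp at hy0)
  · exact Submodule.mem_span_singleton_self x
  · exact Submodule.smul_mem _ _ (Submodule.mem_span_singleton_self x)
  · intro h0
    have : (a - 1) • x = 0 := by rw [sub_smul, one_smul, ← h0, sub_self]
    rcases smul_eq_zero.1 this with h3 | h3
    · exact ha1 (sub_eq_zero.1 h3)
    · exact hx.1 h3

lemma F2 (hq : Nat.card F = 2) (a : F) : a = 0 ∨ a = 1 := by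
  classical
  haveI := Fintype.ofFinite F
  rw [Nat.card_eq_fintype_card] at hq
  by_contra hc
  push Not at hc
  have : 2 < Fintype.card F := Fintype.two_lt_card_iff.2 ⟨0, 1, a, zero_ne_one, hc.1.symm, hc.2.symm⟩
  omega

lemma F2two (hq : Nat.card F = 2) : (2 : F) = 0 := by
  haveI := Fintype.ofFinite F
  have := Nat.cast_card_eq_zero F
  rw [← Nat.card_eq_fintype_card, hq] at this
  exact_mod_cast this

lemma tv_add_eq {x u : VV m F} (h : om x u = 0) : tv (x + u) 1 = tv x 1 * (tv u 1 * sg x u) := by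
  apply Sp.ext'
  intro w
  have h' := om_zero_swap h
  rw [Sp.mul_apply, Sp.mul_apply, sg_apply h, tv_apply, tv_apply, tv_apply]
  simp [h, h']
  module

lemma SpD.sg_not (h : SpD m F bl k lam r p f) (hq : Nat.card F = 2) {α : P} {x u : VV m F} (hx : x ∈ Da F α)
    (hxu : om x u = 0) (hu0 : u ≠ 0) (hux : u ≠ x) : sg x u ∉ MulAction.stabilizer (Sp m F) α := by
  intro hs
  set H := MulAction.stabilizer (Sp m F) α
  have h2 := F2two hq
  have mem1 : ∀ z : VV m F, z ≠ 0 → tv z 1 ∈ H → z ∈ DS H := by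
    intro z hz hz1
    refine ⟨hz, fun c => ?_⟩
    rcases F2 hq c with rfl | rfl
    · rw [tv_zero]; exact H.one_mem
    · exact hz1
  have hxx : x + x = 0 := by rw [← two_smul F, h2, zero_smul]
  have huu : u + u = 0 := by rw [← two_smul F, h2, zero_smul]
  have hxu0 : x + u ≠ 0 := by
    intro h0
    apply hux
    calc u = x + x + u := by rw [hxx, zero_add]
      _ = x + (x + u) := by abel
      _ = x := by rw [h0, add_zero]
  -- conclusion from u ∈ D
  have fin : u ∈ DS H → x + u ∈ DS H → False := by
    intro d1 d2
    refine h.no_plane (α := α) (Submodule.span F {x, u}) ?_ ?_ (n1 := x) (n2 := u)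
      (Submodule.subset_span (by simp)) (Submodule.subset_span (by simp)) hx.1 hu0 hux.symm
    · intro y hy z hz
      obtain ⟨a, b, rfl⟩ := Submodule.mem_span_pair.1 hy
      obtain ⟨a', b', rfl⟩ := Submodule.mem_span_pair.1 hz
      simp [hxu, om_zero_swap hxu]
    · intro y hy hy0
      obtain ⟨a, b, rfl⟩ := Submodule.mem_span_pair.1 hy
      rcases F2 hq a with rfl | rfl <;> rcases F2 hq b with rfl | rfl
      · simp at hy0
      · simpa using d1
      · simpa using hx
      · simpa using d2
  have fin1 : u ∈ DS H → False := fun d1 => fin d1 (mem1 _ hxu0 (by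
    rw [tv_add_eq hxu]; exact H.mul_mem (hx.2 1) (H.mul_mem (d1.2 1) hs)))
  have fin2 : x + u ∈ DS H → False := fun d2 => fin (mem1 _ hu0 (by
    have h3 := tv_add_eq hxu
    rw [← mul_assoc, ← tv_comm (om_zero_swap hxu), mul_assoc] at h3
    have h4 : tv u 1 = tv (x + u) 1 * (tv x 1 * sg x u)⁻¹ := by rw [h3, mul_inv_cancel_right]
    rw [h4]
    exact H.mul_mem (d2.2 1) (H.inv_mem (H.mul_mem (hx.2 1) hs)))) d2
  obtain ⟨y, hy, hyx⟩ : ∃ y ∈ DS H, om y x ≠ 0 := by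
    by_contra hc
    push Not at hc
    exact hx.1 (h.D_span ⟨x, hx⟩ x hc)
  have hyx1 : om y x = 1 := (F2 hq _).resolve_left hyx
  have hxy1 : om x y = 1 := (F2 hq _).resolve_left (fun h0 => hyx (om_zero_swap h0))
  have dyx : y + x ∈ DS H := DS.add hy hx hyx
  have ds := DS.map hy hs
  rw [sg_apply hxu, hyx1, one_smul] at ds
  have hux' := om_zero_swap hxu
  rcases F2 hq (om y u) with e | e
  · rw [e, zero_smul, add_zero] at ds
    apply fin2
    have huy := om_zero_swap e
    have := DS.add dyx ds (by simp [hxu, hxy1, e])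
    rw [show y + x + (y + u) = (2 : F) • y + (x + u) by module, h2, zero_smul, zero_add] at this
    exact this
  · rw [e, one_smul] at ds
    apply fin1
    have := DS.add dyx ds (by simp [hxu, hxy1, hyx1, e, h2]; rw [show (1 : F) + 1 = 2 by norm_num, h2]; simp)
    rw [show y + x + (y + x + u) = (2 : F) • (y + x) + u by module, h2, zero_smul, zero_add] at this
    exact this

/-! divisors of v -/

lemma SpD.two_iff (h : SpD m F bl k lam r p f) : (2 : F) = 0 ↔ p = 2 := by
  constructor
  · intro h2
    by_contra hne
    have h4 : ((Nat.gcd p 2 : ℕ) : F) = 0 := by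
      have hc : ringChar F ∣ Nat.gcd p 2 :=
        Nat.dvd_gcd (ringChar.dvd h.pF) (ringChar.dvd (by exact_mod_cast h2))
      exact (ringChar.spec F _).2 hc
    have : Nat.gcd p 2 = 1 := (Nat.coprime_primes h.hp Nat.prime_two).2 hne
    rw [this] at h4
    simp at h4
  · rintro rfl
    exact_mod_cast h.pF

lemma SpD.eps_odd (h : SpD m F bl k lam r p f) (hp : p ≠ 2) : eps F = 1 := by
  unfold eps; rw [if_neg (fun h0 => hp (h.two_iff.1 h0))]

lemma SpD.eps_even (h : SpD m F bl k lam r p f) (hp : p = 2) : eps F = 2 := by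
  unfold eps; rw [if_pos (h.two_iff.2 hp)]

def NoTv (m : ℕ) (F : Type*) [Field F] (P : Type*) [MulAction (Sp m F) P] : Prop :=
  ∀ (α : P) (x : VV m F) (c : F), x ≠ 0 → c ≠ 0 → tv x c • α ≠ α

lemma SpD.i0 (h : SpD m F bl k lam r p f) : ∃ i : Fin m, True := ⟨⟨0, by have := h.hm; omega⟩, trivial⟩

/-- case N, q odd -/
lemma SpD.div_N_odd (h : SpD m F bl k lam r p f) (hp : p ≠ 2) (hN : NoTv m F P) : Nat.card F ^ m ∣ Fintype.card P := by
  obtain ⟨i, -⟩ := h.i0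
  rw [h.hq, ← pow_mul]
  apply dvd_of_orbits (RR i F) h.hp (RR_pgroup i h.hq)
  intro β
  have := AU_N i (MulAction.stabilizer (Sp m F) β) (fun c hc hm => hN β _ c (eb_ne i) hc hm)
  rwa [h.eps_odd hp, one_mul, h.hq, ← pow_mul] at this

/-- case N, q even, and all q = 2 -/
lemma SpD.div_N_even (h : SpD m F bl k lam r p f) (hp : p = 2) (hN : NoTv m F P ∨ Nat.card F = 2) :
    ∃ E, Nat.card F ^ m = 2 * E ∧ E ∣ Fintype.card P := by
  obtain ⟨i, -⟩ := h.i0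
  have hf := h.f1
  have hm := h.hm
  have hfm : 1 ≤ f * m := Nat.mul_pos hf (by omega)
  have e : Nat.card F ^ m = 2 * p ^ (f * m - 1) := by
    rw [h.hq, ← pow_mul, hp, ← pow_succ', Nat.sub_add_cancel hfm]
  refine ⟨p ^ (f * m - 1), e, ?_⟩
  apply dvd_of_orbits (RR i F) h.hp (RR_pgroup i h.hq)
  intro β
  by_cases hD : ∀ c : F, c ≠ 0 → tv (eb i F) c ∉ MulAction.stabilizer (Sp m F) β
  · have := AU_N i (MulAction.stabilizer (Sp m F) β) hD
    rw [h.eps_even hp, e] at this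
    omega
  · push Not at hD
    obtain ⟨c, hc, hcm⟩ := hD
    rcases hN with hN | hq2
    · exact absurd hcm (hN β _ c (eb_ne i) hc)
    have hc1 : c = 1 := (F2 hq2 c).resolve_left hc
    subst hc1
    have hx : eb i F ∈ Da F β := by
      refine ⟨eb_ne i, fun c => ?_⟩
      rcases F2 hq2 c with rfl | rfl
      · rw [tv_zero]; exact Subgroup.one_mem _
      · exact hcm
    have := AU_2 i (MulAction.stabilizer (Sp m F) β) (by
      intro φ hφ
      apply h.sg_not hq2 hx (Ph.perp i φ)
      · intro h0
        exact hφ (Subtype.ext (congrArg Prod.snd h0))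
      · intro h0
        have := congrFun (congrArg Prod.fst h0) i
        simp [eb, ee] at this)
    have hf1 : f = 1 := by
      have h3 := h.hq
      rw [hq2, hp] at h3
      exact (Nat.pow_right_injective le_rfl (by simpa using h3.symm) : f = 1)
    rw [h.hq, ← pow_mul] at this
    rwa [hf1, one_mul] at this ⊢

lemma SpD.div_P (h : SpD m F bl k lam r p f) (hq : 2 < Nat.card F) :
    (p ≠ 2 → Nat.card F ^ (m - 1) * p ∣ Fintype.card P) ∧ (p = 2 → Nat.card F ^ (m - 1) ∣ Fintype.card P) := by
  obtain ⟨i, -⟩ := h.i0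
  have key : ∀ β : P, Nat.card F ^ (m - 1) * p ≤ eps F * (MulAction.stabilizer (Sp m F) β).relIndex (RR i F) := by
    intro β
    apply AU_P i h.hp h.hq
    by_contra hc
    push Not at hc
    exact h.D_empty hq β (eb i F) ⟨eb_ne i, hc⟩
  constructor
  · intro hp
    rw [h.hq, ← pow_mul, ← pow_succ]
    apply dvd_of_orbits (RR i F) h.hp (RR_pgroup i h.hq)
    intro β
    have := key β
    rwa [h.eps_odd hp, one_mul, h.hq, ← pow_mul, ← pow_succ] at this
  · intro hp
    rw [h.hq, ← pow_mul]
    apply dvd_of_orbits (RR i F) h.hp (RR_pgroup i h.hq)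
    intro β
    have := key β
    rw [h.eps_even hp, h.hq, ← pow_mul] at this
    rw [show p ^ (f * (m - 1)) * p = 2 * p ^ (f * (m - 1)) by rw [hp]; ring] at this
    omega

end
end NFT

namespace NFT

lemma burn {A Ω : Type*} [Group A] [Fintype A] [MulAction A Ω] [Fintype Ω] (S : Finset A) (N f : ℕ)
    (hS0 : S.Nonempty) (hN : Fintype.card A = S.card * N) (hS : ∀ a ∈ S, ∀ w : Ω, a • w = w)
    (hf : ∀ a ∉ S, Nat.card (MulAction.fixedBy Ω a) = f) (hlt : f < Fintype.card Ω) : N ≤ Fintype.card Ω := by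
  classical
  have h1 := MulAction.sum_card_fixedBy_eq_card_orbits_mul_card_group A Ω
  have h2 : ∑ g : A, Fintype.card (MulAction.fixedBy Ω g) = S.card * Fintype.card Ω + (Fintype.card A - S.card) * f := by
    rw [← Finset.sum_add_sum_compl S]
    congr 1
    · rw [Finset.sum_congr rfl (g := fun _ => Fintype.card Ω), Finset.sum_const, smul_eq_mul]
      intro a ha
      rw [← Nat.card_eq_fintype_card, ← Nat.card_eq_fintype_card]
      apply Nat.card_congr
      exact (Equiv.subtypeUnivEquiv (fun w => hS a ha w))
    · rw [Finset.sum_congr rfl (g := fun _ => f), Finset.sum_const, smul_eq_mul, Finset.card_compl]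
      intro a ha
      rw [← Nat.card_eq_fintype_card]
      exact hf a (Finset.mem_compl.1 ha)
  rw [h2, hN] at h1
  generalize Fintype.card (Quotient (MulAction.orbitRel A Ω)) = o at h1
  have hs : 0 < S.card := hS0.card_pos
  have hN0 : 0 < N := by
    rcases Nat.eq_zero_or_pos N with h0 | h0
    · rw [h0, mul_zero] at hN
      have : 0 < Fintype.card A := Fintype.card_pos
      omega
    · exact h0
  have h3 : S.card * N - S.card = S.card * (N - 1) := by rw [Nat.mul_sub, mul_one]
  rw [h3, show S.card * Fintype.card Ω + S.card * (N - 1) * f = S.card * (Fintype.card Ω + (N - 1) * f) by ring,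
    show o * (S.card * N) = S.card * (o * N) by ring] at h1
  have h4 := Nat.eq_of_mul_eq_mul_left hs h1
  obtain ⟨n, rfl⟩ : ∃ n, N = n + 1 := ⟨N - 1, by omega⟩
  rw [Nat.add_sub_cancel] at h4
  by_contra hc
  push Not at hc
  -- o > f
  have h5 : f < o := by
    by_contra h6
    push Not at h6
    have := Nat.mul_le_mul_right (n + 1) h6
    nlinarith
  have := Nat.mul_le_mul_right (n + 1) (show f + 1 ≤ o from h5)
  nlinarith

section
variable {m : ℕ} {F : Type*} [Field F] {P : Type*} [MulAction (Sp m F) P]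

def zst (x : VV m F) (P : Type*) [MulAction (Sp m F) P] : Setoid P where
  r a b := ∃ c : F, tv x c • a = b
  iseqv := ⟨fun a => ⟨0, by rw [tv_zero, one_smul]⟩,
    fun {a b} ⟨c, hc⟩ => ⟨-c, by rw [← hc, smul_smul, tv_mul, neg_add_cancel, tv_zero, one_smul]⟩,
    fun {a b d} ⟨c, hc⟩ ⟨e, he⟩ => ⟨e + c, by rw [← he, ← hc, smul_smul, tv_mul]⟩⟩

lemma zst_map {x : VV m F} {g : Sp m F} (hg : g.1 x = x) (a b : P) (h : (zst x P).r a b) :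
    (zst x P).r (g • a) (g • b) := by
  obtain ⟨c, hc⟩ := h
  refine ⟨c, ?_⟩
  have := tv_conj g x c
  rw [hg, mul_inv_eq_iff_eq_mul] at this
  rw [← hc, smul_smul, smul_smul, this]

noncomputable def zmap {x : VV m F} {g : Sp m F} (hg : g.1 x = x) : Quotient (zst x P) → Quotient (zst x P) :=
  Quotient.map (fun a => g • a) (fun a b h => zst_map hg a b h)

noncomputable abbrev zact (x : VV m F) (P : Type*) [MulAction (Sp m F) P] :
    MulAction (Multiplicative (pp x)) (Quotient (zst x P)) where
  smul u w := zmap (sg_x (mem_pp.1 u.toAdd.2)) w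
  one_smul w := by
    induction w using Quotient.inductionOn with | _ a =>
    change (⟦sg x 0 • a⟧ : Quotient (zst x P)) = ⟦a⟧
    rw [sg_zero, one_smul]
  mul_smul u u' w := by
    induction w using Quotient.inductionOn with | _ a =>
    change (⟦sg x (u.toAdd.1 + u'.toAdd.1) • a⟧ : Quotient (zst x P)) = ⟦sg x u.toAdd.1 • sg x u'.toAdd.1 • a⟧
    have h1 := mem_pp.1 u.toAdd.2
    have h2 := mem_pp.1 u'.toAdd.2
    apply Quotient.sound
    refine ⟨om u'.toAdd.1 u.toAdd.1, ?_⟩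
    rw [smul_smul, smul_smul, sg_mul h1 h2, sg_tv_comm]
    exact (pp x).add_mem u.toAdd.2 u'.toAdd.2

end

section
variable {m : ℕ} {F : Type*} [Field F] [Finite F] {P : Type*} [MulAction (Sp m F) P] [Fintype P] [DecidableEq P]
  {bl : Finset (Finset P)} {k lam r p f : ℕ}

lemma card_span {x : VV m F} (hx : x ≠ 0) : Nat.card (Submodule.span F {x}) = Nat.card F :=
  Nat.card_congr (LinearEquiv.toSpanNonzeroSingleton F (VV m F) x hx).symm.toEquiv

lemma SpD.big_odd (h : SpD m F bl k lam r p f) (hp : p ≠ 2) : Nat.card F ^ (2 * m - 2) < Fintype.card P := by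
  classical
  have h2 : (2 : F) ≠ 0 := fun h0 => hp (h.two_iff.1 h0)
  have hm := h.hm
  obtain ⟨x, hx⟩ := h.ex_ne
  haveI : Fintype (VV m F) := Fintype.ofFinite _
  letI := zact x P
  haveI : Fintype (Quotient (zst x P)) := Fintype.ofFinite _
  haveI : Fintype (Multiplicative (pp x)) := Fintype.ofFinite _
  have hsm : ∀ (u : Multiplicative (pp x)) (a : P), u • (⟦a⟧ : Quotient (zst x P)) = ⟦sg x u.toAdd.1 • a⟧ := fun u a => rfl
  -- number of classes < v
  have hlt : Fintype.card (Quotient (zst x P)) < Fintype.card P := by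
    obtain ⟨a, ha⟩ := h.tv_ne hx one_ne_zero
    apply Fintype.card_lt_of_surjective_not_injective (Quotient.mk (zst x P)) Quotient.mk_surjective
    intro hinj
    exact ha (hinj (Quotient.sound ⟨1, rfl⟩)).symm
  refine lt_of_le_of_lt ?_ hlt
  have cV := card_pp hx
  rw [card_VV] at cV
  have hq0 : 0 < Nat.card F := Nat.card_pos
  have hc : Nat.card (pp x) = Nat.card F * Nat.card F ^ (2 * m - 2) := by
    apply Nat.eq_of_mul_eq_mul_right hq0
    rw [cV, mul_assoc, ← pow_succ, ← pow_succ']; congr 1; omega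
  let S : Finset (Multiplicative (pp x)) := Finset.univ.filter fun u => u.toAdd.1 ∈ Submodule.span F {x}
  have hxx : x ∈ pp x := by simp
  have hSc : S.card = Nat.card F := by
    rw [← card_span hx, ← Nat.card_eq_finsetCard]
    have hle : Submodule.span F {x} ≤ pp x := by rw [Submodule.span_le]; simpa using hxx
    refine Nat.card_congr ⟨fun u => ⟨u.1.toAdd.1, (Finset.mem_filter.1 u.2).2⟩,
      fun w => ⟨Multiplicative.ofAdd ⟨w.1, hle w.2⟩, Finset.mem_filter.2 ⟨Finset.mem_univ _, w.2⟩⟩, fun u => rfl, fun w => rfl⟩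
  have hconst : ∀ u u' : Multiplicative (pp x), u ∉ S → u' ∉ S →
      Nat.card (MulAction.fixedBy (Quotient (zst x P)) u) ≤ Nat.card (MulAction.fixedBy (Quotient (zst x P)) u') := by
    intro u u' hu hu'
    have hn : ∀ u : Multiplicative (pp x), u ∉ S → ∀ a : F, u.toAdd.1 ≠ a • x := by
      intro u hu a ha
      exact hu (Finset.mem_filter.2 ⟨Finset.mem_univ _, Submodule.mem_span_singleton.2 ⟨a, ha.symm⟩⟩)
    have hu1 := mem_pp.1 u.toAdd.2
    have hu1' := mem_pp.1 u'.toAdd.2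
    obtain ⟨g, hgx, hgu⟩ := stab_trans hx (hn u hu) (hn u' hu') hu1 hu1'
    have hgi : (g⁻¹).1 x = x := by
      have := congrArg (g⁻¹).1 hgx
      rw [Sp.inv_apply_self] at this; exact this.symm
    have hcm : g * sg x u.toAdd.1 = sg x u'.toAdd.1 * g := by
      have := sg_conj g hu1
      rw [hgx, hgu, mul_inv_eq_iff_eq_mul] at this
      exact this
    apply Nat.card_le_card_of_injective (fun w => (⟨zmap hgx w.1, by
      obtain ⟨w, hw⟩ := w
      induction w using Quotient.inductionOn with | _ a =>
      rw [MulAction.mem_fixedBy, hsm] at hw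
      rw [MulAction.mem_fixedBy]
      change u' • (⟦g • a⟧ : Quotient (zst x P)) = ⟦g • a⟧
      rw [hsm, smul_smul, ← hcm, mul_smul]
      exact Quotient.sound (zst_map hgx _ _ (Quotient.exact hw))⟩ : MulAction.fixedBy (Quotient (zst x P)) u'))
    intro w w' hww
    have h3 : zmap (P := P) hgx w.1 = zmap hgx w'.1 := congrArg Subtype.val hww
    apply Subtype.ext
    have hinv : ∀ w : Quotient (zst x P), zmap hgi (zmap hgx w) = w := by
      intro w
      induction w using Quotient.inductionOn with | _ a =>
      change (⟦g⁻¹ • g • a⟧ : Quotient (zst x P)) = _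
      rw [inv_smul_smul]
    rw [← hinv w.1, h3, hinv]
  -- a point outside S moving something
  have hmove : ∃ u0 : Multiplicative (pp x), u0 ∉ S ∧ ∃ w : Quotient (zst x P), u0 • w ≠ w := by
    by_contra hcon
    push Not at hcon
    have hz : ∀ u : Multiplicative (pp x), ∀ w : Quotient (zst x P), u • w = w := by
      intro u w
      by_cases hu : u ∈ S
      · obtain ⟨a, ha⟩ := Submodule.mem_span_singleton.1 (Finset.mem_filter.1 hu).2
        induction w using Quotient.inductionOn with | _ b =>
        rw [hsm, ← ha, sg_self]
        exact Quotient.sound ((zst x P).symm ⟨2 * a, rfl⟩)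
      · exact hcon u hu w
    have hcomm : ∀ u u' : VV m F, om x u = 0 → om x u' = 0 → ∀ b : P, tv x (2 * om u' u) • b = b := by
      intro u u' hu hu' b
      obtain ⟨c, hc⟩ := (zst x P).symm (Quotient.exact ((hsm (Multiplicative.ofAdd ⟨u, hu⟩) b).symm.trans (hz _ _)))
      obtain ⟨c', hc'⟩ := (zst x P).symm (Quotient.exact ((hsm (Multiplicative.ofAdd ⟨u', hu'⟩) b).symm.trans (hz _ _)))
      change tv x c • b = sg x u • b at hc
      change tv x c' • b = sg x u' • b at hc'
      have e1 : (sg x u * sg x u') • b = (tv x c * tv x c') • b := by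
        rw [mul_smul, ← hc', smul_smul, sg_tv_comm hu, mul_smul, ← hc, smul_smul, tv_mul, tv_mul, add_comm]
      have e2 : (sg x u' * sg x u) • b = (tv x c * tv x c') • b := by
        rw [mul_smul, ← hc, smul_smul, sg_tv_comm hu', mul_smul, ← hc', smul_smul]
      rw [← e2, sg_mul hu hu', sg_mul hu' hu, add_comm u' u, mul_smul, mul_smul, smul_left_cancel_iff] at e1
      have : tv x (om u u') • (tv x (2 * om u' u) • b) = tv x (om u u') • b := by
        rw [smul_smul, tv_mul, ← e1]; congr 2; rw [om_swap u u']; ring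
      exact smul_left_cancel _ this
    -- choose u, u'
    obtain ⟨u, u', hu, hu', huu⟩ : ∃ u u' : VV m F, om x u = 0 ∧ om x u' = 0 ∧ om u' u ≠ 0 := by
      have : ∃ u' ∈ pp x, u' ∉ Submodule.span F {x} := by
        by_contra hcc
        push Not at hcc
        have hle : Nat.card (pp x) ≤ Nat.card (Submodule.span F {x}) :=
          Nat.card_le_card_of_injective (fun u => (⟨u.1, hcc u.1 u.2⟩ : Submodule.span F {x}))
            (fun a b hab => Subtype.ext (Subtype.mk.inj hab))
        rw [card_span hx, hc] at hle
        have h1 := Finite.one_lt_card (α := F)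
        have : 1 < Nat.card F ^ (2 * m - 2) := Nat.one_lt_pow (by omega) h1
        nlinarith
      obtain ⟨u', hu', hn⟩ := this
      obtain ⟨u, h1, h2⟩ := ex_sep _ hn
      exact ⟨u, u', h1 x (Submodule.mem_span_singleton_self x), hu', h2⟩
    obtain ⟨b, hb⟩ := h.tv_ne hx (mul_ne_zero h2 huu)
    exact hb (hcomm u u' hu hu' b)
  obtain ⟨u0, hu0, w0, hw0⟩ := hmove
  refine burn (A := Multiplicative (pp x)) S _ (Nat.card (MulAction.fixedBy (Quotient (zst x P)) u0)) ⟨1, ?_⟩ ?_ ?_ ?_ ?_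
  · exact Finset.mem_filter.2 ⟨Finset.mem_univ _, Submodule.zero_mem _⟩
  · rw [hSc, ← hc, ← Nat.card_eq_fintype_card]; rfl
  · intro u hu w
    obtain ⟨a, ha⟩ := Submodule.mem_span_singleton.1 (Finset.mem_filter.1 hu).2
    induction w using Quotient.inductionOn with | _ b =>
    rw [hsm, ← ha, sg_self]
    exact Quotient.sound ((zst x P).symm ⟨2 * a, rfl⟩)
  · intro a ha
    exact le_antisymm (hconst _ _ ha hu0) (hconst _ _ hu0 ha)
  · rw [Nat.card_eq_fintype_card]
    exact Fintype.card_subtype_lt (x := w0) hw0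

end
end NFT

namespace NFT

section
variable {M : Type*} [AddCommGroup M] [Module ℚ M]

lemma indep_aux {ι A : Type*} [DecidableEq ι] (R : A → (M →ₗ[ℚ] M)) (v : ι → M) (χ : ι → A → ℚ)
    (hv : ∀ i, v i ≠ 0) (hR : ∀ i j, i ≠ j → ∃ a, χ i a ≠ χ j a ∧ ∀ l, R a (v l) = χ l a • v l) :
    ∀ (n : ℕ) (S : Finset ι), S.card = n → ∀ c : ι → ℚ, ∑ i ∈ S, c i • v i = 0 → ∀ i ∈ S, c i = 0 := by
  intro n
  induction n with
  | zero => intro S hS c _ i hi; rw [Finset.card_eq_zero.1 hS] at hi; simp at hi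
  | succ n ih =>
    intro S hS c hc i hi
    by_cases hj : ∃ j ∈ S, j ≠ i
    · obtain ⟨j, hj, hji⟩ := hj
      obtain ⟨a, ha, hl⟩ := hR i j hji.symm
      have h1 := congrArg (R a) hc
      rw [map_sum, map_zero] at h1
      have h2 : ∑ l ∈ S, (c l * (χ l a - χ j a)) • v l = 0 := by
        have h3 := congrArg (fun z => χ j a • z) hc
        simp only [smul_zero, Finset.smul_sum] at h3
        rw [← sub_self (0 : M)]
        nth_rewrite 1 [← h1]
        rw [← h3, ← Finset.sum_sub_distrib]
        apply Finset.sum_congr rfl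
        intro l _
        rw [map_smul, hl]
        module
      rw [← Finset.add_sum_erase S _ hj] at h2
      simp only [sub_self, mul_zero, zero_smul, zero_add] at h2
      have := ih (S.erase j) (by rw [Finset.card_erase_of_mem hj, hS]; rfl) _ h2 i (Finset.mem_erase.2 ⟨hji.symm, hi⟩)
      exact (mul_eq_zero.1 this).resolve_right (sub_ne_zero.2 ha)
    · push Not at hj
      have : S = {i} := Finset.eq_singleton_iff_unique_mem.2 ⟨hi, hj⟩
      rw [this, Finset.sum_singleton] at hc
      exact (smul_eq_zero.1 hc).resolve_right (hv i)

lemma indep {ι A : Type*} (R : A → (M →ₗ[ℚ] M)) (v : ι → M) (χ : ι → A → ℚ)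
    (hv : ∀ i, v i ≠ 0) (hR : ∀ i j, i ≠ j → ∃ a, χ i a ≠ χ j a ∧ ∀ l, R a (v l) = χ l a • v l) :
    LinearIndependent ℚ v := by
  classical
  rw [linearIndependent_iff']
  intro S c hc
  exact indep_aux R v χ hv hR S.card S rfl c hc
end

section
variable {m : ℕ} {F : Type*} [Field F] {M : Type*} [AddCommGroup M] [Module ℚ M]

/-- the unipotent radical of the stabilizer of a line -/
def TT (x : VV m F) : Set (Sp m F) := {k | ∃ u c, om x u = 0 ∧ k = sg x u * tv x c}

lemma TT.tv (x : VV m F) (c : F) : tv x c ∈ TT x := ⟨0, c, by simp, by rw [sg_zero, one_mul]⟩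
lemma TT.sg {x u : VV m F} (h : om x u = 0) : sg x u ∈ TT x := ⟨u, 0, h, by rw [tv_zero, mul_one]⟩

lemma sg_smul {x u : VV m F} (h : om x u = 0) (a : F) : sg (a • x) u = sg x (a • u) := by
  apply Sp.ext'
  intro w
  rw [sg_apply (by simp [h]), sg_apply (by simp [h])]
  simp only [map_smul, smul_eq_mul]
  module

lemma TT.conj {x : VV m F} {g : Sp m F} {a : F} (hg : g.1 x = a • x) (ha : a ≠ 0) {k : Sp m F} (hk : k ∈ TT x) :
    g * k * g⁻¹ ∈ TT x := by
  obtain ⟨u, c, hu, rfl⟩ := hk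
  have h1 : om x (g.1 u) = 0 := by
    have := Sp.om g x u
    rw [hg, hu] at this
    simpa [ha] using this
  refine ⟨a • g.1 u, a * a * c, by simp [h1], ?_⟩
  rw [show g * (NFT.sg x u * NFT.tv x c) * g⁻¹ = (g * NFT.sg x u * g⁻¹) * (g * NFT.tv x c * g⁻¹) by group, sg_conj g hu, tv_conj,
    hg, tv_smul, sg_smul h1]

lemma TT.mul (h2 : (2 : F) = 0) {x : VV m F} {k l : Sp m F} (hk : k ∈ TT x) (hl : l ∈ TT x) : k * l ∈ TT x := by
  obtain ⟨u, c, hu, rfl⟩ := hk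
  obtain ⟨u', c', hu', rfl⟩ := hl
  refine ⟨u + u', om u' u + (c + c'), by simp [hu, hu'], ?_⟩
  rw [← tv_mul, ← mul_assoc (NFT.sg x (u + u')), ← sg_mul hu hu', ← tv_mul, mul_assoc, mul_assoc, ← mul_assoc (NFT.tv x c),
    ← sg_tv_comm hu', mul_assoc]

lemma TT.comm (h2 : (2 : F) = 0) {x : VV m F} {k l : Sp m F} (hk : k ∈ TT x) (hl : l ∈ TT x) : k * l = l * k := by
  have key : ∀ {u c u' c'}, om x u = 0 → om x u' = 0 → (NFT.sg x u * NFT.tv x c) * (NFT.sg x u' * NFT.tv x c')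
      = NFT.sg x (u + u') * NFT.tv x (om u' u + (c + c')) := by
    intro u c u' c' hu hu'
    rw [← tv_mul, ← mul_assoc (NFT.sg x (u + u')), ← sg_mul hu hu', ← tv_mul, mul_assoc, mul_assoc, ← mul_assoc (NFT.tv x c),
      ← sg_tv_comm hu', mul_assoc]
  obtain ⟨u, c, hu, rfl⟩ := hk
  obtain ⟨u', c', hu', rfl⟩ := hl
  rw [key hu hu', key hu' hu, add_comm u' u, add_comm c' c]
  congr 3
  rw [om_swap, neg_eq_iff_add_eq_zero, ← two_mul, h2, zero_mul]

lemma TT.sq (h2 : (2 : F) = 0) {x : VV m F} {k : Sp m F} (hk : k ∈ TT x) : k * k = 1 := by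
  obtain ⟨u, c, hu, rfl⟩ := hk
  have e : (NFT.sg x u * NFT.tv x c) * (NFT.sg x u * NFT.tv x c) = (NFT.sg x u * NFT.sg x u) * (NFT.tv x c * NFT.tv x c) := by
    rw [mul_assoc, mul_assoc, ← mul_assoc (NFT.tv x c), ← sg_tv_comm hu, mul_assoc]
  rw [e, sg_mul hu hu, tv_mul, om_self, tv_zero, mul_one, ← two_mul c, h2, zero_mul, tv_zero, mul_one,
    ← two_smul F, h2, zero_smul, sg_zero]

structure Eig (R : Sp m F →* (M →ₗ[ℚ] M)) (x : VV m F) (v : M) (ε : Sp m F → ℚ) : Prop where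
  h2 : (2 : F) = 0
  x0 : x ≠ 0
  ne : v ≠ 0
  val : ∀ k ∈ TT x, R k v = ε k • v
  pm : ∀ k ∈ TT x, ε k = 1 ∨ ε k = -1
  nt : ∃ c, ε (tv x c) ≠ 1

lemma Eig.exist [Finite F] (h2 : (2 : F) = 0) (R : Sp m F →* (M →ₗ[ℚ] M)) {x : VV m F} (hx : x ≠ 0) {c : F}
    (hc : R (tv x c) ≠ 1) : ∃ v ε, Eig R x v ε := by
  classical
  have hR : ∀ a b : Sp m F, ∀ w, R (a * b) w = R a (R b w) := fun a b w => by rw [map_mul]; rfl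
  obtain ⟨w, hw⟩ : ∃ w, R (tv x c) w ≠ w := by
    by_contra hcon
    push Not at hcon
    exact hc (LinearMap.ext hcon)
  have key : ∀ S : Finset (Sp m F), ∃ v : M, v ≠ 0 ∧ R (tv x c) v = - v ∧
      ∀ k ∈ S, k ∈ TT x → (R k v = v ∨ R k v = - v) := by
    intro S
    induction S using Finset.induction_on with
    | empty =>
      refine ⟨w - R (tv x c) w, sub_ne_zero.2 hw.symm, ?_, by simp⟩
      rw [map_sub, ← hR, TT.sq h2 (TT.tv x c), map_one]
      simp
    | insert k S hk ih =>
      obtain ⟨v, hv0, hvt, hv⟩ := ih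
      by_cases hkT : k ∈ TT x
      · by_cases h0 : v + R k v = 0
        · refine ⟨v, hv0, hvt, ?_⟩
          intro l hl hlT
          rcases Finset.mem_insert.1 hl with rfl | hl
          · right; exact (neg_eq_of_add_eq_zero_right h0).symm
          · exact hv l hl hlT
        · refine ⟨v + R k v, h0, ?_, ?_⟩
          · rw [map_add, ← hR, TT.comm h2 (TT.tv x c) hkT, hR, hvt, map_neg]; abel
          · intro l hl hlT
            rcases Finset.mem_insert.1 hl with rfl | hl
            · left
              rw [map_add, ← hR, TT.sq h2 hlT, map_one, add_comm]; rfl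
            · rw [map_add, ← hR, TT.comm h2 hlT hkT, hR]
              rcases hv l hl hlT with e | e
              · left; rw [e]
              · right; rw [e, map_neg]; abel
      · refine ⟨v, hv0, hvt, ?_⟩
        intro l hl hlT
        rcases Finset.mem_insert.1 hl with rfl | hl
        · exact absurd hlT hkT
        · exact hv l hl hlT
  haveI : Fintype (Sp m F) := Fintype.ofFinite _
  obtain ⟨v, hv0, hvt, hv⟩ := key Finset.univ
  refine ⟨v, fun k => if R k v = v then 1 else -1, h2, hx, hv0, ?_, ?_, c, ?_⟩
  · intro k hk
    by_cases e : R k v = v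
    · simp [e]
    · simp [e, (hv k (Finset.mem_univ _) hk).resolve_left e]
  · intro k hk
    by_cases e : R k v = v <;> simp [e]
  · have : R (tv x c) v ≠ v := by
      rw [hvt]
      intro e
      have h3 : (2 : ℚ) • v = 0 := by
        rw [two_smul]; nth_rewrite 1 [← e]; simp
      exact hv0 ((smul_eq_zero.1 h3).resolve_left (by norm_num))
    simp [this]; norm_num

variable {R : Sp m F →* (M →ₗ[ℚ] M)} {x y : VV m F} {v : M} {ε : Sp m F → ℚ}

lemma Eig.mul (h : Eig R x v ε) {k l : Sp m F} (hk : k ∈ TT x) (hl : l ∈ TT x) : ε (k * l) = ε k * ε l := by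
  have h1 := h.val _ (TT.mul h.h2 hk hl)
  rw [map_mul, Module.End.mul_apply, h.val l hl, map_smul, h.val k hk, smul_smul] at h1
  have h3 : (ε (k * l) - ε l * ε k) • v = 0 := by rw [sub_smul, h1, sub_self]
  have := (smul_eq_zero.1 h3).resolve_right h.ne
  rw [sub_eq_zero.1 this, mul_comm]

lemma Eig.tv_add (h : Eig R x v ε) (c d : F) : ε (tv x (c + d)) = ε (tv x c) * ε (tv x d) := by
  rw [← tv_mul, h.mul (TT.tv x c) (TT.tv x d)]

lemma Eig.one (h : Eig R x v ε) : ε 1 = 1 := by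
  have h1 := h.mul (TT.tv x 0) (TT.tv x 0)
  rw [tv_zero, one_mul] at h1
  rcases h.pm _ (TT.tv x 0) with e | e
  · rwa [tv_zero] at e
  · rw [tv_zero] at e; rw [e] at h1; norm_num at h1

lemma Eig.tv0 (h : Eig R x v ε) : ε (tv x 0) = 1 := by rw [tv_zero, h.one]

lemma Eig.ne0 (h : Eig R x v ε) {k : Sp m F} (hk : k ∈ TT x) : ε k ≠ 0 := by
  rcases h.pm k hk with e | e <;> rw [e] <;> norm_num

lemma Eig.sqq (h : Eig R x v ε) {k : Sp m F} (hk : k ∈ TT x) : ε k * ε k = 1 := by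
  rcases h.pm k hk with e | e <;> rw [e] <;> norm_num

lemma Eig.sg_add (h : Eig R x v ε) {u u' : VV m F} (hu : om x u = 0) (hu' : om x u' = 0) :
    ε (sg x (u + u')) = ε (sg x u) * ε (sg x u') * ε (tv x (om u' u)) := by
  have h1 := congrArg ε (sg_mul hu hu')
  rw [h.mul (TT.sg hu) (TT.sg hu'), h.mul (TT.sg (by simp [hu, hu'])) (TT.tv x _)] at h1
  rw [h1, mul_assoc, h.sqq (TT.tv x _), mul_one]

/-- change of character -/
noncomputable def th (x : VV m F) (ε : Sp m F → ℚ) (w : VV m F) (a : F) : ℚ := ε (sg x (-(a • w))) * ε (tv x (a * a))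

lemma Eig.conj_tv (h : Eig R x v ε) {u w : VV m F} (hu : om x u = 0) (hw : om x w = 0) :
    ε ((tv w 1)⁻¹ * sg x u * tv w 1) = ε (sg x u) * th x ε w (om u w) := by
  have h1 := sg_conj (tv w (-1)) hu
  rw [tv_perp hw, tv_apply, tv_inv, neg_neg] at h1
  rw [tv_inv, h1, show u + (-1 * om u w) • w = u + (-(om u w • w)) by module, h.sg_add hu (by simp [hw]), th, mul_assoc]
  congr 4
  rw [map_neg, LinearMap.neg_apply, map_smul, LinearMap.smul_apply, om_swap w u, smul_eq_mul]; ring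

lemma Eig.th0 (h : Eig R x v ε) (w : VV m F) : th x ε w 0 = 1 := by
  rw [th, zero_smul, neg_zero, sg_zero, mul_zero, tv_zero, h.one, mul_one]

lemma Eig.main [Finite F] (h : Eig R x v ε) (hy : om x y = 1) (W : Set (VV m F)) (hWx : ∀ w ∈ W, om x w = 0) (hWy : ∀ w ∈ W, om w y = 0)
    (h1 : ∀ w ∈ W, w ≠ 0 → ∃ a, th x ε w a ≠ 1) (h3 : ∀ w ∈ W, ∀ w' ∈ W, w ≠ w' → w ≠ 0 → ∀ b : F, w ≠ b • w') :
    LinearIndependent ℚ (fun i : W × Fˣ => R (dg x y (i.2 : F) * tv i.1.1 1) v) := by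
  have hinj : ∀ g : Sp m F, ∀ w, R g w = 0 → w = 0 := by
    intro g w hw
    have := congrArg (R g⁻¹) hw
    rw [← Module.End.mul_apply, ← map_mul, inv_mul_cancel, map_one, map_zero] at this
    exact this
  let G : W × Fˣ → Sp m F := fun i => dg x y (i.2 : F) * tv i.1.1 1
  have hG : ∀ i, (G i).1 x = (i.2 : F) • x := by
    intro i
    rw [Sp.mul_apply, tv_perp (hWx _ i.1.2), dg_x hy i.2.ne_zero]
  have hGi : ∀ i, ((G i)⁻¹).1 x = (i.2 : F)⁻¹ • x := by
    intro i
    have := congrArg ((G i)⁻¹).1 (hG i)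
    rw [Sp.inv_apply_self, map_smul] at this
    have h4 := congrArg (fun z => (i.2 : F)⁻¹ • z) this
    simp only [smul_smul, inv_mul_cancel₀ i.2.ne_zero, one_smul] at h4
    exact h4.symm
  apply indep (fun k => R k) _ (fun i k => ε ((G i)⁻¹ * k * G i))
  · intro i h0
    exact h.ne (hinj _ _ h0)
  · have hval : ∀ k ∈ TT x, ∀ l : W × Fˣ, R k (R (G l) v) = ε ((G l)⁻¹ * k * G l) • R (G l) v := by
      intro k hk l
      have hk' : (G l)⁻¹ * k * G l ∈ TT x := by
        have := TT.conj (hGi l) (inv_ne_zero l.2.ne_zero) hk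
        rwa [inv_inv] at this
      rw [← map_smul, ← h.val _ hk', ← Module.End.mul_apply, ← Module.End.mul_apply, ← map_mul, ← map_mul]
      congr 2; group
    suffices ∀ i j : W × Fˣ, i ≠ j → ∃ k ∈ TT x, ε ((G i)⁻¹ * k * G i) ≠ ε ((G j)⁻¹ * k * G j) by
      intro i j hij
      obtain ⟨k, hk, hk'⟩ := this i j hij
      exact ⟨k, hk', hval k hk⟩
    intro i j hij
    by_cases h2 : i.2 = j.2
    · have hw : i.1 ≠ j.1 := fun e => hij (Prod.ext e h2)
      have hw' : i.1.1 ≠ j.1.1 := fun e => hw (Subtype.ext e)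
      -- key
      have key : ∀ w ∈ W, ∀ w' ∈ W, w ≠ w' → w ≠ 0 → ∃ u, om x u = 0 ∧ th x ε w (om u w) ≠ th x ε w' (om u w') := by
        intro w hw w' hw' hne hw0
        obtain ⟨a, ha⟩ := h1 w hw hw0
        have hns : w ∉ Submodule.span F {x, w'} := by
          intro hs
          obtain ⟨b, c, hbc⟩ := Submodule.mem_span_pair.1 hs
          have hb : b = 0 := by
            have := congrArg (fun z => om z y) hbc
            simpa [hy, hWy w hw, hWy w' hw'] using this
          rw [hb, zero_smul, zero_add] at hbc
          exact h3 w hw w' hw' hne hw0 c hbc.symm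
        obtain ⟨u, hu1, hu2⟩ := ex_sep _ hns
        have hux := hu1 x (Submodule.subset_span (by simp))
        have huw := hu1 w' (Submodule.subset_span (by simp))
        have hu2' : om u w ≠ 0 := fun e => hu2 (om_zero_swap e)
        refine ⟨(a / om u w) • u, by simp [hux], ?_⟩
        rw [map_smul, LinearMap.smul_apply, LinearMap.smul_apply, om_zero_swap huw, smul_zero, h.th0, smul_eq_mul,
          div_mul_cancel₀ _ hu2']
        exact ha
      obtain ⟨u, hu, hth⟩ : ∃ u, om x u = 0 ∧ th x ε i.1.1 (om u i.1.1) ≠ th x ε j.1.1 (om u j.1.1) := by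
        by_cases h0 : i.1.1 = 0
        · obtain ⟨u, a, b⟩ := key _ j.1.2 _ i.1.2 hw'.symm (fun e => hw' (h0.trans e.symm))
          exact ⟨u, a, b.symm⟩
        · exact key _ i.1.2 _ j.1.2 hw' h0
      refine ⟨dg x y (i.2 : F) * sg x u * (dg x y (i.2 : F))⁻¹, TT.conj (dg_x hy i.2.ne_zero) i.2.ne_zero (TT.sg hu), ?_⟩
      have e1 : (G i)⁻¹ * (dg x y (i.2 : F) * sg x u * (dg x y (i.2 : F))⁻¹) * G i = (tv i.1.1 1)⁻¹ * sg x u * tv i.1.1 1 := by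
        simp only [G]; group
      have e2 : (G j)⁻¹ * (dg x y (i.2 : F) * sg x u * (dg x y (i.2 : F))⁻¹) * G j = (tv j.1.1 1)⁻¹ * sg x u * tv j.1.1 1 := by
        simp only [G]; rw [h2]; group
      rw [e1, e2, h.conj_tv hu (hWx _ i.1.2), h.conj_tv hu (hWx _ j.1.2)]
      intro e
      exact hth (mul_left_cancel₀ (h.ne0 (TT.sg hu)) e)
    · by_contra hcon
      push Not at hcon
      have hc : ∀ c, ε (tv x ((i.2 : F)⁻¹ * (i.2 : F)⁻¹ * c)) = ε (tv x ((j.2 : F)⁻¹ * (j.2 : F)⁻¹ * c)) := by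
        intro c
        have := hcon (tv x c) (TT.tv x c)
        have e : ∀ l, (G l)⁻¹ * tv x c * G l = tv x ((l.2 : F)⁻¹ * (l.2 : F)⁻¹ * c) := by
          intro l
          have := tv_conj (G l)⁻¹ x c
          rwa [inv_inv, hGi, tv_smul] at this
        rwa [e, e] at this
      obtain ⟨c, hc0⟩ := h.nt
      set a := (i.2 : F)⁻¹ * (i.2 : F)⁻¹
      set b := (j.2 : F)⁻¹ * (j.2 : F)⁻¹
      have hab : a + b ≠ 0 := by
        intro hab
        have : ((i.2 : F)⁻¹ + (j.2 : F)⁻¹) ^ 2 = 0 := by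
          simp only [a, b] at hab; linear_combination hab + ((i.2 : F)⁻¹ * (j.2 : F)⁻¹) * h.h2
        have h4 := pow_eq_zero_iff (two_ne_zero) |>.1 this
        have h5 : (i.2 : F)⁻¹ = (j.2 : F)⁻¹ := by
          have h6 : (i.2 : F)⁻¹ - (j.2 : F)⁻¹ = 0 := by
            rw [← h4]
            have : (2 : F) * (j.2 : F)⁻¹ = 0 := by rw [h.h2, zero_mul]
            linear_combination -this
          exact sub_eq_zero.1 h6
        exact h2 (Units.ext (inv_injective h5))
      apply hc0
      have := hc (c / (a + b))
      have h7 := h.tv_add (a * (c / (a + b))) (b * (c / (a + b)))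
      rw [this, h.sqq (TT.tv x _), ← add_mul, mul_div_cancel₀ _ hab] at h7
      exact h7
end
end NFT

namespace NFT

section
variable {m : ℕ} {F : Type*} [Field F] [Finite F] {M : Type*} [AddCommGroup M] [Module ℚ M] [FiniteDimensional ℚ M]

def Vp (x y : VV m F) : Submodule F (VV m F) := pp x ⊓ pp y

lemma mem_Vp {x y w : VV m F} : w ∈ Vp x y ↔ om x w = 0 ∧ om y w = 0 := Iff.rfl

lemma card_Vp (hm : 1 ≤ m) {x y : VV m F} (h : om x y = 1) : Nat.card (Vp x y) = Nat.card F ^ (2 * m - 2) := by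
  have hyx : om y x = -1 := by rw [om_swap, h]
  have e : VV m F ≃ (Vp x y) × (F × F) :=
    { toFun := fun w => (⟨w + om y w • x - om x w • y, by
        rw [mem_Vp]; constructor <;> simp [h, hyx]⟩, (om y w, om x w))
      invFun := fun z => z.1.1 - z.2.1 • x + z.2.2 • y
      left_inv := fun w => by simp only []; module
      right_inv := fun z => by
        obtain ⟨⟨w, hw⟩, a, b⟩ := z
        rw [mem_Vp] at hw
        have e1 : om y (w - a • x + b • y) = a := by simp [hw.2, hyx]
        have e2 : om x (w - a • x + b • y) = b := by simp [hw.1, h]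
        refine Prod.ext (Subtype.ext ?_) (Prod.ext e1 e2)
        simp only []
        rw [e1, e2]; module }
  have h1 := Nat.card_congr e
  rw [card_VV, Nat.card_prod, Nat.card_prod] at h1
  have hq0 : 0 < Nat.card F := Nat.card_pos
  apply Nat.eq_of_mul_eq_mul_right (Nat.mul_pos hq0 hq0)
  rw [← h1, ← pow_two, ← pow_add]; congr 1; omega

lemma RL4 (hm : 1 ≤ m) (h2 : (2 : F) = 0) (hq : 2 < Nat.card F) (R : Sp m F →* (M →ₗ[ℚ] M)) {x : VV m F} (hx : x ≠ 0) {c : F}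
    (hc : R (tv x c) ≠ 1) : Nat.card F ^ (2 * m - 2) + 1 ≤ Module.finrank ℚ M := by
  classical
  obtain ⟨v, ε, h⟩ := Eig.exist h2 R hx hc
  obtain ⟨y, hy⟩ := om_nd' hx
  haveI : Fintype F := Fintype.ofFinite F
  have hsq : ∀ c : F, c ≠ 0 → ∃ a, a ≠ 0 ∧ a * a = c := by
    intro c hc
    have hch : ringChar F = 2 := by
      have h3 : ringChar F ∣ 2 := ringChar.dvd (by exact_mod_cast h2)
      rcases (Nat.dvd_prime Nat.prime_two).1 h3 with h4 | h4
      · haveI := ringChar.charP F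
        exact absurd h4 (CharP.char_ne_one F _)
      · exact h4
    obtain ⟨a, ha⟩ := FiniteField.isSquare_of_char_two hch c
    exact ⟨a, by rintro rfl; simp at ha; exact hc ha, ha.symm⟩
  have key : ∀ w : VV m F, ∃ s : F, s ≠ 0 ∧ ∃ a, th x ε (s • w) a ≠ 1 := by
    intro w
    by_contra hcon
    push Not at hcon
    have h3 : ∀ c, c ≠ 0 → ε (sg x (-w)) * ε (tv x c) = 1 := by
      intro c hc
      obtain ⟨a, ha, hac⟩ := hsq c hc
      have := hcon a⁻¹ (inv_ne_zero ha) a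
      rwa [th, smul_smul, mul_inv_cancel₀ ha, one_smul, hac] at this
    obtain ⟨c, hc⟩ := h.nt
    have hc0 : c ≠ 0 := by rintro rfl; exact hc h.tv0
    obtain ⟨d, hd0, hdc⟩ : ∃ d : F, d ≠ 0 ∧ d ≠ c := by
      by_contra hcon
      push Not at hcon
      have : Finset.univ ⊆ ({0, c} : Finset F) := by
        intro z _
        by_cases hz : z = 0
        · simp [hz]
        · simp [hcon z hz]
      have h5 := (Finset.card_le_card this).trans (Finset.card_le_two)
      rw [Finset.card_univ, ← Nat.card_eq_fintype_card] at h5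
      omega
    have hcd : c + d ≠ 0 := by
      intro h0
      apply hdc
      linear_combination h0 - c * h2
    have e1 := h3 c hc0
    have e2 := h3 d hd0
    have e3 := h3 _ hcd
    rw [h.tv_add] at e3
    apply hc
    have hne : ε (sg x (-w)) ≠ 0 := by intro h0; rw [h0] at e1; simp at e1
    have e4 : ε (tv x c) = ε (tv x d) := mul_left_cancel₀ hne (e1.trans e2.symm)
    rw [← e4, h.sqq (TT.tv x c), mul_one] at e3
    rw [e3, one_mul] at e1
    exact e1
  choose s hs0 hs using key
  let φ : Option (Projectivization F (Vp x y)) → VV m F := fun o => o.elim 0 (fun l => s l.rep.1 • l.rep.1)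
  have hrep : ∀ l : Projectivization F (Vp x y), l.rep.1 ≠ 0 := fun l h0 => l.rep_nonzero (Subtype.ext h0)
  have hprop : ∀ (l l' : Projectivization F (Vp x y)) (b : F), l.rep.1 = b • l'.rep.1 → l = l' := by
    intro l l' b hb
    have hb0 : b ≠ 0 := by rintro rfl; rw [zero_smul] at hb; exact hrep l hb
    rw [← l.mk_rep, ← l'.mk_rep, Projectivization.mk_eq_mk_iff']
    exact ⟨b, (Subtype.ext hb).symm⟩
  have hprop2 : ∀ (l l' : Projectivization F (Vp x y)) (b : F), s l.rep.1 • l.rep.1 = b • s l'.rep.1 • l'.rep.1 → l = l' := by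
    intro l l' b hb
    apply hprop l l' ((s l.rep.1)⁻¹ * b * s l'.rep.1)
    rw [mul_assoc, mul_smul, mul_smul, ← hb, smul_smul, inv_mul_cancel₀ (hs0 _), one_smul]
  have hφinj : Function.Injective φ := by
    intro o o' ho
    cases o with
    | none =>
      cases o' with
      | none => rfl
      | some l => exact absurd ho.symm (smul_ne_zero (hs0 _) (hrep l))
    | some l =>
      cases o' with
      | none => exact absurd ho (smul_ne_zero (hs0 _) (hrep l))
      | some l' => exact congrArg some (hprop2 l l' 1 (by rw [one_smul]; exact ho))
  have hmem : ∀ o, φ o ∈ Vp x y := by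
    intro o
    cases o with
    | none => exact Submodule.zero_mem _
    | some l => exact Submodule.smul_mem _ _ l.rep.2
  have hli := h.main hy (Set.range φ) (by rintro _ ⟨o, rfl⟩; exact (mem_Vp.1 (hmem o)).1)
    (by rintro _ ⟨o, rfl⟩; exact om_zero_swap (mem_Vp.1 (hmem o)).2)
    (by
      rintro _ ⟨o, rfl⟩ h0
      cases o with
      | none => exact absurd rfl h0
      | some l => exact hs _)
    (by
      rintro _ ⟨o, rfl⟩ _ ⟨o', rfl⟩ hne h0 b hb
      cases o with
      | none => exact h0 rfl
      | some l =>
        cases o' with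
        | none => rw [show φ none = 0 from rfl, smul_zero] at hb; exact h0 hb
        | some l' => rw [hprop2 l l' b hb] at hne; exact hne rfl)
  haveI : Fintype (Set.range φ × Fˣ) := Fintype.ofFinite _
  have hcard := hli.fintype_card_le_finrank
  rw [← Nat.card_eq_fintype_card, Nat.card_prod, Nat.card_range_of_injective hφinj, Finite.card_option, Nat.card_units,
    add_mul, ← Projectivization.card F (Vp x y), card_Vp hm hy] at hcard
  have : 0 < Nat.card F ^ (2 * m - 2) := pow_pos (by omega) _
  omega

lemma RL2 (hm : 3 ≤ m) (h2 : (2 : F) = 0) (hq : Nat.card F = 2) (R : Sp m F →* (M →ₗ[ℚ] M)) {x : VV m F} (hx : x ≠ 0) {c : F}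
    (hc : R (tv x c) ≠ 1) : 2 ^ (2 * m - 2) + 2 ≤ 2 * Module.finrank ℚ M + 2 ^ (m - 1) := by
  classical
  obtain ⟨v, ε, h⟩ := Eig.exist h2 R hx hc
  obtain ⟨y, hy⟩ := om_nd' hx
  haveI : Fintype F := Fintype.ofFinite F
  haveI : Fintype (VV m F) := Fintype.ofFinite _
  have h1 : ε (tv x 1) = -1 := by
    obtain ⟨c, hc⟩ := h.nt
    rcases F2 hq c with rfl | rfl
    · exact absurd h.tv0 hc
    · exact (h.pm _ (TT.tv x 1)).resolve_left hc
  have hneg : ∀ w : VV m F, -w = w := by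
    intro w
    rw [neg_eq_iff_add_eq_zero, ← two_smul F, h2, zero_smul]
  let W : Finset (Vp x y) := Finset.univ.filter fun w => ε (sg x w.1) = 1
  let W' : Set (VV m F) := {w | w ∈ Vp x y ∧ ε (sg x w) = 1}
  have hli := h.main hy W' (fun w hw => (mem_Vp.1 hw.1).1) (fun w hw => om_zero_swap (mem_Vp.1 hw.1).2)
    (by
      rintro w hw hw0
      refine ⟨1, ?_⟩
      rw [th, one_smul, hneg, hw.2, mul_one, h1]; norm_num)
    (by
      rintro w hw w' hw' hne h0 b hb
      rcases F2 hq b with rfl | rfl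
      · rw [zero_smul] at hb; exact h0 hb
      · rw [one_smul] at hb; exact hne hb)
  have hWW : Nat.card W' = W.card := by
    rw [← Nat.card_eq_finsetCard]
    exact Nat.card_congr ⟨fun w => ⟨⟨w.1, w.2.1⟩, Finset.mem_filter.2 ⟨Finset.mem_univ _, w.2.2⟩⟩,
      fun w => ⟨w.1.1, w.1.2, (Finset.mem_filter.1 w.2).2⟩, fun _ => rfl, fun _ => rfl⟩
  -- Gauss sum
  have hV : Fintype.card (Vp x y) = 2 ^ (2 * m - 2) := by
    rw [← Nat.card_eq_fintype_card, card_Vp (by omega) hy, hq]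
  set hh : Vp x y → ℚ := fun w => ε (sg x w.1) with hhdef
  have hpm : ∀ w, hh w = 1 ∨ hh w = -1 := fun w => h.pm _ (TT.sg (mem_Vp.1 w.2).1)
  have hgs : (∑ w, hh w) * (∑ w, hh w) = 2 ^ (2 * m - 2) := by
    have a1 : ∀ u u' : Vp x y, hh u * hh u' = hh (u' + u) * ε (tv x (om (u' + u).1 u.1)) := by
      intro u u'
      have := h.sg_add (mem_Vp.1 u.2).1 (mem_Vp.1 u'.2).1
      simp only [hhdef]
      rw [show (u' + u).1 = u.1 + u'.1 by rw [add_comm]; rfl, this, map_add, LinearMap.add_apply, om_self, zero_add, mul_assoc,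
        h.sqq (TT.tv x _), mul_one]
    rw [Finset.sum_mul_sum]
    have a2 : ∀ u : Vp x y, ∑ u', hh u * hh u' = ∑ z, hh z * ε (tv x (om z.1 u.1)) := by
      intro u
      rw [Finset.sum_congr rfl (fun u' _ => a1 u u')]
      exact Fintype.sum_equiv (Equiv.addRight u) _ _ (fun _ => rfl)
    rw [Finset.sum_congr rfl (fun u _ => a2 u), Finset.sum_comm]
    rw [Finset.sum_eq_single (0 : Vp x y)]
    · have : ∀ u : Vp x y, hh 0 * ε (tv x (om (0 : Vp x y).1 u.1)) = 1 := by
        intro u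
        simp only [hhdef]
        rw [show ((0 : Vp x y) : VV m F) = 0 from rfl, sg_zero, h.one, map_zero, LinearMap.zero_apply, h.tv0, mul_one]
      rw [Finset.sum_congr rfl (fun u _ => this u), Finset.sum_const, Finset.card_univ, hV]
      simp
    · intro z _ hz
      have hns : z.1 ∉ Submodule.span F {x, y} := by
        intro hs
        obtain ⟨b, c, hbc⟩ := Submodule.mem_span_pair.1 hs
        have hyx : om y x = -1 := by rw [om_swap, hy]
        have hb : b = 0 := by
          have := congrArg (fun w => om y w) hbc
          simpa [hyx, (mem_Vp.1 z.2).2] using this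
        have hc : c = 0 := by
          have := congrArg (fun w => om x w) hbc
          simpa [hy, (mem_Vp.1 z.2).1] using this
        rw [hb, hc] at hbc
        apply hz
        apply Subtype.ext
        rw [← hbc]; simp
      obtain ⟨u0, hu0, hu1⟩ := ex_sep _ hns
      have hu0m : u0 ∈ Vp x y := ⟨hu0 x (Submodule.subset_span (by simp)), hu0 y (Submodule.subset_span (by simp))⟩
      have hu2 : om z.1 u0 = 1 := (F2 hq _).resolve_left hu1
      have : ∑ u : Vp x y, hh z * ε (tv x (om z.1 u.1)) = - ∑ u : Vp x y, hh z * ε (tv x (om z.1 u.1)) := by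
        rw [← Finset.sum_neg_distrib]
        refine Fintype.sum_equiv (Equiv.addRight ⟨u0, hu0m⟩) _ _ ?_
        intro u
        change _ = - (hh z * ε (tv x (om z.1 (u.1 + u0))))
        rw [map_add, hu2, h.tv_add, h1]; ring
      linarith
    · simp
  have hsum : ∑ w, hh w = 2 * (W.card : ℚ) - 2 ^ (2 * m - 2) := by
    have : ∀ w, hh w = 2 * (if ε (sg x w.1) = 1 then 1 else 0) - 1 := by
      intro w
      rcases hpm w with e | e
      · have e' : ε (sg x w.1) = 1 := e
        rw [e, if_pos e']; norm_num
      · have e' : ε (sg x w.1) = -1 := e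
        rw [e, if_neg (by rw [e']; norm_num)]; norm_num
    rw [Finset.sum_congr rfl (fun w _ => this w), Finset.sum_sub_distrib, ← Finset.mul_sum, Finset.sum_boole,
      Finset.sum_const, Finset.card_univ, hV]
    simp [W]
  have hbound : 2 ^ (2 * m - 2) ≤ 2 * W.card + 2 ^ (m - 1) := by
    by_contra hcon
    push Not at hcon
    have hcon' : (2 * (W.card : ℚ) + 2 ^ (m - 1)) < 2 ^ (2 * m - 2) := by exact_mod_cast hcon
    have e : (2 : ℚ) ^ (2 * m - 2) = 2 ^ (m - 1) * 2 ^ (m - 1) := by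
      rw [← pow_add]; congr 1; omega
    rw [hsum] at hgs
    have hp : (0 : ℚ) < 2 ^ (m - 1) := by positivity
    nlinarith
  have hW2 : 2 ≤ W.card := by
    have e : 2 ^ (2 * m - 2) = 2 ^ (m - 1) * 2 ^ (m - 1) := by
      rw [← pow_add]; congr 1; omega
    have : 2 ^ 2 ≤ 2 ^ (m - 1) := Nat.pow_le_pow_right (by norm_num) (by omega)
    nlinarith
  -- the eigenspace is proper
  have hprop : R (tv x 1) ≠ -1 := by
    intro hR
    have hall : ∀ z : VV m F, z ≠ 0 → R (tv z 1) = -1 := by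
      intro z hz
      obtain ⟨g, hg⟩ := sp_trans hx hz
      rw [← hg, ← tv_conj, map_mul, map_mul, hR, mul_neg, mul_one, neg_mul, ← map_mul, mul_inv_cancel, map_one]
    obtain ⟨w, hw, hw0⟩ := Finset.exists_mem_ne hW2 0
    have hw0' : w.1 ≠ 0 := fun e => hw0 (Subtype.ext e)
    have hxw := (mem_Vp.1 w.2).1
    have hxw0 : x + w.1 ≠ 0 := by
      intro h0
      have := congrArg (fun z => om z y) h0
      simp [hy, om_zero_swap (mem_Vp.1 w.2).2] at this
    have := congrArg R (tv_add_eq hxw)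
    rw [map_mul, map_mul, hall _ hxw0, hall _ hw0', hR, neg_mul, one_mul, neg_mul, one_mul, neg_neg] at this
    have h5 := h.val _ (TT.sg hxw)
    rw [← this, (Finset.mem_filter.1 hw).2, one_smul, LinearMap.neg_apply, Module.End.one_apply] at h5
    have h3 : (2 : ℚ) • v = 0 := by
      rw [two_smul]; nth_rewrite 1 [← h5]; simp
    exact h.ne ((smul_eq_zero.1 h3).resolve_left (by norm_num))
  let K : Submodule ℚ M := LinearMap.ker (R (tv x 1) + 1)
  have hKlt : Module.finrank ℚ K < Module.finrank ℚ M := by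
    apply Submodule.finrank_lt
    intro htop
    apply hprop
    have : R (tv x 1) + 1 = 0 := LinearMap.ker_eq_top.1 htop
    exact eq_neg_of_add_eq_zero_left this
  have hmemK : ∀ i : W' × Fˣ, R (dg x y (i.2 : F) * tv i.1.1 1) v ∈ K := by
    intro i
    have hi2 : (i.2 : F) = 1 := (F2 hq _).resolve_left i.2.ne_zero
    have hgx : (dg x y (i.2 : F) * tv i.1.1 1).1 x = x := by
      rw [Sp.mul_apply, tv_perp (mem_Vp.1 i.1.2.1).1, dg_x hy i.2.ne_zero, hi2, one_smul]
    have hcm := tv_conj (dg x y (i.2 : F) * tv i.1.1 1) x 1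
    rw [hgx, mul_inv_eq_iff_eq_mul] at hcm
    change (R (tv x 1) + 1) _ = 0
    rw [LinearMap.add_apply, ← Module.End.mul_apply, ← map_mul, ← hcm, map_mul, Module.End.mul_apply, h.val _ (TT.tv x 1), h1]
    simp
  let vK : W' × Fˣ → K := fun i => ⟨_, hmemK i⟩
  have hliK : LinearIndependent ℚ vK := LinearIndependent.of_comp K.subtype hli
  haveI : Fintype (W' × Fˣ) := Fintype.ofFinite _
  have hcard := hliK.fintype_card_le_finrank
  rw [← Nat.card_eq_fintype_card, Nat.card_prod, hWW, Nat.card_units, hq] at hcard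
  omega
end
end NFT

namespace NFT

section rep
variable {Γ P : Type*} [Group Γ] [MulAction Γ P] [Fintype P] [DecidableEq P]
  {bl : Finset (Finset P)} {k lam r : ℕ}

/-- permutation representation -/
def RP (Γ P : Type*) [Group Γ] [MulAction Γ P] : Γ →* ((P → ℚ) →ₗ[ℚ] (P → ℚ)) where
  toFun g := LinearMap.funLeft ℚ ℚ (fun x => g⁻¹ • x)
  map_one' := by ext f x; simp [LinearMap.funLeft_apply]
  map_mul' a b := by
    apply LinearMap.ext; intro f; funext x
    simp [LinearMap.funLeft_apply, mul_smul]

lemma RP_apply (g : Γ) (f : P → ℚ) (x : P) : RP Γ P g f x = f (g⁻¹ • x) := rfl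

lemma RP_ne {g : Γ} {a : P} (h : g • a ≠ a) : RP Γ P g ≠ 1 := by
  intro h1
  have h2 := congrFun (LinearMap.congr_fun h1 (Pi.single a 1)) (g • a)
  rw [RP_apply, inv_smul_smul] at h2
  simp [h] at h2

/-- action on blocks -/
def bact (hinv : ∀ g : Γ, ∀ B ∈ bl, g • B ∈ bl) : MulAction Γ bl where
  smul g B := ⟨g • B.1, hinv g _ B.2⟩
  one_smul B := Subtype.ext (one_smul Γ B.1)
  mul_smul a b B := Subtype.ext (mul_smul a b B.1)

lemma incid_equi (hinv : ∀ g : Γ, ∀ B ∈ bl, g • B ∈ bl) (g : Γ) (f : P → ℚ) :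
    letI := bact hinv
    RP Γ bl g (incid bl f) = incid bl (RP Γ P g f) := by
  letI := bact hinv
  funext B
  show ∑ x ∈ g⁻¹ • B.1, f x = ∑ x ∈ B.1, f (g⁻¹ • x)
  symm
  apply Finset.sum_bij (fun x _ => g⁻¹ • x)
  · intro x hx; exact mem_smul_fin.2 hx
  · intro x _ y _ h; exact smul_left_cancel _ h
  · intro y hy
    refine ⟨g • y, ?_, inv_smul_smul _ _⟩
    rw [← mem_smul_fin (g := g), smul_inv_smul] at hy
    exact hy
  · intro x _; rfl

/-- cokernel representation -/
def RC (hinv : ∀ g : Γ, ∀ B ∈ bl, g • B ∈ bl) :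
    Γ →* (((bl → ℚ) ⧸ LinearMap.range (incid bl)) →ₗ[ℚ] ((bl → ℚ) ⧸ LinearMap.range (incid bl))) :=
  letI := bact hinv
  { toFun := fun g => Submodule.mapQ _ _ (RP Γ bl g) (by
      rintro _ ⟨f, rfl⟩
      exact ⟨RP Γ P g f, (incid_equi hinv g f).symm⟩)
    map_one' := by
      apply LinearMap.ext; intro x
      obtain ⟨f, rfl⟩ := Submodule.Quotient.mk_surjective _ x
      rw [Submodule.mapQ_apply, map_one]; rfl
    map_mul' := by
      intro a b
      apply LinearMap.ext; intro x
      obtain ⟨f, rfl⟩ := Submodule.Quotient.mk_surjective _ x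
      rw [Submodule.mapQ_apply, map_mul]; rfl }

lemma RC_one (hinv : ∀ g : Γ, ∀ B ∈ bl, g • B ∈ bl) {g : Γ} (hg : RC hinv g = 1) (f : bl → ℚ) :
    letI := bact hinv
    RP Γ bl g f - f ∈ LinearMap.range (incid bl) := by
  letI := bact hinv
  have := LinearMap.congr_fun hg (Submodule.Quotient.mk f)
  rw [← Submodule.Quotient.eq]
  exact this

lemma FTD.coker_dim (h : FTD Γ bl k lam r) :
    Module.finrank ℚ ((bl → ℚ) ⧸ LinearMap.range (incid bl)) + Fintype.card P = bl.card := by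
  have h1 := Submodule.finrank_quotient_add_finrank (LinearMap.range (incid bl))
  rw [LinearMap.finrank_range_of_inj h.incid_inj, Module.finrank_fintype_fun_eq_card,
    Module.finrank_fintype_fun_eq_card, Fintype.card_coe] at h1
  exact h1

lemma FTD.coker_small (h : FTD Γ bl k lam r)
    (ht : ∀ B ∈ bl, ∀ C ∈ bl, ∃ g : Γ, RC h.inv g = 1 ∧ g • B = C) :
    Module.finrank ℚ ((bl → ℚ) ⧸ LinearMap.range (incid bl)) ≤ 1 := by
  letI := bact h.inv
  obtain ⟨x⟩ : Nonempty P := by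
    have := h.kv
    exact Fintype.card_pos_iff.1 (by omega)
  obtain ⟨B, hB, -⟩ := h.ex_block x
  apply finrank_le_one (Submodule.Quotient.mk (Pi.single (⟨B, hB⟩ : bl) (1 : ℚ)))
  intro w
  obtain ⟨f, rfl⟩ := Submodule.Quotient.mk_surjective _ w
  refine ⟨∑ C, f C, ?_⟩
  have h1 : f = ∑ C : bl, f C • Pi.single C (1 : ℚ) := by
    funext D
    rw [Finset.sum_apply]
    simp [Pi.single_apply]
  rw [← Submodule.Quotient.mk_smul, Submodule.Quotient.eq]
  nth_rewrite 2 [h1]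
  rw [Finset.sum_smul, ← Finset.sum_sub_distrib]
  apply Submodule.sum_mem
  intro C _
  rw [← smul_sub]
  apply Submodule.smul_mem
  obtain ⟨g, hg, hgB⟩ := ht C.1 C.2 B hB
  have h2 := RC_one h.inv hg (Pi.single C 1)
  convert h2 using 2
  funext D
  rw [RP_apply, Pi.single_apply, Pi.single_apply]
  congr 1
  rw [inv_smul_eq_iff]
  have : g • C = (⟨B, hB⟩ : bl) := Subtype.ext hgB
  rw [this]
end rep

section
variable {m : ℕ} {F : Type*} [Field F] [Finite F] {P : Type*} [MulAction (Sp m F) P] [Fintype P] [DecidableEq P]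
  {bl : Finset (Finset P)} {k lam r p f : ℕ}

lemma SpD.big_even (h : SpD m F bl k lam r p f) (hp : p = 2) (hq : 2 < Nat.card F) :
    Nat.card F ^ (2 * m - 2) + 1 ≤ Fintype.card P := by
  obtain ⟨x, hx⟩ := h.ex_ne
  obtain ⟨a, ha⟩ := h.tv_ne hx (one_ne_zero)
  have hm := h.hm
  have := RL4 (by omega) (h.two_iff.2 hp) hq (RP (Sp m F) P) hx (RP_ne ha)
  rwa [Module.finrank_fintype_fun_eq_card] at this

lemma SpD.m3 (h : SpD m F bl k lam r p f) (hq : Nat.card F = 2) : 3 ≤ m := by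
  have := h.hm
  have := h.h22
  by_contra hc
  exact this ⟨by omega, hq⟩

lemma SpD.big_two (h : SpD m F bl k lam r p f) (hq : Nat.card F = 2) :
    2 ^ (2 * m - 2) + 2 ≤ 2 * Fintype.card P + 2 ^ (m - 1) := by
  obtain ⟨x, hx⟩ := h.ex_ne
  obtain ⟨a, ha⟩ := h.tv_ne hx (one_ne_zero)
  have := RL2 (h.m3 hq) (F2two hq) hq (RP (Sp m F) P) hx (RP_ne ha)
  rwa [Module.finrank_fintype_fun_eq_card] at this

lemma SpD.coker_nontriv (h : SpD m F bl k lam r p f)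
    (hd : 1 < Module.finrank ℚ ((bl → ℚ) ⧸ LinearMap.range (incid bl))) :
    ∃ (x : VV m F) (c : F), x ≠ 0 ∧ RC h.ftd.inv (tv x c) ≠ 1 := by
  by_contra hc
  push Not at hc
  have := h.ftd.coker_small ?_
  · omega
  intro B hB C hC
  obtain ⟨x, hx⟩ := h.ex_ne
  rcases h.smp (RC h.ftd.inv).ker (MonoidHom.normal_ker _) with h1 | h1
  · obtain ⟨a, ha⟩ := h.tv_ne hx (one_ne_zero)
    exact absurd (h1 _ (MonoidHom.mem_ker.2 (hc x 1 hx)) a) ha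
  · have hk := h.ftd.k3
    obtain ⟨b, hb⟩ : B.Nonempty := by rw [← Finset.card_pos, h.ftd.blk B hB]; omega
    obtain ⟨c, hcC⟩ : C.Nonempty := by rw [← Finset.card_pos, h.ftd.blk C hC]; omega
    obtain ⟨g, -, hg⟩ := h.ftd.trans B hB C hC b hb c hcC
    obtain ⟨n, hn, hn'⟩ := h1 g
    refine ⟨n, MonoidHom.mem_ker.1 hn, ?_⟩
    rw [← hg]
    ext y
    simp only [Finset.mem_smul_finset, hn']

/-- `c = 1` bounds -/
lemma SpD.c_one (h : SpD m F bl k lam r p f) (hp : p = 2) {t : ℕ} (hv : Fintype.card P = 1 + r * t)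
    (hb : bl.card = r * (1 + 1 * t)) :
    (2 < Nat.card F → Nat.card F ^ (2 * m - 2) + 2 ≤ r) ∧
    (Nat.card F = 2 → 2 ^ (2 * m - 2) + 4 ≤ 2 * r + 2 ^ (m - 1)) := by
  have h1 := h.ftd.coker_dim
  have hr := h.ftd.r3
  have hd : Module.finrank ℚ ((bl → ℚ) ⧸ LinearMap.range (incid bl)) + 1 = r := by
    rw [hv, hb] at h1
    have : r * (1 + 1 * t) = r + r * t := by ring
    omega
  obtain ⟨x, c, hx, hc⟩ := h.coker_nontriv (by omega)
  have hm := h.hm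
  constructor
  · intro hq
    have := RL4 (by omega) (h.two_iff.2 hp) hq _ hx hc
    omega
  · intro hq
    have := RL2 (h.m3 hq) (F2two hq) hq _ hx hc
    omega
end
end NFT

namespace NFT

section cent
variable {m : ℕ} {F : Type*} [Field F] [Finite F]

/-- adjointness -/
def Adj (a b : Module.End F (VV m F)) : Prop := ∀ x y, om (a x) y = om x (b y)

lemma Adj.symm {a b : Module.End F (VV m F)} (h : Adj a b) : Adj b a := by
  intro x y
  rw [om_swap, ← h, ← om_swap]

lemma Adj.mul {a b a' b' : Module.End F (VV m F)} (h : Adj a a') (h' : Adj b b') : Adj (a * b) (b' * a') := by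
  intro x y
  rw [Module.End.mul_apply, Module.End.mul_apply, h, h']

lemma Adj.uniq {a b b' : Module.End F (VV m F)} (h : Adj a b) (h' : Adj a b') : b = b' := by
  apply LinearMap.ext; intro y
  apply om_ext; intro w
  rw [om_swap, om_swap _ w, ← h, ← h']

lemma Adj.add {a b a' b' : Module.End F (VV m F)} (h : Adj a a') (h' : Adj b b') : Adj (a + b) (a' + b') := by
  intro x y
  rw [LinearMap.add_apply, LinearMap.add_apply, map_add, map_add, LinearMap.add_apply, h, h']

lemma Adj.neg {a a' : Module.End F (VV m F)} (h : Adj a a') : Adj (-a) (-a') := by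
  intro x y
  rw [LinearMap.neg_apply, LinearMap.neg_apply, map_neg, map_neg, LinearMap.neg_apply, h]

/-- underlying endomorphism -/
def en (ρ : Sp m F) : Module.End F (VV m F) := (ρ.1 : VV m F →ₗ[F] VV m F)

lemma en_apply (ρ : Sp m F) (x : VV m F) : en ρ x = ρ.1 x := rfl

lemma en_mul (a b : Sp m F) : en (a * b) = en a * en b := rfl
lemma en_one : en (1 : Sp m F) = 1 := rfl
lemma en_pow (a : Sp m F) (n : ℕ) : en (a ^ n) = en a ^ n := by
  induction n with
  | zero => rfl
  | succ n ih => rw [pow_succ, en_mul, ih, pow_succ]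

lemma Adj_en (ρ : Sp m F) : Adj (en ρ) (en ρ⁻¹) := fun x y => Sp.om_inv ρ x y

abbrev AA (ρ : Sp m F) : Subalgebra F (Module.End F (VV m F)) := Algebra.adjoin F {en ρ}

lemma AA_comm {ρ : Sp m F} {a b : Module.End F (VV m F)} (ha : a ∈ AA ρ) (hb : b ∈ AA ρ) : a * b = b * a :=
  Algebra.commute_of_mem_adjoin_singleton_of_commute hb (Algebra.commute_of_mem_adjoin_self ha).symm

lemma en_mem (ρ : Sp m F) : en ρ ∈ AA ρ := Algebra.subset_adjoin rfl

lemma en_inv_mem (ρ : Sp m F) : en ρ⁻¹ ∈ AA ρ := by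
  haveI := isOfFinOrder_of_finite ρ
  obtain ⟨n, hn⟩ : ∃ n : ℕ, ρ⁻¹ = ρ ^ n := by
    have : ρ⁻¹ ∈ Submonoid.powers ρ := by
      rw [mem_powers_iff_mem_zpowers]
      exact inv_mem (Subgroup.mem_zpowers ρ)
    obtain ⟨n, hn⟩ := this
    exact ⟨n, hn.symm⟩
  rw [hn, en_pow]
  exact pow_mem (en_mem ρ) n

lemma AA_adj {ρ : Sp m F} {a : Module.End F (VV m F)} (ha : a ∈ AA ρ) : ∃ b ∈ AA ρ, Adj a b := by
  induction ha using Algebra.adjoin_induction with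
  | mem x hx => obtain rfl := hx; exact ⟨_, en_inv_mem ρ, Adj_en ρ⟩
  | algebraMap c =>
    refine ⟨_, Subalgebra.algebraMap_mem _ c, ?_⟩
    intro x y
    simp [Module.algebraMap_end_apply]
  | add x y _ _ hx hy =>
    obtain ⟨b, hb, h1⟩ := hx
    obtain ⟨b', hb', h2⟩ := hy
    exact ⟨_, add_mem hb hb', h1.add h2⟩
  | mul x y _ _ hx hy =>
    obtain ⟨b, hb, h1⟩ := hx
    obtain ⟨b', hb', h2⟩ := hy
    exact ⟨_, mul_mem hb' hb, h1.mul h2⟩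

variable {ρ : Sp m F}

lemma AA_inj (hirr : ∀ U : Submodule F (VV m F), (∀ y ∈ U, ρ.1 y ∈ U) → U = ⊥ ∨ U = ⊤)
    {a : Module.End F (VV m F)} (ha : a ∈ AA ρ) (h0 : a ≠ 0) : LinearMap.ker a = ⊥ := by
  rcases hirr (LinearMap.ker a) (by
    intro y hy
    rw [LinearMap.mem_ker] at hy ⊢
    have := LinearMap.congr_fun (AA_comm ha (en_mem ρ)) y
    rw [Module.End.mul_apply, Module.End.mul_apply, hy, map_zero] at this
    exact this) with h | h
  · exact h
  · exact absurd (LinearMap.ker_eq_top.1 h) h0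

lemma AA_card (hm : 1 ≤ m) (hirr : ∀ U : Submodule F (VV m F), (∀ y ∈ U, ρ.1 y ∈ U) → U = ⊥ ∨ U = ⊤) :
    Nat.card (AA ρ) = Nat.card F ^ (2 * m) := by
  rw [← card_VV]
  have hx : eb (F := F) (⟨0, hm⟩ : Fin m) ≠ 0 := eb_ne _
  set x := eb (F := F) (⟨0, hm⟩ : Fin m)
  apply Nat.card_eq_of_bijective (fun a : AA ρ => a.1 x)
  constructor
  · intro a b hab
    by_contra hne
    have h1 : a.1 - b.1 ≠ 0 := fun h => hne (Subtype.ext (sub_eq_zero.1 h))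
    have h2 := AA_inj hirr (sub_mem a.2 b.2) h1
    rw [LinearMap.ker_eq_bot'] at h2
    exact hx (h2 x (by rw [LinearMap.sub_apply]; exact sub_eq_zero.2 hab))
  · let U : Submodule F (VV m F) := (Subalgebra.toSubmodule (AA ρ)).map (LinearMap.applyₗ x)
    have hU := hirr U (by
      rintro _ ⟨a, ha, rfl⟩
      exact ⟨en ρ * a, (AA ρ).mul_mem (en_mem ρ) ha, rfl⟩)
    have hxU : x ∈ U := ⟨1, (AA ρ).one_mem, rfl⟩
    rcases hU with hU | hU
    · rw [hU, Submodule.mem_bot] at hxU; exact absurd hxU hx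
    · intro y
      have : y ∈ U := by rw [hU]; trivial
      obtain ⟨a, ha, h⟩ := this
      exact ⟨⟨a, ha⟩, h⟩

/-- self-adjoint elements -/
def SA (ρ : Sp m F) : Set (Module.End F (VV m F)) := {a | a ∈ AA ρ ∧ Adj a a}

instance : Finite (Module.End F (VV m F)) := Module.finite_of_finite F

lemma SA_card (hm : 1 ≤ m) (hirr : ∀ U : Submodule F (VV m F), (∀ y ∈ U, ρ.1 y ∈ U) → U = ⊥ ∨ U = ⊤)
    (hodd : ∀ z, ρ.1 (ρ.1 z) = z → z = 0) : Nat.card (SA ρ) ≤ Nat.card F ^ m := by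
  have h1 : Nat.card (SA ρ × SA ρ) ≤ Nat.card (AA ρ) := by
    apply Nat.card_le_card_of_injective (fun s : SA ρ × SA ρ =>
      (⟨s.1.1 + en ρ * s.2.1, add_mem s.1.2.1 (mul_mem (en_mem ρ) s.2.2.1)⟩ : AA ρ))
    rintro ⟨⟨s, hs, hs'⟩, ⟨t, ht, ht'⟩⟩ ⟨⟨s1, hs1, hs1'⟩, ⟨t1, ht1, ht1'⟩⟩ he
    have he := congrArg Subtype.val he
    change s + en ρ * t = s1 + en ρ * t1 at he
    have e1 : s + -s1 = en ρ * (t1 + -t) := by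
      have e0 : s = s1 + en ρ * t1 - en ρ * t := eq_sub_of_add_eq he
      apply LinearMap.ext; intro x
      rw [e0]
      simp only [LinearMap.add_apply, LinearMap.sub_apply, LinearMap.neg_apply, Module.End.mul_apply, map_add, map_neg]
      abel
    have a1 : Adj (s + -s1) (s + -s1) := hs'.add hs1'.neg
    have a2 : Adj (t1 + -t) (t1 + -t) := ht1'.add ht'.neg
    have a3 := (Adj_en ρ).mul a2
    rw [← e1] at a3
    have e2 := a1.uniq a3
    have hd : t1 + -t = 0 := by
      apply LinearMap.ext
      intro x
      rw [LinearMap.zero_apply]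
      apply hodd
      have e3 := LinearMap.congr_fun e2 x
      rw [AA_comm (add_mem ht1 (neg_mem ht)) (en_inv_mem ρ), e1] at e3
      rw [Module.End.mul_apply, Module.End.mul_apply, en_apply, en_apply] at e3
      rw [e3, Sp.apply_inv_self]
    have e4 : t = t1 := by rw [← sub_eq_add_neg, sub_eq_zero] at hd; exact hd.symm
    subst e4
    have e5 : s = s1 := add_right_cancel he
    subst e5
    rfl
  rw [Nat.card_prod, AA_card hm hirr] at h1
  by_contra hc
  push Not at hc
  have : Nat.card F ^ (2 * m) = Nat.card F ^ m * Nat.card F ^ m := by ring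
  nlinarith [Nat.mul_lt_mul_of_lt_of_lt hc hc]

lemma cent_elt (hirr : ∀ U : Submodule F (VV m F), (∀ y ∈ U, ρ.1 y ∈ U) → U = ⊥ ∨ U = ⊤)
    {a : Module.End F (VV m F)} (ha : a ∈ AA ρ) (h0 : a ≠ 0) :
    ∃ (g : Sp m F) (b : Module.End F (VV m F)), b ∈ AA ρ ∧ Adj a b ∧ b ≠ 0 ∧ g * ρ = ρ * g ∧ en g * b = a := by
  obtain ⟨b, hb, hab⟩ := AA_adj ha
  have hb0 : b ≠ 0 := by
    rintro rfl
    apply h0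
    apply LinearMap.ext; intro x
    apply om_nd; intro y
    rw [hab]; simp
  have hkb := AA_inj hirr hb hb0
  have hinj : Function.Injective b := LinearMap.ker_eq_bot.1 hkb
  let e := LinearEquiv.ofInjectiveEndo b hinj
  have he : ∀ x, b (e.symm x) = x := fun x => e.apply_symm_apply x
  have hcomm : ∀ x, a (b x) = b (a x) := fun x => LinearMap.congr_fun (AA_comm ha hb) x
  have hgf : ∀ x y, om ((a ∘ₗ (e.symm : VV m F →ₗ[F] VV m F)) x) ((a ∘ₗ (e.symm : VV m F →ₗ[F] VV m F)) y) = om x y := by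
    intro x y
    simp only [LinearMap.comp_apply, LinearEquiv.coe_coe]
    obtain ⟨x', rfl⟩ : ∃ x', b x' = x := ⟨_, he x⟩
    obtain ⟨y', rfl⟩ : ∃ y', b y' = y := ⟨_, he y⟩
    have s1 : ∀ x', e.symm (b x') = x' := fun x' => e.symm_apply_apply x'
    rw [s1, s1, hab, hab.symm, hcomm]
  refine ⟨mkSp _ hgf, b, hb, hab, hb0, ?_, ?_⟩
  · apply Sp.ext'
    intro x
    obtain ⟨x', rfl⟩ : ∃ x', b x' = x := ⟨_, he x⟩
    have s1 : ∀ x', e.symm (b x') = x' := fun x' => e.symm_apply_apply x'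
    rw [Sp.mul_apply, Sp.mul_apply]
    have c1 : ρ.1 (b x') = b (ρ.1 x') := LinearMap.congr_fun (AA_comm (en_mem ρ) hb) x'
    have c2 : ρ.1 (a x') = a (ρ.1 x') := LinearMap.congr_fun (AA_comm (en_mem ρ) ha) x'
    rw [c1]
    show a (e.symm (b (ρ.1 x'))) = ρ.1 (a (e.symm (b x')))
    rw [s1, s1, c2]
  · apply LinearMap.ext; intro x
    show a (e.symm (b x)) = a x
    congr 1
    exact e.symm_apply_apply x

lemma cent_large (hm : 1 ≤ m) (hirr : ∀ U : Submodule F (VV m F), (∀ y ∈ U, ρ.1 y ∈ U) → U = ⊥ ∨ U = ⊤)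
    (hodd : ∀ z, ρ.1 (ρ.1 z) = z → z = 0) : ∃ S : Finset (Sp m F), (∀ g ∈ S, g * ρ = ρ * g) ∧
      Nat.card F ^ m + 1 ≤ S.card := by
  classical
  haveI : Fintype (Module.End F (VV m F)) := Fintype.ofFinite _
  choose! G B h1 h2 h3 h4 h5 using fun (a : Module.End F (VV m F)) (ha : a ∈ AA ρ ∧ a ≠ 0) => cent_elt hirr ha.1 ha.2
  let A0 : Finset (Module.End F (VV m F)) := Finset.univ.filter (fun a => a ∈ AA ρ ∧ a ≠ 0)
  have hA : ∀ a, a ∈ A0 ↔ a ∈ AA ρ ∧ a ≠ 0 := fun a => by simp [A0]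
  have hq1 := Finite.one_lt_card (α := F)
  have cA : A0.card + 1 = Nat.card F ^ (2 * m) := by
    rw [← AA_card hm hirr]
    have : (insert 0 A0).card = Nat.card (AA ρ) := by
      rw [← Nat.card_eq_finsetCard]
      apply Nat.card_congr
      apply Equiv.subtypeEquivRight
      intro a
      rw [Finset.mem_insert, hA]
      constructor
      · rintro (rfl | h)
        · exact zero_mem _
        · exact h.1
      · intro h
        by_cases h0 : a = 0
        · exact Or.inl h0
        · exact Or.inr ⟨h, h0⟩
    rw [← this, Finset.card_insert_of_notMem]
    rw [hA]; simp
  refine ⟨A0.image G, ?_, ?_⟩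
  · intro g hg
    obtain ⟨a, ha, rfl⟩ := Finset.mem_image.1 hg
    exact h4 a ((hA a).1 ha)
  · have key := Finset.card_le_mul_card_image (f := G) A0 (Nat.card F ^ m - 1) (by
      intro g hg
      obtain ⟨b, hb, rfl⟩ := Finset.mem_image.1 hg
      rw [hA] at hb
      let S0 : Finset (Module.End F (VV m F)) := Finset.univ.filter (fun a => a ∈ SA ρ ∧ a ≠ 0)
      have cS : S0.card + 1 = Nat.card (SA ρ) := by
        have : (insert 0 S0).card = Nat.card (SA ρ) := by
          rw [← Nat.card_eq_finsetCard]
          apply Nat.card_congr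
          apply Equiv.subtypeEquivRight
          intro a
          rw [Finset.mem_insert, Finset.mem_filter]
          constructor
          · rintro (rfl | h)
            · exact ⟨zero_mem _, fun x y => by simp⟩
            · exact h.2.1
          · intro h
            by_cases h0 : a = 0
            · exact Or.inl h0
            · exact Or.inr ⟨Finset.mem_univ _, h, h0⟩
        rw [← this, Finset.card_insert_of_notMem]
        simp [S0]
      have hle := SA_card hm hirr hodd
      have hk := AA_inj hirr (h1 b hb) (h3 b hb)
      have hsurj : Function.Surjective (B b) := LinearMap.surjective_of_injective (LinearMap.ker_eq_bot.1 hk)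
      have : (A0.filter (fun a => G a = G b)).card ≤ S0.card := by
        apply Finset.card_le_card_of_injOn (fun a => a * B b)
        · intro a ha
          have ha := Finset.mem_coe.1 ha
          rw [Finset.mem_filter, hA] at ha
          obtain ⟨ha, hG⟩ := ha
          apply Finset.mem_coe.2
          simp only [S0, Finset.mem_filter, Finset.mem_univ, true_and]
          refine ⟨⟨mul_mem ha.1 (h1 b hb), ?_⟩, ?_⟩
          · have e : a * B b = b * B a := by
              nth_rewrite 1 [← h5 a ha]
              nth_rewrite 2 [← h5 b hb]
              rw [hG, mul_assoc, mul_assoc, AA_comm (h1 a ha) (h1 b hb)]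
            have := (h2 a ha).mul (h2 b hb).symm
            rw [← e] at this
            exact this
          · intro h0
            apply ha.2
            apply LinearMap.ext; intro x
            obtain ⟨y, rfl⟩ := hsurj x
            exact LinearMap.congr_fun h0 y
        · intro a _ a' _ h
          apply LinearMap.ext; intro x
          obtain ⟨y, rfl⟩ := hsurj x
          exact LinearMap.congr_fun h y
      omega)
    have hQ : 1 < Nat.card F ^ m := Nat.one_lt_pow (by omega) hq1
    have e : Nat.card F ^ (2 * m) = Nat.card F ^ m * Nat.card F ^ m := by ring
    rw [e] at cA
    obtain ⟨n, hn⟩ : ∃ n, Nat.card F ^ m = n + 2 := ⟨_, (Nat.sub_add_cancel hQ).symm⟩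
    rw [hn] at key cA ⊢
    have e2 : n + 2 - 1 = n + 1 := by omega
    rw [e2] at key
    by_contra hc
    push Not at hc
    have : (n + 1) * (Finset.image G A0).card ≤ (n + 1) * (n + 2) := Nat.mul_le_mul_left _ (by omega)
    nlinarith
end cent

section
variable {m : ℕ} {F : Type*} [Field F] [Finite F] {P : Type*} [MulAction (Sp m F) P] [Fintype P] [DecidableEq P]
  {bl : Finset (Finset P)} {k lam r p f : ℕ}

lemma ex_perp2 (hm : 2 ≤ m) (x y : VV m F) : ∃ z, z ≠ 0 ∧ om z x = 0 ∧ om z y = 0 := by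
  let φ : VV m F →ₗ[F] (F × F) := (om x).prod (om y)
  have : LinearMap.ker φ ≠ ⊥ := by
    apply LinearMap.ker_ne_bot_of_finrank_lt
    simp only [Module.finrank_prod, Module.finrank_self, Module.finrank_fintype_fun_eq_card, Fintype.card_fin]
    omega
  obtain ⟨z, hz, h0⟩ := Submodule.exists_mem_ne_zero_of_ne_bot this
  have h1 : om x z = 0 := congrArg Prod.fst (LinearMap.mem_ker.1 hz)
  have h2 : om y z = 0 := congrArg Prod.snd (LinearMap.mem_ker.1 hz)
  exact ⟨z, h0, om_zero_swap h1, om_zero_swap h2⟩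

/-- in the partial case `K_α` acts trivially -/
lemma SpD.K_triv (h : SpD m F bl k lam r p f) (hq : 2 < Nat.card F) {α : P} {x : VV m F} {c : F} (hx : x ≠ 0)
    (hc : c ≠ 0) (ht : tv x c • α = α) {g : Sp m F} (hg : g ∈ KK (Sp m F) bl α) (y : P) : g • y = y := by
  by_contra hy
  have hcf : ∀ u : Sp m F, u * g = g * u → u • α = α := fun u hu => h.ftd.comm_fix hg ⟨y, hy⟩ hu
  have hmem : g * tv x c * g⁻¹ * (tv x c)⁻¹ ∈ KK (Sp m F) bl α := by
    have h1 := h.ftd.KK_conj (inv_mem hg) (tv x c)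
    rw [ht] at h1
    have := mul_mem hg h1
    convert this using 1
    group
  rw [tv_conj, tv_inv] at hmem
  by_cases hs : ∃ a : F, g.1 x = a • x
  · obtain ⟨a, ha⟩ := hs
    by_cases ha1 : a * a = 1
    · refine h.D_empty hq α x ⟨hx, fun d => hcf _ ?_⟩
      have := tv_conj g x d
      rw [ha, tv_smul, ha1, one_mul, mul_inv_eq_iff_eq_mul] at this
      exact this.symm
    · rw [ha, tv_smul, tv_mul] at hmem
      refine h.lemK hx ?_ hmem
      have : a * a * c + -c = (a * a - 1) * c := by ring
      rw [this]
      exact mul_ne_zero (sub_ne_zero.2 ha1) hc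
  · push Not at hs
    obtain ⟨z, hz, h1, h2⟩ := ex_perp2 h.hm x (g.1 x)
    refine h.D_empty hq α z ⟨hz, fun d => ?_⟩
    refine h.ftd.comm_fix hmem (h.act_ne hz ?_ ?_) ?_
    · rw [Sp.mul_apply, tv_perp h1, tv_perp h2]
    · intro he
      have e1 : tv (g.1 x) c = tv x c := by
        rw [mul_eq_one_iff_eq_inv, tv_inv, neg_neg] at he; exact he
      obtain ⟨w, hw1, hw2⟩ := ex_perp_not hx hs
      have e2 : (tv (g.1 x) c).1 w = (tv x c).1 w := by rw [e1]
      rw [tv_perp (om_zero_swap hw1), tv_apply, add_eq_left, smul_eq_zero] at e2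
      rcases e2 with e2 | e2
      · exact (mul_ne_zero hc (fun h0 => hw2 (om_zero_swap h0))) e2
      · exact hx (Sp.apply_eq_zero.1 e2)
    · rw [← mul_assoc, tv_comm h2, mul_assoc, tv_comm h1, mul_assoc]

lemma irr_arith {q m a r : ℕ} (hm : 1 ≤ m) (hq : 2 ≤ q) (hr : r.Prime) (h3 : 3 ≤ r) (hrq : ∀ n, ¬ r ∣ q ^ n) (h1 : r ∣ q ^ m + 1)
    (hbig : q ^ (m - 1) < r) (ha : a ≤ 2 * m) (hd : r ∣ q ^ a - 1) : a = 0 ∨ a = 2 * m := by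
  have hsm : ∀ b, b ≤ m - 1 → r ∣ q ^ b - 1 → b = 0 := by
    intro b hb hdb
    have h4 : q ^ b ≤ q ^ (m - 1) := Nat.pow_le_pow_right (by omega) hb
    have h5 := Nat.eq_zero_of_dvd_of_lt hdb (by omega)
    by_contra h0
    have := Nat.one_lt_pow h0 (show 1 < q by omega)
    omega
  rcases lt_trichotomy a m with h | h | h
  · exact Or.inl (hsm a (by omega) hd)
  · exfalso
    subst h
    have hp : 1 ≤ q ^ a := Nat.one_le_pow _ _ (by omega)
    have := (Nat.dvd_sub h1 hd)
    have e : q ^ a + 1 - (q ^ a - 1) = 2 := by omega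
    rw [e] at this
    have := Nat.le_of_dvd (by norm_num) this
    omega
  · right
    have h6 : r ∣ q ^ (2 * m) - 1 := by
      have e : q ^ (2 * m) - 1 = (q ^ m + 1) * (q ^ m - 1) := by
        rw [two_mul, pow_add, ← Nat.sq_sub_sq]; ring_nf
      rw [e]; exact Dvd.dvd.mul_right h1 _
    have h7 := Nat.dvd_sub h6 hd
    have h8 : q ^ (2 * m) - 1 - (q ^ a - 1) = q ^ a * (q ^ (2 * m - a) - 1) := by
      rw [Nat.mul_sub, ← pow_add, mul_one]
      have : a + (2 * m - a) = 2 * m := by omega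
      rw [this]
      have := Nat.one_le_pow a q (by omega)
      omega
    rw [h8] at h7
    rcases (Nat.Prime.dvd_mul hr).1 h7 with h9 | h9
    · exact absurd h9 (hrq a)
    · have := hsm (2 * m - a) (by omega) h9
      omega

lemma SpD.exactness (h : SpD m F bl k lam r p f) (hq : 2 < Nat.card F) {α : P} {x : VV m F} {c : F} (hx : x ≠ 0)
    (hc : c ≠ 0) (ht : tv x c • α = α) (hd : r ∣ Nat.card F ^ m + 1) (hbig : Nat.card F ^ (m - 1) < r) :
    (p ≠ 2 → Nat.card F ^ m + 1 ≤ 2 * r) ∧ (p = 2 → Nat.card F ^ m + 1 ≤ r) := by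
  classical
  obtain ⟨ρ, hρ⟩ := h.ftd.exists_rho' α
  have hm := h.hm
  have hr3 := h.ftd.r3
  have hirr : ∀ U : Submodule F (VV m F), (∀ y ∈ U, ρ.1 y ∈ U) → U = ⊥ ∨ U = ⊤ := by
    intro U hU
    have h1 := h.rho_dvd hρ U hU
    rw [Module.natCard_eq_pow_finrank (K := F)] at h1
    have h2m : Module.finrank F (VV m F) = 2 * m := by
      simp only [Module.finrank_prod, Module.finrank_fintype_fun_eq_card, Fintype.card_fin]; omega
    have hle := Submodule.finrank_le U
    rw [h2m] at hle
    rcases irr_arith (by omega) (by omega) h.ftd.prime hr3 h.r_not_q hd hbig hle h1 with h3 | h3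
    · left; exact Submodule.finrank_eq_zero.1 h3
    · right; exact Submodule.eq_top_of_finrank_eq (h3.trans h2m.symm)
  have hodd : ∀ z, ρ.1 (ρ.1 z) = z → z = 0 := by
    intro z hz
    apply h.lemA hρ
    obtain ⟨a, ha⟩ := hρ.ord
    have ho : Odd (r ^ a) := (h.ftd.prime.odd_of_ne_two (by omega)).pow
    obtain ⟨n, hn⟩ := ho
    have h1 : ρ ^ (2 * n + 1) = 1 := by rw [← hn, ← ha]; exact pow_orderOf_eq_one ρ
    have h2 : ∀ n : ℕ, (ρ ^ (2 * n)).1 z = z := by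
      intro n
      induction n with
      | zero => rfl
      | succ n ih =>
        have : ρ ^ (2 * (n + 1)) = ρ ^ (2 * n) * (ρ * ρ) := by rw [mul_add, pow_add, mul_one, pow_two]
        rw [this, Sp.mul_apply, Sp.mul_apply, hz, ih]
    have h3 : (ρ ^ (2 * n + 1)).1 z = ρ.1 z := by rw [pow_succ', Sp.mul_apply, h2]
    rw [← h3, h1]; rfl
  obtain ⟨S, hS, hcard⟩ := cent_large (by omega) hirr hodd
  obtain ⟨B, hB, hαB⟩ := h.ftd.ex_block α
  have hmaps : ∀ g ∈ S, g • B ∈ bl.filter (fun B => α ∈ B) := by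
    intro g hg
    have := h.ftd.rho_comm_fix hρ (hS g hg)
    rw [Finset.mem_filter]
    refine ⟨h.ftd.inv g B hB, ?_⟩
    rw [← this]; exact mem_smul_fin.2 hαB
  have hfib : ∀ g ∈ S, ∀ g' ∈ S, g • B = g' • B → (∀ w, g'.1 w = g.1 w) ∨ (∀ w, g'.1 w = - g.1 w) := by
    intro g hg g' hg' he
    have hu : (g⁻¹ * g') * ρ = ρ * (g⁻¹ * g') := by
      rw [mul_assoc, hS g' hg', ← mul_assoc, ← mul_assoc]
      congr 1
      rw [inv_mul_eq_iff_eq_mul, ← mul_assoc, hS g hg, mul_inv_cancel_right]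
    have hK : g⁻¹ * g' ∈ KK (Sp m F) bl α := by
      intro C hC hαC
      obtain ⟨i, rfl⟩ := hρ.tr B hB C hC hαB hαC
      have hu' : (g⁻¹ * g') * ρ ^ i = ρ ^ i * (g⁻¹ * g') := Commute.pow_right (show Commute _ ρ from hu) i
      rw [← mul_smul, hu', mul_smul, mul_smul, ← he, inv_smul_smul]
    rcases h.fth _ (h.K_triv hq hx hc ht hK) with h1 | h1
    · left; intro w
      have := congrArg g.1 (h1 w)
      rwa [Sp.mul_apply, Sp.apply_inv_self] at this
    · right; intro w
      have := congrArg g.1 (h1 w)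
      rwa [Sp.mul_apply, Sp.apply_inv_self, map_neg] at this
  have himg : (S.image (fun g => g • B)).card ≤ r := by
    rw [← h.ftd.deg α]
    apply Finset.card_le_card
    intro C hC
    obtain ⟨g, hg, rfl⟩ := Finset.mem_image.1 hC
    exact hmaps g hg
  constructor
  · intro _
    have := Finset.card_le_mul_card_image (f := fun g : Sp m F => g • B) S 2 (by
      intro C hC
      obtain ⟨g, hg, rfl⟩ := Finset.mem_image.1 hC
      refine le_trans (Finset.card_le_card (t := {g, g * mkSp (-LinearMap.id) (by intro x y; simp)}) ?_) Finset.card_le_two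
      intro g' hg'
      rw [Finset.mem_filter] at hg'
      rw [Finset.mem_insert, Finset.mem_singleton]
      rcases hfib g hg g' hg'.1 hg'.2.symm with h1 | h1
      · left; exact Sp.ext' h1
      · right; apply Sp.ext'; intro w
        rw [h1, Sp.mul_apply]
        show _ = g.1 (-w)
        rw [map_neg])
    omega
  · intro hp
    have h2 : (2 : F) = 0 := h.two_iff.2 hp
    have := Finset.card_image_of_injOn (s := S) (f := fun g : Sp m F => g • B) (by
      intro g hg g' hg' he
      rcases hfib g hg g' hg' he with h1 | h1
      · exact (Sp.ext' h1).symm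
      · symm; apply Sp.ext'; intro w
        rw [h1, neg_eq_iff_add_eq_zero, ← two_smul F, h2, zero_smul])
    omega
end
end NFT

namespace NFT

section lag
variable {m : ℕ} {F : Type*} [Field F] [Finite F]

/-- Lagrangian subspaces -/
def Lag (W : Submodule F (VV m F)) : Prop :=
  (∀ x ∈ W, ∀ y ∈ W, om x y = 0) ∧ ∀ x, (∀ w ∈ W, om x w = 0) → x ∈ W

def W0 (m : ℕ) (F : Type*) [Field F] : Submodule F (VV m F) := LinearMap.ker (LinearMap.snd F (Fin m → F) (Fin m → F))
def W1 (m : ℕ) (F : Type*) [Field F] : Submodule F (VV m F) := LinearMap.ker (LinearMap.fst F (Fin m → F) (Fin m → F))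

lemma mem_W0 {x : VV m F} : x ∈ W0 m F ↔ x.2 = 0 := Iff.rfl
lemma mem_W1 {x : VV m F} : x ∈ W1 m F ↔ x.1 = 0 := Iff.rfl

/-- image under `g` -/
def mp (g : Sp m F) (W : Submodule F (VV m F)) : Submodule F (VV m F) := W.map (g.1 : VV m F →ₗ[F] VV m F)

lemma mem_mp {g : Sp m F} {W : Submodule F (VV m F)} {x : VV m F} : x ∈ mp g W ↔ ∃ w ∈ W, g.1 w = x := Iff.rfl

lemma Lag_W0 : Lag (W0 m F) := by
  constructor
  · intro x hx y hy
    rw [mem_W0] at hx hy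
    simp [om_apply, hx, hy]
  · intro x hx
    rw [mem_W0]
    funext i
    have := hx (ee i, 0) (by rw [mem_W0])
    simpa [om_apply, ee] using this

lemma Lag.mp {W : Submodule F (VV m F)} (h : Lag W) (g : Sp m F) : Lag (mp g W) := by
  constructor
  · rintro _ ⟨x, hx, rfl⟩ _ ⟨y, hy, rfl⟩
    exact (Sp.om g x y).trans (h.1 x hx y hy)
  · intro x hx
    refine ⟨g⁻¹.1 x, h.2 _ fun w hw => ?_, Sp.apply_inv_self _ _⟩
    have := hx (g.1 w) ⟨w, hw, rfl⟩
    rw [← Sp.om g, Sp.apply_inv_self]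
    exact this

lemma fun_mult {W : Submodule F (VV m F)} (hW : Lag W) {y y' : VV m F} (hy : y ∉ W)
    (hn : ∀ a : F, y' - a • y ∉ W) : ∃ w ∈ W, om y w = 0 ∧ om y' w ≠ 0 := by
  by_contra hc
  push Not at hc
  obtain ⟨w0, hw0, h0⟩ : ∃ w ∈ W, om y w ≠ 0 := by
    by_contra h1
    push Not at h1
    exact hy (hW.2 y h1)
  apply hn (om y' w0 / om y w0)
  apply hW.2
  intro w hw
  have h2 := hc (w - (om y w / om y w0) • w0) (sub_mem hw (W.smul_mem _ hw0)) (by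
    rw [map_sub, map_smul, smul_eq_mul, div_mul_cancel₀ _ h0, sub_self])
  rw [map_sub, map_smul, smul_eq_mul] at h2
  rw [map_sub, map_smul, LinearMap.sub_apply, LinearMap.smul_apply, smul_eq_mul, ← h2]
  field_simp

lemma Dsub (h2 : (2 : F) = 0) {H : Subgroup (Sp m F)} {W : Submodule F (VV m F)} (hW : Lag W)
    (hWD : ∀ x ∈ W, x ≠ 0 → x ∈ DS H) {y y' : VV m F} (hy : y ∈ DS H) (hy' : y' ∈ DS H) (hne : y + y' ≠ 0) :
    y + y' ∈ DS H := by
  have dbl : ∀ z : VV m F, z + z = 0 := fun z => by rw [← two_smul F, h2, zero_smul]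
  have base : ∀ y ∈ DS H, y ∉ W → ∀ w1 ∈ W, y + w1 ∈ DS H := by
    intro y hy hyW w1 hw1
    obtain ⟨w, hw, h0⟩ : ∃ w ∈ W, om y w ≠ 0 := by
      by_contra h1
      push Not at h1
      exact hyW (hW.2 y h1)
    have hw0 : w ≠ 0 := by rintro rfl; simp at h0
    by_cases h3 : om y w1 = 0
    · have h4 : om y (w1 + w) ≠ 0 := by rw [map_add, h3, zero_add]; exact h0
      have h5 : w1 + w ≠ 0 := fun h => h4 (by rw [h, map_zero])
      have h6 := DS.add hy (hWD _ (add_mem hw1 hw) h5) h4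
      have h7 : om (y + (w1 + w)) w ≠ 0 := by
        rw [map_add, LinearMap.add_apply, hW.1 _ (add_mem hw1 hw) _ hw, add_zero]; exact h0
      have h8 := DS.add h6 (hWD w hw hw0) h7
      have e : y + (w1 + w) + w = y + w1 := by rw [add_assoc, add_assoc, dbl, add_zero]
      rwa [e] at h8
    · exact DS.add hy (hWD _ hw1 (by rintro rfl; simp at h3)) h3
  by_cases h3 : om y y' = 0
  swap
  · exact DS.add hy hy' h3
  by_cases hyW : y ∈ W
  · by_cases hyW' : y' ∈ W
    · exact hWD _ (add_mem hyW hyW') hne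
    · rw [add_comm]; exact base y' hy' hyW' y hyW
  by_cases hyW' : y' ∈ W
  · exact base y hy hyW y' hyW'
  by_cases hd : ∃ a : F, y' - a • y ∈ W
  · obtain ⟨a, ha⟩ := hd
    have e : y + y' = (1 + a) • y + (y' - a • y) := by module
    by_cases h1 : 1 + a = 0
    · rw [e, h1, zero_smul, zero_add]
      refine hWD _ ha ?_
      rw [e, h1, zero_smul, zero_add] at hne
      exact hne
    · rw [e]
      refine base _ (DS.smul hy h1) (fun hm => hyW ?_) _ ha
      have := W.smul_mem (1 + a)⁻¹ hm
      rwa [smul_smul, inv_mul_cancel₀ h1, one_smul] at this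
  · push Not at hd
    obtain ⟨w', hw', a1, a2⟩ := fun_mult hW hyW hd
    obtain ⟨w, hw, b1, b2⟩ := fun_mult (y := y') (y' := y) hW hyW' (by
      intro a ha
      by_cases h0 : a = 0
      · rw [h0, zero_smul, sub_zero] at ha; exact hyW ha
      · apply hd a⁻¹
        have := W.smul_mem (-a⁻¹) ha
        rw [smul_sub, smul_smul, neg_mul, inv_mul_cancel₀ h0] at this
        convert this using 1
        module)
    have hne0 : ∀ {u z : VV m F}, om u z ≠ 0 → z ≠ 0 := by
      rintro u z h rfl; simp at h
    have c1 := DS.add hy (hWD w hw (hne0 b2)) b2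
    have c2' : om y' (w + w') ≠ 0 := by rw [map_add, b1, zero_add]; exact a2
    have c2 := DS.add hy' (hWD _ (add_mem hw hw') (hne0 c2')) c2'
    have c3 := DS.add c1 c2 (by
      simp only [map_add, LinearMap.add_apply]
      rw [h3, a1, hW.1 w hw w hw, hW.1 w hw w' hw', om_zero_swap b1]
      simpa using b2)
    have e : y + w + (y' + (w + w')) = y + y' + w' := by
      have : y + w + (y' + (w + w')) = y + y' + w' + (w + w) := by abel
      rw [this, dbl, add_zero]
    rw [e] at c3
    have c4 := DS.add c3 (hWD w' hw' (hne0 a2)) (by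
      simp only [map_add, LinearMap.add_apply]
      rw [a1, hW.1 w' hw' w' hw']
      simpa using a2)
    rwa [add_assoc, dbl, add_zero] at c4

/-- the subspace -/
def ND (H : Subgroup (Sp m F)) (hs : ∀ y ∈ DS H, ∀ y' ∈ DS H, y + y' ≠ 0 → y + y' ∈ DS H) : Submodule F (VV m F) where
  carrier := {x | x = 0 ∨ x ∈ DS H}
  zero_mem' := Or.inl rfl
  add_mem' := by
    rintro a b (rfl | ha) (rfl | hb)
    · left; simp
    · right; simpa using hb
    · right; simpa using ha
    · by_cases h0 : a + b = 0
      · exact Or.inl h0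
      · exact Or.inr (hs a ha b hb h0)
  smul_mem' := by
    rintro c x (rfl | hx)
    · left; simp
    · by_cases h0 : c = 0
      · left; simp [h0]
      · exact Or.inr (DS.smul hx h0)

lemma mem_ND {H : Subgroup (Sp m F)} {hs} {x : VV m F} : x ∈ ND H hs ↔ x = 0 ∨ x ∈ DS H := Iff.rfl

/-- swapping element -/
noncomputable def JJ (m : ℕ) (F : Type*) [Field F] : Sp m F :=
  mkSp { toFun := fun w => (w.2, -w.1)
         map_add' := by intro x y; ext <;> simp; ring
         map_smul' := by intro c x; ext <;> simp } (by
    intro x y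
    simp [om_apply]
    ring)

lemma JJ_apply (w : VV m F) : (JJ m F).1 w = (w.2, -w.1) := rfl

lemma Sy_card_ge : Nat.card F ^ ((m + 1).choose 2) ≤ Nat.card (Sy m F) := by
  have : Nat.card (Sym2 (Fin m) → F) = Nat.card F ^ ((m + 1).choose 2) := by
    rw [Nat.card_fun, Nat.card_eq_fintype_card (α := Sym2 (Fin m)), Sym2.card, Fintype.card_fin]
  rw [← this]
  apply Nat.card_le_card_of_injective (fun f : Sym2 (Fin m) → F =>
    (⟨Matrix.of fun i j => f s(i, j), by
      change Matrix.transpose _ = _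
      ext i j
      simp [Sym2.eq_swap]⟩ : Sy m F))
  intro f f' h
  funext z
  induction z using Sym2.inductionOn with | _ i j =>
  exact congrFun (congrFun (Subtype.mk.inj h) i) j

/-- orbit counting for `A` -/
lemma orb_count {X : Type*} [MulAction (Sp m F) X] (Ω : Finset X) (β : X) (hΩ : ∀ S : Sy m F, nS S • β ∈ Ω) :
    Nat.card (Sy m F) ≤ Nat.card (WS (MulAction.stabilizer (Sp m F) β)) * Ω.card := by
  classical
  rw [← AddSubgroup.card_mul_index (WS (MulAction.stabilizer (Sp m F) β))]
  apply Nat.mul_le_mul_left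
  rw [← Nat.card_eq_finsetCard]
  apply Nat.card_le_card_of_injective (Quotient.lift (fun S => (⟨nS S • β, hΩ S⟩ : Ω)) (by
    intro a b hab
    have h1 : -a + b ∈ WS (MulAction.stabilizer (Sp m F) β) := QuotientAddGroup.leftRel_apply.1 hab
    rw [mem_WS, MulAction.mem_stabilizer_iff, nS_add, nS_neg, mul_smul, inv_smul_eq_iff] at h1
    exact Subtype.ext h1.symm))
  intro x y
  induction x using Quotient.inductionOn with | _ a =>
  induction y using Quotient.inductionOn with | _ b =>
  intro h
  have h1 : nS a • β = nS b • β := Subtype.mk.inj h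
  apply Quotient.sound
  apply QuotientAddGroup.leftRel_apply.2
  rw [mem_WS, MulAction.mem_stabilizer_iff, nS_add, nS_neg, mul_smul, inv_smul_eq_iff, h1]

/-- the fibre subspace -/
def LL (N : Submodule F (VV m F)) : Submodule F (Fin m → F) := N.comap (LinearMap.inl F (Fin m → F) (Fin m → F))

lemma mem_LL {N : Submodule F (VV m F)} {a : Fin m → F} : a ∈ LL N ↔ ((a, 0) : VV m F) ∈ N := Iff.rfl

lemma LL_dim {N : Submodule F (VV m F)} (hN : W1 m F ≤ N) : Module.finrank F (LL N) + m ≤ Module.finrank F N := by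
  have h1 : Module.finrank F (LL N × (Fin m → F)) = Module.finrank F (LL N) + m := by
    rw [Module.finrank_prod, Module.finrank_fintype_fun_eq_card, Fintype.card_fin]
  rw [← h1]
  let φ : (LL N × (Fin m → F)) →ₗ[F] N :=
    { toFun := fun x => ⟨(x.1.1, x.2), by
        have := N.add_mem x.1.2 (hN (show ((0, x.2) : VV m F) ∈ W1 m F from rfl))
        simpa using this⟩
      map_add' := fun _ _ => rfl
      map_smul' := fun _ _ => rfl }
  apply LinearMap.finrank_le_finrank_of_injective (f := φ)
  intro x y h
  have h1 : ((x.1.1, x.2) : VV m F) = (y.1.1, y.2) := Subtype.mk.inj h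
  exact Prod.ext (Subtype.ext (Prod.mk.inj h1).1) (Prod.mk.inj h1).2

lemma line_count {L : Submodule F (Fin m → F)} (hL : Module.finrank F L ≤ 1) (Y : AddSubgroup (Sy m F))
    (hY : ∀ S ∈ Y, ∀ b, S.1.mulVec b ∈ L) : Nat.card Y ≤ Nat.card F := by
  classical
  obtain ⟨a0, ha0⟩ : ∃ a0 : Fin m → F, ∀ l ∈ L, l ⬝ᵥ a0 = 0 → l = 0 := by
    obtain ⟨⟨v, hv⟩, h⟩ := finrank_le_one_iff.1 hL
    by_cases h0 : v = 0
    · refine ⟨0, fun l hl _ => ?_⟩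
      obtain ⟨c, hc⟩ := h ⟨l, hl⟩
      have := congrArg Subtype.val hc
      simp [h0] at this
      exact this.symm
    · obtain ⟨i, hi⟩ : ∃ i, v i ≠ 0 := by
        by_contra hc; push Not at hc; exact h0 (funext hc)
      refine ⟨Pi.single i 1, fun l hl h1 => ?_⟩
      obtain ⟨c, hc⟩ := h ⟨l, hl⟩
      have hc : c • v = l := congrArg Subtype.val hc
      rw [← hc] at h1 ⊢
      simp at h1
      rcases h1 with h1 | h1
      · simp [h1]
      · exact absurd h1 hi
  have h1 : Nat.card L ≤ Nat.card F := by
    rw [Module.natCard_eq_pow_finrank (K := F)]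
    calc _ ≤ Nat.card F ^ 1 := Nat.pow_le_pow_right Nat.card_pos hL
      _ = _ := pow_one _
  refine le_trans ?_ h1
  apply Nat.card_le_card_of_injective (fun S : Y => (⟨S.1.1.mulVec a0, hY _ S.2 a0⟩ : L))
  intro S T h
  have h2 : S.1.1.mulVec a0 = T.1.1.mulVec a0 := Subtype.mk.inj h
  have h3 : ∀ b, (S.1 - T.1).1.mulVec b = 0 := by
    intro b
    apply ha0 _ (hY _ (sub_mem S.2 T.2) b)
    rw [Sy.dot]
    have : (S.1 - T.1).1.mulVec a0 = 0 := by
      change (S.1.1 - T.1.1).mulVec a0 = 0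
      rw [Matrix.sub_mulVec, h2, sub_self]
    rw [this, dotProduct_zero]
  apply Subtype.ext
  rw [← sub_eq_zero]
  apply Subtype.ext
  apply Matrix.ext_of_mulVec_single
  intro i
  rw [h3]; simp; rfl
end lag
end NFT

namespace NFT

section nb
variable {m : ℕ} {F : Type*} [Field F] {X : Type*} [MulAction (Sp m F) X]

/-- span of the full transvection directions of the stabiliser -/
def NB (m : ℕ) (F : Type*) [Field F] {X : Type*} [MulAction (Sp m F) X] (B : X) : Submodule F (VV m F) :=
  Submodule.span F (DS (MulAction.stabilizer (Sp m F) B))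

lemma DS_NB {B : X} {x : VV m F} (hx : x ∈ DS (MulAction.stabilizer (Sp m F) B)) : x ∈ NB m F B :=
  Submodule.subset_span hx

lemma mem_NB [Finite F] {B : X} (hs : ∀ y ∈ DS (MulAction.stabilizer (Sp m F) B), ∀ y' ∈ DS (MulAction.stabilizer (Sp m F) B),
    y + y' ≠ 0 → y + y' ∈ DS (MulAction.stabilizer (Sp m F) B)) {x : VV m F} (hx : x ∈ NB m F B) (h0 : x ≠ 0) :
    x ∈ DS (MulAction.stabilizer (Sp m F) B) := by
  have : NB m F B ≤ ND _ hs := Submodule.span_le.2 fun x hx => Or.inr hx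
  rcases this hx with h | h
  · exact absurd h h0
  · exact h

lemma DS_conj {B : X} {x : VV m F} (hx : x ∈ DS (MulAction.stabilizer (Sp m F) B)) (g : Sp m F) :
    g.1 x ∈ DS (MulAction.stabilizer (Sp m F) (g • B)) := by
  refine ⟨fun h0 => hx.1 (Sp.apply_eq_zero.1 h0), fun c => ?_⟩
  rw [← tv_conj, MulAction.mem_stabilizer_iff]
  have := MulAction.mem_stabilizer_iff.1 (hx.2 c)
  rw [mul_smul, mul_smul, inv_smul_smul, this]

lemma NB_smul {B : X} {x : VV m F} (hx : x ∈ NB m F B) (g : Sp m F) : g.1 x ∈ NB m F (g • B) := by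
  have : NB m F B ≤ (NB m F (g • B)).comap (g.1 : VV m F →ₗ[F] VV m F) :=
    Submodule.span_le.2 fun x hx => DS_NB (DS_conj hx g)
  exact this hx

lemma NB_finrank [Finite F] (B : X) (g : Sp m F) : Module.finrank F (NB m F B) ≤ Module.finrank F (NB m F (g • B)) := by
  let φ : NB m F B →ₗ[F] NB m F (g • B) := LinearMap.restrict (g.1 : VV m F →ₗ[F] VV m F) (fun x hx => NB_smul hx g)
  apply LinearMap.finrank_le_finrank_of_injective (f := φ)
  intro x y h
  have h1 : g.1 x.1 = g.1 y.1 := Subtype.mk.inj h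
  exact Subtype.ext (g.1.injective h1)

end nb

structure CaseB (m : ℕ) (F : Type*) [Field F] {P : Type*} [MulAction (Sp m F) P] [Fintype P] [DecidableEq P]
    (bl : Finset (Finset P)) (k r p f t c : ℕ) : Prop where
  sp : SpD m F bl k 1 r p f
  p2 : p = 2
  hr : r = Nat.card F ^ m + 1
  hv : Fintype.card P = 1 + r * t
  hk : k = 1 + t
  hc : 2 ≤ c
  hct : c * (t + 1) = Nat.card F ^ m
  hb : bl.card = r * (1 + c * t)

section caseb
variable {m : ℕ} {F : Type*} [Field F] [Finite F] {P : Type*} [MulAction (Sp m F) P] [Fintype P] [DecidableEq P]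
  {bl : Finset (Finset P)} {k r p f t c : ℕ}

lemma CaseB.two (h : CaseB m F bl k r p f t c) : (2 : F) = 0 := h.sp.two_iff.2 h.p2

lemma CaseB.b_odd (h : CaseB m F bl k r p f t c) : ¬ 2 ∣ bl.card := by
  have h1 : 2 ∣ c := by
    have : c ∣ 2 ^ (f * m) := ⟨t + 1, by rw [h.hct, h.sp.hq, h.p2, ← pow_mul]⟩
    obtain ⟨i, -, hi⟩ := (Nat.dvd_prime_pow Nat.prime_two).1 this
    have h2 := h.hc
    rcases i with _ | i
    · simp at hi; omega
    · exact ⟨2 ^ i, by rw [hi, pow_succ, mul_comm]⟩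
  have h2 : 2 ∣ Nat.card F ^ m := by rw [← h.hct]; exact h1.mul_right _
  rw [h.hb, Nat.prime_two.dvd_mul, h.hr]
  obtain ⟨d, hd⟩ := h1
  rintro (h3 | h3)
  · omega
  · rw [hd, mul_assoc] at h3; omega

lemma CaseB.b_lt (h : CaseB m F bl k r p f t c) : bl.card < Nat.card F ^ (2 * m) := by
  have h1 := h.hct
  have h2 := h.hc
  rw [h.hb, h.hr, mul_comm 2 m, pow_mul]
  set Q := Nat.card F ^ m
  have : 1 + c * t + 1 ≤ Q := by rw [← h1]; nlinarith
  nlinarith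

lemma CaseB.ptfix (h : CaseB m F bl k r p f t c) {B B' : Finset P} (hB : B ∈ bl) (hB' : B' ∈ bl) (hne : B ≠ B')
    {α : P} (h1 : α ∈ B) (h2 : α ∈ B') {g : Sp m F} (g1 : g • B = B) (g2 : g • B' = B') : g • α = α := by
  by_contra hc
  have h3 := h.sp.ftd.pair _ _ hc
  rw [Finset.card_eq_one] at h3
  obtain ⟨C, hC⟩ := h3
  have e1 : B ∈ ({C} : Finset (Finset P)) := by
    rw [← hC]; exact Finset.mem_filter.2 ⟨hB, by rw [← g1]; exact mem_smul_fin.2 h1, h1⟩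
  have e2 : B' ∈ ({C} : Finset (Finset P)) := by
    rw [← hC]; exact Finset.mem_filter.2 ⟨hB', by rw [← g2]; exact mem_smul_fin.2 h2, h2⟩
  rw [Finset.mem_singleton] at e1 e2
  exact hne (e1.trans e2.symm)

lemma CaseB.exB0 (h : CaseB m F bl k r p f t c) :
    ∃ B ∈ bl, ∀ x ∈ W0 m F, x ≠ 0 → x ∈ DS (MulAction.stabilizer (Sp m F) B) := by
  classical
  obtain ⟨i, -⟩ := h.sp.i0
  have hq2 : Nat.card F = 2 ^ f := by rw [h.sp.hq, h.p2]
  have h1 := pgroup_card_mod Nat.prime_two (RR_pgroup i hq2) bl (fun g B hB => h.sp.ftd.inv g.1 B hB)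
  have h2 : 0 < (bl.filter fun B => ∀ g : RR i F, g • B = B).card := by
    rcases Nat.eq_zero_or_pos (bl.filter fun B => ∀ g : RR i F, g • B = B).card with h0 | h0
    · rw [h0] at h1
      exact absurd ((Nat.modEq_zero_iff_dvd).1 h1) h.b_odd
    · exact h0
  obtain ⟨B, hB⟩ := Finset.card_pos.1 h2
  obtain ⟨hB, hf⟩ := Finset.mem_filter.1 hB
  refine ⟨B, hB, fun x hx h0 => ⟨h0, fun d => ?_⟩⟩
  have : x = (x.1, 0) := Prod.ext rfl hx
  rw [this, tv_eq_nS]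
  exact hf ⟨_, nS_mem_RR i _⟩

lemma FTD.btrans {Γ P : Type*} [Group Γ] [MulAction Γ P] [Fintype P] [DecidableEq P]
    {bl : Finset (Finset P)} {k lam r : ℕ} (h : FTD Γ bl k lam r) {B B' : Finset P} (hB : B ∈ bl) (hB' : B' ∈ bl) :
    ∃ g : Γ, g • B = B' := by
  have h3 := h.k3
  obtain ⟨x, hx⟩ := Finset.card_pos.1 (show 0 < B.card by rw [h.blk B hB]; omega)
  obtain ⟨y, hy⟩ := Finset.card_pos.1 (show 0 < B'.card by rw [h.blk B' hB']; omega)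
  obtain ⟨g, -, hg⟩ := h.trans B hB B' hB' x hx y hy
  exact ⟨g, hg⟩

lemma CaseB.exLag (h : CaseB m F bl k r p f t c) {B : Finset P} (hB : B ∈ bl) :
    ∃ g : Sp m F, ∀ x ∈ mp g (W0 m F), x ≠ 0 → x ∈ DS (MulAction.stabilizer (Sp m F) B) := by
  obtain ⟨B0, hB0, h0⟩ := h.exB0
  obtain ⟨g, rfl⟩ := h.sp.ftd.btrans hB0 hB
  refine ⟨g, ?_⟩
  rintro _ ⟨x, hx, rfl⟩ hx0
  exact DS_conj (h0 x hx (by rintro rfl; simp at hx0)) g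

lemma CaseB.mem (h : CaseB m F bl k r p f t c) {B : Finset P} (hB : B ∈ bl) {x : VV m F} (hx : x ∈ NB m F B) (h0 : x ≠ 0) :
    x ∈ DS (MulAction.stabilizer (Sp m F) B) := by
  obtain ⟨g, hg⟩ := h.exLag hB
  exact mem_NB (fun y hy y' hy' hne => Dsub h.two (Lag_W0.mp g) hg hy hy' hne) hx h0

lemma CaseB.inter (h : CaseB m F bl k r p f t c) {B B' : Finset P} (hB : B ∈ bl) (hB' : B' ∈ bl) (hne : B ≠ B')
    {α : P} (h1 : α ∈ B) (h2 : α ∈ B') {x : VV m F} (hx : x ∈ NB m F B) (hx' : x ∈ NB m F B') (h0 : x ≠ 0) : x ∈ Da F α :=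
  ⟨h0, fun d => h.ptfix hB hB' hne h1 h2 ((h.mem hB hx h0).2 d) ((h.mem hB' hx' h0).2 d)⟩

lemma CaseB.ex2 (h : CaseB m F bl k r p f t c) {B : Finset P} (hB : B ∈ bl) : ∃ α ∈ B, ∃ B' ∈ bl, B ≠ B' ∧ α ∈ B' := by
  have h3 := h.sp.ftd.k3
  obtain ⟨x, hx⟩ := Finset.card_pos.1 (show 0 < B.card by rw [h.sp.ftd.blk B hB]; omega)
  obtain ⟨y, hy, hxy⟩ := Finset.exists_mem_ne (show 1 < B.card by rw [h.sp.ftd.blk B hB]; omega) x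
  obtain ⟨B', hB', h1, h2⟩ := h.sp.ftd.ex_block_sep hxy.symm
  exact ⟨x, hx, B', hB', fun e => h2 (e ▸ hy), h1⟩

lemma CaseB.finrank_eq (h : CaseB m F bl k r p f t c) {B B' : Finset P} (hB : B ∈ bl) (hB' : B' ∈ bl) :
    Module.finrank F (NB m F B) = Module.finrank F (NB m F B') := by
  obtain ⟨g, rfl⟩ := h.sp.ftd.btrans hB hB'
  apply le_antisymm (NB_finrank B g)
  have := NB_finrank (g • B) g⁻¹
  rwa [inv_smul_smul] at this

lemma VV_finrank : Module.finrank F (VV m F) = 2 * m := by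
  rw [Module.finrank_prod, Module.finrank_fintype_fun_eq_card, Fintype.card_fin]; ring

/-- block with `W1` -/
lemma CaseB.exB1 (h : CaseB m F bl k r p f t c) : ∃ B ∈ bl, W1 m F ≤ NB m F B := by
  obtain ⟨B0, hB0, h0⟩ := h.exB0
  refine ⟨JJ m F • B0, h.sp.ftd.inv _ _ hB0, fun x hx => ?_⟩
  have e : x = (JJ m F).1 (-x.2, 0) := by
    rw [JJ_apply]; exact Prod.ext hx (by simp)
  rw [e]
  apply NB_smul
  by_cases hz : ((-x.2, 0) : VV m F) = 0
  · rw [hz]; exact zero_mem _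
  · exact DS_NB (h0 _ rfl hz)

lemma CaseB.odd_m (h : CaseB m F bl k r p f t c) : ¬ Odd m := by
  intro ho
  have h1 : Nat.card F + 1 ∣ Nat.card F ^ m + 1 ^ m := ho.nat_add_dvd_pow_add_pow _ _
  rw [one_pow, ← h.hr] at h1
  have hq := Finite.one_lt_card (α := F)
  rcases (Nat.dvd_prime h.sp.ftd.prime).1 h1 with h2 | h2
  · omega
  · rw [h.hr] at h2
    have h3 : Nat.card F ^ 1 < Nat.card F ^ m := Nat.pow_lt_pow_right hq (by have := h.sp.hm; omega)
    rw [pow_one] at h3; omega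

lemma CaseB.big (h : CaseB m F bl k r p f t c) (hm : 4 ≤ m) : False := by
  obtain ⟨B1, hB1, hW1⟩ := h.exB1
  have hq := Finite.one_lt_card (α := F)
  by_cases hd : Module.finrank F (NB m F B1) ≤ m + 1
  · have h1 := LL_dim hW1
    have h2 : Nat.card (WS (MulAction.stabilizer (Sp m F) B1)) ≤ Nat.card F := by
      apply line_count (L := LL (NB m F B1)) (by omega)
      intro S hS b
      have hS : nS S • B1 = B1 := hS
      rw [mem_LL]
      have a1 : ((0, b) : VV m F) ∈ NB m F B1 := hW1 rfl
      have a2 := NB_smul a1 (nS S)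
      rw [hS, nS_apply] at a2
      have := sub_mem a2 a1
      simpa using this
    have h3 := orb_count bl B1 (fun S => h.sp.ftd.inv _ _ hB1)
    have h4 := h.b_lt
    have h5 := Sy_card_ge (m := m) (F := F)
    have h6 : Nat.card F ^ (2 * m + 1) ≤ Nat.card F ^ ((m + 1).choose 2) := by
      apply Nat.pow_le_pow_right (by omega)
      rw [Nat.choose_two_right, Nat.le_div_iff_mul_le (by norm_num), Nat.add_sub_cancel]
      nlinarith
    have h7 : Nat.card (WS (MulAction.stabilizer (Sp m F) B1)) * bl.card ≤ Nat.card F * bl.card := Nat.mul_le_mul_right _ h2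
    have h8 : Nat.card F * bl.card < Nat.card F * Nat.card F ^ (2 * m) := Nat.mul_lt_mul_of_pos_left h4 (by omega)
    rw [pow_succ, mul_comm] at h6
    omega
  · push Not at hd
    obtain ⟨α, hα, B', hB', hne, hα'⟩ := h.ex2 hB1
    have e := h.finrank_eq hB1 hB'
    have h1 := Submodule.finrank_sup_add_finrank_inf_eq (NB m F B1) (NB m F B')
    have h2 := Submodule.finrank_le (NB m F B1 ⊔ NB m F B')
    rw [VV_finrank] at h2
    have h3 : 4 ≤ Module.finrank F (NB m F B1 ⊓ NB m F B' : Submodule F (VV m F)) := by omega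
    set I := NB m F B1 ⊓ NB m F B'
    obtain ⟨x, hx, hx0⟩ := Submodule.exists_mem_ne_zero_of_ne_bot (p := I) (by
      intro h0; rw [h0, finrank_bot] at h3; omega)
    -- second vector
    obtain ⟨i, hi⟩ : ∃ i : Module.Dual F (VV m F), i x ≠ 0 := by
      obtain ⟨y, hy⟩ := om_nd' hx0
      refine ⟨om.flip y, ?_⟩
      rw [LinearMap.flip_apply, hy]; exact one_ne_zero
    let φ : I →ₗ[F] F × F := (LinearMap.prod (om x) i).comp I.subtype
    have hk := LinearMap.ker_ne_bot_of_finrank_lt (f := φ) (by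
      rw [Module.finrank_prod, Module.finrank_self]; omega)
    obtain ⟨y, hy, hy0⟩ := Submodule.exists_mem_ne_zero_of_ne_bot hk
    rw [LinearMap.mem_ker] at hy
    have y1 : om x y.1 = 0 := congrArg Prod.fst hy
    have y2 : i y.1 = 0 := congrArg Prod.snd hy
    have hy0' : y.1 ≠ 0 := fun h0 => hy0 (Subtype.ext h0)
    have hsp : ∀ z ∈ Submodule.span F {x, y.1}, ∃ a b : F, z = a • x + b • y.1 := by
      intro z hz
      obtain ⟨a, b, hab⟩ := Submodule.mem_span_pair.1 hz
      exact ⟨a, b, hab.symm⟩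
    refine h.sp.no_plane (α := α) (Submodule.span F {x, y.1}) ?_ ?_ (n1 := x) (n2 := y.1)
      (Submodule.subset_span (by simp)) (Submodule.subset_span (by simp)) hx0 hy0' ?_
    · intro u hu v hv
      obtain ⟨a, b, rfl⟩ := hsp u hu
      obtain ⟨a', b', rfl⟩ := hsp v hv
      simp [y1, om_zero_swap y1]
    · intro u hu hu0
      have : u ∈ I := by
        obtain ⟨a, b, rfl⟩ := hsp u hu
        exact add_mem (I.smul_mem _ hx) (I.smul_mem _ y.2)
      exact h.inter hB1 hB' hne hα hα' this.1 this.2 hu0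
    · rintro h0
      rw [← h0] at y2; exact hi y2
end caseb
end NFT

namespace NFT

section graph
variable {m : ℕ} {F : Type*} [Field F] [Finite F]

lemma ex_graph (g : Sp m F) (hg : ∀ x : Fin m → F, (g.1 (x, 0)).2 = 0 → x = 0) :
    ∃ S : Sy m F, ∀ b, ∃ x, g.1 (x, 0) = (S.1.mulVec b, b) := by
  let φ : (Fin m → F) →ₗ[F] (Fin m → F) := (LinearMap.snd F _ _).comp ((g.1 : VV m F →ₗ[F] VV m F).comp (LinearMap.inl F _ _))
  have hφ : Function.Injective φ := (injective_iff_map_eq_zero φ).2 hg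
  let e := LinearEquiv.ofInjectiveEndo φ hφ
  have he : ∀ b, (g.1 (e.symm b, 0)).2 = b := fun b => e.apply_symm_apply b
  let ψ : (Fin m → F) →ₗ[F] (Fin m → F) :=
    (LinearMap.fst F _ _).comp ((g.1 : VV m F →ₗ[F] VV m F).comp ((LinearMap.inl F _ _).comp (e.symm : (Fin m → F) →ₗ[F] (Fin m → F))))
  have hψ : ∀ b, g.1 (e.symm b, 0) = (ψ b, b) := fun b => Prod.ext rfl (he b)
  have hsym : ∀ b b', ψ b ⬝ᵥ b' = b ⬝ᵥ ψ b' := by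
    intro b b'
    have h1 := Sp.om g ((e.symm b, 0) : VV m F) (e.symm b', 0)
    rw [hψ, hψ] at h1
    simp [om_apply] at h1
    exact sub_eq_zero.1 h1
  refine ⟨⟨LinearMap.toMatrix' ψ, ?_⟩, fun b => ⟨e.symm b, ?_⟩⟩
  · change Matrix.transpose _ = _
    ext i j
    have := hsym (Pi.single i 1) (Pi.single j 1)
    simp at this
    simp [LinearMap.toMatrix'_apply, this, Pi.single_apply] 
  · rw [hψ]; simp [LinearMap.toMatrix'_mulVec]

/-- two by two symmetric matrices -/
def mk2 (a b c : F) : Sy 2 F := ⟨!![a, b; b, c], by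
  change Matrix.transpose _ = _
  ext i j; fin_cases i <;> fin_cases j <;> rfl⟩

lemma mk2_eta (S : Sy 2 F) : S = mk2 (S.1 0 0) (S.1 0 1) (S.1 1 1) := by
  apply Subtype.ext
  have h : S.1.transpose = S.1 := S.2
  have h1 : S.1 1 0 = S.1 0 1 := congrFun (congrFun h 0) 1
  ext i j; fin_cases i <;> fin_cases j <;> simp [mk2, h1]

lemma mk2_sub (a b c a' b' c' : F) : mk2 a b c - mk2 a' b' c' = mk2 (a - a') (b - b') (c - c') := by
  apply Subtype.ext
  ext i j; fin_cases i <;> fin_cases j <;> simp [mk2]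

lemma mk2_sq0 (a : F) : mk2 a 0 0 = sq (ee 0) a := by
  apply Subtype.ext
  ext i j; fin_cases i <;> fin_cases j <;> simp [mk2, sq, ee, Matrix.vecMulVec_apply]

lemma mk2_decomp (a b c : F) : mk2 a b c = sq (ee 0) (a - b) + sq (ee 1) (c - b) + sq (ee 0 + ee 1) b := by
  apply Subtype.ext
  ext i j; fin_cases i <;> fin_cases j <;> simp [mk2, sq, ee, Matrix.vecMulVec_apply]

def f0 (s : F) : Ph (0 : Fin 2) F := ⟨![0, s], by change _ = _; simp⟩
def f1' (s : F) : Ph (1 : Fin 2) F := ⟨![s, 0], by change _ = _; simp⟩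

lemma actS0 (h2 : (2 : F) = 0) (s a b c : F) : actS 0 (f0 s) (mk2 a b c) = mk2 (a + s ^ 2 * c) (b + s * c) c := by
  apply Subtype.ext
  ext i j
  fin_cases i <;> fin_cases j <;>
    simp [actS, mk2, f0, ee, Matrix.mul_apply, Fin.sum_univ_two, Matrix.vecMulVec_apply, Matrix.one_apply] <;>
    first | ring1 | linear_combination (s * b) * h2

lemma actS1 (h2 : (2 : F) = 0) (s a b c : F) : actS 1 (f1' s) (mk2 a b c) = mk2 a (b + s * a) (c + s ^ 2 * a) := by
  apply Subtype.ext
  ext i j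
  fin_cases i <;> fin_cases j <;>
    simp [actS, mk2, f1', ee, Matrix.mul_apply, Fin.sum_univ_two, Matrix.vecMulVec_apply, Matrix.one_apply] <;>
    first | ring1 | linear_combination (s * b) * h2

lemma Y_small (h2 : (2 : F) = 0) (hq : 2 < Nat.card F) (Y : AddSubgroup (Sy 2 F))
    (h0 : ∀ s, ∀ S ∈ Y, actS 0 (f0 s) S ∈ Y) (h1 : ∀ s, ∀ S ∈ Y, actS 1 (f1' s) S ∈ Y)
    (hno : ∀ c : F, c ≠ 0 → mk2 c 0 0 ∉ Y) : Nat.card Y ≤ Nat.card F := by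
  classical
  have k0 : ∀ s a b c : F, mk2 a b c ∈ Y → mk2 (s ^ 2 * c) (s * c) 0 ∈ Y := by
    intro s a b c h
    have := sub_mem (h0 s _ h) h
    rw [actS0 h2, mk2_sub] at this
    simpa using this
  have k1 : ∀ s a b c : F, mk2 a b c ∈ Y → mk2 0 (s * a) (s ^ 2 * a) ∈ Y := by
    intro s a b c h
    have := sub_mem (h1 s _ h) h
    rw [actS1 h2, mk2_sub] at this
    simpa using this
  have kc : ∀ a b c : F, mk2 a b c ∈ Y → c = 0 := by
    intro a b c h
    by_contra hc
    have l1 : ∀ u s : F, s ≠ 0 → mk2 0 (u * s * c) (u ^ 2 * c) ∈ Y := by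
      intro u s hs
      have := k1 (u / s) _ _ _ (k0 s _ _ _ h)
      have e1 : u / s * (s ^ 2 * c) = u * s * c := by field_simp
      have e2 : (u / s) ^ 2 * (s ^ 2 * c) = u ^ 2 * c := by field_simp
      rwa [e1, e2] at this
    obtain ⟨s, hs0, hs1⟩ : ∃ s : F, s ≠ 0 ∧ s ≠ 1 := by
      haveI := Fintype.ofFinite F
      rw [Nat.card_eq_fintype_card] at hq
      by_contra hn
      push Not at hn
      have : (Finset.univ : Finset F) ⊆ {0, 1} := by
        intro s _
        by_cases h : s = 0
        · simp [h]
        · simp [hn s h]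
      have := Finset.card_le_card this
      rw [Finset.card_univ] at this
      have h3 : ({0, 1} : Finset F).card ≤ 2 := Finset.card_le_two
      omega
    have l2 : ∀ b : F, mk2 0 b 0 ∈ Y := by
      intro b
      have hs1' : s - 1 ≠ 0 := sub_ne_zero.2 hs1
      have := sub_mem (l1 (b / (c * (s - 1))) s hs0) (l1 (b / (c * (s - 1))) 1 one_ne_zero)
      rw [mk2_sub] at this
      have e : b / (c * (s - 1)) * s * c - b / (c * (s - 1)) * 1 * c = b := by field_simp
      rw [e] at this
      simpa using this
    have l3 := sub_mem (k0 1 _ _ _ h) (l2 c)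
    rw [mk2_sub] at l3
    simp at l3
    exact hno c hc l3
  have ka : ∀ a b c : F, mk2 a b c ∈ Y → a = 0 := by
    intro a b c h
    have := kc _ _ _ (k1 1 _ _ _ h)
    simpa using this
  apply Nat.card_le_card_of_injective (fun S : Y => S.1.1 0 1)
  intro S T h
  apply Subtype.ext
  have hS := S.2
  have hT := T.2
  have h' : S.1.1 0 1 = T.1.1 0 1 := h
  rw [mk2_eta S.1] at hS ⊢
  rw [mk2_eta T.1] at hT ⊢
  rw [ka _ _ _ hS, kc _ _ _ hS, ka _ _ _ hT, kc _ _ _ hT, h']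

end graph
section m2
variable {F : Type*} [Field F] [Finite F] {P : Type*} [MulAction (Sp 2 F) P] [Fintype P] [DecidableEq P]
  {bl : Finset (Finset P)} {k r p f t c : ℕ}

lemma CaseB.q3 (h : CaseB 2 F bl k r p f t c) : 2 < Nat.card F := by
  have h1 := Finite.one_lt_card (α := F)
  have h2 := h.sp.h22
  omega

lemma CaseB.disj (h : CaseB 2 F bl k r p f t c) {B B' : Finset P} (hB : B ∈ bl) (hB' : B' ∈ bl) (hne : B ≠ B')
    {α : P} (h1 : α ∈ B) (h2 : α ∈ B') {x : VV 2 F} (hx : x ∈ NB 2 F B) (hx' : x ∈ NB 2 F B') : x = 0 := by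
  by_contra h0
  exact h.sp.D_empty h.q3 α x (h.inter hB hB' hne h1 h2 hx hx' h0)

lemma CaseB.dim2 (h : CaseB 2 F bl k r p f t c) {B : Finset P} (hB : B ∈ bl) : Module.finrank F (NB 2 F B) ≤ 2 := by
  obtain ⟨α, hα, B', hB', hne, hα'⟩ := h.ex2 hB
  have e := h.finrank_eq hB hB'
  have h1 := Submodule.finrank_add_finrank_le_of_disjoint (s := NB 2 F B) (t := NB 2 F B') (by
    rw [Submodule.disjoint_def]
    intro x hx hx'
    exact h.disj hB hB' hne hα hα' hx hx')
  rw [VV_finrank] at h1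
  omega

lemma CaseB.noTv (h : CaseB 2 F bl k r p f t c) : NoTv 2 F P := by
  intro α x d hx hd ht
  obtain ⟨B1, hB1, hα1⟩ := h.sp.ftd.ex_block α
  obtain ⟨y, hy, hxy⟩ := Finset.exists_mem_ne (show 1 < B1.card by
    have := h.sp.ftd.k3; rw [h.sp.ftd.blk B1 hB1]; omega) α
  obtain ⟨B2, hB2, hα2, hy2⟩ := h.sp.ftd.ex_block_sep hxy.symm
  have hne : B1 ≠ B2 := fun e => hy2 (e ▸ hy)
  obtain ⟨B, hB, hα, hxB⟩ : ∃ B ∈ bl, α ∈ B ∧ x ∉ NB 2 F B := by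
    by_cases h1 : x ∈ NB 2 F B1
    · exact ⟨B2, hB2, hα2, fun h2 => hx (h.disj hB1 hB2 hne hα1 hα2 h1 h2)⟩
    · exact ⟨B1, hB1, hα1, h1⟩
  obtain ⟨g, hg⟩ := h.exLag hB
  have hgN : ∀ w ∈ mp g (W0 2 F), w ∈ NB 2 F B := by
    intro w hw
    by_cases h0 : w = 0
    · rw [h0]; exact zero_mem _
    · exact DS_NB (hg w hw h0)
  obtain ⟨a, ha, ha0⟩ := Submodule.exists_mem_ne_zero_of_ne_bot (LinearMap.ker_ne_bot_of_finrank_lt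
    (f := (om x).comp ((g.1 : VV 2 F →ₗ[F] VV 2 F).comp (LinearMap.inl F (Fin 2 → F) (Fin 2 → F)))) (by
      rw [Module.finrank_fintype_fun_eq_card, Fintype.card_fin, Module.finrank_self]; norm_num))
  have hw1 : om x (g.1 (a, 0)) = 0 := ha
  have hw2 : g.1 (a, 0) ∈ NB 2 F B := hgN _ ⟨(a, 0), rfl, rfl⟩
  have hw3 : g.1 (a, 0) ≠ 0 := by
    intro h0
    have h0 : ((a, 0) : VV 2 F) = 0 := Sp.apply_eq_zero.1 h0
    exact ha0 (congrArg Prod.fst h0)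
  have htB : tv x d • B = B := by
    by_contra hn
    have h1 : α ∈ tv x d • B := by
      have := (mem_smul_fin (g := tv x d)).2 hα
      rwa [ht] at this
    have h2 := NB_smul hw2 (tv x d)
    rw [tv_perp (om_zero_swap hw1)] at h2
    exact hw3 (h.disj (h.sp.ftd.inv _ _ hB) hB hn h1 hα h2 hw2)
  obtain ⟨w, hw, hwx⟩ : ∃ w ∈ mp g (W0 2 F), om x w ≠ 0 := by
    by_contra hn
    push Not at hn
    exact hxB (hgN _ ((Lag_W0.mp g).2 x hn))
  have h3 := NB_smul (hgN w hw) (tv x d)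
  rw [htB, tv_apply] at h3
  have h4 := sub_mem h3 (hgN w hw)
  rw [add_sub_cancel_left] at h4
  have h5 := (NB 2 F B).smul_mem (d * om w x)⁻¹ h4
  rw [smul_smul, inv_mul_cancel₀, one_smul] at h5
  · exact hxB h5
  · refine mul_ne_zero hd ?_
    rw [om_swap]; simpa using hwx

lemma CaseB.twok (h : CaseB 2 F bl k r p f t c) : 2 * k = Nat.card F ^ 2 := by
  obtain ⟨E, hE, hd⟩ := h.sp.div_N_even h.p2 (Or.inl h.noTv)
  have h1 := h.hct
  have h2 := h.hc
  have h3 := h.hr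
  have h4 := h.hv
  have h5 := h.hk
  have hq := h.q3
  have h6 : E ∣ t + 1 := by
    have e : Fintype.card P = (t + 1) + E * (2 * t) := by rw [h4, h3, hE]; ring
    rw [e] at hd
    exact (Nat.dvd_add_left (Dvd.intro _ rfl)).1 hd
  obtain ⟨j, hj⟩ := h6
  have hE0 : 0 < E := by
    rcases Nat.eq_zero_or_pos E with h0 | h0
    · rw [h0] at hE; have := pow_pos (show 0 < Nat.card F by omega) 2; omega
    · exact h0
  have h7 : c * j = 2 := by
    rw [hj, hE] at h1
    exact Nat.eq_of_mul_eq_mul_left hE0 (by linarith)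
  have h8 : c = 2 := le_antisymm (Nat.le_of_dvd (by norm_num) ⟨j, h7.symm⟩) h2
  rw [← h1, h8, h5]; ring

open Classical in
/-- blocks over a subspace -/
noncomputable def BW (bl : Finset (Finset P)) (W : Submodule F (VV 2 F)) : Finset (Finset P) :=
  bl.filter fun B => W ≤ NB 2 F B

lemma mem_BW {W : Submodule F (VV 2 F)} {B : Finset P} : B ∈ BW bl W ↔ B ∈ bl ∧ W ≤ NB 2 F B := by
  classical
  exact Finset.mem_filter

lemma CaseB.BW_smul (h : CaseB 2 F bl k r p f t c) {W W' : Submodule F (VV 2 F)} (g : Sp 2 F)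
    (hg : ∀ x ∈ W', g⁻¹.1 x ∈ W) {B : Finset P} (hB : B ∈ BW bl W) : g • B ∈ BW bl W' := by
  rw [mem_BW] at *
  refine ⟨h.sp.ftd.inv _ _ hB.1, fun x hx => ?_⟩
  have := NB_smul (hB.2 (hg x hx)) g
  rwa [Sp.apply_inv_self] at this

lemma CaseB.BW1_lt (h : CaseB 2 F bl k r p f t c) : (BW bl (W1 2 F)).card < Nat.card F := by
  classical
  have hq := h.q3
  have h1 : Nat.card (Sy 2 F × BW bl (W1 2 F)) ≤ Nat.card bl := by
    apply Nat.card_le_card_of_injective (fun x : Sy 2 F × BW bl (W1 2 F) =>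
      (⟨nS x.1 • x.2.1, h.sp.ftd.inv _ _ (mem_BW.1 x.2.2).1⟩ : bl))
    rintro ⟨S, B, hB⟩ ⟨T, B', hB'⟩ he
    have he : nS S • B = nS T • B' := Subtype.mk.inj he
    rw [mem_BW] at hB hB'
    have h2 : B' = nS (S - T) • B := by
      rw [sub_eq_neg_add, nS_add, nS_neg, mul_smul, he, inv_smul_smul]
    have hL := LL_dim hB'.2
    have hd := h.dim2 hB'.1
    have hL0 : LL (NB 2 F B') = ⊥ := Submodule.finrank_eq_zero.1 (by omega)
    have hST : S - T = 0 := by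
      apply Subtype.ext
      apply Matrix.ext_of_mulVec_single
      intro i
      have a1 : ((0, Pi.single i 1) : VV 2 F) ∈ NB 2 F B := hB.2 rfl
      have a2 := NB_smul a1 (nS (S - T))
      rw [← h2, nS_apply] at a2
      have a3 := sub_mem a2 (hB'.2 (show ((0, Pi.single i 1) : VV 2 F) ∈ W1 2 F from rfl))
      have a4 : (S - T).1.mulVec (Pi.single i 1) ∈ LL (NB 2 F B') := by
        rw [mem_LL]; simpa using a3
      rw [hL0, Submodule.mem_bot] at a4
      rw [a4]; simp; rfl
    have hS := sub_eq_zero.1 hST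
    subst hS
    rw [sub_self, nS_zero, one_smul] at h2
    subst h2
    rfl
  rw [Nat.card_prod, Nat.card_eq_finsetCard, Nat.card_eq_finsetCard] at h1
  have h2 := h.b_lt
  have h3 := Sy_card_ge (m := 2) (F := F)
  have h4 : (2 + 1).choose 2 = 3 := rfl
  rw [h4] at h3
  by_contra hn
  push Not at hn
  have h5 := Nat.mul_le_mul h3 hn
  have e : Nat.card F ^ 3 * Nat.card F = Nat.card F ^ (2 * 2) := by ring
  omega

lemma CaseB.BW0_lt (h : CaseB 2 F bl k r p f t c) : (BW bl (W0 2 F)).card < Nat.card F := by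
  classical
  refine lt_of_le_of_lt ?_ h.BW1_lt
  apply Finset.card_le_card_of_injOn (fun B => JJ 2 F • B)
  · intro B hB
    refine h.BW_smul _ ?_ hB
    intro x hx
    have e : x = (JJ 2 F).1 (-x.2, 0) := by
      rw [JJ_apply]; exact Prod.ext hx (by simp)
    rw [e, Sp.inv_apply_self]; rfl
  · intro B _ B' _ he
    exact smul_left_cancel _ he

end m2
end NFT

namespace NFT

lemma inv_stable {m : ℕ} {F : Type*} [Field F] [Finite F] {W : Submodule F (VV m F)} {g : Sp m F}
    (hg : ∀ x ∈ W, g.1 x ∈ W) : ∀ x ∈ W, g⁻¹.1 x ∈ W := by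
  have h1 : ∀ n : ℕ, ∀ x ∈ W, (g ^ n).1 x ∈ W := by
    intro n
    induction n with
    | zero => intro x hx; simpa using hx
    | succ n ih => intro x hx; rw [pow_succ, Sp.mul_apply]; exact ih _ (hg x hx)
  have h2 : g⁻¹ = g ^ (orderOf g - 1) := by
    apply inv_eq_of_mul_eq_one_right
    rw [mul_pow_sub_one (orderOf_pos g).ne', pow_orderOf_eq_one]
  rw [h2]; exact h1 _

section m2
variable {F : Type*} [Field F] [Finite F] {P : Type*} [MulAction (Sp 2 F) P] [Fintype P] [DecidableEq P]
  {bl : Finset (Finset P)} {k r p f t c : ℕ}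

lemma tor_conj (i : Fin 2) (φ : Ph i F) {a : F} (ha : a ≠ 0) (ψ : Ph i F) (hψ : ψ.1 = a • φ.1) :
    dg ((ee i, 0) : VV 2 F) (0, ee i) a * uU i φ * (dg ((ee i, 0) : VV 2 F) (0, ee i) a)⁻¹ = uU i ψ := by
  have h1 : om ((ee i, 0) : VV 2 F) (0, ee i) = 1 := by simp [om_apply, ee]
  have hp := Ph.perp i φ
  have hp' := Ph.perp i ψ
  rw [uU, uU, sg_conj _ hp, dg_x h1 ha, dg_perp h1 ha hp (by simp [om_apply])]
  apply Sp.ext'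
  intro w
  rw [sg_apply (by rw [map_smul, LinearMap.smul_apply, hp, smul_zero]), sg_apply hp']
  have e : ((0, ψ.1) : VV 2 F) = a • (0, φ.1) := by rw [hψ]; ext <;> simp
  rw [e, map_smul, map_smul]
  simp only [smul_eq_mul]
  module

lemma tor_stable (i : Fin 2) {a : F} (ha : a ≠ 0) (W : Submodule F (VV 2 F)) (hW : W = W0 2 F ∨ W = W1 2 F) :
    ∀ x ∈ W, (dg ((ee i, 0) : VV 2 F) (0, ee i) a).1 x ∈ W := by
  have h1 : om ((ee i, 0) : VV 2 F) (0, ee i) = 1 := by simp [om_apply, ee]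
  intro x hx
  rw [dg_apply h1 ha]
  rcases hW with rfl | rfl
  · rw [mem_W0] at hx ⊢
    simp [om_apply, hx]
  · rw [mem_W1] at hx ⊢
    simp [om_apply, hx]

lemma uU_stable (i : Fin 2) (φ : Ph i F) (W : Submodule F (VV 2 F)) (hW : W = W0 2 F ∨ W = W1 2 F) :
    ∀ x ∈ W, (uU i φ).1 x ∈ W := by
  intro x hx
  rw [uU_apply]
  rcases hW with rfl | rfl
  · rw [mem_W0] at hx ⊢
    simp [hx]
  · rw [mem_W1] at hx ⊢
    simp [hx]

lemma Ph2 (i : Fin 2) {φ ψ : Ph i F} (hφ : φ ≠ 0) (hψ : ψ ≠ 0) : ∃ a : F, a ≠ 0 ∧ ψ.1 = a • φ.1 := by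
  obtain ⟨j, hj⟩ : ∃ j : Fin 2, ∀ l, l ≠ i → l = j := by
    fin_cases i
    · exact ⟨1, fun l hl => by fin_cases l <;> simp at *⟩
    · exact ⟨0, fun l hl => by fin_cases l <;> simp at *⟩
  have key : ∀ φ : Ph i F, φ ≠ 0 → φ.1 j ≠ 0 := by
    intro φ h h0
    apply h
    apply Subtype.ext
    funext l
    by_cases hl : l = i
    · rw [hl]; exact φ.2
    · rw [hj l hl]; exact h0
  refine ⟨ψ.1 j / φ.1 j, div_ne_zero (key ψ hψ) (key φ hφ), ?_⟩
  funext l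
  by_cases hl : l = i
  · subst hl
    have h1 : φ.1 l = 0 := φ.2
    have h2 : ψ.1 l = 0 := ψ.2
    simp [h1, h2]
  · rw [hj l hl]
    have := key φ hφ
    simp [this]

lemma CaseB.triv (h : CaseB 2 F bl k r p f t c) (i : Fin 2) (W : Submodule F (VV 2 F)) (hW : W = W0 2 F ∨ W = W1 2 F)
    (φ : Ph i F) {B : Finset P} (hB : B ∈ BW bl W) : uU i φ • B = B := by
  classical
  by_contra hne
  have hφ : φ ≠ 0 := by rintro rfl; rw [uU_zero, one_smul] at hne; exact hne rfl
  have hlt : (BW bl W).card < Nat.card F := by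
    rcases hW with rfl | rfl
    · exact h.BW0_lt
    · exact h.BW1_lt
  have stab : ∀ (φ : Ph i F), ∀ B ∈ BW bl W, uU i φ • B ∈ BW bl W := fun φ B hB =>
    h.BW_smul _ (inv_stable (uU_stable i φ W hW)) hB
  letI act : MulAction (Multiplicative (Ph i F)) (BW bl W) :=
    { smul := fun a B => ⟨uU i a.toAdd • B.1, stab _ _ B.2⟩
      one_smul := fun B => Subtype.ext (by change uU i 0 • B.1 = B.1; rw [uU_zero, one_smul])
      mul_smul := fun a b B => Subtype.ext (by
        change uU i (a.toAdd + b.toAdd) • B.1 = uU i a.toAdd • (uU i b.toAdd • B.1); rw [uU_add, mul_smul]) }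
  have act_def : ∀ (a : Multiplicative (Ph i F)) (B : BW bl W), (a • B).1 = uU i a.toAdd • B.1 := fun _ _ => rfl
  haveI : Fintype (Multiplicative (Ph i F)) := Fintype.ofFinite _
  have hcard : Fintype.card (Multiplicative (Ph i F)) = Nat.card F := by
    rw [← Nat.card_eq_fintype_card]
    change Nat.card (Ph i F) = _
    rw [Ph_card]; simp
  have hle : ∀ a b : Multiplicative (Ph i F), a ≠ 1 → b ≠ 1 →
      Nat.card (MulAction.fixedBy (BW bl W) a) ≤ Nat.card (MulAction.fixedBy (BW bl W) b) := by
    intro a b ha hb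
    obtain ⟨s, hs, hab⟩ := Ph2 i (φ := a.toAdd) (ψ := b.toAdd) ha hb
    have hc := tor_conj i a.toAdd hs b.toAdd hab
    set d := dg ((ee i, 0) : VV 2 F) (0, ee i) s
    have hd : ∀ B ∈ BW bl W, d • B ∈ BW bl W := fun B hB => h.BW_smul _ (inv_stable (tor_stable i hs W hW)) hB
    apply Nat.card_le_card_of_injective (fun B : MulAction.fixedBy (BW bl W) a =>
      (⟨⟨d • B.1.1, hd _ B.1.2⟩, by
        rw [MulAction.mem_fixedBy]
        apply Subtype.ext
        rw [act_def]
        have h1 : uU i a.toAdd • B.1.1 = B.1.1 := congrArg Subtype.val (MulAction.mem_fixedBy.1 B.2)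
        rw [← hc]
        change (d * uU i a.toAdd * d⁻¹) • d • B.1.1 = d • B.1.1
        rw [mul_smul, mul_smul, inv_smul_smul, h1]⟩ : MulAction.fixedBy (BW bl W) b))
    intro B B' he
    have h1 : d • B.1.1 = d • B'.1.1 := congrArg (fun x => x.1.1) he
    exact Subtype.ext (Subtype.ext (smul_left_cancel _ h1))
  have hb := burn (A := Multiplicative (Ph i F)) (Ω := BW bl W) {1} (Nat.card F)
    (Nat.card (MulAction.fixedBy (BW bl W) (Multiplicative.ofAdd φ))) (by simp) (by rw [hcard]; simp)
    (by intro a ha w; rw [Finset.mem_singleton] at ha; rw [ha, one_smul])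
    (by
      intro a ha
      rw [Finset.mem_singleton] at ha
      exact le_antisymm (hle _ _ ha hφ) (hle _ _ hφ ha))
    (by
      rw [← Nat.card_eq_fintype_card]
      apply Set.ncard_lt_card
      intro hu
      have h1 : (⟨B, hB⟩ : BW bl W) ∈ MulAction.fixedBy (BW bl W) (Multiplicative.ofAdd φ) := by
        rw [hu]; trivial
      exact hne (congrArg Subtype.val (MulAction.mem_fixedBy.1 h1)))
  rw [Fintype.card_coe] at hb
  omega

lemma CaseB.exPair (h : CaseB 2 F bl k r p f t c) : ∃ α : P, ∃ B ∈ BW bl (W0 2 F), ∃ B' ∈ BW bl (W1 2 F),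
    B ≠ B' ∧ α ∈ B ∧ α ∈ B' := by
  obtain ⟨B0, hB0, h0⟩ := h.exB0
  have hB0' : B0 ∈ BW bl (W0 2 F) := mem_BW.2 ⟨hB0, fun x hx => by
    by_cases hx0 : x = 0
    · rw [hx0]; exact zero_mem _
    · exact DS_NB (h0 x hx hx0)⟩
  obtain ⟨α, hα, B', hB', hne, hα'⟩ := h.ex2 hB0
  obtain ⟨g, hg⟩ := h.exLag hB'
  have hgN : ∀ x : Fin 2 → F, g.1 (x, 0) ∈ NB 2 F B' := by
    intro x
    by_cases hx : g.1 (x, 0) = 0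
    · rw [hx]; exact zero_mem _
    · exact DS_NB (hg _ ⟨(x, 0), rfl, rfl⟩ hx)
  obtain ⟨S, hS⟩ := ex_graph g (by
    intro x hx
    have h1 : g.1 (x, 0) = 0 := h.disj hB0 hB' hne hα hα' ((mem_BW.1 hB0').2 hx) (hgN x)
    have h2 : ((x, 0) : VV 2 F) = 0 := Sp.apply_eq_zero.1 h1
    exact congrArg Prod.fst h2)
  refine ⟨(nS S)⁻¹ • α, (nS S)⁻¹ • B0, h.BW_smul _ ?_ hB0', (nS S)⁻¹ • B', ?_, ?_, mem_smul_fin.2 hα, mem_smul_fin.2 hα'⟩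
  · intro x hx
    rw [inv_inv, nS_apply]; exact hx
  · refine mem_BW.2 ⟨h.sp.ftd.inv _ _ hB', fun x hx => ?_⟩
    obtain ⟨y, hy⟩ := hS x.2
    have h1 := NB_smul (hgN y) (nS S)⁻¹
    rw [hy] at h1
    have e : ((S.1.mulVec x.2, x.2) : VV 2 F) = (nS S).1 x := by
      rw [nS_apply]
      have : x.1 = 0 := hx
      rw [this, zero_add]
    rwa [e, Sp.inv_apply_self] at h1
  · intro he; exact hne (smul_left_cancel _ he)

lemma CaseB.two_false (h : CaseB 2 F bl k r p f t c) : False := by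
  obtain ⟨α, B, hB, B', hB', hne, hα, hα'⟩ := h.exPair
  have hq := h.q3
  have hu : ∀ (i : Fin 2) (φ : Ph i F), uU i φ • α = α := fun i φ =>
    h.ptfix (mem_BW.1 hB).1 (mem_BW.1 hB').1 hne hα hα' (h.triv i _ (Or.inl rfl) φ hB) (h.triv i _ (Or.inr rfl) φ hB')
  have hY := Y_small h.two hq (WS (MulAction.stabilizer (Sp 2 F) α))
    (by
      intro s S hS
      rw [mem_WS] at *
      rw [← uU_conj]
      exact Subgroup.mul_mem _ (Subgroup.mul_mem _ (hu _ _) hS) (Subgroup.inv_mem _ (hu _ _)))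
    (by
      intro s S hS
      rw [mem_WS] at *
      rw [← uU_conj]
      exact Subgroup.mul_mem _ (Subgroup.mul_mem _ (hu _ _) hS) (Subgroup.inv_mem _ (hu _ _)))
    (by
      intro d hd hm
      rw [mem_WS, mk2_sq0] at hm
      have := tv_eq_nS (ee 0 : Fin 2 → F) (-d)
      rw [neg_neg] at this
      rw [← this] at hm
      refine h.noTv α _ _ ?_ (neg_ne_zero.2 hd) hm
      intro h0
      have h1 : (ee 0 : Fin 2 → F) = 0 := congrArg Prod.fst h0
      have h2 := congrFun h1 0
      simp [ee] at h2)
  have hsq : ∀ (v : Fin 2 → F) (d : F), nS (sq v d) • B = B := by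
    intro v d
    have := tv_eq_nS v (-d)
    rw [neg_neg] at this
    rw [← this]
    by_cases hv : ((v, 0) : VV 2 F) = 0
    · rw [hv, tv_zero', one_smul]
    · exact (h.mem (mem_BW.1 hB).1 ((mem_BW.1 hB).2 (show ((v, 0) : VV 2 F) ∈ W0 2 F from rfl)) hv).2 (-d)
  have hA : ∀ S : Sy 2 F, nS S • B = B := by
    intro S
    rw [mk2_eta S, mk2_decomp, nS_add, nS_add, mul_smul, mul_smul, hsq, hsq, hsq]
  have h1 := orb_count (m := 2) (F := F) B α (fun S => by
    have := (mem_smul_fin (g := nS S)).2 hα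
    rwa [hA] at this)
  rw [h.sp.ftd.blk B (mem_BW.1 hB).1] at h1
  have h3 := Sy_card_ge (m := 2) (F := F)
  have h4 : (2 + 1).choose 2 = 3 := rfl
  rw [h4] at h3
  have h5 := h.twok
  have h6 : Nat.card (WS (MulAction.stabilizer (Sp 2 F) α)) * k ≤ Nat.card F * k := Nat.mul_le_mul_right _ hY
  have h7 : Nat.card F ^ 3 ≤ Nat.card F * k := by omega
  have h8 : Nat.card F * (2 * k) ≤ Nat.card F * k := by rw [h5]; linarith [pow_succ (Nat.card F) 2, h7, mul_comm (Nat.card F) (Nat.card F ^ 2)]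
  have h9 := Nat.le_of_mul_le_mul_left h8 (by omega)
  have := h.sp.ftd.k3
  omega

end m2

lemma CaseB.false {m : ℕ} {F : Type*} [Field F] [Finite F] {P : Type*} [MulAction (Sp m F) P] [Fintype P] [DecidableEq P]
    {bl : Finset (Finset P)} {k r p f t c : ℕ} (h : CaseB m F bl k r p f t c) : False := by
  have h1 := h.odd_m
  have h2 := h.sp.hm
  rcases Nat.lt_or_ge m 4 with h3 | h3
  · have : m = 2 := by
      interval_cases m
      · rfl
      · exact absurd (by decide) h1
    subst this
    exact h.two_false
  · exact h.big h3
end NFT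

namespace NFT
namespace Num

lemma dvd_plus {E Q r h t : ℕ} (hE : E ∣ Q) (hrh : r * h = Q + 1) (hd : E ∣ 1 + r * t) : E ∣ h + t := by
  have h1 : E ∣ h * (1 + r * t) := hd.mul_left _
  have e : h * (1 + r * t) = Q * t + (h + t) := by
    have : h * (1 + r * t) = h + (r * h) * t := by ring
    rw [this, hrh]; ring
  rw [e] at h1
  exact (Nat.dvd_add_right (hE.mul_right t)).1 h1

lemma dvd_minus {E Q r h t : ℕ} (hE : E ∣ Q) (hrh : r * h + 1 = Q) (hd : E ∣ 1 + r * t) : (E : ℤ) ∣ (h : ℤ) - t := by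
  have h1 : (E : ℤ) ∣ h * (1 + r * t) := by exact_mod_cast hd.mul_left h
  have h2 : (E : ℤ) ∣ Q := by exact_mod_cast hE
  have h3 : (Q : ℤ) = r * h + 1 := by exact_mod_cast hrh.symm
  have e : (h : ℤ) * (1 + r * t) = Q * t + (h - t) := by rw [h3]; ring
  rw [e] at h1
  exact (dvd_add_right (h2.mul_right _)).1 h1

lemma small_dvd {E a b : ℕ} (hd : (E : ℤ) ∣ (a : ℤ) - b) (ha : a < E) (hb : b < E) : a = b := by
  have := Int.eq_zero_of_abs_lt_dvd hd (by rw [abs_lt]; constructor <;> omega)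
  omega

lemma A_plus {Q r h t : ℕ} (hQ : ¬ 2 ∣ Q) (hr : r.Prime) (h3 : 3 ≤ r) (hrh : r * h = Q + 1) (hd : Q ∣ 1 + r * t)
    (ht : t + 1 ≤ r) (ht1 : 1 ≤ t) : False := by
  have h1 := Nat.le_of_dvd (by omega) (dvd_plus (dvd_refl Q) hrh hd)
  have h2 : h = 1 := by
    rcases Nat.lt_or_ge h 2 with h0 | h0
    · rcases Nat.eq_zero_or_pos h with h4 | h4
      · rw [h4] at hrh; omega
      · omega
    · nlinarith
  rw [h2, mul_one] at hrh
  have : 2 ∣ r := by omega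
  have := (Nat.prime_dvd_prime_iff_eq Nat.prime_two hr).1 this
  omega

lemma A_minus {Q r h t : ℕ} (h3 : 3 ≤ r) (hrh : r * h + 1 = Q) (hd : Q ∣ 1 + r * t)
    (ht : t + 1 ≤ r) (hh : 1 ≤ h) : 1 + r * t = Q := by
  have := small_dvd (dvd_minus (dvd_refl Q) hrh hd) (by nlinarith) (by nlinarith)
  rw [← this, ← hrh]; ring

lemma not_pow2 {n : ℕ} : 2 ^ n ≠ 14 ∧ 2 ^ n ≠ 6 := by
  rcases Nat.lt_or_ge n 4 with h | h
  · interval_cases n <;> norm_num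
  · have := Nat.pow_le_pow_right (show 0 < 2 by norm_num) h
    omega

/-- plus, E = Q/2 -/
lemma B_plus {n E r h t : ℕ} (hQ : 2 ^ n = 2 * E) (hE : 4 ≤ E) (h3 : 3 ≤ r) (hrh : r * h = 2 * E + 1)
    (hd : E ∣ 1 + r * t) (ht : t + 1 ≤ r) (ht1 : 1 ≤ t) (hv : 5 ≤ 1 + r * t) :
    r = 2 * E + 1 ∧ (t + 1 = E ∨ t + 1 = 2 * E) := by
  have hn := @not_pow2 n
  rw [hQ] at hn
  have hdv := dvd_plus (Dvd.intro_left 2 rfl) hrh hd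
  have h1 := Nat.le_of_dvd (by omega) hdv
  have h2 : h = 1 := by
    by_contra h0
    have hodd : ∀ a b : ℕ, a * b = 2 * E + 1 → a % 2 = 1 := by
      intro a b hab
      by_contra hc
      have : 2 ∣ a := by omega
      have := this.mul_right b
      omega
    have a1 := hodd r h hrh
    have a2 := hodd h r (by rw [mul_comm]; exact hrh)
    have a3 : 3 ≤ h := by omega
    obtain ⟨x, rfl⟩ := Nat.exists_eq_add_of_le h3
    obtain ⟨y, rfl⟩ := Nat.exists_eq_add_of_le a3
    have a4 : x + y + x * y ≤ 2 := by nlinarith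
    have a5 : x ≤ 2 := by nlinarith
    have a6 : y ≤ 2 := by nlinarith
    interval_cases x <;> interval_cases y <;> (try omega)
    have : t = 1 ∨ t = 2 := by omega
    rcases this with rfl | rfl
    · omega
    · have e : E = 4 := by omega
      rw [e] at hd; omega
  rw [h2, mul_one] at hrh
  refine ⟨hrh, ?_⟩
  rw [h2] at hdv h1
  obtain ⟨j, hj⟩ := hdv
  have : j < 3 := by
    by_contra hc; push Not at hc
    have := Nat.mul_le_mul_left E hc
    omega
  interval_cases j <;> omega

lemma lamc {r lam c t Q : ℕ} (hr : r = lam + c + lam * c * t) (hQ : r = Q + 1) (hl : 1 ≤ lam) (hc : 1 ≤ c) :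
    Q + (lam - 1) * (c - 1) = lam * c * (t + 1) := by
  obtain ⟨x, rfl⟩ := Nat.exists_eq_add_of_le hl
  obtain ⟨y, rfl⟩ := Nat.exists_eq_add_of_le hc
  simp only [Nat.add_sub_cancel_left]
  nlinarith

lemma B_plus_ns {E r t lam c : ℕ} (hE : 4 ≤ E) (hrE : r = 2 * E + 1) (ht : t + 1 = E ∨ t + 1 = 2 * E)
    (hr : r = lam + c + lam * c * t) (hl : 1 ≤ lam) (hc : 1 ≤ c) :
    c = 1 ∨ (lam = 1 ∧ 2 ≤ c ∧ c * (t + 1) = 2 * E) := by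
  have h1 := lamc hr hrE hl hc
  by_cases h2 : c = 1
  · exact Or.inl h2
  by_cases h3 : lam = 1
  · right
    subst h3
    refine ⟨rfl, by omega, ?_⟩
    simp at h1; omega
  exfalso
  have h4 : E ≤ t + 1 := by omega
  have h5 := Nat.mul_le_mul_left (lam * c) h4
  obtain ⟨x, rfl⟩ := Nat.exists_eq_add_of_le (show 2 ≤ lam by omega)
  obtain ⟨y, rfl⟩ := Nat.exists_eq_add_of_le (show 2 ≤ c by omega)
  have e1 : 2 + x - 1 = 1 + x := by omega
  have e2 : 2 + y - 1 = 1 + y := by omega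
  rw [e1, e2] at h1
  have h6 : (2 + x) * (2 + y) * E ≤ 2 * E + (1 + x) * (1 + y) := by omega
  have h7 : 0 ≤ x * y := Nat.zero_le _
  nlinarith [Nat.mul_le_mul_left (x * y) hE, Nat.mul_le_mul_left x hE, Nat.mul_le_mul_left y hE]

lemma B_plus_sym {E r t lam : ℕ} (hE : 4 ≤ E) (hrE : r = 2 * E + 1) (ht : t + 1 = E ∨ t + 1 = 2 * E)
    (hr : lam * t = r - 1) : False := by
  have h1 : t ∣ 2 * E := ⟨lam, by rw [mul_comm t, hr, hrE]; omega⟩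
  rcases ht with h | h
  · have : 2 * E = 2 * t + 2 := by omega
    rw [this] at h1
    have := Nat.le_of_dvd (by norm_num) ((Nat.dvd_add_right (Dvd.intro_left 2 rfl)).1 h1)
    omega
  · rw [← h] at h1
    have := Nat.le_of_dvd (by norm_num) ((Nat.dvd_add_right (dvd_refl t)).1 h1)
    omega

lemma B_minus {n E r h t : ℕ} (hQ : 2 ^ n = 2 * E) (hE : 4 ≤ E) (h3 : 3 ≤ r) (hrh : r * h + 1 = 2 * E)
    (hd : E ∣ 1 + r * t) (ht : t + 1 ≤ r) (ht1 : 1 ≤ t) :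
    1 + r * t = 2 * E ∨ (r + 1 = 2 * E ∧ t = E + 1) := by
  have hdv := dvd_minus (Dvd.intro_left 2 rfl) hrh hd
  have hh : h < E := by nlinarith
  have hh1 : 1 ≤ h := by rcases Nat.eq_zero_or_pos h with h4 | h4; (rw [h4] at hrh; omega); exact h4
  by_cases hth : t = h
  · left; rw [hth, ← hrh]; ring
  right
  rcases Nat.lt_or_ge t h with h0 | h0
  · exact absurd (small_dvd hdv hh (by omega)).symm hth
  · have h1 : E ≤ t - h := by
      apply Nat.le_of_dvd (by omega)
      have : ((t - h : ℕ) : ℤ) = -((h : ℤ) - t) := by omega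
      have h5 : (E : ℤ) ∣ ((t - h : ℕ) : ℤ) := by rw [this]; exact (dvd_neg).2 hdv
      exact_mod_cast h5
    have h2 : h = 1 := by
      by_contra hc
      have h22 : 2 ≤ h := by omega
      have h23 : r * 2 ≤ r * h := Nat.mul_le_mul_left r h22
      omega
    subst h2
    have h4 : t = E + 1 := by
      by_contra hne
      have h5 : (E : ℤ) ∣ (t : ℤ) - (E + 1 : ℕ) := by
        have : (t : ℤ) - (E + 1 : ℕ) = -(((1 : ℕ) : ℤ) - t) - E := by push_cast; ring
        rw [this]; exact dvd_sub ((dvd_neg).2 hdv) (dvd_refl _)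
      have := Int.eq_zero_of_abs_lt_dvd h5 (by rw [abs_lt]; constructor <;> push_cast <;> omega)
      push_cast at this
      omega
    exact ⟨by omega, h4⟩

lemma B_minus2_ns {E r t lam c : ℕ} (hE : 4 ≤ E) (hrE : r + 1 = 2 * E) (ht : t = E + 1)
    (hr : r = lam + c + lam * c * t) (hl : 1 ≤ lam) (hc : 1 ≤ c) : c = 1 ∧ E = 4 := by
  have h1 : lam * c < 2 := by
    by_contra h0
    push Not at h0
    have := Nat.mul_le_mul_right t h0
    omega
  have h2 : c = 1 := by nlinarith
  have h4 : lam = 1 := by nlinarith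
  subst h2; subst h4
  refine ⟨rfl, by omega⟩

lemma B_minus2_sym {n E r t lam : ℕ} (hQ : 2 ^ n = 2 * E) (hE : 4 ≤ E) (hrE : r + 1 = 2 * E) (ht : t = E + 1)
    (hr : lam * t = r - 1) : False := by
  have hn := @not_pow2 n
  rw [hQ] at hn
  rcases Nat.lt_or_ge lam 2 with h | h
  · interval_cases lam
    · omega
    · omega
  · have := Nat.mul_le_mul_right t h
    omega

/-- partial minus : r (q-1) = Q - 1 -/
lemma P_minus_r {q D r h s : ℕ} (hq : 3 ≤ q) (hr : r.Prime) (hs : s * (q - 1) + 1 = q * D) (hD : q ≤ D)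
    (hrh : r * h + 1 = q * D) (hrD : D < r) : r * (q - 1) + 1 = q * D := by
  have h1 : r ∣ s * (q - 1) := ⟨h, by omega⟩
  rcases hr.dvd_mul.1 h1 with h2 | h2
  · obtain ⟨g, hg⟩ := h2
    have : g = 1 := by
      rcases Nat.lt_or_ge g 2 with h0 | h0
      · interval_cases g
        · simp at hg; subst hg; nlinarith
        · rfl
      · exfalso
        obtain ⟨y, rfl⟩ := Nat.exists_eq_add_of_le hq
        have e : 3 + y - 1 = 2 + y := by omega
        rw [e] at hs
        have h4 : 2 * (D + 1) ≤ s := by rw [hg]; nlinarith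
        nlinarith
    rw [this, mul_one] at hg
    rw [← hg]; exact hs
  · have := Nat.le_of_dvd (by omega) h2
    omega

lemma P_minus_odd {q D E r t : ℕ} (hq : 3 ≤ q) (hD : q ≤ D) (hE : E ∣ q * D) (hE3 : 3 * D ≤ E)
    (hrh : r * (q - 1) + 1 = q * D) (hd : E ∣ 1 + r * t) (ht : t + 1 ≤ r) : 1 + r * t = q * D := by
  have h1 := dvd_minus hE hrh hd
  obtain ⟨y, rfl⟩ := Nat.exists_eq_add_of_le hq
  have e : 3 + y - 1 = 2 + y := by omega
  rw [e] at hrh h1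
  have h2 : r < 3 * D := by nlinarith
  have := small_dvd h1 (by omega) (by omega)
  rw [← this, ← hrh]; ring

lemma P_minus_even {q D r t : ℕ} (hq : 4 ≤ q) (hD : q ≤ D)
    (hrh : r * (q - 1) + 1 = q * D) (hd : D ∣ 1 + r * t) (ht : t + 1 ≤ r) :
    r < 2 * D ∧ (1 + r * t = q * D ∨ t = q - 1 + D) := by
  have h1 := dvd_minus (Dvd.intro_left q rfl) hrh hd
  obtain ⟨y, rfl⟩ := Nat.exists_eq_add_of_le hq
  have e : 4 + y - 1 = 3 + y := by omega
  rw [e] at hrh h1 ⊢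
  have h2 : r < 2 * D := by nlinarith
  refine ⟨h2, ?_⟩
  rcases Nat.lt_or_ge t D with h3 | h3
  · left
    have := small_dvd h1 (by omega) h3
    rw [← this, ← hrh]; ring
  · right
    have h5 : (D : ℤ) ∣ ((3 + y : ℕ) : ℤ) - ((t - D : ℕ) : ℤ) := by
      have : ((3 + y : ℕ) : ℤ) - ((t - D : ℕ) : ℤ) = (((3 + y : ℕ) : ℤ) - t) + D := by omega
      rw [this]; exact dvd_add h1 (dvd_refl _)
    have := small_dvd h5 (by omega) (by omega)
    omega

lemma P_minus_ns {q D r t lam c : ℕ} (hr2 : r < 2 * D) (ht : t = q - 1 + D)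
    (hr : r = lam + c + lam * c * t) (hl : 1 ≤ lam) (hc : 1 ≤ c) : c = 1 := by
  have h1 : lam * c < 2 := by
    by_contra h0
    push Not at h0
    have := Nat.mul_le_mul_right t h0
    omega
  nlinarith

lemma P_minus_sym {q D r t lam : ℕ} (hq : 4 ≤ q) (h2q : 2 ∣ q) (h2D : 2 ∣ D) (hp : r.Prime) (h3 : 3 ≤ r)
    (hr2 : r < 2 * D) (ht : t = q - 1 + D) (hr : lam * t = r - 1) : False := by
  rcases Nat.lt_or_ge lam 2 with h | h
  · interval_cases lam
    · omega
    · have : 2 ∣ r := by omega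
      have := (Nat.prime_dvd_prime_iff_eq Nat.prime_two hp).1 this
      omega
  · have := Nat.mul_le_mul_right t h
    omega

lemma P_plus_even_ns {q D r t lam c : ℕ} (hq : 4 ≤ q) (hD : q ≤ D) (hrQ : r = q * D + 1) (hd : D ∣ 1 + r * t)
    (hr : r = lam + c + lam * c * t) (hl : 1 ≤ lam) (hc : 1 ≤ c) :
    c = 1 ∨ (lam = 1 ∧ 2 ≤ c ∧ c * (t + 1) = q * D) := by
  have h1 := lamc hr hrQ hl hc
  by_cases h2 : c = 1
  · exact Or.inl h2
  by_cases h3 : lam = 1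
  · right
    subst h3
    refine ⟨rfl, by omega, ?_⟩
    simp at h1; omega
  exfalso
  have hd1 : D ∣ 1 + t := dvd_plus (Q := q * D) (h := 1) (Dvd.intro_left q rfl) (by rw [mul_one, hrQ]) hd
  rw [add_comm] at hd1
  have h4 := Nat.le_of_dvd (by omega) hd1
  have h5 : D ∣ (lam - 1) * (c - 1) := by
    have h6 : D ∣ q * D + (lam - 1) * (c - 1) := by rw [h1]; exact hd1.mul_left _
    exact (Nat.dvd_add_right (Dvd.intro_left q rfl)).1 h6
  obtain ⟨x, rfl⟩ := Nat.exists_eq_add_of_le (show 2 ≤ lam by omega)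
  obtain ⟨y, rfl⟩ := Nat.exists_eq_add_of_le (show 2 ≤ c by omega)
  have e1 : 2 + x - 1 = 1 + x := by omega
  have e2 : 2 + y - 1 = 1 + y := by omega
  rw [e1, e2] at h1 h5
  have h6 := Nat.le_of_dvd (by positivity) h5
  have h7 := Nat.mul_le_mul_left ((2 + x) * (2 + y)) h4
  have h8 := Nat.mul_le_mul_right D hD
  set M := (1 + x) * (1 + y) with hM
  have h9 : (2 + x) * (2 + y) = M + x + y + 3 := by rw [hM]; ring
  rw [h9] at h7 h1
  have h10 : (M + 3) * D ≤ q * D + M := by nlinarith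
  nlinarith

lemma P_plus_even_sym {n q D r t lam : ℕ} (hn : 2 ^ n = q * D) (hq : 4 ≤ q) (hD : q ≤ D) (h2D : 2 ∣ D) (hrQ : r = q * D + 1)
    (hd : D ∣ 1 + r * t) (hr : lam * t = r - 1) : False := by
  have hd1 : D ∣ 1 + t := dvd_plus (Q := q * D) (h := 1) (Dvd.intro_left q rfl) (by rw [mul_one, hrQ]) hd
  have h1 : t ∣ 2 ^ n := ⟨lam, by rw [hn, mul_comm t, hr, hrQ]; omega⟩
  obtain ⟨i, -, hi⟩ := (Nat.dvd_prime_pow Nat.prime_two).1 h1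
  have h2 : 2 ∣ 1 + t := h2D.trans hd1
  rcases i with _ | i
  · simp at hi; rw [hi] at hd1
    have := Nat.le_of_dvd (by norm_num) hd1
    omega
  · rw [pow_succ] at hi; omega

lemma P_plus_odd_r {Q r : ℕ} (hQ : ¬ 2 ∣ Q) (hp : r.Prime) (h3 : 3 ≤ r) (hd : r ∣ Q + 1) (hx : Q + 1 ≤ 2 * r) : 2 * r = Q + 1 := by
  obtain ⟨h, hh⟩ := hd
  have : h ≤ 2 := by
    by_contra hc
    have : 3 ≤ h := by omega
    nlinarith
  interval_cases h
  · omega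
  · have : 2 ∣ r := by omega
    have := (Nat.prime_dvd_prime_iff_eq Nat.prime_two hp).1 this
    omega
  · omega

lemma P_plus_odd_ns {q D E r t lam c : ℕ} (hq : 3 ≤ q) (hD : q ≤ D) (hE : E ∣ q * D) (hE3 : 3 * D ≤ E) (hrQ : 2 * r = q * D + 1)
    (hd : E ∣ 1 + r * t) (hr : r = lam + c + lam * c * t) (hl : 1 ≤ lam) (hc : 1 ≤ c) : False := by
  have hd1 : E ∣ 2 + t := dvd_plus (Q := q * D) (h := 2) hE (by rw [mul_comm, hrQ]) hd
  have h4 := Nat.le_of_dvd (by omega) hd1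
  obtain ⟨x, rfl⟩ := Nat.exists_eq_add_of_le hl
  obtain ⟨y, rfl⟩ := Nat.exists_eq_add_of_le hc
  have h1 : q * D + (1 + 2 * x) * (1 + 2 * y) = 2 * (1 + x) * (1 + y) * (2 + t) := by nlinarith
  have h5 : E ∣ (1 + 2 * x) * (1 + 2 * y) := by
    have h6 : E ∣ q * D + (1 + 2 * x) * (1 + 2 * y) := by rw [h1]; exact hd1.mul_left _
    exact (Nat.dvd_add_right hE).1 h6
  have h6 := Nat.le_of_dvd (by positivity) h5
  have h7 := Nat.mul_le_mul_left (4 * ((1 + x) * (1 + y))) h4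
  set M := (1 + 2 * x) * (1 + 2 * y) with hM
  have h9 : 4 * ((1 + x) * (1 + y)) = M + 2 * x + 2 * y + 3 := by rw [hM]; ring
  have h10 : 2 * (q * D) + 2 * M = 4 * ((1 + x) * (1 + y)) * (2 + t) := by nlinarith
  rw [← h10, h9] at h7
  have h11 : (M + 3) * E ≤ 2 * (q * D) + 2 * M := by nlinarith
  have h12 : q * D ≤ D * D := Nat.mul_le_mul_right D hD
  nlinarith

lemma P_plus_odd_sym {q D E r t lam : ℕ} (hq : 3 ≤ q) (hD : q ≤ D) (hE : E ∣ q * D) (hE3 : 3 * D ≤ E) (hrQ : 2 * r = q * D + 1)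
    (hd : E ∣ 1 + r * t) (h3 : 3 ≤ r) (hr : lam * t = r - 1) : False := by
  have hd1 : E ∣ 2 + t := dvd_plus (Q := q * D) (h := 2) hE (by rw [mul_comm, hrQ]) hd
  have h4 := Nat.le_of_dvd (by omega) hd1
  have hl : 1 ≤ lam := by
    rcases Nat.eq_zero_or_pos lam with h | h
    · rw [h] at hr; omega
    · exact h
  have hr' : lam * t + 1 = r := by omega
  have h1 : q * D + (4 * lam - 1) = 2 * lam * (2 + t) := by
    have : q * D + 4 * lam = 2 * lam * (2 + t) + 1 := by nlinarith
    omega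
  have h5 : E ∣ 4 * lam - 1 := by
    have h6 : E ∣ q * D + (4 * lam - 1) := by rw [h1]; exact hd1.mul_left _
    exact (Nat.dvd_add_right hE).1 h6
  have h6 := Nat.le_of_dvd (by omega) h5
  have h7 := Nat.mul_le_mul_left (2 * lam) h4
  have h8 : 2 * lam * E + 1 ≤ q * D + 4 * lam := by omega
  have h12 : q * D ≤ D * D := Nat.mul_le_mul_right D hD
  have h13 : E + 1 ≤ 4 * lam := by omega
  have h14 : (E + 1) * (E - 2) ≤ 4 * lam * (E - 2) := Nat.mul_le_mul_right _ h13
  obtain ⟨z, rfl⟩ := Nat.exists_eq_add_of_le (show 2 ≤ E by omega)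
  simp only [Nat.add_sub_cancel_left] at h14
  nlinarith

end Num
end NFT

namespace NFT

section
variable {m : ℕ} {F : Type*} [Field F] [Finite F] {P : Type*} [MulAction (Sp m F) P] [Fintype P] [DecidableEq P]
  {bl : Finset (Finset P)} {k lam r p f : ℕ}

lemma SpD.q2 (h : SpD m F bl k lam r p f) : 2 ≤ Nat.card F := by
  rw [h.hq]
  exact h.hp.two_le.trans (Nat.le_self_pow (by have := h.f1; omega) p)

lemma SpD.p_dvd_q (h : SpD m F bl k lam r p f) : p ∣ Nat.card F := by
  rw [h.hq]; exact dvd_pow_self p (by have := h.f1; omega)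

lemma SpD.two_dvd (h : SpD m F bl k lam r p f) (hd : 2 ∣ Nat.card F) : p = 2 := by
  rw [h.hq] at hd
  exact ((Nat.prime_dvd_prime_iff_eq Nat.prime_two h.hp).1 (Nat.prime_two.dvd_of_dvd_pow hd)).symm

lemma SpD.qD (h : SpD m F bl k lam r p f) : Nat.card F ^ m = Nat.card F * Nat.card F ^ (m - 1) := by
  rw [mul_comm, ← pow_succ]; congr 1; have := h.hm; omega

lemma SpD.DD (h : SpD m F bl k lam r p f) : Nat.card F ^ (2 * m - 2) = Nat.card F ^ (m - 1) * Nat.card F ^ (m - 1) := by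
  rw [← pow_add]; congr 1; have := h.hm; omega

lemma SpD.qleD (h : SpD m F bl k lam r p f) : Nat.card F ≤ Nat.card F ^ (m - 1) :=
  Nat.le_self_pow (by have := h.hm; omega) _

lemma SpD.not_two_dvd (h : SpD m F bl k lam r p f) (hp : p ≠ 2) : ¬ 2 ∣ Nat.card F ^ m := fun hd =>
  hp (h.two_dvd (Nat.prime_two.dvd_of_dvd_pow hd))

lemma SpD.ftdlam (h : SpD m F bl k lam r p f) : 1 ≤ lam := h.ftd.lam1

/-- no transvection fixes a point, odd characteristic -/
lemma SpD.caseA (h : SpD m F bl k lam r p f) (hp : p ≠ 2) (hN : NoTv m F P) : False := by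
  obtain ⟨t, ht1, ht, hv, hk, hcase⟩ := h.ftd.params
  have h3 := h.ftd.r3
  have hd := h.div_N_odd hp hN
  rw [hv] at hd
  have hb := h.big_odd hp
  rw [h.DD, hv] at hb
  have hq := h.qD
  have hqD := h.qleD
  rcases h.r_dvd with hr | hr
  · have h1 : 1 ≤ Nat.card F ^ m := Nat.one_le_pow _ _ (by have := h.q2; omega)
    obtain ⟨e, he⟩ := hr
    have he' : r * e + 1 = Nat.card F ^ m := by omega
    have he1 : 1 ≤ e := by
      rcases Nat.eq_zero_or_pos e with h0 | h0
      · rw [h0] at he'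
        have h2 := h.q2
        have : 2 * 2 ≤ Nat.card F * Nat.card F ^ (m - 1) := Nat.mul_le_mul h2 (h2.trans hqD)
        omega
      · exact h0
    have := Num.A_minus h3 he' hd ht he1
    have h4 : Nat.card F * Nat.card F ^ (m - 1) ≤ Nat.card F ^ (m - 1) * Nat.card F ^ (m - 1) :=
      Nat.mul_le_mul_right _ hqD
    omega
  · obtain ⟨e, he⟩ := hr
    exact Num.A_plus (h.not_two_dvd hp) h.ftd.prime h3 he.symm hd ht ht1

/-- building case (b) -/
lemma SpD.toB (h : SpD m F bl k lam r p f) (hp : p = 2) {t c : ℕ} (hl : lam = 1)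
    (hr : r = Nat.card F ^ m + 1) (hv : Fintype.card P = 1 + r * t) (hk : k = 1 + lam * t) (hc : 2 ≤ c)
    (hct : c * (t + 1) = Nat.card F ^ m) (hb : bl.card = r * (1 + c * t)) : False := by
  subst hl
  exact CaseB.false (t := t) (c := c) (m := m) (F := F) (bl := bl) (k := k) (r := r) (p := p) (f := f)
    { sp := h, p2 := hp, hr := hr, hv := hv, hk := by omega, hc := hc, hct := hct, hb := hb }

lemma SpD.q_even (h : SpD m F bl k lam r p f) (hp : p = 2) (hq : 2 < Nat.card F) : 4 ≤ Nat.card F := by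
  have := h.p_dvd_q
  rw [hp] at this
  omega

/-- even characteristic, divisibility by `Q / 2` -/
lemma SpD.caseN_even (h : SpD m F bl k lam r p f) (hp : p = 2) (hN : NoTv m F P ∨ Nat.card F = 2) : False := by
  obtain ⟨t, ht1, ht, hv, hk, hcase⟩ := h.ftd.params
  have h3 := h.ftd.r3
  have hkv := h.ftd.kv
  have hk3 := h.ftd.k3
  have hl := h.ftd.lam1
  obtain ⟨E, hE, hd⟩ := h.div_N_even hp hN
  rw [hv] at hd
  have hQ : 2 ^ (f * m) = 2 * E := by rw [← hE, h.hq, hp, pow_mul]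
  have hq := h.qD
  have hqD := h.qleD
  have h2 := h.q2
  have hDD := h.DD
  have hone : ∀ (hb : bl.card = r * (1 + 1 * t)), _ := fun hb => h.c_one hp hv hb
  have hbe := h.big_even hp
  have hbt := h.big_two
  have hm3 := h.m3
  have hpr := h.ftd.prime
  rw [hv] at hkv hbe hbt
  rw [hDD] at hbe hone
  have hrd := h.r_dvd
  have htoB : ∀ c, lam = 1 → r = 2 * E + 1 → 2 ≤ c → c * (t + 1) = 2 * E → bl.card = r * (1 + c * t) → False :=
    fun c h1 h2 h3 h4 h5 => h.toB hp h1 (by rw [h2, hE]) hv hk h3 (by rw [h4, hE]) h5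
  rw [hE] at hrd hq
  -- E small data
  have hcases : (Nat.card F = 2 ∧ 2 ^ (2 * m - 2) = 4 ^ (m - 3) * 16 ∧ 2 ^ (m - 1) = 2 ^ (m - 3) * 4 ∧ E = 2 ^ (m - 3) * 4 ∧
      4 ^ (m - 3) = 2 ^ (m - 3) * 2 ^ (m - 3)) ∨
      (4 ≤ Nat.card F ∧ 8 ≤ E) := by
    by_cases hc2 : Nat.card F = 2
    · left
      have := hm3 hc2
      obtain ⟨n, rfl⟩ := Nat.exists_eq_add_of_le this
      refine ⟨hc2, ?_, ?_, ?_, ?_⟩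
      · have : 2 * (3 + n) - 2 = 2 * n + 4 := by omega
        rw [this, pow_add, pow_mul]; simp
      · have : 3 + n - 1 = n + 2 := by omega
        rw [this, pow_add]; simp
      · rw [hc2] at hE
        have : 3 + n - 3 = n := by omega
        rw [this]
        rw [pow_add] at hE
        omega
      · rw [← mul_pow]; norm_num
    · right
      have h4 := h.q_even hp (by omega)
      refine ⟨h4, ?_⟩
      have : 4 * 4 ≤ Nat.card F * Nat.card F ^ (m - 1) := Nat.mul_le_mul h4 (h4.trans hqD)
      omega
  have hE4 : 4 ≤ E := by
    rcases hcases with hh | hh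
    · have := Nat.one_le_two_pow (n := m - 3)
      omega
    · omega
  rcases hrd with hr | hr
  · obtain ⟨e, he⟩ := hr
    have he' : r * e + 1 = 2 * E := by omega
    rcases Num.B_minus hQ hE4 h3 he' hd ht ht1 with h5 | ⟨h5, h6⟩
    · -- v = Q
      rcases hcases with ⟨c1, c2, c3, c4, c5⟩ | ⟨c1, c2⟩
      · have hb := hbt c1
        rw [c2, c3] at hb
        set z := 2 ^ (m - 3) with hz
        have hz1 : z = 1 := by
          have hz0 : 1 ≤ z := Nat.one_le_two_pow
          by_contra hne
          have hz2 : 2 ≤ z := by omega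
          rw [c5] at hb
          have := Nat.mul_le_mul_right z hz2
          omega
        rw [hz1] at c4 c3 c5
        have hv8 : r * t = 7 := by omega
        have hr7 : r ∣ 7 := ⟨t, hv8.symm⟩
        have hr7' : r = 7 := by
          rcases (Nat.dvd_prime (by norm_num)).1 hr7 with h8 | h8 <;> omega
        subst hr7'
        have ht7 : t = 1 := by omega
        subst ht7
        rcases hcase with h9 | ⟨c, hc1, hc2, hc3, hc4⟩
        · omega
        · have hlam : lam ≤ 7 := by omega
          have hcc : c ≤ 7 := by omega
          have hc1 : c = 1 := by
            by_contra hcn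
            have : lam * 2 ≤ lam * c := Nat.mul_le_mul_left _ (by omega)
            have : lam = 1 := by omega
            omega
          subst hc1
          have := (hone hc4).2 c1
          rw [c2, c3, c5] at this
          omega
      · have := hbe (by omega)
        have h8 : Nat.card F * Nat.card F ^ (m - 1) ≤ Nat.card F ^ (m - 1) * Nat.card F ^ (m - 1) :=
          Nat.mul_le_mul_right _ hqD
        omega
    · rcases hcase with h9 | ⟨c, hc1, hc2, hc3, hc4⟩
      · exact Num.B_minus2_sym hQ hE4 h5 h6 h9
      · obtain ⟨rfl, rfl⟩ := Num.B_minus2_ns hE4 h5 h6 hc2 hl hc1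
        rcases hcases with ⟨c1, c2, c3, c4, c5⟩ | ⟨c1, c2⟩
        · have := (hone hc4).2 c1
          have hz1 : 2 ^ (m - 3) = 1 := by omega
          rw [c2, c3, c5, hz1] at this
          omega
        · omega
  · obtain ⟨e, he⟩ := hr
    have hv5 : 5 ≤ 1 + r * t := by omega
    obtain ⟨h5, h6⟩ := Num.B_plus hQ hE4 h3 he.symm hd ht ht1 hv5
    rcases hcase with h9 | ⟨c, hc1, hc2, hc3, hc4⟩
    · exact Num.B_plus_sym hE4 h5 h6 h9
    · rcases Num.B_plus_ns hE4 h5 h6 hc2 hl hc1 with rfl | ⟨h7, h8, h9⟩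
      · rcases hcases with ⟨c1, c2, c3, c4, c5⟩ | ⟨c1, c2⟩
        · have hb := (hone hc4).2 c1
          rw [c2, c3, c5] at hb
          set z := 2 ^ (m - 3) with hz
          have hz1 : z = 1 := by
            have hz0 : 1 ≤ z := Nat.one_le_two_pow
            by_contra hne
            have hz2 : 2 ≤ z := by omega
            have := Nat.mul_le_mul_right z hz2
            omega
          have : r = 9 := by omega
          rw [this] at hpr
          norm_num at hpr
        · have := (hone hc4).1 (by omega)
          have h8 : Nat.card F * Nat.card F ^ (m - 1) ≤ Nat.card F ^ (m - 1) * Nat.card F ^ (m - 1) :=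
            Nat.mul_le_mul_right _ hqD
          omega
      · exact htoB c h7 h5 h8 h9 hc4

/-- partial case -/
lemma SpD.caseP (h : SpD m F bl k lam r p f) (hq2 : 2 < Nat.card F) {α : P} {x : VV m F} {c : F} (hx : x ≠ 0)
    (hc : c ≠ 0) (htv : tv x c • α = α) : False := by
  obtain ⟨t, ht1, ht, hv, hk, hcase⟩ := h.ftd.params
  have h3 := h.ftd.r3
  have hl := h.ftd.lam1
  have hpr := h.ftd.prime
  have hq := h.qD
  have hqD := h.qleD
  have hDD := h.DD
  have hone : ∀ (hp : p = 2) (hb : bl.card = r * (1 + 1 * t)), _ := fun hp hb => (h.c_one hp hv hb).1 hq2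
  have hbe : p = 2 → _ := fun hp => h.big_even hp hq2
  have hbo := h.big_odd
  have hdiv := h.div_P hq2
  have hvlt := h.ftd.v_lt
  have hex := fun hd hb => h.exactness hq2 hx hc htv hd hb
  have hrd := h.r_dvd
  have hnt := h.not_two_dvd
  have hpq := h.p_dvd_q
  have hp3 : p ≠ 2 → 3 ≤ p := fun hp => by have := h.hp.two_le; omega
  have hqe := fun hp => h.q_even hp hq2
  have hQ2 : p = 2 → 2 ^ (f * m) = Nat.card F ^ m := fun hp => by rw [h.hq, hp, pow_mul]
  have h2D : p = 2 → 2 ∣ Nat.card F ^ (m - 1) := fun hp => by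
    rw [hp] at hpq
    exact hpq.trans (dvd_pow_self _ (by have := h.hm; omega))
  have htoB : p = 2 → ∀ c, lam = 1 → r = Nat.card F ^ m + 1 → 2 ≤ c → c * (t + 1) = Nat.card F ^ m →
      bl.card = r * (1 + c * t) → False :=
    fun hp c h1 h2 h3 h4 h5 => h.toB hp h1 h2 hv hk h3 h4 h5
  obtain ⟨s, hs⟩ : ∃ s, s * (Nat.card F - 1) + 1 = Nat.card F ^ m := by
    have h1 : Nat.card F - 1 ∣ Nat.card F ^ m - 1 := by simpa using Nat.sub_dvd_pow_sub_pow (Nat.card F) 1 m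
    obtain ⟨s, hs⟩ := h1
    have : 1 ≤ Nat.card F ^ m := Nat.one_le_pow _ _ (by omega)
    refine ⟨s, ?_⟩
    rw [mul_comm, ← hs]; omega
  rw [hv] at hbe hbo hdiv hvlt
  rw [hDD] at hbe hbo hone
  rw [hq] at hs hrd hex htoB hQ2 hnt
  clear hx hc htv
  generalize hqq : Nat.card F = q at *
  generalize hDe : q ^ (m - 1) = D at *
  have hqqD : q * D ≤ D * D := Nat.mul_le_mul_right _ hqD
  have hDv : D * D < 1 + r * t := by
    by_cases hp : p = 2
    · have := hbe hp; omega
    · exact hbo hp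
  have hDr : D < r := by
    by_contra hcon
    have : r * r ≤ D * D := Nat.mul_le_mul (by omega) (by omega)
    rw [pow_two] at hvlt
    omega
  have hEo : p ≠ 2 → D * p ∣ q * D ∧ 3 * D ≤ D * p := fun hp => by
    refine ⟨by rw [mul_comm q]; exact Nat.mul_dvd_mul_left _ hpq, ?_⟩
    rw [mul_comm 3]; exact Nat.mul_le_mul_left _ (hp3 hp)
  rcases hrd with hr | hr
  · obtain ⟨e, he⟩ := hr
    have he' : r * e + 1 = q * D := by omega
    have hr1 := Num.P_minus_r (by omega) hpr hs hqD he' hDr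
    by_cases hp : p = 2
    · obtain ⟨h5, h6 | h6⟩ := Num.P_minus_even (hqe hp) hqD hr1 (hdiv.2 hp) ht
      · omega
      · rcases hcase with h9 | ⟨c, hc1, hc2, hc3, hc4⟩
        · exact Num.P_minus_sym (hqe hp) (hp ▸ hpq) (h2D hp) hpr h3 h5 h6 h9
        · obtain rfl := Num.P_minus_ns h5 h6 hc2 hl hc1
          have := hone hp hc4
          have : 2 * D ≤ D * D := Nat.mul_le_mul_right _ (by omega)
          omega
    · have := Num.P_minus_odd (by omega) hqD (hEo hp).1 (hEo hp).2 hr1 (hdiv.1 hp) ht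
      omega
  · by_cases hp : p = 2
    · have hx := (hex hr hDr).2 hp
      have hrQ : r = q * D + 1 := le_antisymm (Nat.le_of_dvd (by omega) hr) hx
      rcases hcase with h9 | ⟨c, hc1, hc2, hc3, hc4⟩
      · exact Num.P_plus_even_sym (hQ2 hp) (hqe hp) hqD (h2D hp) hrQ (hdiv.2 hp) h9
      · rcases Num.P_plus_even_ns (hqe hp) hqD hrQ (hdiv.2 hp) hc2 hl hc1 with rfl | ⟨h7, h8, h9⟩
        · have := hone hp hc4
          omega
        · exact htoB hp c h7 hrQ h8 h9 hc4
    · have hx := (hex hr hDr).1 hp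
      have hr2 := Num.P_plus_odd_r (hnt hp) hpr h3 hr hx
      rcases hcase with h9 | ⟨c, hc1, hc2, hc3, hc4⟩
      · exact Num.P_plus_odd_sym (by omega) hqD (hEo hp).1 (hEo hp).2 hr2 (hdiv.1 hp) h3 h9
      · exact Num.P_plus_odd_ns (by omega) hqD (hEo hp).1 (hEo hp).2 hr2 (hdiv.1 hp) hc2 hl hc1

lemma SpD.false (h : SpD m F bl k lam r p f) : False := by
  by_cases hN : NoTv m F P
  · by_cases hp : p = 2
    · exact h.caseN_even hp (Or.inl hN)
    · exact h.caseA hp hN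
  · by_cases hq : Nat.card F = 2
    · have hp : p = 2 := h.two_dvd (by rw [hq])
      exact h.caseN_even hp (Or.inr hq)
    · unfold NoTv at hN
      push Not at hN
      obtain ⟨α, x, c, hx, hc, ht⟩ := hN
      exact h.caseP (by have := h.q2; omega) hx hc ht

end
end NFT

namespace NFT

lemma coprime_action {S : Type*} [Group S] [Finite S] {p r a : ℕ} (hp : p.Prime) (hr : r.Prime) (hS : IsPGroup p S)
    (hna : ∃ x y : S, x * y ≠ y * x) (σ : MulAut S) (hσ : σ ^ (r ^ a) = 1) (hfix : ∀ s, σ s = s → s = 1) :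
    (1 + r) ^ 2 ≤ Nat.card S := by
  classical
  haveI : Fact p.Prime := ⟨hp⟩
  haveI := Fintype.ofFinite S
  obtain ⟨x, y, hxy⟩ := hna
  haveI : Nontrivial S := ⟨⟨x * y, y * x, hxy⟩⟩
  haveI : Finite (MulAut S) := Finite.of_injective (fun σ : MulAut S => (σ : S → S)) DFunLike.coe_injective
  obtain ⟨b, -, hb⟩ := (Nat.dvd_prime_pow hr).1 (orderOf_dvd_of_pow_eq_one hσ)
  have key : ∀ H : Subgroup S, (∀ s ∈ H, σ s ∈ H) → r ∣ Nat.card H - 1 := by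
    intro H hH
    have h1 := card_dvd_of_no_fix hr σ hb ((Finset.univ.filter fun s : S => s ∈ H).erase 1) (by
      intro s hs
      simp only [Finset.mem_erase, Finset.mem_filter, Finset.mem_univ, true_and] at hs ⊢
      refine ⟨?_, hH _ hs.2⟩
      rw [MulAut.smul_def]
      simpa using hs.1) (by
      intro s hs h
      simp only [Finset.mem_erase, Finset.mem_filter, Finset.mem_univ, true_and] at hs
      exact hs.1 (hfix s h))
    rw [Finset.card_erase_of_mem (by simp)] at h1
    convert h1 using 2
    rw [Nat.card_eq_fintype_card, ← Fintype.card_subtype]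
  have hc : Nontrivial (Subgroup.center S) := hS.center_nontrivial
  have hc2 : 1 < Nat.card (Subgroup.center S) := Finite.one_lt_card_iff_nontrivial.2 hc
  have h1 := key (Subgroup.center S) (by
    intro s hs
    rw [Subgroup.mem_center_iff] at hs ⊢
    intro g
    have := congrArg σ (hs (σ⁻¹ g))
    simpa using this)
  have h2 := key ⊤ (by simp)
  rw [Subgroup.card_top] at h2
  have h3 := Subgroup.card_mul_index (Subgroup.center S)
  have h4 : (Subgroup.center S).index ≠ 1 := by
    intro h
    rw [Subgroup.index_eq_one] at h
    have : x ∈ Subgroup.center S := by rw [h]; trivial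
    exact hxy ((Subgroup.mem_center_iff.1 this y).symm)
  have h5 : (Subgroup.center S).index ≠ 0 := Subgroup.index_ne_zero_of_finite
  obtain ⟨u, hu⟩ := h1
  have hu1 : Nat.card (Subgroup.center S) = 1 + r * u := by omega
  have hu0 : 1 ≤ u := by
    rcases Nat.eq_zero_or_pos u with h | h
    · rw [h] at hu1; omega
    · exact h
  have h6 : r ∣ (Subgroup.center S).index - 1 := by
    set n := (Subgroup.center S).index
    have e : Nat.card S - 1 = r * (u * n) + (n - 1) := by
      rw [← h3, hu1]
      have : (1 + r * u) * n = n + r * (u * n) := by ring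
      omega
    rw [e] at h2
    exact (Nat.dvd_add_right (Dvd.intro _ rfl)).1 h2
  have h7 : r ≤ (Subgroup.center S).index - 1 := Nat.le_of_dvd (by omega) h6
  have h8 : r * 1 ≤ r * u := Nat.mul_le_mul_left _ hu0
  rw [pow_two, ← h3, hu1]
  exact Nat.mul_le_mul (by omega) (by omega)

section
variable {m : ℕ} {F : Type*} [Field F] [Finite F]

lemma ex_perp2z (hm : 2 ≤ m) (x z : VV m F) : ∃ y : VV m F, y ≠ 0 ∧ om x y = 0 ∧ om z y = 0 := by
  have h1 : LinearMap.ker ((om x).prod (om z)) ≠ ⊥ := by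
    apply LinearMap.ker_ne_bot_of_finrank_lt
    simp only [Module.finrank_prod, Module.finrank_fintype_fun_eq_card, Fintype.card_fin, Module.finrank_self]
    omega
  obtain ⟨y, hy, hy0⟩ := Submodule.exists_mem_ne_zero_of_ne_bot h1
  rw [LinearMap.mem_ker, LinearMap.prod_apply] at hy
  exact ⟨y, hy0, (Prod.ext_iff.1 hy).1, (Prod.ext_iff.1 hy).2⟩

/-- a `p`-element fixes a vector -/
lemma p_fix_vec (hm : 2 ≤ m) {p f : ℕ} (hp : p.Prime) (hq : Nat.card F = p ^ f) {g : Sp m F} {n : ℕ} (hg : g ^ (p ^ n) = 1) :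
    ∃ x : VV m F, x ≠ 0 ∧ g.1 x = x := by
  classical
  haveI := Fintype.ofFinite F
  by_contra hc
  push Not at hc
  obtain ⟨b, -, hb⟩ := (Nat.dvd_prime_pow hp).1 (orderOf_dvd_of_pow_eq_one hg)
  have hb' : orderOf g.1 = p ^ b := by rw [← hb]; exact Subgroup.orderOf_coe g
  haveI : Finite (VV m F ≃ₗ[F] VV m F) := Finite.of_injective (fun σ : VV m F ≃ₗ[F] VV m F => (σ : VV m F → VV m F)) DFunLike.coe_injective
  have h1 := card_dvd_of_no_fix hp g.1 hb' (Finset.univ.erase (0 : VV m F)) (by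
      intro s hs
      simp only [Finset.mem_erase, Finset.mem_univ, and_true] at hs ⊢
      intro h
      exact hs (by simpa using h)) (by
      intro s hs
      simp only [Finset.mem_erase, Finset.mem_univ, and_true] at hs
      exact hc s hs)
  rw [Finset.card_erase_of_mem (by simp), Finset.card_univ, Fintype.card_prod, Fintype.card_fun, Fintype.card_fin,
    ← Nat.card_eq_fintype_card, ← pow_add] at h1
  have h2 : p ∣ Nat.card F := by
    rw [hq]
    apply dvd_pow_self
    rintro rfl
    have : 1 < Nat.card F := Finite.one_lt_card
    rw [hq] at this; simp at this
  have h3 : p ∣ Nat.card F ^ (m + m) := h2.trans (dvd_pow_self _ (by omega))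
  have h4 : 1 ≤ Nat.card F ^ (m + m) := Nat.one_le_pow _ _ Nat.card_pos
  have h5 : p ∣ 1 := by
    have := (Nat.dvd_sub h3 h1)
    rwa [show Nat.card F ^ (m + m) - (Nat.card F ^ (m + m) - 1) = 1 by omega] at this
  exact hp.one_lt.ne' (Nat.dvd_one.1 h5)

/-- the standard `p`-subgroup is non abelian, even modulo scalars -/
lemma RR_nonab (hm : 2 ≤ m) : ∃ (i : Fin m), ∃ s ∈ RR i F, ∃ t ∈ RR i F, ∃ x : VV m F, x ≠ 0 ∧
    (s * t * s⁻¹ * t⁻¹).1 x = x ∧ s * t * s⁻¹ * t⁻¹ ≠ 1 := by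
  let i : Fin m := ⟨0, by omega⟩
  let j : Fin m := ⟨1, by omega⟩
  have hij : i ≠ j := by simp [i, j]
  let φ : Ph i F := ⟨Pi.single j 1, by change (Pi.single j (1 : F) : Fin m → F) i = 0; simp [hij]⟩
  refine ⟨i, uU i φ, uU_mem_RR i φ, nS (sq (ee j) 1), nS_mem_RR i _, (ee i, 0), ?_, ?_, ?_⟩
  · intro h
    have := congrFun (Prod.ext_iff.1 h).1 i
    simp [ee] at this
  · rw [uU_conj, ← nS_neg, ← nS_add]
    simp [nS_apply]
  · intro h
    rw [mul_inv_eq_one, mul_inv_eq_iff_eq_mul] at h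
    have h1 : (uU i φ * nS (sq (ee j) 1)).1 (0, ee j) = (nS (sq (ee j) 1) * uU i φ).1 (0, ee j) := by rw [h]
    rw [Sp.mul_apply, Sp.mul_apply, uU_apply, uU_apply] at h1
    have h2 := congrFun (Prod.ext_iff.1 h1).1 i
    simp [nS_apply, sq, ee, φ, hij, hij.symm, Matrix.vecMulVec, Matrix.mulVec, dotProduct, Pi.single_apply] at h2

end
end NFT

namespace NFT

section
variable {m : ℕ} {F : Type*} [Field F] [Finite F] {G P : Type*} [Group G] [Finite G] [MulAction G P] [Fintype P] [DecidableEq P]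
  {bl : Finset (Finset P)} {k lam r p f : ℕ}

lemma normal_trans (h : FTD G bl k lam r) (hfth : ∀ g : G, (∀ x : P, g • x = x) → g = 1) (X : Subgroup G) [hX : X.Normal]
    (hX1 : ∃ x ∈ X, x ≠ 1) (α β : P) : ∃ g ∈ X, g • α = β := by
  classical
  haveI : MulAction.IsPretransitive G P := ⟨h.ptrans⟩
  by_contra hc
  push Not at hc
  obtain ⟨t, ht1, ht, hv, -⟩ := h.params
  have hlt := h.v_lt
  have h3 := h.r3
  have hB := MulAction.IsBlock.ncard_block_mul_ncard_orbit_eq (MulAction.IsBlock.orbit_of_normal (G := G) (N := X) α)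
    ⟨α, MulAction.mem_orbit_self α⟩
  -- the orbit is non trivial
  have hne : ∃ β, β ≠ α ∧ β ∈ MulAction.orbit X α := by
    by_contra hcon
    push Not at hcon
    obtain ⟨x, hx, hx1⟩ := hX1
    apply hx1
    apply hfth
    intro γ
    obtain ⟨g, rfl⟩ := h.ptrans α γ
    have h1 : g⁻¹ * x * g⁻¹⁻¹ ∈ X := hX.conj_mem x hx g⁻¹
    have h2 : (g⁻¹ * x * g⁻¹⁻¹) • α = α := by
      by_contra hh
      exact hcon _ hh ⟨⟨_, h1⟩, rfl⟩
    rw [inv_inv, mul_smul, mul_smul, inv_smul_eq_iff] at h2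
    exact h2
  obtain ⟨ρ, hρ⟩ := h.exists_rho' α
  obtain ⟨a, ha⟩ := hρ.ord
  set O : Finset P := Finset.univ.filter fun y => y ∈ MulAction.orbit X α with hO
  have hOc : (MulAction.orbit X α).ncard = O.card := by
    rw [← Set.ncard_coe_finset]; congr 1; ext y; simp [hO]
  have h1 : r ∣ (O.erase α).card := by
    apply card_dvd_of_no_fix h.prime ρ ha
    · intro y hy
      simp only [hO, Finset.mem_erase, Finset.mem_filter, Finset.mem_univ, true_and] at hy ⊢
      refine ⟨fun hh => hy.1 ?_, ?_⟩
      · rw [← hρ.fix] at hh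
        exact MulAction.injective ρ hh
      · obtain ⟨⟨x, hx⟩, hxy⟩ := hy.2
        refine ⟨⟨ρ * x * ρ⁻¹, hX.conj_mem x hx ρ⟩, ?_⟩
        change (ρ * x * ρ⁻¹) • α = ρ • y
        have h5 : x • α = y := hxy
        have h6 : ρ⁻¹ • α = α := by rw [inv_smul_eq_iff, hρ.fix]
        rw [mul_smul, h6, mul_smul, h5]
    · intro y hy hh
      exact (Finset.mem_erase.1 hy).1 (h.rho_fix_only hρ hh)
  have hαO : α ∈ O := by simp [hO]
  rw [Finset.card_erase_of_mem hαO] at h1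
  obtain ⟨β', hβ', hβO⟩ := hne
  have h2 : 1 < O.card := Finset.one_lt_card.2 ⟨α, hαO, β', by simpa [hO] using hβO, hβ'.symm⟩
  have h4 : O.card < Fintype.card P := by
    rw [← Finset.card_univ]
    apply Finset.card_lt_card
    refine ⟨Finset.subset_univ _, fun hs => ?_⟩
    have := hs (Finset.mem_univ β)
    simp only [hO, Finset.mem_filter, Finset.mem_univ, true_and] at this
    obtain ⟨⟨x, hx⟩, hxy⟩ := this
    exact hc x hx hxy
  rw [hOc, Nat.card_eq_fintype_card] at hB
  set l := (MulAction.orbit G (MulAction.orbit X α)).ncard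
  obtain ⟨s, hs⟩ := h1
  have hO1 : O.card = 1 + r * s := by omega
  have hs1 : 1 ≤ s := by
    rcases Nat.eq_zero_or_pos s with h0 | h0
    · rw [h0] at hO1; omega
    · exact h0
  have hl1 : 2 ≤ l := by
    by_contra hl
    have : l ≤ 1 := by omega
    have := Nat.mul_le_mul_left O.card this
    omega
  have h6 : r ∣ l - 1 := by
    have e : r * t = r * (s * l) + (l - 1) := by
      have : (1 + r * s) * l = l + r * (s * l) := by ring
      rw [hO1] at hB
      omega
    exact (Nat.dvd_add_right (Dvd.intro _ rfl)).1 (e ▸ Dvd.intro _ rfl)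
  have h7 : r ≤ l - 1 := Nat.le_of_dvd (by omega) h6
  have h8 : r * 1 ≤ r * s := Nat.mul_le_mul_left _ hs1
  have h9 : r * r ≤ O.card * l := Nat.mul_le_mul (by omega) (by omega)
  rw [pow_two] at hlt
  omega

lemma normal_bad (h : FTD G bl k lam r) (hfth : ∀ g : G, (∀ x : P, g • x = x) → g = 1) (φ : Sp m F →* G)
    (hX : φ.range.Normal) (hker : ∀ g, φ g = 1 → (∀ w, g.1 w = w) ∨ (∀ w, g.1 w = -w))
    (hsmp : ∀ N : Subgroup (Sp m F), N.Normal → (∀ g ∈ N, φ g = 1) ∨ (∀ g, ∃ n ∈ N, φ n = φ g))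
    (hm : 2 ≤ m) (hp : p.Prime) (hq : Nat.card F = p ^ f)
    (hK : ∀ α : P, ∀ g ∈ φ.range, g • α = α → g ∈ KK G bl α) : False := by
  classical
  haveI : Fact p.Prime := ⟨hp⟩
  haveI : Fact r.Prime := ⟨h.prime⟩
  obtain ⟨α₀⟩ := h.point
  have hne : ∀ g : G, g ≠ 1 → ∃ x : P, g • x ≠ x := by
    intro g hg
    by_contra hc
    push Not at hc
    exact hg (hfth g hc)
  have hcent : ∀ (α : P) (g u : G), g ∈ φ.range → g ≠ 1 → g • α = α → u * g = g * u → u • α = α :=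
    fun α g u hg h1 h2 h3 => h.comm_fix (hK α g hg h2) (hne g h1) h3
  have htv1 : ∀ (x : VV m F) (c : F), x ≠ 0 → c ≠ 0 → φ (tv x c) ≠ 1 := by
    intro x c hx hc h1
    exact hc (tv_eq_one hx (scalar_fix (hker _ h1) hx (tv_self x c)))
  have x0 : ∃ x : VV m F, x ≠ 0 := ⟨_, eb_ne (F := F) ⟨0, by omega⟩⟩
  obtain ⟨x0, hx0⟩ := x0
  -- no transvection fixes a point
  have hno : ∀ (α : P) (x : VV m F) (c : F), x ≠ 0 → c ≠ 0 → φ (tv x c) • α ≠ α := by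
    intro α x c hx hc hfix
    have hperp : ∀ (y z : VV m F) (d e : F), y ≠ 0 → d ≠ 0 → om y z = 0 → φ (tv y d) • α = α → φ (tv z e) • α = α := by
      intro y z d e hy hd hyz hf
      apply hcent α (φ (tv y d)) _ ⟨_, rfl⟩ (htv1 y d hy hd) hf
      rw [← map_mul, ← map_mul, tv_comm hyz]
    have hall : ∀ (z : VV m F) (e : F), φ (tv z e) • α = α := by
      intro z e
      obtain ⟨y, hy, h1, h2⟩ := ex_perp2z hm x z
      exact hperp y z 1 e hy one_ne_zero (om_zero_swap h2) (hperp x y c 1 hx hc h1 hfix)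
    let N : Subgroup (Sp m F) := ((MulAction.stabilizer G α).comap φ).normalCore
    have hmem : ∀ (x : VV m F) (c : F), tv x c ∈ N := by
      intro x c b
      rw [tv_conj, Subgroup.mem_comap, MulAction.mem_stabilizer_iff]
      exact hall _ _
    rcases hsmp N (Subgroup.normalCore_normal _) with h1 | h1
    · exact htv1 x0 1 hx0 one_ne_zero (h1 _ (hmem x0 1))
    · obtain ⟨β, hβ⟩ := h.ex_not α
      obtain ⟨_, ⟨g, rfl⟩, hg⟩ := normal_trans h hfth φ.range ⟨_, ⟨tv x0 1, rfl⟩, htv1 x0 1 hx0 one_ne_zero⟩ α β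
      obtain ⟨n, hn, hn'⟩ := h1 g
      have := Subgroup.normalCore_le _ hn
      rw [Subgroup.mem_comap, MulAction.mem_stabilizer_iff, hn', hg] at this
      exact hβ this
  -- no p-element fixes a point
  have hpel : ∀ (α : P) (s : G) (n : ℕ), s ∈ φ.range → s ^ p ^ n = 1 → s • α = α → s = 1 := by
    intro α s n hs hsn hsα
    by_contra hs1
    obtain ⟨g, rfl⟩ := hs
    have hg2 : (g ^ p ^ n) ^ 2 = 1 := by
      have := hker (g ^ p ^ n) (by rw [map_pow, hsn])
      apply Sp.ext'
      intro w
      rw [pow_two, Sp.mul_apply, Sp.one_apply]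
      rcases this with h1 | h1
      · rw [h1, h1]
      · rw [h1, h1, neg_neg]
    obtain ⟨g', n', hg', hg'1, hg'α⟩ : ∃ (g' : Sp m F) (n' : ℕ), g' ^ p ^ n' = 1 ∧ φ g' ≠ 1 ∧ φ g' • α = α := by
      by_cases hp2 : p = 2
      · refine ⟨g, n + 1, ?_, hs1, hsα⟩
        rw [pow_succ, pow_mul, hp2]
        rw [hp2] at hg2
        exact hg2
      · refine ⟨g ^ 2, n, ?_, ?_, ?_⟩
        · rw [← pow_mul, mul_comm, pow_mul]; exact hg2
        · intro hh
          rw [map_pow] at hh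
          apply hs1
          have h1 := orderOf_dvd_of_pow_eq_one hh
          have h2 := orderOf_dvd_of_pow_eq_one hsn
          have hco : Nat.Coprime 2 (p ^ n) := Nat.Coprime.pow_right _ ((Nat.coprime_primes Nat.prime_two hp).2 (Ne.symm hp2))
          have := Nat.dvd_gcd h1 h2
          rw [hco.gcd_eq_one] at this
          exact orderOf_eq_one_iff.1 (Nat.dvd_one.1 this)
        · rw [map_pow, pow_two, mul_smul, hsα, hsα]
    obtain ⟨x, hx, hgx⟩ := p_fix_vec hm hp hq hg'
    apply hno α x 1 hx one_ne_zero
    apply hcent α (φ g') _ ⟨_, rfl⟩ hg'1 hg'α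
    rw [← map_mul, ← map_mul]
    congr 1
    have := tv_conj g' x 1
    rw [hgx, mul_inv_eq_iff_eq_mul] at this
    exact this.symm
  -- r does not divide |X|
  have hrX : ¬ r ∣ Nat.card φ.range := by
    intro hd
    obtain ⟨⟨x, hx⟩, hxo⟩ := exists_prime_orderOf_dvd_card' r hd
    have hxo' : orderOf x = r := by rw [← hxo]; exact (Subgroup.orderOf_mk x hx).symm
    have : ∃ y : P, x • y = y := by
      by_contra hc
      push Not at hc
      have h1 := card_dvd_of_no_fix (a := 1) h.prime x (by rw [hxo', pow_one]) (Finset.univ : Finset P) (by simp) (fun y _ => hc y)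
      obtain ⟨t, ht1, ht, hv, -⟩ := h.params
      rw [Finset.card_univ, hv] at h1
      have := (Nat.dvd_add_left (Dvd.intro t rfl)).1 h1
      exact h.prime.one_lt.ne' (Nat.dvd_one.1 this)
    obtain ⟨y, hy⟩ := this
    have h1 := h.KK_no_r (hK y x hx hy) (by rw [← hxo', pow_orderOf_eq_one])
    have := hfth x h1
    rw [this, orderOf_one] at hxo'
    exact h.prime.one_lt.ne hxo'
  obtain ⟨ρ, hρ⟩ := h.exists_rho' α₀
  obtain ⟨a, ha⟩ := hρ.ord
  -- a Sylow subgroup normalised by ρ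
  obtain ⟨S, hS⟩ : ∃ S : Sylow p φ.range, (MulAut.conjNormal ρ : MulAut φ.range) • S = S := by
    by_contra hc
    push Not at hc
    letI : MulAction G (Sylow p φ.range) := MulAction.compHom _ (MulAut.conjNormal : G →* MulAut φ.range)
    haveI := Fintype.ofFinite (Sylow p φ.range)
    have h1 := card_dvd_of_no_fix h.prime ρ ha (Finset.univ : Finset (Sylow p φ.range)) (by simp) (fun y _ => hc y)
    rw [Finset.card_univ, ← Nat.card_eq_fintype_card] at h1
    obtain ⟨S⟩ : Nonempty (Sylow p φ.range) := inferInstance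
    exact hrX ((h1.trans S.card_dvd_index).trans (Subgroup.index_dvd_card _))
  have hSmem : ∀ s ∈ S, (MulAut.conjNormal ρ : MulAut φ.range) s ∈ S := by
    intro s hs
    have h1 : (MulAut.conjNormal ρ : MulAut φ.range) s ∈ ((MulAut.conjNormal ρ : MulAut φ.range) • S : Sylow p φ.range) := by
      exact Subgroup.smul_mem_pointwise_smul s _ _ hs
    rwa [hS] at h1
  have hpo : ∀ s ∈ S, ∃ n, (s : G) ^ p ^ n = 1 := by
    intro s hs
    obtain ⟨n, hn⟩ := S.2 ⟨s, hs⟩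
    refine ⟨n, ?_⟩
    have := congrArg (fun z : S => ((z : φ.range) : G)) hn
    simpa using this
  -- |S| ≤ v
  have hSv : Nat.card S ≤ Fintype.card P := by
    rw [← Nat.card_eq_fintype_card]
    apply Nat.card_le_card_of_injective (fun s : S => ((s : φ.range) : G) • α₀)
    intro s s' hss
    change ((s : φ.range) : G) • α₀ = ((s' : φ.range) : G) • α₀ at hss
    have hm1 : (s'⁻¹ * s : S).1 ∈ S := (s'⁻¹ * s : S).2
    obtain ⟨n, hn⟩ := hpo _ hm1
    have h1 := hpel α₀ _ n (s'⁻¹ * s : S).1.2 hn (by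
      push_cast
      rw [mul_smul, hss, inv_smul_smul])
    have h2 : s'⁻¹ * s = 1 := Subtype.ext (Subtype.ext h1)
    exact (inv_mul_eq_one.1 h2).symm
  -- the automorphism
  let c : MulAut φ.range := MulAut.conjNormal ρ
  have hcn : ∀ (n : ℕ) (x : φ.range), (((c ^ n) x : φ.range) : G) = ρ ^ n * x * (ρ ^ n)⁻¹ := by
    intro n x
    rw [← map_pow, MulAut.conjNormal_apply]
  let σf : S →* S := (c.toMonoidHom.comp S.toSubgroup.subtype).codRestrict S.toSubgroup (fun s => hSmem s.1 s.2)
  have hσi : Function.Injective σf := by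
    intro s s' hss
    apply Subtype.ext
    apply c.injective
    exact congrArg Subtype.val hss
  let σ : MulAut S := MulEquiv.ofBijective σf (Finite.injective_iff_bijective.1 hσi)
  have hσv : ∀ (n : ℕ) (s : S), (((σ ^ n) s : S) : φ.range) = (c ^ n) (s : φ.range) := by
    intro n
    induction n with
    | zero => intro s; rfl
    | succ n ih =>
      intro s
      rw [pow_succ, pow_succ, MulAut.mul_apply, MulAut.mul_apply, ih]
      rfl
  have hbig := coprime_action (a := a) hp h.prime S.2 (by
      by_contra hab
      push Not at hab
      obtain ⟨i, s, hs, t, ht, x, hx, hfx, hst⟩ := RR_nonab (F := F) hm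
      apply hst
      refine scalar_fix (hker _ ?_) hx hfx
      have hR : IsPGroup p ((RR i F).map φ.rangeRestrict) := (RR_pgroup i hq).map _
      obtain ⟨T, hT⟩ := hR.exists_le_sylow
      obtain ⟨g, hg⟩ := MulAction.exists_smul_eq φ.range T S
      have hmemS : ∀ u ∈ RR i F, g * φ.rangeRestrict u * g⁻¹ ∈ S := by
        intro u hu
        rw [← hg]
        exact Subgroup.smul_mem_pointwise_smul _ (MulAut.conj g) T.toSubgroup (hT ⟨u, hu, rfl⟩)
      have h1 := hab ⟨_, hmemS s hs⟩ ⟨_, hmemS t ht⟩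
      have h2 := congrArg Subtype.val h1
      change (g * φ.rangeRestrict s * g⁻¹) * (g * φ.rangeRestrict t * g⁻¹) =
        (g * φ.rangeRestrict t * g⁻¹) * (g * φ.rangeRestrict s * g⁻¹) at h2
      have h3 : φ.rangeRestrict s * φ.rangeRestrict t = φ.rangeRestrict t * φ.rangeRestrict s := by
        have e1 : ∀ a b : φ.range, (g * a * g⁻¹) * (g * b * g⁻¹) = g * (a * b) * g⁻¹ := by intro a b; group
        rw [e1, e1] at h2
        exact mul_left_cancel (mul_right_cancel h2)
      have h4 : φ s * φ t = φ t * φ s := congrArg Subtype.val h3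
      rw [map_mul, map_mul, map_mul, map_inv, map_inv, h4]
      group) σ (by
      apply MulEquiv.ext
      intro s
      apply Subtype.ext
      rw [hσv]
      apply Subtype.ext
      rw [hcn, ← ha, pow_orderOf_eq_one]
      simp) (by
      intro s hs
      have h1 : (c (s : φ.range) : φ.range) = s := congrArg Subtype.val hs
      have h2 : ρ * ((s : φ.range) : G) * ρ⁻¹ = (s : φ.range) := by
        have := congrArg (Subtype.val) h1
        rwa [MulAut.conjNormal_apply] at this
      rw [mul_inv_eq_iff_eq_mul] at h2
      have h3 := h.rho_comm_fix hρ h2.symm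
      obtain ⟨n, hn⟩ := hpo s.1 s.2
      exact Subtype.ext (Subtype.ext (hpel α₀ _ n s.1.2 hn h3)))
  have h1 := h.v_lt
  have h2 : Nat.card S < r ^ 2 := hSv.trans_lt h1
  have h3 : (1 + r) ^ 2 < r ^ 2 := lt_of_le_of_lt hbig h2
  have h4 : r ^ 2 ≤ (1 + r) ^ 2 := Nat.pow_le_pow_left (by omega) 2
  omega

theorem S1 (h : FTD G bl k lam r) (hfth : ∀ g : G, (∀ x : P, g • x = x) → g = 1) (φ : Sp m F →* G)
    (hX : φ.range.Normal) (hker : ∀ g, φ g = 1 → (∀ w, g.1 w = w) ∨ (∀ w, g.1 w = -w))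
    (hsmp : ∀ N : Subgroup (Sp m F), N.Normal → (∀ g ∈ N, φ g = 1) ∨ (∀ g, ∃ n ∈ N, φ n = φ g))
    (hm : 2 ≤ m) (hp : p.Prime) (hq : Nat.card F = p ^ f) (h22 : ¬ (m = 2 ∧ Nat.card F = 2)) : False := by
  classical
  have hX1 : ∃ x ∈ φ.range, x ≠ 1 := by
    have hx := eb_ne (F := F) (⟨0, by omega⟩ : Fin m)
    refine ⟨_, ⟨tv (eb ⟨0, by omega⟩ F) 1, rfl⟩, fun h1 => ?_⟩
    exact one_ne_zero (tv_eq_one hx (scalar_fix (hker _ h1) hx (tv_self _ 1)))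
  by_cases hK : ∀ α : P, ∀ g ∈ φ.range, g • α = α → g ∈ KK G bl α
  · exact normal_bad h hfth φ hX hker hsmp hm hp hq hK
  push Not at hK
  obtain ⟨α, g₀, hg₀, hgα, hgK⟩ := hK
  obtain ⟨ρ, hρN, hρ⟩ := h.exists_rho α (MulAction.stabilizer G α) (φ.range ⊓ MulAction.stabilizer G α)
    (fun g hg => hg) (h.stab_trans α) inf_le_right
    (fun g hg n hn => Subgroup.mem_inf.2 ⟨hX.conj_mem n (Subgroup.mem_inf.1 hn).1 g, (MulAction.stabilizer G α).mul_mem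
      ((MulAction.stabilizer G α).mul_mem hg (Subgroup.mem_inf.1 hn).2) ((MulAction.stabilizer G α).inv_mem hg)⟩)
    (fun hle => hgK (hle (Subgroup.mem_inf.2 ⟨hg₀, hgα⟩)))
  letI act : MulAction (Sp m F) P := MulAction.compHom P φ
  have hsm : ∀ (g : Sp m F) (x : P), g • x = φ g • x := fun _ _ => rfl
  have hsmB : ∀ (g : Sp m F) (B : Finset P), g • B = φ g • B := fun _ _ => rfl
  have hftd : FTD (Sp m F) bl k lam r :=
    { blk := h.blk, pair := h.pair, deg := h.deg, prime := h.prime, k3 := h.k3, kv := h.kv, lam1 := h.lam1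
      inv := fun g B hB => by rw [hsmB]; exact h.inv _ B hB
      trans := by
        intro B₁ hB₁ B₂ hB₂ x₁ hx₁ x₂ hx₂
        obtain ⟨_, ⟨a, rfl⟩, ha⟩ := normal_trans h hfth φ.range hX1 x₁ α
        obtain ⟨_, ⟨b, rfl⟩, hb⟩ := normal_trans h hfth φ.range hX1 x₂ α
        obtain ⟨i, hi⟩ := hρ.tr (φ a • B₁) (h.inv _ _ hB₁) (φ b • B₂) (h.inv _ _ hB₂)
          (by rw [← ha]; exact mem_smul_fin.2 hx₁) (by rw [← hb]; exact mem_smul_fin.2 hx₂)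
        obtain ⟨c, hc⟩ := hρN.1
        have hfi : ρ ^ i • α = α := by
          have : ρ ^ i ∈ MulAction.stabilizer G α := pow_mem (show ρ ∈ MulAction.stabilizer G α from hρ.fix) i
          exact this
        refine ⟨b⁻¹ * c ^ i * a, ?_, ?_⟩
        · rw [hsm, map_mul, map_mul, map_pow, map_inv, hc, mul_smul, mul_smul, ha, hfi, ← hb, inv_smul_smul]
        · rw [hsmB, map_mul, map_mul, map_pow, map_inv, hc, mul_smul, mul_smul, hi, inv_smul_smul] }
  have hsp : SpD m F bl k lam r p f :=
    { ftd := hftd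
      fth := fun g hg => hker g (hfth _ hg)
      smp := by
        intro N hN
        rcases hsmp N hN with h1 | h1
        · left
          intro g hg x
          rw [hsm, h1 g hg, one_smul]
        · right
          intro g
          obtain ⟨n, hn, e⟩ := h1 g
          exact ⟨n, hn, fun x => by rw [hsm, hsm, e]⟩
      hm := hm, hp := hp, hq := hq, h22 := h22 }
  exact hsp.false

end
end NFT

namespace NFT
section Final

/-! ### Comparison with the matrix group -/

variable {m : ℕ} {F : Type*} [Field F]

/-- the standard coordinates -/
def coordEq (m : ℕ) (F : Type*) [Field F] : VV m F ≃ₗ[F] (Fin m ⊕ Fin m → F) :=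
  (LinearEquiv.sumArrowLequivProdArrow (Fin m) (Fin m) F F).symm

lemma coordEq_apply (x : VV m F) : coordEq m F x = Sum.elim x.1 x.2 := rfl

lemma om_J (x y : VV m F) :
    coordEq m F x ⬝ᵥ (Matrix.J (Fin m) F).mulVec (coordEq m F y) = - om x y := by
  rw [coordEq_apply, coordEq_apply, Matrix.J, Matrix.fromBlocks_mulVec, om_apply]
  simp [Matrix.neg_mulVec]
  ring

lemma mat_ext {n : Type*} [Fintype n] [DecidableEq n] {M N : Matrix n n F}
    (h : ∀ u v : n → F, u ⬝ᵥ M.mulVec v = u ⬝ᵥ N.mulVec v) : M = N := by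
  ext i j
  simpa using h (Pi.single i 1) (Pi.single j 1)

/-- the matrix of an endomorphism -/
def coordMat (g : VV m F →ₗ[F] VV m F) : Matrix (Fin m ⊕ Fin m) (Fin m ⊕ Fin m) F :=
  LinearMap.toMatrix' ((coordEq m F).toLinearMap ∘ₗ g ∘ₗ (coordEq m F).symm.toLinearMap)

lemma MM_mulVec (g : VV m F →ₗ[F] VV m F) (x : VV m F) :
    (coordMat g).mulVec (coordEq m F x) = coordEq m F (g x) := by
  rw [coordMat, LinearMap.toMatrix'_mulVec]
  simp

lemma MM_mem (g : VV m F →ₗ[F] VV m F) :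
    coordMat g ∈ Matrix.symplecticGroup (Fin m) F ↔ ∀ x y, om (g x) (g y) = om x y := by
  rw [SymplecticGroup.mem_iff']
  have key : ∀ x y, coordEq m F x ⬝ᵥ ((coordMat g).transpose * Matrix.J (Fin m) F * coordMat g).mulVec (coordEq m F y) =
      - om (g x) (g y) := by
    intro x y
    rw [← om_J, ← MM_mulVec, ← MM_mulVec, ← Matrix.mulVec_mulVec, ← Matrix.mulVec_mulVec,
      Matrix.dotProduct_mulVec, Matrix.vecMul_transpose]
  constructor
  · intro h x y
    have := key x y
    rw [h, om_J] at this
    exact (neg_injective this).symm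
  · intro h
    apply mat_ext
    intro u v
    obtain ⟨x, rfl⟩ := (coordEq m F).surjective u
    obtain ⟨y, rfl⟩ := (coordEq m F).surjective v
    rw [key, om_J, h]

lemma MM_inj {g h : VV m F →ₗ[F] VV m F} (e : coordMat g = coordMat h) : g = h := by
  ext1 <;> skip
  all_goals
    apply LinearMap.ext
    intro x
    apply (coordEq m F).injective
    have h1 := MM_mulVec g
    have h2 := MM_mulVec h
    simp only [LinearMap.comp_apply]
    rw [← h1, ← h2, e]

lemma MM_mul (g h : VV m F →ₗ[F] VV m F) : coordMat (g ∘ₗ h) = coordMat g * coordMat h := by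
  apply mat_ext
  intro u v
  obtain ⟨y, rfl⟩ := (coordEq m F).surjective v
  rw [MM_mulVec, ← Matrix.mulVec_mulVec, MM_mulVec, MM_mulVec]; rfl

/-- the comparison homomorphism -/
def spHom (m : ℕ) (F : Type*) [Field F] : Sp m F →* Matrix.symplecticGroup (Fin m) F where
  toFun g := ⟨coordMat g.1.toLinearMap, (MM_mem _).2 g.2⟩
  map_one' := by
    apply Subtype.ext
    apply mat_ext
    intro u v
    obtain ⟨y, rfl⟩ := (coordEq m F).surjective v
    change u ⬝ᵥ (coordMat _).mulVec _ = u ⬝ᵥ (1 : Matrix _ _ F).mulVec _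
    rw [MM_mulVec, Matrix.one_mulVec]; rfl
  map_mul' a b := by
    apply Subtype.ext
    exact MM_mul _ _

lemma spHom_inj : Function.Injective (spHom m F) := by
  intro a b e
  apply Sp.ext'
  intro x
  have := MM_inj (congrArg Subtype.val e)
  exact congrArg (fun f : VV m F →ₗ[F] VV m F => f x) this

lemma spHom_surj : Function.Surjective (spHom m F) := by
  intro A
  let f : VV m F →ₗ[F] VV m F := (coordEq m F).symm.toLinearMap ∘ₗ Matrix.toLin' A.1 ∘ₗ (coordEq m F).toLinearMap
  have hf : coordMat f = A.1 := by
    apply mat_ext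
    intro u v
    obtain ⟨y, rfl⟩ := (coordEq m F).surjective v
    rw [MM_mulVec]
    simp [f]
  have hm : coordMat f ∈ Matrix.symplecticGroup (Fin m) F := by rw [hf]; exact A.2
  refine ⟨mkSp f ((MM_mem f).1 hm), Subtype.ext ?_⟩
  rw [← hf]
  rfl

end Final

theorem main_aux {P : Type*} [Fintype P] [DecidableEq P]
    (blocks : Finset (Finset P)) (k lam r : ℕ) (hlam : 1 ≤ lam)
    (hblk : ∀ B ∈ blocks, B.card = k)
    (hpair : ∀ x y : P, x ≠ y → (blocks.filter fun B => x ∈ B ∧ y ∈ B).card = lam)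
    (hk : 2 < k) (hkv : k < Fintype.card P - 1)
    (hr : r.Prime) (hrepl : ∀ x : P, (blocks.filter fun B => x ∈ B).card = r)
    (G : Subgroup (Equiv.Perm P)) (hAut : ∀ g ∈ G, ∀ B ∈ blocks, B.image g ∈ blocks)
    (hFT : ∀ B₁ ∈ blocks, ∀ B₂ ∈ blocks, ∀ x₁ ∈ B₁, ∀ x₂ ∈ B₂,
      ∃ g ∈ G, g x₁ = x₂ ∧ B₁.image g = B₂)
    (X : Subgroup G) (hXnormal : X.Normal) (hXsimple : IsSimpleGroup X)
    (m : ℕ) (hm : 2 ≤ m) (F : Type*) [Field F] [Fintype F]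
    (h22 : ¬(m = 2 ∧ Fintype.card F = 2))
    (hiso : Nonempty (X ≃* (Matrix.symplecticGroup (Fin m) F ⧸
      Subgroup.center (Matrix.symplecticGroup (Fin m) F)))) :
    False := by
  obtain ⟨e⟩ := hiso
  have hftd : FTD G blocks k lam r :=
    { blk := hblk, pair := hpair, deg := hrepl, prime := hr, k3 := hk, kv := by omega, lam1 := hlam
      inv := fun g B hB => hAut g.1 g.2 B hB
      trans := by
        intro B₁ hB₁ B₂ hB₂ x₁ hx₁ x₂ hx₂
        obtain ⟨g, hg, h1, h2⟩ := hFT B₁ hB₁ B₂ hB₂ x₁ hx₁ x₂ hx₂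
        exact ⟨⟨g, hg⟩, h1, h2⟩ }
  let ψ : Sp m F →* X := e.symm.toMonoidHom.comp
    ((QuotientGroup.mk' (Subgroup.center (Matrix.symplecticGroup (Fin m) F))).comp (spHom m F))
  have hψs : Function.Surjective ψ :=
    e.symm.surjective.comp ((QuotientGroup.mk'_surjective _).comp spHom_surj)
  have hψk : ∀ g, ψ g = 1 → (∀ w, g.1 w = w) ∨ (∀ w, g.1 w = -w) := by
    intro g hg
    have h1 : (QuotientGroup.mk' (Subgroup.center (Matrix.symplecticGroup (Fin m) F))) (spHom m F g) = 1 := by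
      apply e.symm.injective
      rw [map_one]
      exact hg
    have h2 : spHom m F g ∈ Subgroup.center (Matrix.symplecticGroup (Fin m) F) :=
      (QuotientGroup.eq_one_iff _).1 h1
    apply comm_tv_scalar
    intro x
    apply spHom_inj
    rw [map_mul, map_mul]
    exact (Subgroup.mem_center_iff.1 h2 _).symm
  let φ : Sp m F →* G := X.subtype.comp ψ
  have hrange : φ.range = X := by
    ext x
    constructor
    · rintro ⟨g, rfl⟩
      exact (ψ g).2
    · intro hx
      obtain ⟨g, hg⟩ := hψs ⟨x, hx⟩
      exact ⟨g, congrArg Subtype.val hg⟩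
  obtain ⟨p, _, f, hp, hq⟩ := FiniteField.card' F
  refine S1 (f := f) hftd ?_ φ (by rw [hrange]; exact hXnormal) ?_ ?_ hm hp
    (by rw [Nat.card_eq_fintype_card, hq]) (by rw [Nat.card_eq_fintype_card]; exact h22)
  · intro g hg
    apply Subtype.ext
    exact Equiv.ext hg
  · intro g hg
    exact hψk g (Subtype.ext hg)
  · intro N hN
    rcases (hN.map ψ hψs).eq_bot_or_eq_top with h | h
    · left
      intro g hg
      have : ψ g ∈ N.map ψ := ⟨g, hg, rfl⟩
      rw [h] at this
      exact congrArg Subtype.val (Subgroup.mem_bot.1 this)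
    · right
      intro g
      have : ψ g ∈ N.map ψ := by rw [h]; trivial
      obtain ⟨n, hn, e⟩ := this
      exact ⟨n, hn, congrArg Subtype.val e⟩

end NFT

/-- There is no nontrivial 2-design with prime replication number `r` admitting a
flag-transitive automorphism group `G` that is almost simple with socle
`X ≅ PSp₂ₘ(F)` with `m ≥ 2` and `(m, |F|) ≠ (2, 2)`. -/
theorem no_flag_transitive_PSp_socle [Fintype P] [DecidableEq P]
    (blocks : Finset (Finset P)) (v k lam r : ℕ)
    (hD : IsTwoDesign blocks v k lam) (hk : 2 < k) (hkv : k < v - 1)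
    (hr : r.Prime) (hrepl : ∀ x : P, pointDegree blocks x = r)
    (G : Subgroup (Equiv.Perm P)) (hAut : IsAutGroup blocks G)
    (hFT : IsFlagTransitive blocks G)
    (X : Subgroup G) (hXnormal : X.Normal) (hXsimple : IsSimpleGroup X)
    (hXnonabelian : ∃ a b : X, a * b ≠ b * a)
    (hXcent : Subgroup.centralizer (X : Set G) = ⊥)
    (m : ℕ) (hm : 2 ≤ m) (F : Type*) [Field F] [Fintype F]
    (h22 : ¬(m = 2 ∧ Fintype.card F = 2))
    (hiso : Nonempty (X ≃* (Matrix.symplecticGroup (Fin m) F ⧸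
      Subgroup.center (Matrix.symplecticGroup (Fin m) F)))) :
    False := by
  obtain ⟨hv, _, hlam, hblk, hpair⟩ := hD
  subst hv
  exact NFT.main_aux blocks k lam r hlam hblk hpair hk hkv hr hrepl G hAut hFT X hXnormal hXsimple m hm F h22 hiso
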